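/- Let p_1 = 2 < p_2 = 3 < ⋯ be the sequence of all primes. There exist absolute positive constants A and N such that for every integer m ≥ 2 there is an integer k = k(m) with the following property: for all integers q ≥ 3 and a with gcd(a,q) = 1, there exist infinitely many n such that p_{n+1} ≡ p_{n+2} ≡ ⋯ ≡ p_{n+m} ≡ a (mod q) and p_{n+m} − p_{n+1} < A q^N k² log(qk). -/

import Mathlib

section ModPC1
open Finset in
/-- all partial sums bounded by `K` -/
def bsum (f : ℕ → ℂ) (K : ℝ) : Prop := ∀ M : ℕ, ‖∑ n ∈ Finset.range M, f n‖ ≤ K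

lemma bsum_of_periodic (f : ℕ → ℂ) (r : ℕ) (hr : 0 < r) (hf : ∀ n, ‖f n‖ ≤ 1)
    (hper : ∀ n, f (n + r) = f n) (h0 : ∑ n ∈ Finset.range r, f n = 0) : bsum f r := by
  have hper' : ∀ t n, f (r * t + n) = f n := by
    intro t
    induction t with
    | zero => intro n; simp
    | succ t ih =>
      intro n
      rw [show r * (t + 1) + n = (r * t + n) + r by ring, hper, ih]
  have hmul : ∀ t, ∑ n ∈ Finset.range (r * t), f n = 0 := by
    intro t
    induction t with
    | zero => simp
    | succ t ih =>
      rw [show r * (t + 1) = r * t + r by ring, Finset.sum_range_add, ih]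
      simp only [hper', h0, add_zero]
  intro M
  have hM : M = r * (M / r) + M % r := (Nat.div_add_mod M r).symm
  rw [hM, Finset.sum_range_add, hmul, zero_add]
  simp only [hper']
  calc ‖∑ n ∈ Finset.range (M % r), f n‖ ≤ ∑ n ∈ Finset.range (M % r), (1 : ℝ) :=
        norm_sum_le_of_le _ (fun n _ => hf n)
    _ = (M % r : ℕ) := by simp
    _ ≤ r := by exact_mod_cast (Nat.mod_lt _ hr).le

lemma sum_range_char {r : ℕ} [NeZero r] (χ : ZMod r → ℂ) :
    ∑ n ∈ Finset.range r, χ (n : ZMod r) = ∑ a : ZMod r, χ a := by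
  refine Finset.sum_bij (fun n _ => (n : ZMod r)) (fun _ _ => Finset.mem_univ _) ?_ ?_ ?_
  · intro a ha b hb hab
    simp only [Finset.mem_range] at ha hb
    rw [ZMod.natCast_eq_natCast_iff] at hab
    exact Nat.ModEq.eq_of_lt_of_lt hab ha hb
  · intro a _
    exact ⟨a.val, Finset.mem_range.2 (ZMod.val_lt a), ZMod.natCast_zmod_val a⟩
  · intro a _; rfl

lemma char_bsum {r : ℕ} [NeZero r] (χ : DirichletCharacter ℂ r) (hχ : χ ≠ 1) :
    bsum (fun n => χ n) r := by
  apply bsum_of_periodic _ _ (Nat.pos_of_ne_zero (NeZero.ne r))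
  · intro n; exact χ.norm_le_one _
  · intro n; simp
  · rw [sum_range_char (fun a => χ a)]
    exact MulChar.sum_eq_zero_of_ne_one hχ

lemma abel_bound (f : ℕ → ℂ) (K : ℝ) (hf : bsum f K) (g : ℕ → ℂ) (a b : ℕ) (hab : a ≤ b) :
    ‖∑ n ∈ Finset.Ico a b, f n * g n‖ ≤
      2 * K * (‖g b‖ + ∑ n ∈ Finset.Ico a b, ‖g (n + 1) - g n‖) := by
  set F : ℕ → ℂ := fun n => ∑ i ∈ Finset.Ico a n, f i with hF
  have hFb : ∀ n, a ≤ n → ‖F n‖ ≤ 2 * K := by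
    intro n hn
    simp only [hF]
    rw [Finset.sum_Ico_eq_sub _ hn]
    calc _ ≤ ‖∑ n ∈ Finset.range n, f n‖ + ‖∑ n ∈ Finset.range a, f n‖ := norm_sub_le _ _
      _ ≤ K + K := add_le_add (hf _) (hf _)
      _ = 2 * K := by ring
  have key : ∑ n ∈ Finset.Ico a b, f n * g n =
      F b * g b - ∑ n ∈ Finset.Ico a b, F (n + 1) * (g (n + 1) - g n) := by
    induction b, hab using Nat.le_induction with
    | base => simp [hF]
    | succ n hn ih =>
      rw [Finset.sum_Ico_succ_top hn, Finset.sum_Ico_succ_top hn, ih]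
      have : F (n + 1) = F n + f n := by simp only [hF]; rw [Finset.sum_Ico_succ_top hn]
      rw [this]; ring
  rw [key]
  calc _ ≤ ‖F b * g b‖ + ‖∑ n ∈ Finset.Ico a b, F (n + 1) * (g (n + 1) - g n)‖ := norm_sub_le _ _
    _ ≤ 2 * K * ‖g b‖ + ∑ n ∈ Finset.Ico a b, 2 * K * ‖g (n + 1) - g n‖ := by
        apply add_le_add
        · rw [norm_mul]; exact mul_le_mul_of_nonneg_right (hFb b hab) (norm_nonneg _)
        · apply norm_sum_le_of_le
          intro n hn
          rw [norm_mul]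
          exact mul_le_mul_of_nonneg_right (hFb _ (by simp at hn; omega)) (norm_nonneg _)
    _ = _ := by rw [← Finset.mul_sum]; ring

lemma abel_bound_anti (f : ℕ → ℂ) (K : ℝ) (hf : bsum f K) (g : ℕ → ℝ) (a b : ℕ) (hab : a ≤ b)
    (hg0 : 0 ≤ g b) (hg : ∀ n, a ≤ n → g (n + 1) ≤ g n) :
    ‖∑ n ∈ Finset.Ico a b, f n * (g n : ℂ)‖ ≤ 2 * K * g a := by
  refine (abel_bound f K hf (fun n => (g n : ℂ)) a b hab).trans (le_of_eq ?_)
  congr 1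
  have : ∑ n ∈ Finset.Ico a b, ‖((g (n + 1) : ℝ) : ℂ) - (g n : ℂ)‖ = g a - g b := by
    have h1 : ∀ n ∈ Finset.Ico a b, ‖((g (n + 1) : ℝ) : ℂ) - (g n : ℂ)‖ = -(g (n+1) - g n) := by
      intro n hn
      rw [← Complex.ofReal_sub, Complex.norm_real, Real.norm_eq_abs, abs_of_nonpos]
      have := hg n (by simp at hn; omega)
      linarith
    rw [Finset.sum_congr rfl h1, Finset.sum_neg_distrib, Finset.sum_Ico_sub g hab]; ring
  rw [this, Complex.norm_real, Real.norm_eq_abs, abs_of_nonneg hg0]; ring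

lemma large_sieve {J : Type*} [Fintype J] [DecidableEq J] (f : J → ℕ → ℂ)
    (hf : ∀ j n, ‖f j n‖ ≤ 1) (K : ℝ) (hK : 0 ≤ K)
    (hoff : ∀ i j, i ≠ j → bsum (fun n => f i n * (starRingEnd ℂ) (f j n)) K)
    (A B : ℕ) (hA : 1 ≤ A) (hAB : A ≤ B) (a : ℕ → ℂ) :
    ∑ j, ‖∑ n ∈ Finset.Ico A B, a n * f j n‖ ^ 2 ≤
      (∑ n ∈ Finset.Ico A B, (1 : ℝ) / n + 2 * K * Fintype.card J / A) *
        ∑ n ∈ Finset.Ico A B, (n : ℝ) * ‖a n‖ ^ 2 := by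
  set T : J → ℂ := fun j => ∑ n ∈ Finset.Ico A B, a n * f j n with hT
  set D : ℝ := ∑ j, ‖T j‖ ^ 2 with hD
  set E : ℝ := ∑ n ∈ Finset.Ico A B, (n : ℝ) * ‖a n‖ ^ 2 with hE
  set H : ℝ := ∑ n ∈ Finset.Ico A B, (1 : ℝ) / n with hH
  set V : ℕ → ℂ := fun n => ∑ j, (starRingEnd ℂ) (T j) * f j n with hV
  have hD0 : 0 ≤ D := Finset.sum_nonneg fun _ _ => by positivity
  have hE0 : 0 ≤ E := Finset.sum_nonneg fun _ _ => by positivity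
  have hDV : (D : ℂ) = ∑ n ∈ Finset.Ico A B, a n * V n := by
    simp only [hD, hV, Complex.ofReal_sum, Finset.mul_sum]
    rw [Finset.sum_comm]
    refine Finset.sum_congr rfl fun j _ => ?_
    rw [Complex.ofReal_pow, ← Complex.conj_mul', show T j = ∑ n ∈ Finset.Ico A B, a n * f j n from rfl,
      Finset.mul_sum]
    exact Finset.sum_congr rfl fun n _ => by ring
  have hD1 : D ≤ ∑ n ∈ Finset.Ico A B, (√(n:ℝ) * ‖a n‖) * (‖V n‖ / √(n:ℝ)) := by
    have : D = ‖(D : ℂ)‖ := by rw [Complex.norm_real, Real.norm_eq_abs, abs_of_nonneg hD0]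
    rw [this, hDV]
    refine norm_sum_le_of_le _ fun n hn => ?_
    have hn' : (0 : ℝ) < n := by
      simp only [Finset.mem_Ico] at hn
      exact_mod_cast (by omega : 0 < n)
    have := Real.sqrt_pos.2 hn'
    rw [norm_mul]
    apply le_of_eq; field_simp
  have hD2 : D ^ 2 ≤ E * ∑ n ∈ Finset.Ico A B, ‖V n‖ ^ 2 / n := by
    calc D ^ 2 ≤ (∑ n ∈ Finset.Ico A B, (√(n:ℝ) * ‖a n‖) * (‖V n‖ / √(n:ℝ))) ^ 2 :=
          pow_le_pow_left₀ hD0 hD1 2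
      _ ≤ _ := Finset.sum_mul_sq_le_sq_mul_sq _ _ _
      _ = _ := by
          congr 1
          · exact Finset.sum_congr rfl fun n _ => by rw [mul_pow, Real.sq_sqrt (by positivity)]
          · exact Finset.sum_congr rfl fun n _ => by rw [div_pow, Real.sq_sqrt (by positivity)]
  have hV1 : ((∑ n ∈ Finset.Ico A B, ‖V n‖ ^ 2 / n : ℝ) : ℂ) =
      ∑ i, ∑ j, (starRingEnd ℂ) (T i) * T j *
        ∑ n ∈ Finset.Ico A B, (f i n * (starRingEnd ℂ) (f j n)) * ((1 / n : ℝ) : ℂ) := by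
    have h1 : ∀ n ∈ Finset.Ico A B, ((‖V n‖ ^ 2 / n : ℝ) : ℂ) =
        ∑ i, ∑ j, (starRingEnd ℂ) (T i) * T j *
          ((f i n * (starRingEnd ℂ) (f j n)) * ((1 / n : ℝ) : ℂ)) := by
      intro n _
      rw [Complex.ofReal_div, Complex.ofReal_pow, ← Complex.mul_conj']
      simp only [hV, map_sum, map_mul, Complex.conj_conj]
      rw [Finset.sum_mul_sum, Finset.sum_div]
      refine Finset.sum_congr rfl fun i _ => ?_
      rw [Finset.sum_div]
      refine Finset.sum_congr rfl fun j _ => ?_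
      push_cast; ring
    rw [Complex.ofReal_sum, Finset.sum_congr rfl h1, Finset.sum_comm]
    refine Finset.sum_congr rfl fun i _ => ?_
    rw [Finset.sum_comm]
    refine Finset.sum_congr rfl fun j _ => ?_
    exact (Finset.mul_sum _ _ _).symm
  set c : J → J → ℝ := fun i j => (if i = j then H else 0) + 2 * K / A with hc
  have hH0 : 0 ≤ H := Finset.sum_nonneg fun _ _ => by positivity
  have hA' : (0 : ℝ) < A := by exact_mod_cast hA
  have hbound : ∀ i j, ‖∑ n ∈ Finset.Ico A B, (f i n * (starRingEnd ℂ) (f j n)) * ((1 / n : ℝ) : ℂ)‖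
      ≤ c i j := by
    intro i j
    by_cases hij : i = j
    · simp only [hc, hij, if_true]
      have : ‖∑ n ∈ Finset.Ico A B, (f j n * (starRingEnd ℂ) (f j n)) * ((1 / n : ℝ) : ℂ)‖ ≤ H := by
        refine norm_sum_le_of_le _ fun n _ => ?_
        rw [norm_mul, norm_mul, RCLike.norm_conj, Complex.norm_real, Real.norm_eq_abs,
          abs_of_nonneg (by positivity)]
        have := hf j n
        have h1 : ‖f j n‖ * ‖f j n‖ ≤ 1 := by nlinarith [norm_nonneg (f j n)]
        exact mul_le_of_le_one_left (by positivity) h1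
      have : 0 ≤ 2 * K / A := by positivity
      linarith
    · simp only [hc, hij, if_false, zero_add]
      have := abel_bound_anti _ K (hoff i j hij) (fun n => 1 / (n:ℝ)) A B hAB (by positivity)
        (by
          intro n hn
          have : (0:ℝ) < n := by exact_mod_cast (by omega : 0 < n)
          apply one_div_le_one_div_of_le this
          push_cast; linarith)
      refine this.trans (le_of_eq ?_); ring
  have hVle : ∑ n ∈ Finset.Ico A B, ‖V n‖ ^ 2 / n ≤ (H + 2 * K * Fintype.card J / A) * D := by
    have h0 : 0 ≤ ∑ n ∈ Finset.Ico A B, ‖V n‖ ^ 2 / n := Finset.sum_nonneg fun _ _ => by positivity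
    have h1 : ∑ n ∈ Finset.Ico A B, ‖V n‖ ^ 2 / n =
        ‖((∑ n ∈ Finset.Ico A B, ‖V n‖ ^ 2 / n : ℝ) : ℂ)‖ := by
      rw [Complex.norm_real, Real.norm_eq_abs, abs_of_nonneg h0]
    rw [h1, hV1]
    calc _ ≤ ∑ i, ∑ j, ‖T i‖ * ‖T j‖ * c i j := by
          refine norm_sum_le_of_le _ fun i _ => norm_sum_le_of_le _ fun j _ => ?_
          rw [norm_mul, norm_mul, RCLike.norm_conj]
          exact mul_le_mul_of_nonneg_left (hbound i j) (by positivity)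
      _ = H * D + 2 * K / A * (∑ i, ‖T i‖) ^ 2 := by
          simp only [hc, mul_add, Finset.sum_add_distrib, mul_ite, mul_zero, Finset.sum_ite_eq,
            Finset.mem_univ, if_true]
          congr 1
          · rw [hD, Finset.mul_sum]; exact Finset.sum_congr rfl fun i _ => by ring
          · rw [sq, Finset.sum_mul_sum, Finset.mul_sum]
            refine Finset.sum_congr rfl fun i _ => ?_
            rw [Finset.mul_sum]
            exact Finset.sum_congr rfl fun i _ => by ring
      _ ≤ H * D + 2 * K / A * (Fintype.card J * D) := by
          have := sq_sum_le_card_mul_sum_sq (s := (Finset.univ : Finset J)) (f := fun i => ‖T i‖)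
          rw [Finset.card_univ] at this
          gcongr
      _ = _ := by ring
  rcases hD0.eq_or_lt with h | h
  · rw [← h]
    positivity
  · have : D * D ≤ ((H + 2 * K * Fintype.card J / A) * E) * D := by
      nlinarith [mul_le_mul_of_nonneg_left hVle hE0]
    exact le_of_mul_le_mul_right this h

end ModPC1

section ModPC2
section transferSection
open MeasureTheory FourierTransform

lemma schwartz_inv (φ : SchwartzMap ℝ ℂ) (x : ℝ) :
    φ x = ∫ ξ : ℝ, Complex.exp ((2 * Real.pi * ξ * x : ℝ) * Complex.I) * (𝓕 φ) ξ := by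
  have h : 𝓕⁻ (𝓕 φ) = φ := FourierTransform.fourierInv_fourier_eq φ
  conv_lhs => rw [← h]
  rw [SchwartzMap.fourierInv_coe, Real.fourierInv_eq']
  refine integral_congr_ae (Filter.Eventually.of_forall fun ξ => ?_)
  simp only [smul_eq_mul, RCLike.inner_apply, conj_trivial]
  congr 3
  push_cast; ring

lemma schwartz_poly_integrable (φ : SchwartzMap ℝ ℂ) (C : ℕ) :
    Integrable (fun ξ : ℝ => ‖φ ξ‖ * (1 + |2 * Real.pi * ξ|) ^ C) := by
  have : (fun ξ : ℝ => ‖φ ξ‖ * (1 + |2 * Real.pi * ξ|) ^ C) = fun ξ : ℝ =>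
      ∑ m ∈ Finset.range (C + 1), (‖ξ‖ ^ (C - m) * ‖φ ξ‖) * ((2 * Real.pi) ^ (C - m) * (C.choose m)) := by
    funext ξ
    rw [add_pow, Finset.mul_sum]
    refine Finset.sum_congr rfl fun m _ => ?_
    rw [abs_mul, abs_of_pos (by positivity : 0 < 2 * Real.pi), mul_pow, Real.norm_eq_abs ξ]
    ring
  rw [this]
  exact integrable_finsetSum _ fun m _ => (φ.integrable_pow_mul volume _).mul_const _

lemma term_transfer (a : ℕ → ℂ) (σ : ℝ) (hσ : 0 < σ) (N : ℝ) (hN : 0 < N) (ξ : ℝ) (n : ℕ) :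
    a n * (((N / n) ^ σ : ℝ) : ℂ) * Complex.exp ((2 * Real.pi * ξ * (Real.log n - Real.log N) : ℝ) * Complex.I)
    = LSeries.term a (σ + ((-(2 * Real.pi * ξ) : ℝ) : ℂ) * Complex.I) n *
      (((N ^ σ : ℝ) : ℂ) * Complex.exp ((-(2 * Real.pi * ξ * Real.log N) : ℝ) * Complex.I)) := by
  rcases Nat.eq_zero_or_pos n with rfl | hn
  · simp [Real.zero_rpow hσ.ne']
  · have hn' : (n : ℂ) ≠ 0 := by exact_mod_cast hn.ne'
    have hnr : (0:ℝ) < n := by exact_mod_cast hn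
    rw [LSeries.term_of_ne_zero hn.ne', Complex.cpow_def_of_ne_zero hn', Real.div_rpow hN.le hnr.le,
      div_eq_mul_inv, div_eq_mul_inv, ← Complex.exp_neg, ← Real.rpow_neg hnr.le, Real.rpow_def_of_pos hnr (-σ)]
    push_cast
    rw [mul_comm ((N ^ σ : ℝ) : ℂ) (Complex.exp _)]
    have : ∀ u v w x y : ℂ, u + v = w + x → a n * (Complex.exp u * y) * Complex.exp v =
        a n * Complex.exp w * (y * Complex.exp x) := by
      intro u v w x y h
      have h2 : Complex.exp u * Complex.exp v = Complex.exp w * Complex.exp x := by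
        rw [← Complex.exp_add, ← Complex.exp_add, h]
      linear_combination a n * y * h2
    apply this
    push_cast; ring

theorem transfer (φ : SchwartzMap ℝ ℂ) (C : ℕ) : ∃ K : ℝ, 0 ≤ K ∧ ∀ (σ N : ℝ), 0 < σ → 0 < N →
    ∀ (a : ℕ → ℂ), LSeriesSummable a σ → ∀ M : ℝ,
      (∀ t : ℝ, ‖LSeries a (σ + t * Complex.I)‖ ≤ M * (1 + |t|) ^ C) →
      ‖∑' n : ℕ, a n * (((N / n) ^ σ : ℝ) : ℂ) * φ (Real.log n - Real.log N)‖ ≤ K * M * N ^ σ := by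
  refine ⟨∫ ξ : ℝ, ‖(𝓕 φ) ξ‖ * (1 + |2 * Real.pi * ξ|) ^ C,
    integral_nonneg fun ξ => by positivity, ?_⟩
  intro σ N hσ hN a ha M hM
  set F : ℕ → ℝ → ℂ := fun n ξ => LSeries.term a (σ + ((-(2 * Real.pi * ξ) : ℝ) : ℂ) * Complex.I) n *
      ((((N ^ σ : ℝ) : ℂ) * Complex.exp ((-(2 * Real.pi * ξ * Real.log N) : ℝ) * Complex.I)) * (𝓕 φ) ξ) with hF
  have hF' : ∀ n ξ, F n ξ = a n * (((N / n) ^ σ : ℝ) : ℂ) *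
      (Complex.exp ((2 * Real.pi * ξ * (Real.log n - Real.log N) : ℝ) * Complex.I) * (𝓕 φ) ξ) := by
    intro n ξ
    have := term_transfer a σ hσ N hN ξ n
    simp only [hF]
    rw [← mul_assoc, ← this]; ring
  have hnorm : ∀ n ξ, ‖F n ξ‖ = ‖a n * (((N / n) ^ σ : ℝ) : ℂ)‖ * ‖(𝓕 φ) ξ‖ := by
    intro n ξ
    rw [hF', norm_mul, norm_mul (Complex.exp _), Complex.norm_exp_ofReal_mul_I, one_mul]
  have hFint : ∀ n, Integrable (F n) := by
    intro n
    refine Integrable.mono' ((SchwartzMap.integrable (𝓕 φ)).norm.const_mul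
      ‖a n * (((N / n) ^ σ : ℝ) : ℂ)‖) ?_ (Filter.Eventually.of_forall fun ξ => (hnorm n ξ).le)
    have : F n = fun ξ => a n * (((N / n) ^ σ : ℝ) : ℂ) *
      (Complex.exp ((2 * Real.pi * ξ * (Real.log n - Real.log N) : ℝ) * Complex.I) * (𝓕 φ) ξ) :=
        funext fun ξ => hF' n ξ
    rw [this]
    apply Continuous.aestronglyMeasurable
    have := (𝓕 φ).continuous
    fun_prop
  have hterm : ∀ n, a n * (((N / n) ^ σ : ℝ) : ℂ) * φ (Real.log n - Real.log N) = ∫ ξ, F n ξ := by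
    intro n
    rw [schwartz_inv φ (Real.log n - Real.log N), ← integral_const_mul]
    exact integral_congr_ae (Filter.Eventually.of_forall fun ξ => (hF' n ξ).symm)
  have hsum0 : Summable fun n : ℕ => ‖a n * (((N / n) ^ σ : ℝ) : ℂ)‖ := by
    have h1 := (Summable.norm ha).mul_right (N ^ σ)
    refine h1.congr fun n => ?_
    have := term_transfer a σ hσ N hN 0 n
    simp only [mul_zero, zero_mul, Complex.ofReal_zero, Complex.exp_zero, mul_one, neg_zero, add_zero] at this
    rw [this, norm_mul, Complex.norm_real, Real.norm_eq_abs, abs_of_nonneg (by positivity)]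
  have hsum : Summable fun n => ∫ ξ, ‖F n ξ‖ := by
    simp only [hnorm, integral_const_mul]
    exact hsum0.mul_right _
  simp only [hterm]
  rw [(hasSum_integral_of_summable_integral_norm hFint hsum).tsum_eq]
  have hL : ∀ ξ, ∑' n, F n ξ = LSeries a (σ + ((-(2 * Real.pi * ξ) : ℝ) : ℂ) * Complex.I) *
      ((((N ^ σ : ℝ) : ℂ) * Complex.exp ((-(2 * Real.pi * ξ * Real.log N) : ℝ) * Complex.I)) * (𝓕 φ) ξ) := by
    intro ξ
    simp only [hF]
    rw [tsum_mul_right]; rfl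
  calc _ ≤ ∫ ξ, (M * N ^ σ) * (‖(𝓕 φ) ξ‖ * (1 + |2 * Real.pi * ξ|) ^ C) := by
        refine norm_integral_le_of_norm_le ((schwartz_poly_integrable (𝓕 φ) C).const_mul _)
          (Filter.Eventually.of_forall fun ξ => ?_)
        rw [hL, norm_mul, norm_mul, norm_mul, Complex.norm_exp_ofReal_mul_I, Complex.norm_real,
          Real.norm_eq_abs, abs_of_nonneg (by positivity : 0 ≤ N ^ σ), mul_one]
        have := hM (-(2 * Real.pi * ξ))
        rw [abs_neg] at this
        calc _ ≤ (M * (1 + |2 * Real.pi * ξ|) ^ C) * (N ^ σ * ‖(𝓕 φ) ξ‖) := by gcongr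
          _ = _ := by ring
    _ = _ := by rw [integral_const_mul]; ring
end transferSection

end ModPC2

section ModPC3
/-- the smooth bump -/
noncomputable def psib : ContDiffBump (0 : ℝ) := ⟨2, 3, by norm_num, by norm_num⟩

noncomputable def sg (N : ℝ) : ℝ := 1 + 1 / Real.log N

/-- the smooth weight -/
noncomputable def om (N x : ℝ) : ℝ := (N / x) ^ sg N * psib (Real.log x - Real.log N)

lemma psib_nonneg (u : ℝ) : 0 ≤ psib u := psib.nonneg
lemma psib_le_one (u : ℝ) : psib u ≤ 1 := psib.le_one
lemma psib_one {u : ℝ} (h : |u| ≤ 2) : psib u = 1 :=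
  psib.one_of_mem_closedBall (by simpa [psib] using h)
lemma psib_zero {u : ℝ} (h : 3 ≤ |u|) : psib u = 0 :=
  psib.zero_of_le_dist (by simpa [psib] using h)

lemma sg_bounds {N : ℝ} (hN : 3 ≤ N) : 1 < sg N ∧ sg N ≤ 2 := by
  have h1 : 1 < Real.log N := by
    rw [Real.lt_log_iff_exp_lt (by linarith)]
    linarith [Real.exp_one_lt_three]
  have h2 : 0 < Real.log N := by linarith
  unfold sg
  constructor
  · have : 0 < 1 / Real.log N := by positivity
    linarith
  · have : 1 / Real.log N ≤ 1 := by rw [div_le_one h2]; exact h1.le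
    linarith

lemma N_rpow_sg {N : ℝ} (hN : 3 ≤ N) : N ^ sg N = Real.exp 1 * N := by
  have h1 : 1 < Real.log N := by
    rw [Real.lt_log_iff_exp_lt (by linarith)]
    linarith [Real.exp_one_lt_three]
  rw [Real.rpow_def_of_pos (by linarith), sg, mul_add, mul_one, mul_one_div, div_self (by linarith),
    Real.exp_add, Real.exp_log (by linarith), mul_comm]

/-- weight in the log variable -/
noncomputable def hw (s u : ℝ) : ℝ := Real.exp (-(s * u)) * psib u

lemma om_eq {N x : ℝ} (hN : 0 < N) (hx : 0 < x) : om N x = hw (sg N) (Real.log x - Real.log N) := by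
  unfold om hw
  congr 1
  rw [Real.rpow_def_of_pos (by positivity), Real.log_div hN.ne' hx.ne']
  congr 1; ring

lemma hw_nonneg (s u : ℝ) : 0 ≤ hw s u := mul_nonneg (Real.exp_pos _).le (psib_nonneg _)

lemma hw_le {s : ℝ} (hs : 0 ≤ s) (hs2 : s ≤ 2) (u : ℝ) : hw s u ≤ Real.exp 6 := by
  by_cases hu : 3 ≤ |u|
  · rw [hw, psib_zero hu]; simp; positivity
  · push Not at hu
    have := abs_lt.1 hu
    calc hw s u ≤ Real.exp (-(s * u)) * 1 := by
          unfold hw; gcongr; exact psib_le_one u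
      _ ≤ Real.exp 6 := by
          rw [mul_one]; apply Real.exp_le_exp.2; nlinarith

lemma om_nonneg {N x : ℝ} (hN : 0 < N) (hx : 0 ≤ x) : 0 ≤ om N x :=
  mul_nonneg (Real.rpow_nonneg (by positivity) _) (psib_nonneg _)

lemma om_zero {N : ℝ} (hN : 3 ≤ N) : om N 0 = 0 := by
  have := sg_bounds hN
  unfold om; rw [div_zero, Real.zero_rpow (by linarith), zero_mul]

lemma om_le {N x : ℝ} (hN : 3 ≤ N) (hx : 0 ≤ x) : om N x ≤ Real.exp 6 := by
  have h := sg_bounds hN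
  rcases hx.eq_or_lt with h0 | h0
  · rw [← h0, om_zero hN]; positivity
  · rw [om_eq (by linarith) h0]; exact hw_le (by linarith) h.2 _

lemma om_supp {N x : ℝ} (hN : 0 < N) (hx : 0 < x) (h : om N x ≠ 0) :
    Real.exp (-3) * N < x ∧ x < Real.exp 3 * N := by
  rw [om_eq hN hx] at h
  have h3 : ¬ 3 ≤ |Real.log x - Real.log N| := by
    intro h3; apply h; unfold hw; rw [psib_zero h3, mul_zero]
  push Not at h3
  have h4 := abs_lt.1 h3
  constructor
  · rw [← Real.exp_log hx, ← Real.exp_log hN, ← Real.exp_add]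
    apply Real.exp_lt_exp.2; linarith
  · rw [← Real.exp_log hx, ← Real.exp_log hN, ← Real.exp_add]
    apply Real.exp_lt_exp.2; linarith

lemma om_ge_one {N x : ℝ} (hN : 3 ≤ N) (hx : Real.exp (-2) * N ≤ x) (hx2 : x ≤ N) : 1 ≤ om N x := by
  have hN0 : 0 < N := by linarith
  have hx0 : 0 < x := lt_of_lt_of_le (by positivity) hx
  have h := sg_bounds hN
  have h1 : Real.log x ≤ Real.log N := Real.log_le_log hx0 hx2
  have h2 : -2 + Real.log N ≤ Real.log x := by
    have := Real.log_le_log (by positivity) hx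
    rwa [Real.log_mul (by positivity) hN0.ne', Real.log_exp] at this
  rw [om_eq hN0 hx0, hw, psib_one (abs_le.2 ⟨by linarith, by linarith⟩), mul_one]
  apply Real.one_le_exp; nlinarith

lemma hw_lip : ∃ C : ℝ, 0 ≤ C ∧ ∀ s : ℝ, 0 ≤ s → s ≤ 2 → ∀ u v : ℝ, |hw s u - hw s v| ≤ C * |u - v| := by
  have hc : Continuous (deriv psib) := (psib.contDiff (n := 1)).continuous_deriv le_rfl
  have hd : Differentiable ℝ psib := (psib.contDiff (n := 1)).differentiable (by norm_num)
  obtain ⟨M, hM⟩ := (isCompact_Icc (a := (-4 : ℝ)) (b := 4)).exists_bound_of_continuousOn hc.continuousOn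
  have hM0 : 0 ≤ M := (norm_nonneg _).trans (hM 0 (by norm_num))
  refine ⟨Real.exp 8 * (2 + M), by positivity, ?_⟩
  intro s hs hs2 u v
  have hdw : ∀ x, HasDerivAt (hw s) (Real.exp (-(s * x)) * (-s) * psib x + Real.exp (-(s * x)) * deriv psib x) x := by
    intro x
    have h1 : HasDerivAt (fun x => Real.exp (-(s * x))) (Real.exp (-(s * x)) * (-s)) x := by
      have := ((hasDerivAt_id x).const_mul s).neg.exp
      simpa using this
    exact h1.mul (hd x).hasDerivAt
  have hb : ∀ x ∈ (Set.univ : Set ℝ), ‖Real.exp (-(s * x)) * (-s) * psib x + Real.exp (-(s * x)) * deriv psib x‖ ≤ Real.exp 8 * (2 + M) := by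
    intro x _
    by_cases hx : 4 ≤ |x|
    · have h0 : psib x = 0 := psib_zero (by linarith)
      have h1 : deriv psib x = 0 := by
        have : psib =ᶠ[nhds x] fun _ => (0 : ℝ) := by
          have : ∀ᶠ y in nhds x, 3 < |y| := continuous_abs.continuousAt.eventually (lt_mem_nhds (by linarith))
          filter_upwards [this] with y hy using psib_zero hy.le
        rw [this.deriv_eq]; simp
      rw [h0, h1]; simp; positivity
    · push Not at hx
      have h4 := abs_lt.1 hx
      have h5 : ‖deriv psib x‖ ≤ M := hM x ⟨by linarith, by linarith⟩
      have h6 : Real.exp (-(s * x)) ≤ Real.exp 8 := Real.exp_le_exp.2 (by nlinarith)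
      have h7 : ‖-s * psib x‖ ≤ 2 := by
        rw [norm_mul, norm_neg, Real.norm_eq_abs, abs_of_nonneg hs, Real.norm_eq_abs, abs_of_nonneg (psib_nonneg x)]
        nlinarith [psib_le_one x, psib_nonneg x]
      have : Real.exp (-(s * x)) * (-s) * psib x + Real.exp (-(s * x)) * deriv psib x =
        Real.exp (-(s * x)) * (-s * psib x + deriv psib x) := by ring
      rw [this, norm_mul, Real.norm_eq_abs, abs_of_pos (Real.exp_pos _)]
      refine mul_le_mul h6 ((norm_add_le _ _).trans (add_le_add h7 h5)) (norm_nonneg _) (by positivity)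
  have := convex_univ.norm_image_sub_le_of_norm_hasDerivWithin_le (f := hw s)
    (fun x _ => (hdw x).hasDerivWithinAt) hb (Set.mem_univ v) (Set.mem_univ u)
  simpa [Real.norm_eq_abs] using this

/-- Schwartz versions `u^i psi(u)` -/
noncomputable def psis (i : ℕ) : SchwartzMap ℝ ℂ :=
  HasCompactSupport.toSchwartzMap (f := fun u : ℝ => ((u ^ i * psib u : ℝ) : ℂ))
    (by
      have h : HasCompactSupport (psib : ℝ → ℝ) := psib.hasCompactSupport
      have h2 : HasCompactSupport (fun u : ℝ => u ^ i * psib u) := h.mul_left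
      exact h2.comp_left (g := fun x : ℝ => (x : ℂ)) (by simp))
    (by
      have : ContDiff ℝ (⊤ : ℕ∞) (fun u : ℝ => u ^ i * psib u) := (contDiff_id.pow i).mul psib.contDiff
      exact Complex.ofRealCLM.contDiff.comp this)

lemma psis_apply (i : ℕ) (u : ℝ) : psis i u = ((u ^ i * psib u : ℝ) : ℂ) := rfl

end ModPC3

section ModPC0
lemma hs_le (x : ℕ) : ∑ n ∈ Finset.Icc 1 x, (1 : ℝ) / n ≤ 1 + Real.log x := by
  have := harmonic_le_one_add_log x
  rw [harmonic_eq_sum_Icc] at this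
  push_cast at this
  simpa [one_div] using this

lemma sum_conv_le (x : ℕ) (F G : ℕ → ℝ) (hF : ∀ n, 0 ≤ F n) (hG : ∀ n, 0 ≤ G n) :
    ∑ n ∈ Finset.Icc 1 x, (∑ ab ∈ n.divisorsAntidiagonal, F ab.1 * G ab.2) / n ≤
      (∑ n ∈ Finset.Icc 1 x, F n / n) * (∑ n ∈ Finset.Icc 1 x, G n / n) := by
  rw [Finset.sum_mul_sum, ← Finset.sum_product']
  have h1 : ∀ n ∈ Finset.Icc 1 x, (∑ ab ∈ n.divisorsAntidiagonal, F ab.1 * G ab.2) / n ≤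
      ∑ ab ∈ (Finset.Icc 1 x ×ˢ Finset.Icc 1 x).filter (fun ab => ab.1 * ab.2 = n),
        F ab.1 / ab.1 * (G ab.2 / ab.2) := by
    intro n hn
    rw [Finset.sum_div]
    have hn' := Finset.mem_Icc.1 hn
    refine (Finset.sum_le_sum (g := fun ab => F ab.1 / ab.1 * (G ab.2 / ab.2)) ?_).trans
      (Finset.sum_le_sum_of_subset_of_nonneg ?_ ?_)
    · intro ab hab
      rw [Nat.mem_divisorsAntidiagonal] at hab
      rw [← hab.1]; push_cast
      rw [div_mul_div_comm]
    · intro ab hab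
      rw [Nat.mem_divisorsAntidiagonal] at hab
      have h1 : 0 < ab.1 := Nat.pos_of_ne_zero (by rintro h; rw [h] at hab; simp at hab; omega)
      have h2 : 0 < ab.2 := Nat.pos_of_ne_zero (by rintro h; rw [h] at hab; simp at hab; omega)
      have h3 : ab.1 ≤ n := Nat.le_of_dvd hn'.1 ⟨_, hab.1.symm⟩
      have h4 : ab.2 ≤ n := Nat.le_of_dvd hn'.1 ⟨_, (mul_comm _ _).trans hab.1 |>.symm⟩
      simp only [Finset.mem_filter, Finset.mem_product, Finset.mem_Icc]
      exact ⟨⟨⟨h1, by omega⟩, ⟨h2, by omega⟩⟩, hab.1⟩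
    · intro ab _ _
      exact mul_nonneg (div_nonneg (hF _) (by positivity)) (div_nonneg (hG _) (by positivity))
  refine (Finset.sum_le_sum h1).trans ?_
  refine Finset.sum_fiberwise_le_sum_of_sum_fiber_nonneg (f := fun ab : ℕ × ℕ => F ab.1 / ab.1 * (G ab.2 / ab.2)) ?_
  intro y _
  exact Finset.sum_nonneg fun ab _ => mul_nonneg (div_nonneg (hF _) (by positivity)) (div_nonneg (hG _) (by positivity))

lemma sum_tau (x : ℕ) : ∑ n ∈ Finset.Icc 1 x, (n.divisors.card : ℝ) / n ≤ (1 + Real.log x) ^ 2 := by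
  have h := sum_conv_le x (fun _ => 1) (fun _ => 1) (by simp) (by simp)
  have h0 : 0 ≤ ∑ n ∈ Finset.Icc 1 x, (1 : ℝ) / n := Finset.sum_nonneg fun _ _ => by positivity
  have h2 := hs_le x
  calc _ = ∑ n ∈ Finset.Icc 1 x, (∑ ab ∈ n.divisorsAntidiagonal, (1:ℝ) * 1) / n := by
        refine Finset.sum_congr rfl fun n _ => ?_
        simp [← Nat.map_div_right_divisors]
    _ ≤ _ := h
    _ ≤ _ := by rw [← sq]; exact pow_le_pow_left₀ h0 h2 2

lemma card_divisors_mul_le (a b : ℕ) : (a * b).divisors.card ≤ a.divisors.card * b.divisors.card := by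
  rw [Nat.divisors_mul]; exact Finset.card_mul_le

lemma sum_tau_sq (x : ℕ) : ∑ n ∈ Finset.Icc 1 x, (n.divisors.card : ℝ) ^ 2 / n ≤ (1 + Real.log x) ^ 4 := by
  have h := sum_conv_le x (fun n => n.divisors.card) (fun n => n.divisors.card) (by simp) (by simp)
  have h0 : 0 ≤ ∑ n ∈ Finset.Icc 1 x, (n.divisors.card : ℝ) / n := Finset.sum_nonneg fun _ _ => by positivity
  have h2 := sum_tau x
  calc _ ≤ ∑ n ∈ Finset.Icc 1 x, (∑ ab ∈ n.divisorsAntidiagonal, (ab.1.divisors.card : ℝ) * ab.2.divisors.card) / n := by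
        refine Finset.sum_le_sum fun n _ => ?_
        gcongr
        have : (n.divisors.card : ℝ) ^ 2 = ∑ ab ∈ n.divisorsAntidiagonal, (n.divisors.card : ℝ) := by
          simp [← Nat.map_div_right_divisors, sq]
        rw [this]
        refine Finset.sum_le_sum fun ab hab => ?_
        rw [← (Nat.mem_divisorsAntidiagonal.1 hab).1]
        exact_mod_cast card_divisors_mul_le _ _
    _ ≤ _ := h
    _ ≤ _ := by
        rw [← sq, show (1 + Real.log x) ^ 4 = ((1 + Real.log x) ^ 2) ^ 2 by ring]
        exact pow_le_pow_left₀ h0 h2 2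

lemma sum_divisors_sqfree {α : Type*} [AddCommMonoid α] {n : ℕ} (hn : Squarefree n) (F : ℕ → α) :
    ∑ d ∈ n.divisors, F d = ∑ T ∈ n.primeFactors.powerset, F (∏ p ∈ T, p) := by
  rw [← Nat.divisors_filter_squarefree_of_squarefree hn, Nat.sum_divisors_filter_squarefree hn.ne_zero]
  refine Finset.sum_congr ?_ fun T _ => ?_
  · rw [Nat.factors_eq]; rfl
  · rw [Finset.prod_val]; rfl

lemma omega_prod {T : Finset ℕ} (hT : ∀ p ∈ T, p.Prime) : (∏ p ∈ T, p).primeFactors = T :=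
  Nat.primeFactors_prod hT

lemma sum_pow_omega (M x : ℕ) :
    ∑ n ∈ (Finset.Icc 1 x).filter Squarefree, (M : ℝ) ^ n.primeFactors.card / n ≤ (1 + Real.log x) ^ M := by
  have hl : 0 ≤ Real.log x := Real.log_natCast_nonneg x
  induction M with
  | zero =>
    rw [pow_zero]
    calc _ ≤ ∑ n ∈ (Finset.Icc 1 x).filter Squarefree, (if n = 1 then (1:ℝ) else 0) := by
          refine Finset.sum_le_sum fun n hn => ?_
          simp only [Finset.mem_filter, Finset.mem_Icc] at hn
          split_ifs with h
          · simp [h]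
          · have : n.primeFactors.card ≠ 0 := by
              rw [Ne, Finset.card_eq_zero, Nat.primeFactors_eq_empty]; omega
            simp [this]
      _ ≤ 1 := by
          rw [Finset.sum_ite_eq']; split_ifs <;> norm_num
  | succ M ih =>
    have h := sum_conv_le x (fun n => if Squarefree n then (M : ℝ) ^ n.primeFactors.card else 0) (fun _ => 1)
      (by intro n; split_ifs <;> positivity) (by simp)
    calc _ ≤ ∑ n ∈ Finset.Icc 1 x, (∑ ab ∈ n.divisorsAntidiagonal,
            (if Squarefree ab.1 then (M : ℝ) ^ ab.1.primeFactors.card else 0) * 1) / n := by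
          rw [Finset.sum_filter]
          refine Finset.sum_le_sum fun n hn => ?_
          split_ifs with hs
          · gcongr
            apply le_of_eq
            rw [Nat.sum_divisorsAntidiagonal (f := fun a b => (if Squarefree a then (M : ℝ) ^ a.primeFactors.card else 0) * 1),
              sum_divisors_sqfree hs]
            have := Finset.sum_pow_mul_eq_add_pow (M : ℝ) 1 n.primeFactors
            push_cast
            rw [← this]
            refine Finset.sum_congr rfl fun T hT => ?_
            have hT' : ∀ p ∈ T, p.Prime := fun p hp => Nat.prime_of_mem_primeFactors (Finset.mem_powerset.1 hT hp)
            have hsq : Squarefree (∏ p ∈ T, p) := by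
              apply hs.squarefree_of_dvd
              rw [← Nat.prod_primeFactors_of_squarefree hs]
              exact Finset.prod_dvd_prod_of_subset _ _ _ (Finset.mem_powerset.1 hT)
            rw [omega_prod hT', if_pos hsq]; simp
          · apply div_nonneg _ (by positivity)
            refine Finset.sum_nonneg fun ab _ => ?_
            split_ifs <;> positivity
      _ ≤ _ := h
      _ ≤ (1 + Real.log x) ^ M * (1 + Real.log x) := by
          refine mul_le_mul ?_ (hs_le x) (Finset.sum_nonneg fun _ _ => by positivity) (by positivity)
          refine le_trans (le_of_eq ?_) ih
          rw [Finset.sum_filter]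
          refine Finset.sum_congr rfl fun n _ => ?_
          split_ifs <;> simp
      _ = _ := by ring

end ModPC0

section ModPC4
lemma vaughan_ring {R : Type*} [CommRing R] (L M A z : R) :
    L = A + M * (L * z) - (M * A) * z + (L - A) * (1 - M * z) := by ring

open ArithmeticFunction in
lemma vaughan_id (U : ℕ) :
    ∃ Ml Ll : ArithmeticFunction ℝ, (∀ n, Ml n = if n ≤ U then ((ArithmeticFunction.moebius n : ℤ) : ℝ) else 0) ∧
      (∀ n, Ll n = if n ≤ U then ArithmeticFunction.vonMangoldt n else 0) ∧
      (ArithmeticFunction.vonMangoldt : ArithmeticFunction ℝ) =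
        Ll + Ml * ArithmeticFunction.log - (Ml * Ll) * (ArithmeticFunction.zeta : ArithmeticFunction ℝ) +
        (ArithmeticFunction.vonMangoldt - Ll) * (1 - Ml * (ArithmeticFunction.zeta : ArithmeticFunction ℝ)) := by
  refine ⟨⟨fun n => if n ≤ U then ((ArithmeticFunction.moebius n : ℤ) : ℝ) else 0, by simp⟩,
    ⟨fun n => if n ≤ U then ArithmeticFunction.vonMangoldt n else 0, by simp⟩, fun n => rfl, fun n => rfl, ?_⟩
  rw [← ArithmeticFunction.vonMangoldt_mul_zeta]
  exact vaughan_ring _ _ _ _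

lemma exists_phase (z : ℂ) : ∃ c : ℂ, ‖c‖ ≤ 1 ∧ c * z = (‖z‖ : ℂ) := by
  by_cases hz : z = 0
  · exact ⟨0, by simp, by simp [hz]⟩
  · have hz' : (‖z‖ : ℂ) ≠ 0 := by simpa using hz
    refine ⟨(starRingEnd ℂ) z / ‖z‖, ?_, ?_⟩
    · rw [norm_div, RCLike.norm_conj]; simp [hz]
    · rw [div_mul_eq_mul_div, Complex.conj_mul', sq, mul_div_assoc, div_self hz', mul_one]

lemma sum_dirichlet (X : ℕ) (F : ℕ → ℕ → ℂ) (hF : ∀ a b, X < a * b → F a b = 0) :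
    ∑ n ∈ Finset.Icc 1 X, ∑ ab ∈ n.divisorsAntidiagonal, F ab.1 ab.2 =
      ∑ a ∈ Finset.Icc 1 X, ∑ b ∈ Finset.Icc 1 X, F a b := by
  rw [← Finset.sum_product' (f := F)]
  have h1 : ∀ n ∈ Finset.Icc 1 X, ∑ ab ∈ n.divisorsAntidiagonal, F ab.1 ab.2 =
      ∑ ab ∈ (Finset.Icc 1 X ×ˢ Finset.Icc 1 X).filter (fun ab => ab.1 * ab.2 = n), F ab.1 ab.2 := by
    intro n hn
    have hn' := Finset.mem_Icc.1 hn
    refine Finset.sum_congr ?_ fun _ _ => rfl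
    ext ab
    rw [Nat.mem_divisorsAntidiagonal]
    simp only [Finset.mem_filter, Finset.mem_product, Finset.mem_Icc]
    constructor
    · intro hab
      have h1 : 0 < ab.1 := Nat.pos_of_ne_zero (by rintro h; rw [h] at hab; simp at hab; omega)
      have h2 : 0 < ab.2 := Nat.pos_of_ne_zero (by rintro h; rw [h] at hab; simp at hab; omega)
      have h3 : ab.1 ≤ n := Nat.le_of_dvd hn'.1 ⟨_, hab.1.symm⟩
      have h4 : ab.2 ≤ n := Nat.le_of_dvd hn'.1 ⟨_, (mul_comm _ _).trans hab.1 |>.symm⟩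
      exact ⟨⟨⟨h1, by omega⟩, ⟨h2, by omega⟩⟩, hab.1⟩
    · intro h; exact ⟨h.2, by omega⟩
  rw [Finset.sum_congr rfl h1, Finset.sum_fiberwise_eq_sum_filter, Finset.sum_filter]
  refine Finset.sum_congr rfl fun ab hab => ?_
  split_ifs with h
  · rfl
  · simp only [Finset.mem_product, Finset.mem_Icc] at hab h
    refine (hF _ _ ?_).symm
    by_contra h2
    exact h ⟨Nat.mul_pos hab.1.1 hab.2.1, by omega⟩

/-- cut-off -/
noncomputable def XN (N : ℝ) : ℕ := ⌈Real.exp 3 * N⌉₊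

lemma om_big {N : ℝ} (hN : 3 ≤ N) {n : ℕ} (h : XN N < n) : om N n = 0 := by
  by_contra h0
  have hn : (0:ℝ) < n := by exact_mod_cast (by omega : 0 < n)
  have h1 := (om_supp (by linarith) hn h0).2
  have h2 : Real.exp 3 * N ≤ XN N := Nat.le_ceil _
  have h3 : (XN N : ℝ) < n := by exact_mod_cast h
  linarith

lemma om_lip : ∃ C : ℝ, 0 ≤ C ∧ ∀ N : ℝ, 3 ≤ N → ∀ b m : ℕ, 0 < b → 0 < m →
    |om N ((b * (m + 1) : ℕ) : ℝ) - om N ((b * m : ℕ) : ℝ)| ≤ C / m := by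
  obtain ⟨C, hC, h⟩ := hw_lip
  refine ⟨C, hC, fun N hN b m hb hm => ?_⟩
  have hs := sg_bounds hN
  have hb' : (0:ℝ) < b := by exact_mod_cast hb
  have hm' : (0:ℝ) < m := by exact_mod_cast hm
  push_cast
  rw [om_eq (by linarith) (by positivity), om_eq (by linarith) (by positivity)]
  refine (h _ (by linarith) hs.2 _ _).trans ?_
  rw [Real.log_mul hb'.ne' (by positivity), Real.log_mul hb'.ne' hm'.ne']
  have h1 : Real.log (m + 1) - Real.log m = Real.log (1 + 1 / m) := by
    rw [← Real.log_div (by positivity) (by positivity)]; congr 1; field_simp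
  have h2 : Real.log (1 + 1 / (m:ℝ)) ≤ 1 / m := by
    have := Real.log_le_sub_one_of_pos (show 0 < 1 + 1 / (m:ℝ) by positivity)
    linarith
  have h3 : 0 ≤ Real.log (1 + 1 / (m:ℝ)) := Real.log_nonneg (by simp)
  rw [show Real.log b + Real.log (m + 1) - Real.log N - (Real.log b + Real.log m - Real.log N) =
    Real.log (m+1) - Real.log m by ring, h1, abs_of_nonneg h3]
  exact (mul_le_mul_of_nonneg_left h2 hC).trans (le_of_eq (by ring))

lemma typeI_inner : ∃ C : ℝ, 0 ≤ C ∧ ∀ N : ℝ, 3 ≤ N → ∀ (f : ℕ → ℂ) (K : ℝ), bsum f K →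
    ∀ (g : ℕ → ℝ) (G : ℝ), (∀ m, 0 < m → m ≤ XN N + 1 → |g m| ≤ G) →
    (∀ m : ℕ, 0 < m → |g (m + 1) - g m| ≤ G / m) → ∀ b : ℕ, 0 < b →
    ‖∑ m ∈ Finset.Icc 1 (XN N), f m * ((g m * om N ((b * m : ℕ) : ℝ) : ℝ) : ℂ)‖ ≤
      C * K * G * (1 + Real.log (XN N)) := by
  obtain ⟨C, hC, h⟩ := om_lip
  refine ⟨2 * (C + Real.exp 6), by positivity, ?_⟩
  intro N hN f K hf g G hg hg' b hb
  have hK : 0 ≤ K := (norm_nonneg _).trans (hf 0)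
  have hG : 0 ≤ G := (abs_nonneg _).trans (hg 1 one_pos (by omega))
  have hIco : Finset.Icc 1 (XN N) = Finset.Ico 1 (XN N + 1) := by ext; simp
  have := abel_bound f K hf (fun m => ((g m * om N ((b * m : ℕ) : ℝ) : ℝ) : ℂ)) 1 (XN N + 1) (by omega)
  rw [hIco]
  refine this.trans ?_
  have h0 : om N ((b * (XN N + 1) : ℕ) : ℝ) = 0 := om_big hN (by nlinarith)
  rw [h0, mul_zero, Complex.ofReal_zero, norm_zero, zero_add, ← hIco]
  have hsum : ∑ m ∈ Finset.Icc 1 (XN N), ‖((g (m+1) * om N ((b * (m+1) : ℕ) : ℝ) : ℝ) : ℂ) -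
      ((g m * om N ((b * m : ℕ) : ℝ) : ℝ) : ℂ)‖ ≤ ∑ m ∈ Finset.Icc 1 (XN N), (G * (C + Real.exp 6)) * (1 / (m:ℝ)) := by
    refine Finset.sum_le_sum fun m hm => ?_
    rw [Finset.mem_Icc] at hm
    rw [← Complex.ofReal_sub, Complex.norm_real, Real.norm_eq_abs]
    have e : g (m+1) * om N ((b * (m+1) : ℕ) : ℝ) - g m * om N ((b * m : ℕ) : ℝ) =
      g (m+1) * (om N ((b * (m+1) : ℕ) : ℝ) - om N ((b * m : ℕ) : ℝ)) + (g (m+1) - g m) * om N ((b * m : ℕ) : ℝ) := by ring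
    rw [e]
    refine (abs_add_le _ _).trans ?_
    rw [abs_mul, abs_mul, abs_of_nonneg (om_nonneg (by linarith) (Nat.cast_nonneg (b * m)))]
    calc _ ≤ G * (C / m) + G / m * Real.exp 6 := by
          refine add_le_add (mul_le_mul (hg _ (by omega) (by omega)) (h N hN b m hb (by omega)) (abs_nonneg _) hG)
            (mul_le_mul (hg' m (by omega)) (om_le hN (Nat.cast_nonneg _)) (om_nonneg (by linarith) (Nat.cast_nonneg _)) (by positivity))
      _ = _ := by ring
  calc _ ≤ 2 * K * ∑ m ∈ Finset.Icc 1 (XN N), (G * (C + Real.exp 6)) * (1 / (m:ℝ)) := by gcongr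
    _ = 2 * K * ((G * (C + Real.exp 6)) * ∑ m ∈ Finset.Icc 1 (XN N), (1 / (m:ℝ))) := by rw [← Finset.mul_sum]
    _ ≤ 2 * K * ((G * (C + Real.exp 6)) * (1 + Real.log (XN N))) := by
        gcongr; exact hs_le _
    _ = _ := by ring

lemma typeI : ∃ C : ℝ, 0 ≤ C ∧ ∀ N : ℝ, 3 ≤ N → ∀ (f : ℕ → ℂ) (K : ℝ), bsum f K →
    (∀ n, ‖f n‖ ≤ 1) → (∀ m n, f (m * n) = f m * f n) →
    ∀ (g α : ArithmeticFunction ℝ) (G V : ℝ), (∀ m, 0 < m → m ≤ XN N + 1 → |g m| ≤ G) →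
    (∀ m : ℕ, 0 < m → |g (m + 1) - g m| ≤ G / m) → ∑ b ∈ Finset.Icc 1 (XN N), |α b| ≤ V →
    ‖∑ n ∈ Finset.Icc 1 (XN N), ((α * g) n : ℂ) * f n * (om N n : ℂ)‖ ≤
      C * K * G * (1 + Real.log (XN N)) * V := by
  obtain ⟨C, hC, h⟩ := typeI_inner
  refine ⟨C, hC, ?_⟩
  intro N hN f K hf hf1 hfm g α G V hg hg' hV
  have hK : 0 ≤ K := (norm_nonneg _).trans (hf 0)
  have hG : 0 ≤ G := (abs_nonneg _).trans (hg 1 one_pos (by omega))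
  have e1 : ∑ n ∈ Finset.Icc 1 (XN N), ((α * g) n : ℂ) * f n * (om N n : ℂ) =
      ∑ n ∈ Finset.Icc 1 (XN N), ∑ ab ∈ n.divisorsAntidiagonal,
        (α ab.1 * f ab.1 * (f ab.2 * ((g ab.2 * om N ((ab.1 * ab.2 : ℕ) : ℝ) : ℝ) : ℂ))) := by
    refine Finset.sum_congr rfl fun n _ => ?_
    rw [ArithmeticFunction.mul_apply]
    push_cast
    rw [Finset.sum_mul, Finset.sum_mul]
    refine Finset.sum_congr rfl fun ab hab => ?_
    rw [← (Nat.mem_divisorsAntidiagonal.1 hab).1, hfm]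
    push_cast; ring
  rw [e1, sum_dirichlet (XN N) (fun a b => (α a * f a * (f b * ((g b * om N ((a * b : ℕ) : ℝ) : ℝ) : ℂ))))
    (fun a b hab => by rw [om_big hN hab]; simp)]
  calc _ ≤ ∑ a ∈ Finset.Icc 1 (XN N), |α a| * (C * K * G * (1 + Real.log (XN N))) := by
        refine norm_sum_le_of_le _ fun a ha => ?_
        rw [Finset.mem_Icc] at ha
        rw [← Finset.mul_sum, norm_mul, norm_mul, Complex.norm_real, Real.norm_eq_abs]
        refine mul_le_mul ?_ (h N hN f K hf g G hg hg' a (by omega)) (norm_nonneg _) (abs_nonneg _)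
        exact mul_le_of_le_one_right (abs_nonneg _) (hf1 a)
    _ = (∑ a ∈ Finset.Icc 1 (XN N), |α a|) * (C * K * G * (1 + Real.log (XN N))) := by rw [Finset.sum_mul]
    _ ≤ V * (C * K * G * (1 + Real.log (XN N))) := by
        gcongr
    _ = _ := by ring

end ModPC4

section ModPC5
lemma typeII_LS {J : Type*} [Fintype J] [DecidableEq J] (f : J → ℕ → ℂ)
    (hf : ∀ j n, ‖f j n‖ ≤ 1) (K : ℝ) (hK : 0 ≤ K)
    (hoff : ∀ i j, i ≠ j → bsum (fun n => f i n * (starRingEnd ℂ) (f j n)) K)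
    (U Y : ℕ) (hUY : U ≤ Y) (hU : 2 * K * Fintype.card J ≤ U + 1)
    (a : ℕ → ℝ) (ha : ∀ n, n ≤ U → a n = 0) (s : ℂ) (hs : 1 ≤ s.re) (E : ℝ)
    (hE : ∑ n ∈ Finset.Icc 1 Y, a n ^ 2 / n ≤ E) :
    ∑ j, ‖∑ n ∈ Finset.Icc 1 Y, a n * f j n * (n : ℂ) ^ (-s)‖ ^ 2 ≤ (2 + Real.log Y) * E := by
  have h := large_sieve f hf K hK hoff (U + 1) (Y + 1) (by omega) (by omega) (fun n => a n * (n : ℂ) ^ (-s))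
  have hsub : Finset.Ico (U + 1) (Y + 1) ⊆ Finset.Icc 1 Y := by
    intro n hn; simp only [Finset.mem_Ico, Finset.mem_Icc] at *; omega
  have e1 : ∀ j, ∑ n ∈ Finset.Icc 1 Y, a n * f j n * (n : ℂ) ^ (-s) =
      ∑ n ∈ Finset.Ico (U + 1) (Y + 1), a n * (n : ℂ) ^ (-s) * f j n := by
    intro j
    symm
    rw [Finset.sum_subset hsub]
    · exact Finset.sum_congr rfl fun n _ => by ring
    · intro n hn hn'
      simp only [Finset.mem_Ico, Finset.mem_Icc] at *
      rw [ha n (by omega)]; simp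
  simp only [e1]
  refine h.trans ?_
  have hlog := Real.log_natCast_nonneg Y
  refine mul_le_mul ?_ ?_ (Finset.sum_nonneg fun _ _ => by positivity) (by positivity)
  · have h1 : ∑ n ∈ Finset.Ico (U + 1) (Y + 1), (1 : ℝ) / n ≤ 1 + Real.log Y :=
      (Finset.sum_le_sum_of_subset_of_nonneg hsub fun _ _ _ => by positivity).trans (hs_le Y)
    have h2 : 2 * K * Fintype.card J / ((U + 1 : ℕ) : ℝ) ≤ 1 := by
      rw [div_le_one (by positivity)]; push_cast; exact hU
    linarith
  · refine le_trans ?_ hE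
    refine (Finset.sum_le_sum (g := fun n => a n ^ 2 / n) ?_).trans
      (Finset.sum_le_sum_of_subset_of_nonneg hsub fun _ _ _ => by positivity)
    intro n hn
    have hn0 : 0 < n := by simp only [Finset.mem_Ico] at hn; omega
    have hn1 : (1 : ℝ) ≤ n := by exact_mod_cast hn0
    rw [norm_mul, Complex.norm_real, Real.norm_eq_abs, Complex.norm_natCast_cpow_of_pos hn0, mul_pow, sq_abs,
      Complex.neg_re]
    have h1 : (n : ℝ) ^ (-s.re) ≤ (n : ℝ) ^ (-1 : ℝ) := Real.rpow_le_rpow_of_exponent_le hn1 (by linarith)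
    rw [Real.rpow_neg_one] at h1
    have h2 : ((n : ℝ) ^ (-s.re)) ^ 2 ≤ ((n : ℝ)⁻¹) ^ 2 := pow_le_pow_left₀ (by positivity) h1 2
    calc (n:ℝ) * (a n ^ 2 * ((n : ℝ) ^ (-s.re)) ^ 2) ≤ (n:ℝ) * (a n ^ 2 * ((n : ℝ)⁻¹) ^ 2) := by gcongr
      _ = _ := by field_simp

lemma typeII : ∃ C : ℝ, 0 ≤ C ∧ ∀ N : ℝ, 3 ≤ N → ∀ (J : Type) [Fintype J] [DecidableEq J] (f : J → ℕ → ℂ),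
    (∀ j n, ‖f j n‖ ≤ 1) → (∀ j m n, f j (m * n) = f j m * f j n) → ∀ K : ℝ, 0 ≤ K →
    (∀ i j, i ≠ j → bsum (fun n => f i n * (starRingEnd ℂ) (f j n)) K) →
    ∀ U : ℕ, U ≤ XN N → 2 * K * Fintype.card J ≤ U + 1 →
    ∀ a β : ArithmeticFunction ℝ, (∀ n, n ≤ U → a n = 0) → (∀ n, n ≤ U → β n = 0) → ∀ E : ℝ,
    ∑ n ∈ Finset.Icc 1 (XN N), a n ^ 2 / n ≤ E → ∑ n ∈ Finset.Icc 1 (XN N), β n ^ 2 / n ≤ E →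
    ∑ j, ‖∑ n ∈ Finset.Icc 1 (XN N), ((a * β) n : ℂ) * f j n * (om N n : ℂ)‖ ≤
      C * N * ((2 + 2 * Real.log (XN N)) * E) := by
  obtain ⟨C, hC, htr⟩ := transfer (psis 0) 0
  refine ⟨C * Real.exp 1, by positivity, ?_⟩
  intro N hN J _ _ f hf hfm K hK hoff U hUX hU a β ha hβ E hEa hEβ
  set X := XN N with hX
  set Y := X * X with hY
  have hX1 : 1 ≤ X := Nat.one_le_iff_ne_zero.2 (by
    rw [hX, XN, Ne, Nat.ceil_eq_zero]; push Not; positivity)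
  have hXY : X ≤ Y := by rw [hY]; nlinarith
  have hsg := sg_bounds hN
  set S : J → ℂ := fun j => ∑ n ∈ Finset.Icc 1 X, ((a * β) n : ℂ) * f j n * (om N n : ℂ) with hS
  choose c hc1 hc2 using fun j => exists_phase (S j)
  set a' : ℕ → ℝ := fun n => if n ≤ X then a n else 0 with ha'
  set β' : ℕ → ℝ := fun n => if n ≤ X then β n else 0 with hβ'
  set A : ℕ → ℂ := fun n => ∑ j, c j * (f j n * ∑ ab ∈ n.divisorsAntidiagonal, ((a' ab.1 * β' ab.2 : ℝ) : ℂ)) with hA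
  have hAY : ∀ n, Y < n → A n = 0 := by
    intro n hn
    simp only [hA]
    refine Finset.sum_eq_zero fun j _ => ?_
    rw [Finset.sum_eq_zero, mul_zero, mul_zero]
    intro ab hab
    have h1 := (Nat.mem_divisorsAntidiagonal.1 hab).1
    by_cases h2 : ab.1 ≤ X
    · have h3 : ¬ ab.2 ≤ X := fun h3 => by
        have := Nat.mul_le_mul h2 h3
        omega
      simp [hβ', h3]
    · simp [ha', h2]
  have hA0 : A 0 = 0 := by simp [hA]
  have hAX : ∀ n ∈ Finset.Icc 1 X, A n = ∑ j, c j * (f j n * ((a * β) n : ℂ)) := by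
    intro n hn
    rw [Finset.mem_Icc] at hn
    simp only [hA]
    refine Finset.sum_congr rfl fun j _ => ?_
    rw [ArithmeticFunction.mul_apply]
    push_cast
    congr 2
    refine Finset.sum_congr rfl fun ab hab => ?_
    have h1 := (Nat.mem_divisorsAntidiagonal.1 hab).1
    have h3 : ab.1 ≤ n := Nat.le_of_dvd hn.1 ⟨_, h1.symm⟩
    have h4 : ab.2 ≤ n := Nat.le_of_dvd hn.1 ⟨_, (mul_comm _ _).trans h1 |>.symm⟩
    simp [ha', hβ', h3.trans hn.2, h4.trans hn.2]
  have hterm : ∀ s : ℂ, ∀ n ∉ Finset.Icc 1 Y, LSeries.term A s n = 0 := by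
    intro s n hn
    simp only [Finset.mem_Icc, not_and_or, not_le] at hn
    rcases hn with h | h
    · have : n = 0 := by omega
      simp [this]
    · rw [LSeries.term_def, hAY n h]; simp
  have hsumm : ∀ s : ℂ, LSeriesSummable A s := fun s => summable_of_ne_finset_zero (hterm s)
  have hL : ∀ s : ℂ, LSeries A s = ∑ j, c j * ((∑ n ∈ Finset.Icc 1 Y, a' n * f j n * (n : ℂ) ^ (-s)) *
      (∑ n ∈ Finset.Icc 1 Y, β' n * f j n * (n : ℂ) ^ (-s))) := by
    intro s
    rw [LSeries, tsum_eq_sum (hterm s)]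
    have h1 : ∀ n ∈ Finset.Icc 1 Y, LSeries.term A s n = ∑ j, c j * ∑ ab ∈ n.divisorsAntidiagonal,
        (a' ab.1 * f j ab.1 * (ab.1 : ℂ) ^ (-s)) * (β' ab.2 * f j ab.2 * (ab.2 : ℂ) ^ (-s)) := by
      intro n hn
      rw [Finset.mem_Icc] at hn
      rw [LSeries.term_of_ne_zero (by omega), div_eq_mul_inv, ← Complex.cpow_neg]
      simp only [hA]
      rw [Finset.sum_mul]
      refine Finset.sum_congr rfl fun j _ => ?_
      rw [Finset.mul_sum, Finset.mul_sum, Finset.mul_sum, Finset.sum_mul]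
      refine Finset.sum_congr rfl fun ab hab => ?_
      rw [← (Nat.mem_divisorsAntidiagonal.1 hab).1, hfm]
      push_cast
      rw [Complex.natCast_mul_natCast_cpow]; ring
    rw [Finset.sum_congr rfl h1, Finset.sum_comm]
    refine Finset.sum_congr rfl fun j _ => ?_
    rw [← Finset.mul_sum, sum_dirichlet Y (fun x y => (a' x * f j x * (x : ℂ) ^ (-s)) * (β' y * f j y * (y : ℂ) ^ (-s))),
      Finset.sum_mul_sum]
    intro x y hxy
    by_cases h2 : x ≤ X
    · have h3 : ¬ y ≤ X := fun h3 => by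
        have := Nat.mul_le_mul h2 h3
        omega
      simp [hβ', h3]
    · simp [ha', h2]
  have hE' : ∀ b : ArithmeticFunction ℝ, ∑ n ∈ Finset.Icc 1 X, b n ^ 2 / n ≤ E →
      ∑ n ∈ Finset.Icc 1 Y, (if n ≤ X then b n else 0) ^ 2 / n ≤ E := by
    intro b hb
    refine le_trans (le_of_eq ?_) hb
    symm
    rw [← Finset.sum_subset (Finset.Icc_subset_Icc_right hXY : Finset.Icc 1 X ⊆ Finset.Icc 1 Y)]
    · refine Finset.sum_congr rfl fun n hn => ?_
      rw [if_pos (Finset.mem_Icc.1 hn).2]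
    · intro n hn hn'
      simp only [Finset.mem_Icc] at hn hn'
      rw [if_neg (by omega)]; simp
  have hM : ∀ t : ℝ, ‖LSeries A (sg N + t * Complex.I)‖ ≤ ((2 + 2 * Real.log X) * E) * (1 + |t|) ^ 0 := by
    intro t
    set s : ℂ := sg N + t * Complex.I with hs
    have hre : 1 ≤ s.re := by simp [hs]; exact hsg.1.le
    have hlogY : Real.log Y = 2 * Real.log X := by
      rw [hY, Nat.cast_mul, Real.log_mul (by positivity) (by positivity)]; ring
    have hA1 := typeII_LS f hf K hK hoff U Y (hUX.trans hXY) hU a' (fun n hn => by simp [ha', ha n hn]) s hre E (hE' a hEa)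
    have hB1 := typeII_LS f hf K hK hoff U Y (hUX.trans hXY) hU β' (fun n hn => by simp [hβ', hβ n hn]) s hre E (hE' β hEβ)
    rw [hL, pow_zero, mul_one]
    calc _ ≤ ∑ j, (‖∑ n ∈ Finset.Icc 1 Y, a' n * f j n * (n : ℂ) ^ (-s)‖ ^ 2 +
          ‖∑ n ∈ Finset.Icc 1 Y, β' n * f j n * (n : ℂ) ^ (-s)‖ ^ 2) / 2 := by
          refine norm_sum_le_of_le _ fun j _ => ?_
          rw [norm_mul, norm_mul]
          refine (mul_le_of_le_one_left (by positivity) (hc1 j)).trans ?_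
          nlinarith [sq_nonneg (‖∑ n ∈ Finset.Icc 1 Y, a' n * f j n * (n : ℂ) ^ (-s)‖ -
            ‖∑ n ∈ Finset.Icc 1 Y, β' n * f j n * (n : ℂ) ^ (-s)‖)]
      _ ≤ _ := by
          rw [← Finset.sum_div, Finset.sum_add_distrib]
          rw [hlogY] at hA1 hB1
          linarith
  have hfin := htr (sg N) N (by linarith) (by linarith) A (hsumm _) _ hM
  have e2 : ∑' n : ℕ, A n * (((N / n) ^ sg N : ℝ) : ℂ) * psis 0 (Real.log n - Real.log N) = ∑ j, (‖S j‖ : ℂ) := by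
    have e3 : ∀ n : ℕ, A n * (((N / n) ^ sg N : ℝ) : ℂ) * psis 0 (Real.log n - Real.log N) = A n * (om N n : ℂ) := by
      intro n
      rw [psis_apply, om, pow_zero, one_mul]; push_cast; ring
    simp only [e3]
    rw [tsum_eq_sum (s := Finset.Icc 1 X)]
    · rw [Finset.sum_congr rfl fun n hn => by rw [hAX n hn, Finset.sum_mul], Finset.sum_comm]
      refine Finset.sum_congr rfl fun j _ => ?_
      rw [← hc2 j]
      simp only [hS]
      rw [Finset.mul_sum]
      exact Finset.sum_congr rfl fun n _ => by ring
    · intro n hn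
      simp only [Finset.mem_Icc, not_and_or, not_le] at hn
      rcases hn with h | h
      · have : n = 0 := by omega
        rw [this, hA0, zero_mul]
      · rw [om_big hN h]; simp
  rw [e2, ← Complex.ofReal_sum, Complex.norm_real, Real.norm_eq_abs, N_rpow_sg hN] at hfin
  refine (le_abs_self _).trans (hfin.trans (le_of_eq ?_))
  ring

end ModPC5

section ModPC6
noncomputable def Lg (N : ℝ) : ℝ := 1 + Real.log (XN N)

lemma XN_pos {N : ℝ} (hN : 3 ≤ N) : 1 ≤ XN N := Nat.one_le_iff_ne_zero.2 (by
    rw [XN, Ne, Nat.ceil_eq_zero]; push Not; positivity)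

lemma Lg_one {N : ℝ} (hN : 3 ≤ N) : 1 ≤ Lg N := by
  have : (1:ℝ) ≤ XN N := by exact_mod_cast XN_pos hN
  have := Real.log_nonneg this
  unfold Lg; linarith

lemma XN_le {N : ℝ} (hN : 3 ≤ N) : (XN N : ℝ) ≤ Real.exp 4 * N := by
  have h1 : (XN N : ℝ) < Real.exp 3 * N + 1 := Nat.ceil_lt_add_one (by positivity)
  have h2 : Real.exp 4 = Real.exp 3 * Real.exp 1 := by rw [← Real.exp_add]; norm_num
  have h3 := Real.add_one_le_exp (1:ℝ)
  have h4 := Real.add_one_le_exp (3:ℝ)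
  have h5 : Real.exp 3 * 2 ≤ Real.exp 4 := by rw [h2]; nlinarith
  nlinarith

lemma log_ge_one {N : ℝ} (hN : 3 ≤ N) : 1 ≤ Real.log N := by
  rw [Real.le_log_iff_exp_le (by linarith)]
  have := Real.exp_one_lt_d9; linarith

lemma Lg_le {N : ℝ} (hN : 3 ≤ N) : Lg N ≤ 6 * Real.log N := by
  have h0 : (0:ℝ) < XN N := by exact_mod_cast XN_pos hN
  have h1 := Real.log_le_log h0 (XN_le hN)
  rw [Real.log_mul (by positivity) (by positivity), Real.log_exp] at h1
  have := log_ge_one hN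
  unfold Lg; linarith

lemma log_XN_add_one_le {N : ℝ} (hN : 3 ≤ N) {m : ℕ} (h0 : 0 < m) (h : m ≤ XN N + 1) : Real.log m ≤ Lg N := by
  have h1 : (1:ℝ) ≤ XN N := by exact_mod_cast XN_pos hN
  have h2 : (m:ℝ) ≤ XN N + 1 := by exact_mod_cast h
  have hm : (0:ℝ) < m := by exact_mod_cast h0
  have h3 : Real.log m ≤ Real.log (Real.exp 1 * XN N) := by
    refine Real.log_le_log hm ?_
    have := Real.add_one_le_exp (1:ℝ)
    nlinarith
  rw [Real.log_mul (by positivity) (by positivity), Real.log_exp] at h3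
  unfold Lg; linarith

open ArithmeticFunction in
lemma BVcore : ∃ C : ℝ, 0 ≤ C ∧ ∀ N : ℝ, 3 ≤ N → ∀ y : ℝ, 2 ≤ y → y ^ 50 ≤ N →
    ∀ (J : Type) [Fintype J] [DecidableEq J] (f : J → ℕ → ℂ),
    (∀ j n, ‖f j n‖ ≤ 1) → (∀ j m n, f j (m * n) = f j m * f j n) → ∀ K : ℝ, 0 ≤ K → K ≤ y →
    (∀ j, bsum (f j) K) →
    (∀ i j, i ≠ j → bsum (fun n => f i n * (starRingEnd ℂ) (f j n)) K) → (Fintype.card J : ℝ) ≤ y →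
    ∑ j, ‖∑ n ∈ Finset.Icc 1 (XN N), (vonMangoldt n : ℂ) * f j n * (om N n : ℂ)‖ ≤ C * N * Lg N ^ 5 := by
  obtain ⟨C1, hC1, hI⟩ := typeI
  obtain ⟨C2, hC2, hII⟩ := typeII
  refine ⟨2 * C1 + 8 * C2, by positivity, ?_⟩
  intro N hN y hy hyN J _ _ f hf hfm K hK hKy hb hoff hcard
  set U := ⌊y ^ 5⌋₊ with hU
  have hU1 : (U : ℝ) ≤ y ^ 5 := Nat.floor_le (by positivity)
  have hU2 : y ^ 5 ≤ U + 1 := (Nat.lt_floor_add_one _).le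
  have hL := Lg_one hN
  have hX1 := XN_pos hN
  have hy1 : (1:ℝ) ≤ y := by linarith
  have he3 : Real.exp 3 ≤ 2 ^ 5 := by
    have : Real.exp 3 = Real.exp 1 ^ 3 := by rw [← Real.exp_nat_mul]; norm_num
    rw [this]
    have := Real.exp_one_lt_d9
    calc Real.exp 1 ^ 3 ≤ 2.7182818286 ^ 3 := by gcongr
      _ ≤ _ := by norm_num
  have hUX : U ≤ XN N := by
    have : (U:ℝ) ≤ XN N := by
      have h1 : y ^ 5 ≤ y ^ 50 := pow_le_pow_right₀ hy1 (by norm_num)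
      have h2 : Real.exp 3 * N ≤ XN N := Nat.le_ceil _
      have h3 := Real.add_one_le_exp (3:ℝ)
      nlinarith
    exact_mod_cast this
  obtain ⟨Ml, Ll, hMl, hLl, hid⟩ := vaughan_id U
  have hMl1 : ∀ n, |Ml n| ≤ 1 := by
    intro n
    rw [hMl]
    split_ifs
    · exact_mod_cast ArithmeticFunction.abs_moebius_le_one
    · simp
  have hMlz : ∀ n, U < n → Ml n = 0 := fun n hn => by rw [hMl, if_neg (by omega)]
  have hLlz : ∀ n, U < n → Ll n = 0 := fun n hn => by rw [hLl, if_neg (by omega)]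
  have hLl0 : ∀ n, 0 ≤ Ll n := by
    intro n; rw [hLl]; split_ifs
    · exact vonMangoldt_nonneg
    · exact le_rfl
  have hLlΛ : ∀ n, Ll n ≤ vonMangoldt n := by
    intro n; rw [hLl]; split_ifs
    · exact le_rfl
    · exact vonMangoldt_nonneg
  -- term 0
  have t0 : ∀ j, ∑ n ∈ Finset.Icc 1 (XN N), (Ll n : ℂ) * f j n * (om N n : ℂ) = 0 := by
    intro j
    refine Finset.sum_eq_zero fun n hn => ?_
    by_cases h : U < n
    · rw [hLlz n h]; simp
    · have : om N n = 0 := by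
        by_contra h0
        have hn0 : (0:ℝ) < n := by exact_mod_cast (Finset.mem_Icc.1 hn).1
        have h1 := (om_supp (by linarith) hn0 h0).1
        have h2 : (n:ℝ) ≤ U := by exact_mod_cast (not_lt.1 h)
        have h3 : Real.exp (-3) * N < y ^ 5 := by linarith
        have h4 : N < y ^ 5 * Real.exp 3 := by
          have := mul_lt_mul_of_pos_right h3 (Real.exp_pos 3)
          rwa [mul_right_comm, ← Real.exp_add, neg_add_cancel, Real.exp_zero, one_mul] at this
        have h5 : y ^ 5 * Real.exp 3 ≤ y ^ 5 * y ^ 5 := by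
          have : (2:ℝ)^5 ≤ y^5 := by gcongr
          gcongr; linarith
        have h6 : y ^ 5 * y ^ 5 ≤ y ^ 50 := by
          rw [← pow_add]; exact pow_le_pow_right₀ hy1 (by norm_num)
        linarith
      rw [this]; simp
  -- term 1
  have t1 : ∀ j, ‖∑ n ∈ Finset.Icc 1 (XN N), ((Ml * ArithmeticFunction.log) n : ℂ) * f j n * (om N n : ℂ)‖ ≤
      C1 * K * Lg N * Lg N * U := by
    intro j
    refine hI N hN (f j) K (hb j) (hf j) (hfm j) ArithmeticFunction.log Ml (Lg N) U ?_ ?_ ?_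
    · intro m hm hm'
      rw [ArithmeticFunction.log_apply, abs_of_nonneg (Real.log_natCast_nonneg _)]
      exact log_XN_add_one_le hN hm hm'
    · intro m hm
      have hm' : (0:ℝ) < m := by exact_mod_cast hm
      rw [ArithmeticFunction.log_apply, ArithmeticFunction.log_apply]
      push_cast
      have h1 : Real.log (m + 1) - Real.log m = Real.log (1 + 1 / m) := by
        rw [← Real.log_div (by positivity) (by positivity)]; congr 1; field_simp
      have h2 : Real.log (1 + 1 / (m:ℝ)) ≤ 1 / m := by
        have := Real.log_le_sub_one_of_pos (show 0 < 1 + 1 / (m:ℝ) by positivity)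
        linarith
      have h3 : 0 ≤ Real.log (1 + 1 / (m:ℝ)) := Real.log_nonneg (by simp)
      rw [h1, abs_of_nonneg h3]
      refine h2.trans ?_
      gcongr
    · calc ∑ b ∈ Finset.Icc 1 (XN N), |Ml b| ≤ ∑ b ∈ Finset.Icc 1 (XN N), if b ≤ U then (1:ℝ) else 0 := by
            refine Finset.sum_le_sum fun b _ => ?_
            split_ifs with h
            · exact hMl1 b
            · rw [hMlz b (by omega), abs_zero]
        _ = ((Finset.Icc 1 (XN N)).filter (fun b => b ≤ U)).card := by simp
        _ ≤ (Finset.Icc 1 U).card := by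
            gcongr
            intro b hb
            simp only [Finset.mem_filter, Finset.mem_Icc] at *
            omega
        _ = U := by simp
  have t2 : ∀ j, ‖∑ n ∈ Finset.Icc 1 (XN N), (((Ml * Ll) * (zeta : ArithmeticFunction ℝ)) n : ℂ) * f j n * (om N n : ℂ)‖ ≤
      C1 * K * 1 * Lg N * ((U:ℝ) ^ 2 * Lg N) := by
    intro j
    refine hI N hN (f j) K (hb j) (hf j) (hfm j) (zeta : ArithmeticFunction ℝ) (Ml * Ll) 1 _ ?_ ?_ ?_
    · intro m hm hm'
      simp [natCoe_apply, zeta_apply, hm.ne']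
    · intro m hm
      simp [natCoe_apply, zeta_apply, hm.ne']
    · have hb1 : ∀ n, 0 < n → |(Ml * Ll) n| ≤ Real.log n := by
        intro n hn
        rw [ArithmeticFunction.mul_apply]
        calc |∑ ab ∈ n.divisorsAntidiagonal, Ml ab.1 * Ll ab.2| ≤ ∑ ab ∈ n.divisorsAntidiagonal, |Ml ab.1 * Ll ab.2| :=
              Finset.abs_sum_le_sum_abs _ _
          _ ≤ ∑ ab ∈ n.divisorsAntidiagonal, vonMangoldt ab.2 := by
              refine Finset.sum_le_sum fun ab _ => ?_
              rw [abs_mul, abs_of_nonneg (hLl0 _)]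
              calc |Ml ab.1| * Ll ab.2 ≤ 1 * vonMangoldt ab.2 :=
                    mul_le_mul (hMl1 _) (hLlΛ _) (hLl0 _) zero_le_one
                _ = _ := one_mul _
          _ = ∑ d ∈ n.divisors, vonMangoldt d := by
              rw [Nat.sum_divisorsAntidiagonal' (f := fun _ b => vonMangoldt b)]
          _ = Real.log n := vonMangoldt_sum
      have hb2 : ∀ n ∈ Finset.Icc 1 (XN N), |(Ml * Ll) n| ≤ Lg N := fun n hn => by
        have := Finset.mem_Icc.1 hn
        exact (hb1 n this.1).trans (log_XN_add_one_le hN this.1 (by omega))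
      have hz : ∀ n, U ^ 2 < n → (Ml * Ll) n = 0 := by
        intro n hn
        rw [ArithmeticFunction.mul_apply]
        refine Finset.sum_eq_zero fun ab hab => ?_
        have := (Nat.mem_divisorsAntidiagonal.1 hab).1
        by_cases h : ab.1 ≤ U
        · by_cases h' : ab.2 ≤ U
          · have : ab.1 * ab.2 ≤ U * U := Nat.mul_le_mul h h'
            nlinarith
          · rw [hLlz _ (by omega), mul_zero]
        · rw [hMlz _ (by omega), zero_mul]
      have : ∑ b ∈ Finset.Icc 1 (XN N), |(Ml * Ll) b| ≤ ∑ b ∈ Finset.Icc 1 (XN N), (if b ≤ U^2 then Lg N else 0) := by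
        refine Finset.sum_le_sum fun b hb => ?_
        split_ifs with h
        · exact hb2 b hb
        · rw [hz b (by omega), abs_zero]
      refine this.trans ?_
      rw [← Finset.sum_filter, Finset.sum_const, nsmul_eq_mul]
      refine mul_le_mul_of_nonneg_right ?_ (by linarith)
      have : ((Finset.Icc 1 (XN N)).filter (fun b => b ≤ U^2)).card ≤ (Finset.Icc 1 (U^2)).card := by
        refine Finset.card_le_card ?_
        intro b hb
        simp only [Finset.mem_filter, Finset.mem_Icc] at *
        omega
      rw [Nat.card_Icc] at this
      have h3 : ((Finset.Icc 1 (XN N)).filter (fun b => b ≤ U^2)).card ≤ U^2 := by omega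
      exact_mod_cast h3
  have t3 : ∑ j, ‖∑ n ∈ Finset.Icc 1 (XN N), (((vonMangoldt - Ll) * (1 - Ml * (zeta : ArithmeticFunction ℝ))) n : ℂ) * f j n * (om N n : ℂ)‖ ≤
      C2 * N * ((2 + 2 * Real.log (XN N)) * (4 * Lg N ^ 4)) := by
    have hsub : ∀ (F G : ArithmeticFunction ℝ) n, (F - G) n = F n - G n := by
      intro F G n
      rw [sub_eq_add_neg, ArithmeticFunction.add_apply, sub_eq_add_neg]; rfl
    refine hII N hN J f hf hfm K hK hoff U hUX ?_ _ _ ?_ ?_ _ ?_ ?_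
    · have : 2 * K * Fintype.card J ≤ y * y * y := by
        have : 0 ≤ (Fintype.card J : ℝ) := Nat.cast_nonneg _
        gcongr
      have h2 : y * y * y ≤ y ^ 5 := by
        have : y * y * y = y ^ 3 := by ring
        rw [this]; exact pow_le_pow_right₀ hy1 (by norm_num)
      linarith
    · intro n hn
      rw [hsub, hLl, if_pos hn, sub_self]
    · intro n hn
      rw [hsub, ArithmeticFunction.coe_mul_zeta_apply]
      have h1 : ∀ d ∈ n.divisors, Ml d = ((ArithmeticFunction.moebius d : ℤ) : ℝ) := by
        intro d hd
        rw [hMl, if_pos ((Nat.divisor_le hd).trans hn)]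
      rw [Finset.sum_congr rfl h1, ← Int.cast_sum]
      have := congrArg (fun F : ArithmeticFunction ℤ => F n) (ArithmeticFunction.moebius_mul_coe_zeta)
      simp only [ArithmeticFunction.coe_mul_zeta_apply] at this
      rw [this, ArithmeticFunction.one_apply, ArithmeticFunction.one_apply]
      split_ifs <;> simp
    · have hlogX : ∀ n ∈ Finset.Icc 1 (XN N), (vonMangoldt - Ll) n ^ 2 / n ≤ Lg N ^ 2 * (1 / n) := by
        intro n hn
        have hn' := Finset.mem_Icc.1 hn
        rw [hsub, mul_one_div]
        have h1 : 0 ≤ vonMangoldt n - Ll n := by linarith [hLlΛ n]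
        have h2 : vonMangoldt n - Ll n ≤ Lg N := by
          have := log_XN_add_one_le hN hn'.1 (by omega)
          have := vonMangoldt_le_log (n := n)
          linarith [hLl0 n]
        gcongr
      calc _ ≤ ∑ n ∈ Finset.Icc 1 (XN N), Lg N ^ 2 * (1 / (n:ℝ)) := Finset.sum_le_sum hlogX
        _ = Lg N ^ 2 * ∑ n ∈ Finset.Icc 1 (XN N), (1 / (n:ℝ)) := by rw [Finset.mul_sum]
        _ ≤ Lg N ^ 2 * Lg N := by gcongr; exact hs_le _
        _ ≤ 4 * Lg N ^ 4 := by
          have : Lg N ^ 3 ≤ Lg N ^ 4 := pow_le_pow_right₀ hL (by norm_num)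
          have : 0 ≤ Lg N ^ 4 := by positivity
          nlinarith
    · have hβ : ∀ n ∈ Finset.Icc 1 (XN N), (1 - Ml * (zeta : ArithmeticFunction ℝ)) n ^ 2 / n ≤ 4 * ((n.divisors.card : ℝ)^2 / n) := by
        intro n hn
        have hn' := Finset.mem_Icc.1 hn
        rw [hsub, ArithmeticFunction.coe_mul_zeta_apply]
        have h1 : |∑ d ∈ n.divisors, Ml d| ≤ n.divisors.card := by
          refine (Finset.abs_sum_le_sum_abs _ _).trans ?_
          refine (Finset.sum_le_sum fun d _ => hMl1 d).trans ?_
          simp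
        have h2 : |(1 : ArithmeticFunction ℝ) n| ≤ 1 := by
          rw [ArithmeticFunction.one_apply]; split_ifs <;> simp
        have h3 : (1:ℝ) ≤ n.divisors.card := by
          exact_mod_cast Finset.card_pos.2 (Nat.nonempty_divisors.2 (by omega))
        have h4 : |(1 : ArithmeticFunction ℝ) n - ∑ d ∈ n.divisors, Ml d| ≤ 2 * n.divisors.card := by
          refine (abs_sub _ _).trans ?_
          linarith
        rw [← mul_div_assoc]
        gcongr
        calc _ = |(1 : ArithmeticFunction ℝ) n - ∑ d ∈ n.divisors, Ml d| ^ 2 := (sq_abs _).symm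
          _ ≤ (2 * n.divisors.card) ^ 2 := by gcongr
          _ = _ := by ring
      calc _ ≤ ∑ n ∈ Finset.Icc 1 (XN N), 4 * ((n.divisors.card : ℝ)^2 / n) := Finset.sum_le_sum hβ
        _ = 4 * ∑ n ∈ Finset.Icc 1 (XN N), ((n.divisors.card : ℝ)^2 / n) := by rw [Finset.mul_sum]
        _ ≤ 4 * Lg N ^ 4 := by gcongr; exact sum_tau_sq _
  have hdec : ∀ j, ‖∑ n ∈ Finset.Icc 1 (XN N), (vonMangoldt n : ℂ) * f j n * (om N n : ℂ)‖ ≤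
      C1 * K * Lg N * Lg N * U + C1 * K * 1 * Lg N * ((U:ℝ) ^ 2 * Lg N) +
      ‖∑ n ∈ Finset.Icc 1 (XN N), (((vonMangoldt - Ll) * (1 - Ml * (zeta : ArithmeticFunction ℝ))) n : ℂ) * f j n * (om N n : ℂ)‖ := by
    intro j
    have e : ∑ n ∈ Finset.Icc 1 (XN N), (vonMangoldt n : ℂ) * f j n * (om N n : ℂ) =
        ∑ n ∈ Finset.Icc 1 (XN N), (Ll n : ℂ) * f j n * (om N n : ℂ) +
        ∑ n ∈ Finset.Icc 1 (XN N), ((Ml * ArithmeticFunction.log) n : ℂ) * f j n * (om N n : ℂ) -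
        ∑ n ∈ Finset.Icc 1 (XN N), (((Ml * Ll) * (zeta : ArithmeticFunction ℝ)) n : ℂ) * f j n * (om N n : ℂ) +
        ∑ n ∈ Finset.Icc 1 (XN N), (((vonMangoldt - Ll) * (1 - Ml * (zeta : ArithmeticFunction ℝ))) n : ℂ) * f j n * (om N n : ℂ) := by
      rw [← Finset.sum_add_distrib, ← Finset.sum_sub_distrib, ← Finset.sum_add_distrib]
      refine Finset.sum_congr rfl fun n _ => ?_
      have hsub : ∀ (F G : ArithmeticFunction ℝ) n, (F - G) n = F n - G n := by
        intro F G n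
        rw [sub_eq_add_neg, ArithmeticFunction.add_apply, sub_eq_add_neg]; rfl
      have := congrArg (fun F : ArithmeticFunction ℝ => F n) hid
      simp only [ArithmeticFunction.add_apply, hsub (Ll + Ml * ArithmeticFunction.log)] at this
      rw [this]
      push_cast
      ring
    rw [e, t0 j, zero_add]
    refine (norm_add_le _ _).trans (add_le_add_left ((norm_sub_le _ _).trans (add_le_add (t1 j) (t2 j))) _)
  refine (Finset.sum_le_sum fun j _ => hdec j).trans ?_
  rw [Finset.sum_add_distrib, Finset.sum_const, nsmul_eq_mul, Finset.card_univ]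
  have hU0 : (0:ℝ) ≤ U := Nat.cast_nonneg _
  have hN0 : 0 < N := by linarith
  have hL25 : Lg N ^ 2 ≤ Lg N ^ 5 := pow_le_pow_right₀ hL (by norm_num)
  have hUU : (U:ℝ) ≤ (U:ℝ)^2 := by
    have : U ≤ U ^ 2 := Nat.le_self_pow (by norm_num) _
    exact_mod_cast this
  have b1 : (Fintype.card J : ℝ) * (C1 * K * Lg N * Lg N * U + C1 * K * 1 * Lg N * ((U:ℝ) ^ 2 * Lg N)) ≤
      2 * C1 * (N * Lg N ^ 5) := by
    have h1 : (Fintype.card J : ℝ) * (C1 * K * Lg N * Lg N * U + C1 * K * 1 * Lg N * ((U:ℝ) ^ 2 * Lg N)) =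
      C1 * ((Fintype.card J : ℝ) * K * (U + (U:ℝ)^2) * Lg N ^ 2) := by ring
    have h2 : (Fintype.card J : ℝ) * K * (U + (U:ℝ)^2) ≤ y * y * (2 * (y^5)^2) := by
      have : (U:ℝ)^2 ≤ (y^5)^2 := by gcongr
      gcongr
      linarith
    have h3 : y * y * (2 * (y^5)^2) ≤ 2 * N := by
      have : y * y * (2 * (y^5)^2) = 2 * y ^ 12 := by ring
      have h4 : y ^ 12 ≤ y ^ 50 := pow_le_pow_right₀ hy1 (by norm_num)
      linarith
    rw [h1]
    calc C1 * ((Fintype.card J : ℝ) * K * (U + (U:ℝ)^2) * Lg N ^ 2) ≤ C1 * ((2 * N) * Lg N ^ 5) := by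
          exact mul_le_mul_of_nonneg_left (mul_le_mul (h2.trans h3) hL25 (by positivity) (by positivity)) hC1
      _ = _ := by ring
  have b2 : C2 * N * ((2 + 2 * Real.log (XN N)) * (4 * Lg N ^ 4)) = 8 * C2 * (N * Lg N ^ 5) := by
    unfold Lg; ring
  rw [b2] at t3
  nlinarith

end ModPC6

section ModPC7
noncomputable def lco (i : ℕ) (f : ℕ → ℂ) (n : ℕ) : ℂ := ((Real.log n) ^ i : ℝ) * f n

lemma one_add_log_pow_le (i : ℕ) : ∃ C : ℝ, 1 ≤ C ∧ ∀ u : ℝ, 1 ≤ u → (1 + Real.log u) ^ i ≤ C * u ^ (1/2 : ℝ) := by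
  refine ⟨(4 * (i + 1)) ^ i, one_le_pow₀ (by have : (0:ℝ) ≤ i := Nat.cast_nonneg i; linarith), fun u hu => ?_⟩
  set ε : ℝ := 1 / (2 * (i + 1)) with hε
  have hi : (0:ℝ) ≤ i := Nat.cast_nonneg i
  have hε0 : 0 < ε := by positivity
  have h1 : Real.log u ≤ u ^ ε / ε := Real.log_le_rpow_div (by linarith) hε0
  have h2 : 1 ≤ u ^ ε := Real.one_le_rpow hu hε0.le
  have h3 : (1:ℝ) ≤ 2 * (i + 1) := by linarith
  have h4 : 1 + Real.log u ≤ (4 * (i + 1)) * u ^ ε := by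
    have : u ^ ε / ε = 2 * (i + 1) * u ^ ε := by rw [hε]; field_simp
    rw [this] at h1
    nlinarith
  have h0 : 0 ≤ 1 + Real.log u := by linarith [Real.log_nonneg hu]
  calc (1 + Real.log u) ^ i ≤ ((4 * (i + 1)) * u ^ ε) ^ i := by gcongr
    _ = (4 * (i + 1)) ^ i * (u ^ ε) ^ i := mul_pow _ _ _
    _ = (4 * (i + 1)) ^ i * u ^ (ε * i) := by rw [← Real.rpow_natCast (u ^ ε), ← Real.rpow_mul (by linarith)]
    _ ≤ _ := by
      gcongr
      · rw [hε, div_mul_eq_mul_div, div_le_div_iff₀ (by positivity) (by norm_num)]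
        linarith

lemma lser_summable (i : ℕ) (a : ℕ → ℂ) (ha : ∀ n, ‖a n‖ ≤ (Real.log n) ^ i) {s : ℂ} (hs : 1 < s.re) :
    LSeriesSummable a s := by
  set ε : ℝ := (s.re - 1) / (2 * (i + 1)) with hε
  have hi : (0:ℝ) ≤ i := Nat.cast_nonneg i
  have hε0 : 0 < ε := by have : 0 < s.re - 1 := by linarith
                         positivity
  refine LSeriesSummable_of_le_const_mul_rpow (x := 1 + (s.re - 1) / 2) (by linarith) ⟨(1/ε) ^ i, fun n hn => ?_⟩
  have hn1 : (1:ℝ) ≤ n := by exact_mod_cast Nat.one_le_iff_ne_zero.2 hn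
  refine (ha n).trans ?_
  have h1 : Real.log n ≤ (n:ℝ) ^ ε / ε := Real.log_le_rpow_div (by linarith) hε0
  calc (Real.log n) ^ i ≤ ((n:ℝ) ^ ε / ε) ^ i := by gcongr
    _ = (1/ε) ^ i * (n:ℝ) ^ (ε * i) := by
      rw [div_pow, ← Real.rpow_natCast ((n:ℝ) ^ ε), ← Real.rpow_mul (by linarith)]; ring
    _ ≤ _ := by
      gcongr
      · rw [hε, div_mul_eq_mul_div, div_le_iff₀ (by positivity)]
        nlinarith

lemma lco_summable (i : ℕ) (f : ℕ → ℂ) (hf : ∀ n, ‖f n‖ ≤ 1) {s : ℂ} (hs : 1 < s.re) :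
    LSeriesSummable (lco i f) s := by
  refine lser_summable i _ (fun n => ?_) hs
  have : 0 ≤ Real.log n := Real.log_natCast_nonneg n
  rw [lco, norm_mul, Complex.norm_real, Real.norm_of_nonneg (by positivity)]
  nlinarith [hf n, norm_nonneg (f n), pow_nonneg this i]

lemma tail_32 (a b : ℕ) (ha : 1 ≤ a) (hab : a ≤ b) :
    ∑ n ∈ Finset.Ico a b, (n:ℝ) ^ (-(3/2) : ℝ) ≤ 4 * (1 / Real.sqrt a) := by
  have key : ∀ n ∈ Finset.Ico a b, (n:ℝ) ^ (-(3/2) : ℝ) ≤ -(4 * (1 / Real.sqrt ((n + 1 : ℕ) : ℝ)) - 4 * (1 / Real.sqrt n)) := by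
    intro n hn
    have hn0 : (1:ℝ) ≤ n := by exact_mod_cast ha.trans (Finset.mem_Ico.1 hn).1
    push_cast
    set x := Real.sqrt n with hx
    set y := Real.sqrt (n + 1) with hy
    have hx0 : 0 < x := Real.sqrt_pos.2 (by linarith)
    have hxx : x ^ 2 = n := Real.sq_sqrt (by linarith)
    have hyy : y ^ 2 = n + 1 := Real.sq_sqrt (by linarith)
    have hy0 : 0 < y := Real.sqrt_pos.2 (by linarith)
    have hx1 : 1 ≤ x := Real.one_le_sqrt.2 hn0
    have e1 : (n:ℝ) ^ (-(3/2) : ℝ) = 1 / x ^ 3 := by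
      rw [hx, Real.sqrt_eq_rpow, ← Real.rpow_natCast, ← Real.rpow_mul (by linarith), Real.rpow_neg (by linarith), one_div]
      norm_num
    rw [e1]
    have hxy : x ≤ y := Real.sqrt_le_sqrt (by linarith)
    have hy2 : y ≤ 3/2 * x := by
      have : y ^ 2 ≤ (3/2 * x) ^ 2 := by nlinarith
      exact (pow_le_pow_iff_left₀ hy0.le (by positivity) (by norm_num)).1 this
    have : -(4 * (1 / y) - 4 * (1 / x)) = 4 / (x * y * (x + y)) := by
      have h : (y - x) * (x + y) = 1 := by nlinarith
      field_simp
      linarith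
    rw [this, div_le_div_iff₀ (by positivity) (by positivity)]
    have h5 : x * y * (x + y) ≤ x * (3/2 * x) * (x + 3/2 * x) := by gcongr
    have : 0 < x ^ 3 := by positivity
    nlinarith
  refine (Finset.sum_le_sum key).trans ?_
  rw [Finset.sum_neg_distrib, Finset.sum_Ico_sub (fun n : ℕ => 4 * (1 / Real.sqrt (n:ℝ))) hab]
  have : 0 ≤ 4 * (1 / Real.sqrt (b:ℝ)) := by positivity
  linarith

lemma var_bound (i : ℕ) (C : ℝ) (hC : ∀ u : ℝ, 1 ≤ u → (1 + Real.log u) ^ i ≤ C * u ^ (1/2 : ℝ))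
    (s : ℂ) (hs : 1 ≤ s.re) (n : ℕ) (hn : 1 ≤ n) :
    ‖(((Real.log (n + 1 : ℕ)) ^ i : ℝ) : ℂ) * ((n + 1 : ℕ) : ℂ) ^ (-s) - (((Real.log n) ^ i : ℝ) : ℂ) * (n : ℂ) ^ (-s)‖ ≤
      C * (i + ‖s‖) * (n:ℝ) ^ (-(3/2) : ℝ) := by
  have hn0 : (1:ℝ) ≤ n := by exact_mod_cast hn
  have hi0 : (0:ℝ) ≤ i := Nat.cast_nonneg i
  set g : ℝ → ℂ := fun u => ((Real.log u ^ i : ℝ) : ℂ) * (u : ℂ) ^ (-s) with hg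
  set g' : ℝ → ℂ := fun u => ((i * Real.log u ^ (i - 1) * u⁻¹ : ℝ) : ℂ) * (u : ℂ) ^ (-s) +
    ((Real.log u ^ i : ℝ) : ℂ) * (-s * (u : ℂ) ^ (-s - 1)) with hg'
  have hd : ∀ u ∈ Set.Icc (n:ℝ) (n + 1), HasDerivWithinAt g (g' u) (Set.Icc (n:ℝ) (n + 1)) u := by
    intro u hu
    have hu0 : 0 < u := by linarith [hu.1]
    have h1 : HasDerivAt (fun u : ℝ => ((Real.log u ^ i : ℝ) : ℂ)) ((i * Real.log u ^ (i - 1) * u⁻¹ : ℝ) : ℂ) u :=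
      ((Real.hasDerivAt_log hu0.ne').pow i).ofReal_comp
    have h2 : HasDerivAt (fun u : ℝ => (u : ℂ) ^ (-s)) (-s * (u : ℂ) ^ (-s - 1)) u :=
      hasDerivAt_ofReal_cpow_const hu0.ne' (by
        intro h
        rw [neg_eq_zero] at h
        rw [h] at hs; norm_num at hs)
    exact (h1.mul h2).hasDerivWithinAt
  have hb : ∀ u ∈ Set.Ico (n:ℝ) (n + 1), ‖g' u‖ ≤ C * (i + ‖s‖) * (n:ℝ) ^ (-(3/2) : ℝ) := by
    intro u hu
    have hu1 : 1 ≤ u := by linarith [hu.1]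
    have hu0 : 0 < u := by linarith
    have hl : 0 ≤ Real.log u := Real.log_nonneg hu1
    have hl1 : Real.log u ^ (i - 1) ≤ (1 + Real.log u) ^ i := by
      calc Real.log u ^ (i - 1) ≤ (1 + Real.log u) ^ (i - 1) := by gcongr; linarith
        _ ≤ _ := pow_le_pow_right₀ (by linarith) (by omega)
    have hl2 : Real.log u ^ i ≤ (1 + Real.log u) ^ i := by gcongr; linarith
    have n1 : ‖(u:ℂ) ^ (-s)‖ ≤ u⁻¹ := by
      rw [Complex.norm_cpow_eq_rpow_re_of_pos hu0, ← Real.rpow_neg_one]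
      exact Real.rpow_le_rpow_of_exponent_le hu1 (by simp; linarith)
    have n2 : ‖(u:ℂ) ^ (-s - 1)‖ ≤ u⁻¹ * u⁻¹ := by
      rw [Complex.norm_cpow_eq_rpow_re_of_pos hu0, ← Real.rpow_neg_one, ← Real.rpow_add hu0]
      exact Real.rpow_le_rpow_of_exponent_le hu1 (by simp; linarith)
    have m1 : ‖g' u‖ ≤ (i + ‖s‖) * ((1 + Real.log u) ^ i * (u⁻¹ * u⁻¹)) := by
      refine (norm_add_le _ _).trans ?_
      rw [norm_mul, norm_mul, norm_mul, Complex.norm_real, Complex.norm_real, norm_neg,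
        Real.norm_of_nonneg (by positivity), Real.norm_of_nonneg (by positivity)]
      calc _ ≤ i * (1 + Real.log u) ^ i * u⁻¹ * u⁻¹ + (1 + Real.log u) ^ i * (‖s‖ * (u⁻¹ * u⁻¹)) := by gcongr
        _ = _ := by ring
    refine m1.trans ?_
    have e1 : u ^ (1/2:ℝ) * (u⁻¹ * u⁻¹) = u ^ (-(3/2):ℝ) := by
      rw [← Real.rpow_neg_one, ← Real.rpow_add hu0, ← Real.rpow_add hu0]; norm_num
    calc (i + ‖s‖) * ((1 + Real.log u) ^ i * (u⁻¹ * u⁻¹)) ≤ (i + ‖s‖) * ((C * u ^ (1/2 : ℝ)) * (u⁻¹ * u⁻¹)) := by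
          gcongr; exact hC u hu1
      _ = C * (i + ‖s‖) * u ^ (-(3/2):ℝ) := by rw [← e1]; ring
      _ ≤ _ := by
        have hC0 : 0 ≤ C := by have := hC 1 le_rfl; simp at this; linarith
        refine mul_le_mul_of_nonneg_left ?_ (by positivity)
        exact Real.rpow_le_rpow_of_nonpos (by linarith) hu.1 (by norm_num)
  have := norm_image_sub_le_of_norm_deriv_le_segment' hd hb (n + 1) (by simp)
  simp only [hg] at this
  push_cast at this ⊢
  simpa using this

lemma Lbound (i : ℕ) : ∃ C : ℝ, 1 ≤ C ∧ ∀ (f : ℕ → ℂ) (K Y : ℝ), (∀ n, ‖f n‖ ≤ 1) → bsum f K → 1 ≤ Y →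
    K ≤ Real.exp Y → ∀ s : ℂ, 1 < s.re → s.re ≤ 2 →
    ‖LSeries (lco i f) s‖ ≤ C * Y ^ (i + 1) * (1 + |s.im|) := by
  obtain ⟨C, hC1, hC⟩ := one_add_log_pow_le i
  have hi0 : (0:ℝ) ≤ i := Nat.cast_nonneg i
  refine ⟨4 * 3 ^ i + 2 * C * (1 + 4 * (i + 2)), ?_, ?_⟩
  · have : (1:ℝ) ≤ 3 ^ i := one_le_pow₀ (by norm_num)
    have : 0 ≤ 2 * C * (1 + 4 * ((i:ℝ) + 2)) := by positivity
    linarith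
  intro f K Y hf hb hY hKY s hs1 hs2
  have hK : 0 ≤ K := (norm_nonneg _).trans (hb 0)
  set M := ⌈Real.exp (2 * Y)⌉₊ with hM
  have hMl : Real.exp (2 * Y) ≤ M := Nat.le_ceil _
  have hMu : (M:ℝ) ≤ Real.exp (3 * Y) := by
    have h1 : (M:ℝ) < Real.exp (2 * Y) + 1 := Nat.ceil_lt_add_one (by positivity)
    have h2 : Real.exp (3 * Y) = Real.exp (2 * Y) * Real.exp Y := by rw [← Real.exp_add]; ring_nf
    have h3 := Real.add_one_le_exp Y
    have h4 := Real.add_one_le_exp (2*Y)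
    nlinarith
  have hM1 : 1 ≤ M := by
    have : (0:ℝ) < M := lt_of_lt_of_le (Real.exp_pos _) hMl
    exact_mod_cast this
  have hMR : (1:ℝ) ≤ M := by exact_mod_cast hM1
  have hKM : K * (1 / Real.sqrt M) ≤ 1 := by
    have : Real.exp Y ≤ Real.sqrt M := by
      apply Real.le_sqrt_of_sq_le
      rw [← Real.exp_nat_mul]; push_cast; exact hMl
    rw [mul_one_div, div_le_one (Real.sqrt_pos.2 (by linarith))]
    linarith
  have hlogM : Real.log M ≤ 3 * Y := by
    rw [Real.log_le_iff_le_exp (by linarith)]; exact hMu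
  set g : ℕ → ℂ := fun n => ((Real.log n ^ i : ℝ) : ℂ) * (n : ℂ) ^ (-s) with hg
  have hterm : ∀ n, 1 ≤ n → LSeries.term (lco i f) s n = f n * g n := by
    intro n hn
    rw [LSeries.term_of_ne_zero (by omega), lco, hg]
    simp only
    rw [Complex.cpow_neg, div_eq_mul_inv]; ring
  have hgn : ∀ n : ℕ, 1 ≤ n → ‖g n‖ ≤ Real.log n ^ i * (1 / n) := by
    intro n hn
    have hn1 : (1:ℝ) ≤ n := by exact_mod_cast hn
    have hl : 0 ≤ Real.log n := Real.log_nonneg hn1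
    simp only [hg]
    rw [norm_mul, Complex.norm_real, Real.norm_of_nonneg (by positivity), Complex.norm_natCast_cpow_of_pos (by omega)]
    gcongr
    rw [one_div, ← Real.rpow_neg_one]
    exact Real.rpow_le_rpow_of_exponent_le hn1 (by simp; linarith)
  have head : ∀ L, L ≤ M → ‖∑ n ∈ Finset.Ico 1 L, f n * g n‖ ≤ 4 * 3 ^ i * Y ^ (i + 1) := by
    intro L hL
    calc ‖∑ n ∈ Finset.Ico 1 L, f n * g n‖ ≤ ∑ n ∈ Finset.Ico 1 L, ‖f n * g n‖ := norm_sum_le _ _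
      _ ≤ ∑ n ∈ Finset.Ico 1 L, (3 * Y) ^ i * (1 / (n:ℝ)) := by
        refine Finset.sum_le_sum fun n hn => ?_
        have hn' := Finset.mem_Ico.1 hn
        have hn1 : (1:ℝ) ≤ n := by exact_mod_cast hn'.1
        have hl : 0 ≤ Real.log n := Real.log_nonneg hn1
        have hlM : Real.log n ≤ Real.log M := Real.log_le_log (by linarith) (by exact_mod_cast (by omega : n ≤ M))
        rw [norm_mul]
        calc ‖f n‖ * ‖g n‖ ≤ 1 * (Real.log n ^ i * (1 / n)) := by
              gcongr
              · exact hf n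
              · exact hgn n hn'.1
          _ ≤ _ := by rw [one_mul]; gcongr; linarith
      _ ≤ ∑ n ∈ Finset.Icc 1 M, (3 * Y) ^ i * (1 / (n:ℝ)) := by
        refine Finset.sum_le_sum_of_subset_of_nonneg ?_ (fun _ _ _ => by positivity)
        intro n hn
        simp only [Finset.mem_Ico, Finset.mem_Icc] at *; omega
      _ = (3 * Y) ^ i * ∑ n ∈ Finset.Icc 1 M, (1 / (n:ℝ)) := by rw [Finset.mul_sum]
      _ ≤ (3 * Y) ^ i * (4 * Y) := by
        gcongr
        refine (hs_le M).trans ?_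
        linarith
      _ = _ := by rw [mul_pow]; ring
  have hns : ‖s‖ ≤ 2 + |s.im| := by
    refine (Complex.norm_le_abs_re_add_abs_im s).trans ?_
    rw [abs_of_pos (by linarith : 0 < s.re)]; linarith
  have tail : ∀ L, M ≤ L → ‖∑ n ∈ Finset.Ico M L, f n * g n‖ ≤ 2 * C * (1 + 4 * (i + 2)) * (1 + |s.im|) := by
    intro L hL
    refine (abel_bound f K hb g M L hL).trans ?_
    have b1 : ‖g L‖ ≤ C * (1 / Real.sqrt M) := by
      have hL1 : (1:ℝ) ≤ L := by exact_mod_cast hM1.trans hL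
      have hl : 0 ≤ Real.log L := Real.log_nonneg hL1
      calc ‖g L‖ ≤ Real.log L ^ i * (1 / L) := hgn L (hM1.trans hL)
        _ ≤ (1 + Real.log L) ^ i * (1 / L) := by gcongr; linarith
        _ ≤ (C * (L:ℝ) ^ (1/2:ℝ)) * (1 / L) := by gcongr; exact hC _ hL1
        _ = C * (1 / Real.sqrt L) := by
          rw [← Real.sqrt_eq_rpow]
          have : Real.sqrt L * Real.sqrt L = L := Real.mul_self_sqrt (by linarith)
          have h0 : 0 < Real.sqrt L := Real.sqrt_pos.2 (by linarith)
          nth_rw 2 [← this]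
          field_simp
        _ ≤ _ := by
          have h0 : 0 < Real.sqrt M := Real.sqrt_pos.2 (by linarith)
          have : Real.sqrt M ≤ Real.sqrt L := Real.sqrt_le_sqrt (by exact_mod_cast hL)
          gcongr
    have b2 : ∑ n ∈ Finset.Ico M L, ‖g (n + 1) - g n‖ ≤ C * (i + ‖s‖) * (4 * (1 / Real.sqrt M)) := by
      calc _ ≤ ∑ n ∈ Finset.Ico M L, C * (i + ‖s‖) * (n:ℝ) ^ (-(3/2) : ℝ) :=
            Finset.sum_le_sum fun n hn => var_bound i C hC s hs1.le n (hM1.trans (Finset.mem_Ico.1 hn).1)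
        _ = C * (i + ‖s‖) * ∑ n ∈ Finset.Ico M L, (n:ℝ) ^ (-(3/2) : ℝ) := by rw [Finset.mul_sum]
        _ ≤ _ := by gcongr; exact tail_32 M L hM1 hL
    calc 2 * K * (‖g L‖ + ∑ n ∈ Finset.Ico M L, ‖g (n + 1) - g n‖) ≤
          2 * K * (C * (1 / Real.sqrt M) + C * (i + ‖s‖) * (4 * (1 / Real.sqrt M))) := by gcongr
      _ = 2 * C * (1 + 4 * (i + ‖s‖)) * (K * (1 / Real.sqrt M)) := by ring
      _ ≤ 2 * C * (1 + 4 * (i + ‖s‖)) * 1 := by gcongr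
      _ ≤ 2 * C * ((1 + 4 * (i + 2)) * (1 + |s.im|)) := by
        rw [mul_one]
        gcongr
        have := abs_nonneg s.im
        nlinarith
      _ = _ := by ring
  have tot : ∀ L : ℕ, ‖∑ n ∈ Finset.range L, LSeries.term (lco i f) s n‖ ≤
      (4 * 3 ^ i + 2 * C * (1 + 4 * (i + 2))) * Y ^ (i + 1) * (1 + |s.im|) := by
    intro L
    have hYi : 1 ≤ Y ^ (i + 1) := one_le_pow₀ hY
    have ht : 1 ≤ 1 + |s.im| := by linarith [abs_nonneg s.im]
    have hbig : 4 * 3 ^ i * Y ^ (i + 1) + 2 * C * (1 + 4 * (i + 2)) * (1 + |s.im|) ≤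
        (4 * 3 ^ i + 2 * C * (1 + 4 * (i + 2))) * Y ^ (i + 1) * (1 + |s.im|) := by
      have e1 : 4 * 3 ^ i * Y ^ (i + 1) * 1 ≤ 4 * 3 ^ i * Y ^ (i + 1) * (1 + |s.im|) := by gcongr
      have e2 : 2 * C * (1 + 4 * (i + 2)) * (1 + |s.im|) * 1 ≤ 2 * C * (1 + 4 * (i + 2)) * (1 + |s.im|) * Y ^ (i + 1) := by gcongr
      linarith
    have hsplit : ∑ n ∈ Finset.range L, LSeries.term (lco i f) s n = ∑ n ∈ Finset.Ico 1 L, f n * g n := by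
      rcases Nat.eq_zero_or_pos L with h | h
      · subst h; simp
      · rw [Finset.range_eq_Ico, Finset.sum_eq_sum_Ico_succ_bot h, LSeries.term_zero, zero_add]
        exact Finset.sum_congr rfl fun n hn => hterm n (Finset.mem_Ico.1 hn).1
    rw [hsplit]
    refine le_trans ?_ hbig
    by_cases h : L ≤ M
    · refine (head L h).trans ?_
      have : 0 ≤ 2 * C * (1 + 4 * ((i:ℝ) + 2)) * (1 + |s.im|) := by positivity
      linarith
    · rw [← Finset.sum_Ico_consecutive _ hM1 (by omega : M ≤ L)]
      exact (norm_add_le _ _).trans (add_le_add (head M le_rfl) (tail L (by omega)))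
  have hsum : Summable (LSeries.term (lco i f) s) := lco_summable i f hf hs1
  exact le_of_tendsto hsum.hasSum.tendsto_sum_nat.norm (Filter.Eventually.of_forall tot)

end ModPC7

section ModPC8
open MeasureTheory

lemma int_bound (g : ℝ → ℂ) (c : ℝ) (s : ℂ) (hs : c < s.re) (hg : ∀ t : ℝ, 1 < t → ‖g t‖ ≤ t ^ c) :
    ‖∫ t in Set.Ioi (1 : ℝ), g t * (t : ℂ) ^ (-(s + 1))‖ ≤ 1 / (s.re - c) := by
  have h1 : ∀ t ∈ Set.Ioi (1:ℝ), ‖g t * (t : ℂ) ^ (-(s + 1))‖ ≤ t ^ (c - s.re - 1) := by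
    intro t ht
    have ht' : (1:ℝ) < t := ht
    rw [norm_mul, Complex.norm_cpow_eq_rpow_re_of_pos (by linarith)]
    calc _ ≤ t ^ c * t ^ (-(s+1)).re := by gcongr; exact hg t ht'
      _ = _ := by rw [← Real.rpow_add (by linarith)]; congr 1; simp; ring
  have hi : IntegrableOn (fun t : ℝ => t ^ (c - s.re - 1)) (Set.Ioi 1) :=
    integrableOn_Ioi_rpow_of_lt (by linarith) one_pos
  calc _ ≤ ∫ t in Set.Ioi (1 : ℝ), t ^ (c - s.re - 1) :=
        norm_integral_le_of_norm_le hi (by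
          rw [ae_restrict_iff' measurableSet_Ioi]; exact Filter.Eventually.of_forall h1)
    _ = 1 / (s.re - c) := by
      rw [integral_Ioi_rpow_of_lt (by linarith) one_pos]
      rw [show c - s.re - 1 + 1 = -(s.re - c) by ring, Real.one_rpow]
      rw [neg_div_neg_eq]

lemma ser_int (a : ℕ → ℂ) (ha : ∀ n, ‖a n‖ ≤ 1) {s : ℂ} (hs : 1 < s.re) :
    LSeries a s = s * ∫ t in Set.Ioi (1 : ℝ), (∑ k ∈ Finset.Icc 1 ⌊t⌋₊, a k) * (t:ℂ) ^ (-(s + 1)) := by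
  apply LSeries_eq_mul_integral' a zero_le_one hs
  refine Asymptotics.IsBigO.of_bound 1 (Filter.Eventually.of_forall fun n => ?_)
  rw [one_mul, Real.rpow_one, Real.norm_natCast, Real.norm_of_nonneg (Finset.sum_nonneg fun _ _ => norm_nonneg _)]
  calc _ ≤ ∑ k ∈ Finset.Icc 1 n, (1:ℝ) := Finset.sum_le_sum fun k _ => ha k
    _ = n := by simp

lemma ser_bound (a : ℕ → ℂ) (ha : ∀ n, ‖a n‖ ≤ 1) {s : ℂ} (hs : 1 < s.re) :
    ‖LSeries a s‖ ≤ ‖s‖ / (s.re - 1) := by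
  rw [ser_int a ha hs, norm_mul]
  rw [div_eq_mul_one_div]
  gcongr
  apply int_bound _ 1 s hs
  intro t ht
  rw [Real.rpow_one]
  calc _ ≤ ∑ k ∈ Finset.Icc 1 ⌊t⌋₊, (1:ℝ) := norm_sum_le_of_le _ fun k _ => ha k
    _ = ⌊t⌋₊ := by simp
    _ ≤ t := Nat.floor_le (by linarith)

lemma zeta_bound {s : ℂ} (hs : 1 < s.re) :
    ‖LSeries (fun _ => 1) s‖ ≤ ‖s‖ * (1 / ‖s - 1‖ + 1) := by
  rw [ser_int (fun _ => 1) (by simp) hs, norm_mul]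
  gcongr
  have hI : IntegrableOn (fun t : ℝ => (t:ℂ) ^ (-s)) (Set.Ioi 1) :=
    integrableOn_Ioi_cpow_of_lt (by simpa using hs) one_pos
  have hI2 : IntegrableOn (fun t : ℝ => ((⌊t⌋₊:ℂ) - t) * (t:ℂ) ^ (-(s+1))) (Set.Ioi 1) := by
    have hi : IntegrableOn (fun t : ℝ => t ^ (- s.re - 1)) (Set.Ioi 1) :=
      integrableOn_Ioi_rpow_of_lt (by linarith) one_pos
    refine Integrable.mono' hi ?_ ?_
    · apply Measurable.aestronglyMeasurable
      have : Measurable (fun t : ℝ => (⌊t⌋₊:ℂ)) := by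
        exact (measurable_of_countable (fun n : ℕ => (n:ℂ))).comp Nat.measurable_floor
      fun_prop
    · rw [ae_restrict_iff' measurableSet_Ioi]
      refine Filter.Eventually.of_forall fun t ht => ?_
      have ht' : (1:ℝ) < t := ht
      rw [norm_mul, Complex.norm_cpow_eq_rpow_re_of_pos (by linarith)]
      have : ‖(⌊t⌋₊:ℂ) - t‖ ≤ 1 := by
        have : (⌊t⌋₊:ℂ) - t = (((⌊t⌋₊:ℝ) - t : ℝ) : ℂ) := by push_cast; rfl
        rw [this, Complex.norm_real, Real.norm_eq_abs, abs_le]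
        constructor <;> linarith [Nat.floor_le (by linarith : (0:ℝ) ≤ t), Nat.lt_floor_add_one t]
      calc _ ≤ 1 * t ^ (-(s+1)).re := by gcongr
        _ = _ := by rw [one_mul]; congr 1; simp; ring
  have e : ∫ t in Set.Ioi (1 : ℝ), (∑ k ∈ Finset.Icc 1 ⌊t⌋₊, (1:ℂ)) * (t:ℂ) ^ (-(s + 1)) =
      (∫ t in Set.Ioi (1 : ℝ), (t:ℂ) ^ (-s)) + ∫ t in Set.Ioi (1 : ℝ), ((⌊t⌋₊:ℂ) - t) * (t:ℂ) ^ (-(s+1)) := by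
    rw [← integral_add hI hI2]
    refine setIntegral_congr_fun measurableSet_Ioi fun t ht => ?_
    have ht' : (1:ℝ) < t := ht
    have h0 : (t:ℂ) ≠ 0 := by exact_mod_cast (by linarith : t ≠ 0)
    have : (t:ℂ) ^ (-s) = t * (t:ℂ) ^ (-(s+1)) := by
      conv_lhs => rw [show -s = 1 + (-(s+1)) by ring]
      rw [Complex.cpow_add _ _ h0, Complex.cpow_one]
    simp only [Finset.sum_const, Nat.card_Icc, Nat.add_sub_cancel, nsmul_eq_mul, mul_one]
    rw [this]; ring
  rw [e]
  refine (norm_add_le _ _).trans (add_le_add ?_ ?_)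
  · rw [integral_Ioi_cpow_of_lt (by simpa using hs) one_pos]
    simp only [Complex.ofReal_one, Complex.one_cpow, norm_div, norm_neg, norm_one]
    rw [show -s + 1 = -(s - 1) by ring, norm_neg]
  · refine (int_bound _ 0 s (by linarith) ?_).trans ?_
    · intro t ht
      rw [Real.rpow_zero]
      have : (⌊t⌋₊:ℂ) - t = (((⌊t⌋₊:ℝ) - t : ℝ) : ℂ) := by push_cast; rfl
      rw [this, Complex.norm_real, Real.norm_eq_abs, abs_le]
      constructor <;> linarith [Nat.floor_le (by linarith : (0:ℝ) ≤ t), Nat.lt_floor_add_one t]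
    · rw [sub_zero, div_le_one (by linarith)]; linarith

lemma lco_zero (f : ℕ → ℂ) : lco 0 f = f := by
  funext n; simp [lco]

lemma Lbound0 : ∃ C : ℝ, 1 ≤ C ∧ ∀ (f : ℕ → ℂ) (K Y : ℝ), (∀ n, ‖f n‖ ≤ 1) → bsum f K → 1 ≤ Y →
    K ≤ Real.exp Y → ∀ s : ℂ, 1 < s.re → s.re ≤ 2 → ‖LSeries f s‖ ≤ C * Y * (1 + |s.im|) := by
  obtain ⟨C, h1, h⟩ := Lbound 0
  refine ⟨C, h1, fun f K Y a b c d s hs hs' => ?_⟩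
  have := h f K Y a b c d s hs hs'
  simpa [lco_zero] using this

lemma Llip : ∃ C : ℝ, 1 ≤ C ∧ ∀ (f : ℕ → ℂ) (K Y : ℝ), (∀ n, ‖f n‖ ≤ 1) → bsum f K → 1 ≤ Y →
    K ≤ Real.exp Y → ∀ (T : ℝ) (s s' : ℂ), 1 < s.re → s.re ≤ 2 → 1 < s'.re → s'.re ≤ 2 → |s.im| ≤ T → |s'.im| ≤ T →
    ‖LSeries f s' - LSeries f s‖ ≤ C * Y ^ 2 * (1 + T) * ‖s' - s‖ := by
  obtain ⟨C, h1, h⟩ := Lbound 1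
  refine ⟨C, h1, fun f K Y hf b c d T s s' hs1 hs2 hs1' hs2' hT hT' => ?_⟩
  set S : Set ℂ := (Complex.re ⁻¹' (Set.Ioc 1 2)) ∩ (Complex.im ⁻¹' (Set.Icc (-T) T)) with hS
  have hconv : Convex ℝ S := by
    apply Convex.inter
    · exact (convex_Ioc (1:ℝ) 2).linear_preimage Complex.reLm
    · exact (convex_Icc (-T) T).linear_preimage Complex.imLm
  have hab : LSeries.abscissaOfAbsConv f ≤ 1 := by
    apply LSeries.abscissaOfAbsConv_le_of_forall_lt_LSeriesSummable
    intro y hy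
    have := lco_summable 0 f hf (s := (y:ℂ)) (by simpa using hy)
    rwa [lco_zero] at this
  refine hconv.norm_image_sub_le_of_norm_hasDerivWithin_le (f := LSeries f) (f' := fun s => -LSeries (LSeries.logMul f) s) (s := S)
    (C := C * Y ^ 2 * (1 + T)) ?_ ?_ ?_ ?_
  · intro x hx
    exact (LSeries_hasDerivAt (lt_of_le_of_lt hab (by exact_mod_cast hx.1.1))).hasDerivWithinAt
  · intro x hx
    rw [norm_neg]
    have e : LSeries.logMul f = lco 1 f := by
      funext n; simp [lco, LSeries.logMul, Complex.natCast_log]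
    rw [e]
    refine (h f K Y hf b c d x hx.1.1 hx.1.2).trans ?_
    have : |x.im| ≤ T := abs_le.2 hx.2
    have : (1 + 1 : ℕ) = 2 := rfl
    gcongr
  · exact ⟨⟨hs1, hs2⟩, abs_le.1 hT⟩
  · exact ⟨⟨hs1', hs2'⟩, abs_le.1 hT'⟩

lemma triv_bound : ∃ C : ℝ, 1 ≤ C ∧ ∀ (r : ℕ) [NeZero r] (Y : ℝ), 1 ≤ Y → (r:ℝ) ≤ Real.exp Y → ∀ s : ℂ, 1 < s.re → s.re ≤ 2 →
    ‖LSeries (fun n => (1 : DirichletCharacter ℂ r) n) s‖ ≤ ‖s‖ * (1 / ‖s - 1‖ + 1) + C * Y * (1 + |s.im|) := by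
  obtain ⟨C, h1, h⟩ := Lbound0
  refine ⟨C, h1, fun r _ Y hY hr s hs hs' => ?_⟩
  have hr0 : (0:ℝ) < r := by exact_mod_cast Nat.pos_of_ne_zero (NeZero.ne r)
  set κ : ℝ := (r.totient : ℝ) / r with hκ
  have hκ0 : 0 ≤ κ := by positivity
  have hκ1 : κ ≤ 1 := by rw [hκ, div_le_one hr0]; exact_mod_cast Nat.totient_le r
  set g : ℕ → ℂ := fun n => (1 : DirichletCharacter ℂ r) n - κ with hg
  have hg1 : ∀ n, ‖g n‖ ≤ 1 := by
    intro n
    simp only [hg]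
    by_cases hu : IsUnit (n : ZMod r)
    · rw [MulChar.one_apply hu, ← Complex.ofReal_one, ← Complex.ofReal_sub, Complex.norm_real, Real.norm_of_nonneg] <;> linarith
    · rw [MulChar.map_nonunit _ hu, zero_sub, norm_neg, Complex.norm_real, Real.norm_of_nonneg] <;> linarith
  have hb : bsum g r := by
    apply bsum_of_periodic _ _ (Nat.pos_of_ne_zero (NeZero.ne r)) hg1
    · intro n; simp [hg]
    · simp only [hg, Finset.sum_sub_distrib]
      rw [sum_range_char (fun a => (1 : DirichletCharacter ℂ r) a), MulChar.sum_one_eq_card_units]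
      simp only [ZMod.card_units_eq_totient, Finset.sum_const, Finset.card_range, nsmul_eq_mul, hκ]
      push_cast
      field_simp
      simp
  have h2 := h g r Y hg1 hb hY hr s hs hs'
  have e : (fun n : ℕ => (1 : DirichletCharacter ℂ r) n) = (κ : ℂ) • (fun _ : ℕ => (1:ℂ)) + g := by
    funext n; simp [hg]
  rw [e, LSeries_add, LSeries_smul]
  · refine (norm_add_le _ _).trans (add_le_add ?_ h2)
    rw [norm_mul, Complex.norm_real, Real.norm_of_nonneg hκ0]
    have := zeta_bound hs
    nlinarith [norm_nonneg (LSeries (fun _ => 1) s)]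
  · have := lco_summable 0 (fun _ => 1) (by simp) hs
    rw [lco_zero] at this
    exact this.smul _
  · have := lco_summable 0 g hg1 hs
    rwa [lco_zero] at this

lemma core_real (a : ℝ → ℝ) (C1 C2 Z : ℝ) (hC1 : 1 ≤ C1) (hC2 : 1 ≤ C2) (hZ : 1 ≤ Z) (ha : ∀ x, 0 ≤ a x)
    (h1 : ∀ x, 0 < x → x ≤ 1 → x ^ 3 ≤ 8 * C1 * Z ^ 7 * a x ^ 4)
    (h2 : ∀ x x', 0 < x → x ≤ 1 → 0 < x' → x' ≤ 1 → |a x - a x'| ≤ C2 * Z ^ 2 * |x - x'|) (d : ℝ) (hd : 0 < d) (hd1 : d ≤ 1) :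
    1 ≤ 128 * C1 * C2 ^ 3 * Z ^ 13 * a d := by
  set η : ℝ := 1 / (128 * C1 * C2 ^ 4 * Z ^ 15) with hη
  have hη0 : 0 < η := by positivity
  have hη1 : η ≤ 1 := by
    rw [hη, div_le_one (by positivity)]
    have := one_le_pow₀ hZ (n := 15)
    have := one_le_pow₀ hC2 (n := 4)
    have h3 : 1 ≤ C2 ^ 4 * Z ^ 15 := one_le_mul_of_one_le_of_one_le ‹_› ‹_›
    have h4 : 1 ≤ C1 * (C2 ^ 4 * Z ^ 15) := one_le_mul_of_one_le_of_one_le ‹_› ‹_›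
    linarith
  have key : ∀ x, η ≤ x → x ≤ 1 → 2 * C2 * Z ^ 2 * η ≤ a x := by
    intro x hx hx1
    have := h1 x (by linarith) hx1
    have h3 : η ^ 3 ≤ x ^ 3 := by gcongr
    refine le_of_pow_le_pow_left₀ (n := 4) (by norm_num) (ha x) ?_
    have h4 : (2 * C2 * Z ^ 2 * η) ^ 4 * (8 * C1 * Z ^ 7) = η ^ 3 := by
      have : η * (128 * C1 * C2 ^ 4 * Z ^ 15) = 1 := by rw [hη]; field_simp
      calc _ = η ^ 3 * (η * (128 * C1 * C2 ^ 4 * Z ^ 15)) := by ring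
        _ = _ := by rw [this, mul_one]
    have h5 : (0:ℝ) < 8 * C1 * Z ^ 7 := by positivity
    nlinarith
  have fin : C2 * Z ^ 2 * η ≤ a d := by
    rcases le_total η d with h | h
    · have := key d h hd1
      have : 0 ≤ C2 * Z ^ 2 * η := by positivity
      linarith
    · have k1 := key η le_rfl hη1
      have k2 := h2 η d hη0 hη1 hd hd1
      have k3 : |η - d| ≤ η := by rw [abs_of_nonneg] <;> linarith
      have k4 : C2 * Z ^ 2 * |η - d| ≤ C2 * Z ^ 2 * η := by gcongr
      have := le_abs_self (a η - a d)
      linarith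
  have : η * (128 * C1 * C2 ^ 4 * Z ^ 15) = 1 := by rw [hη]; field_simp
  calc (1:ℝ) = 128 * C1 * C2 ^ 3 * Z ^ 13 * (C2 * Z ^ 2 * η) := by rw [← this]; ring
    _ ≤ _ := by gcongr

lemma char_norm {r : ℕ} (χ : DirichletCharacter ℂ r) : ∀ n : ℕ, ‖(fun j : ℕ => χ j) n‖ ≤ 1 := fun n => χ.norm_le_one _

/-- lower bound for L-functions to the right of the one-line -/
lemma Llower : ∃ C : ℝ, 1 ≤ C ∧ ∀ (r : ℕ) [NeZero r] (χ : DirichletCharacter ℂ r) (Y d : ℝ), χ ≠ 1 → 1 ≤ Y → (r:ℝ) ≤ Real.exp Y →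
    0 < d → d ≤ 1 → (χ ^ 2 ≠ 1 ∨ 1 ≤ Y ^ 4 * ‖LSeries (fun n => χ n) (1 + d)‖) → ∀ t : ℝ,
    1 ≤ C * (Y * (1 + |t|)) ^ 13 * ‖LSeries (fun n => χ n) (1 + d + t * Complex.I)‖ := by
  obtain ⟨A, hA1, hA⟩ := Lbound0
  obtain ⟨B, hB1, hB⟩ := Llip
  obtain ⟨D, hD1, hD⟩ := triv_bound
  set C1 : ℝ := 20 * B + 2 * A + 2 * D with hC1
  refine ⟨128 * C1 * B ^ 3, ?_, ?_⟩
  · have : 1 ≤ B ^ 3 := one_le_pow₀ hB1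
    have : 1 ≤ C1 := by linarith
    nlinarith
  intro r _ χ Y d hχ hY hr hd hd1 hex t
  have hχb := char_bsum χ hχ
  set Z := Y * (1 + |t|) with hZd
  have ht0 := abs_nonneg t
  have hYZ : Y ≤ Z := by rw [hZd]; nlinarith
  have htZ : 1 + |t| ≤ Z := by rw [hZd]; nlinarith
  have hZ : 1 ≤ Z := by linarith
  by_cases hsm : χ ^ 2 = 1 ∧ |t| < 1 / (4 * B * Y ^ 6)
  · obtain ⟨hsq, hts⟩ := hsm
    have h1 : 1 ≤ Y ^ 4 * ‖LSeries (fun n => χ n) (1 + d)‖ := by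
      rcases hex with h | h
      · exact absurd hsq h
      · exact h
    have h2 := hB _ r Y (char_norm χ) hχb hY hr |t| (1 + d) (1 + d + t * Complex.I) (by simpa using hd) (by simp; linarith)
      (by simpa using hd) (by simp; linarith) (by simp) (by simp)
    have h3 : ‖(1 + (d:ℂ) + t * Complex.I) - (1 + d)‖ = |t| := by simp
    rw [h3] at h2
    set L := ‖LSeries (fun n => χ n) (1 + d + t * Complex.I)‖
    have h4 : ‖LSeries (fun n => χ n) (1 + d)‖ ≤ L + B * Y ^ 2 * (1 + |t|) * |t| := by
      have := norm_sub_norm_le (LSeries (fun n => χ n) (1 + d)) (LSeries (fun n => χ n) (1 + d + t * Complex.I))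
      rw [norm_sub_rev] at this
      linarith
    have h5 : 1 / (4 * B * Y ^ 6) ≤ 1 := by
      rw [div_le_one (by positivity)]
      have : 1 ≤ Y ^ 6 := one_le_pow₀ hY
      nlinarith
    have h6 : B * Y ^ 2 * (1 + |t|) * |t| ≤ 1 / (2 * Y ^ 4) := by
      calc B * Y ^ 2 * (1 + |t|) * |t| ≤ B * Y ^ 2 * 2 * (1 / (4 * B * Y ^ 6)) := by gcongr; linarith
        _ = _ := by field_simp; norm_num
    have h7 : 1 ≤ 2 * (Y ^ 4 * L) := by
      have : Y ^ 4 * ‖LSeries (fun n => χ n) (1 + d)‖ ≤ Y ^ 4 * (L + 1 / (2 * Y ^ 4)) := by gcongr; linarith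
      have e : Y ^ 4 * (L + 1 / (2 * Y ^ 4)) = Y ^ 4 * L + 1/2 := by field_simp
      linarith
    have h8 : Y ^ 4 ≤ Z ^ 13 := by
      calc Y ^ 4 ≤ Z ^ 4 := by gcongr
        _ ≤ Z ^ 13 := pow_le_pow_right₀ hZ (by norm_num)
    have hL0 : 0 ≤ L := norm_nonneg _
    have h9 : 2 ≤ 128 * C1 * B ^ 3 := by
      have : 1 ≤ B ^ 3 := one_le_pow₀ hB1
      have : 1 ≤ C1 := by linarith
      nlinarith
    calc (1:ℝ) ≤ 2 * (Y ^ 4 * L) := h7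
      _ ≤ 128 * C1 * B ^ 3 * (Z ^ 13 * L) := by gcongr
      _ = _ := by ring
  · have hsqb : ∀ x : ℝ, 0 < x → x ≤ 1 → ‖LSeries (fun n => (χ ^ 2) n) (1 + x + 2 * Complex.I * t)‖ ≤ C1 * Z ^ 7 := by
      intro x hx hx1
      have im_e : (1 + (x:ℂ) + 2 * Complex.I * t).im = 2 * t := by simp
      have re_e : (1 + (x:ℂ) + 2 * Complex.I * t).re = 1 + x := by simp
      have habs : |2 * t| = 2 * |t| := by rw [abs_mul]; norm_num
      have hZ7 : Z ≤ Z ^ 7 := le_self_pow₀ hZ (by norm_num)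
      have hlin : Y * (1 + 2 * |t|) ≤ 2 * Z := by rw [hZd]; nlinarith
      by_cases hsq : χ ^ 2 = 1
      · rw [hsq]
        have hts : 1 / (4 * B * Y ^ 6) ≤ |t| := by
          by_contra hh
          exact hsm ⟨hsq, not_le.1 hh⟩
        have h1 := hD r Y hY hr (1 + x + 2 * Complex.I * t) (by rw [re_e]; linarith) (by rw [re_e]; linarith)
        rw [im_e, habs] at h1
        have h2 : ‖1 + (x:ℂ) + 2 * Complex.I * t‖ ≤ 2 * Z := by
          refine (Complex.norm_le_abs_re_add_abs_im _).trans ?_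
          rw [re_e, im_e, habs, abs_of_pos (by linarith)]
          linarith
        have h3 : |t| ≤ ‖1 + (x:ℂ) + 2 * Complex.I * t - 1‖ := by
          refine le_trans ?_ (Complex.abs_im_le_norm _)
          rw [Complex.sub_im, im_e, Complex.one_im, sub_zero, habs]; linarith
        have h0 : 0 < 1 / (4 * B * Y ^ 6) := by positivity
        have h4 : 1 / ‖1 + (x:ℂ) + 2 * Complex.I * t - 1‖ ≤ 4 * B * Y ^ 6 := by
          calc _ ≤ 1 / (1 / (4 * B * Y ^ 6)) := by gcongr; linarith
            _ = _ := by rw [one_div_one_div]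
        have hZ6 : 1 ≤ Z ^ 6 := one_le_pow₀ hZ
        have hY6 : Y ^ 6 ≤ Z ^ 6 := by gcongr
        calc _ ≤ _ := h1
          _ ≤ 2 * Z * (4 * B * Z ^ 6 + 1 * Z ^ 6) + D * (2 * Z ^ 7) := by
            rw [mul_assoc D]
            have q1 : D * (Y * (1 + 2 * |t|)) ≤ D * (2 * Z ^ 7) :=
              mul_le_mul_of_nonneg_left (by linarith) (by linarith)
            refine add_le_add ?_ q1
            gcongr
            · refine h4.trans ?_
              gcongr
            · linarith
          _ = (8 * B + 2 + 2 * D) * Z ^ 7 := by ring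
          _ ≤ C1 * Z ^ 7 := by gcongr; linarith
      · have h1 := hA _ r Y (char_norm (χ ^ 2)) (char_bsum _ hsq) hY hr (1 + x + 2 * Complex.I * t) (by rw [re_e]; linarith) (by rw [re_e]; linarith)
        rw [im_e, habs] at h1
        calc _ ≤ _ := h1
          _ = A * (Y * (1 + 2 * |t|)) := by ring
          _ ≤ A * (2 * Z ^ 7) := mul_le_mul_of_nonneg_left (by linarith) (by linarith)
          _ = 2 * A * Z ^ 7 := by ring
          _ ≤ C1 * Z ^ 7 := by gcongr; linarith
    have := core_real (fun x => ‖LSeries (fun n => χ n) (1 + x + t * Complex.I)‖) C1 B Z (by linarith) hB1 hZ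
      (fun x => norm_nonneg _) ?_ ?_ d hd hd1
    · exact this
    · intro x hx hx1
      have h1 := DirichletCharacter.norm_LSeries_product_ge_one χ hx t
      rw [norm_mul, norm_mul, norm_pow, norm_pow] at h1
      have h2 := ser_bound _ (char_norm (1 : DirichletCharacter ℂ r)) (s := 1 + x) (by simpa using hx)
      have h3 : ‖(1 + (x:ℂ))‖ / ((1 + (x:ℂ)).re - 1) ≤ 2 / x := by
        have : (1 + (x:ℂ)).re - 1 = x := by simp
        rw [this]
        gcongr
        rw [← Complex.ofReal_one, ← Complex.ofReal_add, Complex.norm_real, Real.norm_of_nonneg] <;> linarith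
      rw [mul_comm Complex.I] at h1
      have h4 : 1 ≤ (2 / x) ^ 3 * ‖LSeries (fun n => χ n) (1 + x + t * Complex.I)‖ ^ 4 * (C1 * Z ^ 7) := by
        refine h1.le.trans ?_
        gcongr
        · exact h2.trans h3
        · exact hsqb x hx hx1
      calc x ^ 3 = x ^ 3 * 1 := by ring
        _ ≤ x ^ 3 * ((2 / x) ^ 3 * ‖LSeries (fun n => χ n) (1 + x + t * Complex.I)‖ ^ 4 * (C1 * Z ^ 7)) := by gcongr
        _ = _ := by field_simp; ring
    · intro x x' hx hx1 hx' hx1'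
      refine (abs_norm_sub_norm_le _ _).trans ?_
      refine (hB _ r Y (char_norm χ) hχb hY hr |t| (1 + x' + t * Complex.I) (1 + x + t * Complex.I) (by simpa using hx') (by simp; linarith)
        (by simpa using hx) (by simp; linarith) (by simp) (by simp)).trans ?_
      have e : (1 + (x:ℂ) + t * Complex.I) - (1 + x' + t * Complex.I) = ((x - x' : ℝ) : ℂ) := by push_cast; ring
      rw [e, Complex.norm_real, Real.norm_eq_abs, mul_assoc B]
      gcongr
      rw [hZd, mul_pow]
      gcongr
      nlinarith

end ModPC8

section ModPC9
open ArithmeticFunction in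
noncomputable def lamc (f : ℕ → ℂ) (n : ℕ) : ℂ := (vonMangoldt n : ℂ) * f n

lemma lamc_summable (i : ℕ) (f : ℕ → ℂ) (hf : ∀ n, ‖f n‖ ≤ 1) {s : ℂ} (hs : 1 < s.re) :
    LSeriesSummable (lco i (lamc f)) s := by
  refine lser_summable (i+1) _ (fun n => ?_) hs
  have h0 : 0 ≤ Real.log n := Real.log_natCast_nonneg n
  have h1 : 0 ≤ ArithmeticFunction.vonMangoldt n := ArithmeticFunction.vonMangoldt_nonneg
  have h2 : ArithmeticFunction.vonMangoldt n ≤ Real.log n := ArithmeticFunction.vonMangoldt_le_log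
  rw [lco, lamc, norm_mul, norm_mul, Complex.norm_real, Complex.norm_real, Real.norm_of_nonneg (by positivity),
    Real.norm_of_nonneg h1, pow_succ]
  gcongr
  calc _ ≤ Real.log n * 1 := by gcongr; exact hf n
    _ = _ := mul_one _

lemma lco_succ (i : ℕ) (f : ℕ → ℂ) (hf : ∀ a b, f (a * b) = f a * f b) :
    lco (i + 1) f = ∑ l ∈ Finset.range (i + 1), ((i.choose l : ℂ)) • (LSeries.convolution (lco l (lamc f)) (lco (i - l) f)) := by
  funext n
  rw [Finset.sum_apply]
  simp only [Pi.smul_apply, LSeries.convolution_def, smul_eq_mul, Finset.mul_sum]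
  rw [Finset.sum_comm]
  have : ∀ p ∈ n.divisorsAntidiagonal, ∑ l ∈ Finset.range (i + 1), (i.choose l : ℂ) * (lco l (lamc f) p.1 * lco (i - l) f p.2)
      = ((ArithmeticFunction.vonMangoldt p.1 : ℝ) : ℂ) * (f n * ((Real.log n) ^ i : ℝ)) := by
    intro p hp
    obtain ⟨h1, h2⟩ := Nat.mem_divisorsAntidiagonal.1 hp
    have h3 : p.1 ≠ 0 := fun h => h2 (by rw [← h1, h, zero_mul])
    have h4 : p.2 ≠ 0 := fun h => h2 (by rw [← h1, h, mul_zero])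
    have h5 : Real.log n = Real.log p.1 + Real.log p.2 := by
      rw [← h1]; push_cast; exact Real.log_mul (by exact_mod_cast h3) (by exact_mod_cast h4)
    rw [h5, add_pow, ← h1, hf]
    push_cast
    rw [Finset.mul_sum, Finset.mul_sum]
    refine Finset.sum_congr rfl fun l _ => ?_
    simp only [lco, lamc]
    push_cast
    ring
  rw [Finset.sum_congr rfl this, ← Finset.sum_mul]
  have h6 : ∑ p ∈ n.divisorsAntidiagonal, ((ArithmeticFunction.vonMangoldt p.1 : ℝ) : ℂ) = ((Real.log n : ℝ) : ℂ) := by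
    rw [← Complex.ofReal_sum, Nat.sum_divisorsAntidiagonal (fun a _ => ArithmeticFunction.vonMangoldt a),
      ArithmeticFunction.vonMangoldt_sum]
  rw [h6, lco]
  push_cast
  ring

lemma Lser_succ (i : ℕ) (f : ℕ → ℂ) (hf : ∀ a b, f (a * b) = f a * f b) (hf1 : ∀ n, ‖f n‖ ≤ 1) {s : ℂ} (hs : 1 < s.re) :
    LSeries (lco (i + 1) f) s = ∑ l ∈ Finset.range (i + 1), (i.choose l : ℂ) * (LSeries (lco l (lamc f)) s * LSeries (lco (i - l) f) s) := by
  rw [lco_succ i f hf, LSeries_sum]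
  · refine Finset.sum_congr rfl fun l _ => ?_
    rw [LSeries_smul, LSeries_convolution' (lamc_summable l f hf1 hs) (lco_summable _ f hf1 hs)]
  · intro l _
    exact ((lamc_summable l f hf1 hs).convolution (lco_summable _ f hf1 hs)).smul _

lemma Lbound_all (i : ℕ) : ∃ C : ℝ, 1 ≤ C ∧ ∀ j ≤ i, ∀ (f : ℕ → ℂ) (K Y : ℝ), (∀ n, ‖f n‖ ≤ 1) → bsum f K → 1 ≤ Y →
    K ≤ Real.exp Y → ∀ s : ℂ, 1 < s.re → s.re ≤ 2 →
    ‖LSeries (lco j f) s‖ ≤ C * (Y * (1 + |s.im|)) ^ (i + 1) := by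
  induction i with
  | zero =>
    obtain ⟨C, h1, h⟩ := Lbound 0
    refine ⟨C, h1, fun j hj f K Y a b c d s e g => ?_⟩
    obtain rfl : j = 0 := by omega
    simpa [mul_assoc] using h f K Y a b c d s e g
  | succ i ih =>
    obtain ⟨C, h1, h⟩ := ih
    obtain ⟨C', h1', h'⟩ := Lbound (i + 1)
    refine ⟨C + C', by linarith, fun j hj f K Y a b c d s e g => ?_⟩
    have hs := abs_nonneg s.im
    have hZ : 1 ≤ Y * (1 + |s.im|) := by nlinarith
    rcases Nat.lt_or_ge j (i+1) with hj' | hj'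
    · refine (h j (by omega) f K Y a b c d s e g).trans ?_
      have : (Y * (1 + |s.im|)) ^ (i + 1) ≤ (Y * (1 + |s.im|)) ^ (i + 1 + 1) := pow_le_pow_right₀ hZ (by omega)
      gcongr
      linarith
    · obtain rfl : j = i + 1 := by omega
      refine (h' f K Y a b c d s e g).trans ?_
      rw [mul_assoc, mul_pow]
      gcongr
      · linarith
      · exact le_self_pow₀ (by linarith) (by omega)

def nonexc {r : ℕ} (χ : DirichletCharacter ℂ r) (Y d : ℝ) : Prop :=
  χ ^ 2 ≠ 1 ∨ 1 ≤ Y ^ 4 * ‖LSeries (fun n => χ n) (1 + d)‖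

lemma Gbound (i : ℕ) : ∃ C : ℝ, 1 ≤ C ∧ ∃ D : ℕ, ∀ j < i, ∀ (r : ℕ) [NeZero r] (χ : DirichletCharacter ℂ r) (Y d : ℝ), χ ≠ 1 → 1 ≤ Y → (r:ℝ) ≤ Real.exp Y →
    0 < d → d ≤ 1 → nonexc χ Y d → ∀ t : ℝ,
    ‖LSeries (lco j (lamc fun n => χ n)) (1 + d + t * Complex.I)‖ ≤ C * (Y * (1 + |t|)) ^ D := by
  induction i with
  | zero => exact ⟨1, le_rfl, 0, fun j hj => absurd hj (by omega)⟩
  | succ i ih =>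
    obtain ⟨C, hC1, D, h⟩ := ih
    obtain ⟨A, hA1, hA⟩ := Lbound_all (i + 1)
    obtain ⟨B, hB1, hB⟩ := Llower
    have hnew : 1 ≤ B * A * (1 + 2 ^ i * C) := by
      have : 0 ≤ 2 ^ i * C := by positivity
      have : 1 ≤ B * A := one_le_mul_of_one_le_of_one_le hB1 hA1
      nlinarith
    refine ⟨C + B * A * (1 + 2 ^ i * C), by linarith, D + (i + 15), ?_⟩
    intro j hj r _ χ Y d hχ hY hr hd hd1 hex t
    have ht := abs_nonneg t
    set Z := Y * (1 + |t|) with hZd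
    have hZ : 1 ≤ Z := by rw [hZd]; nlinarith
    rcases Nat.lt_or_ge j i with hj' | hj'
    · refine (h j hj' r χ Y d hχ hY hr hd hd1 hex t).trans ?_
      gcongr
      · linarith
      · omega
    · obtain rfl : j = i := by omega
      set s : ℂ := 1 + d + t * Complex.I with hs
      have hre : s.re = 1 + d := by simp [hs]
      have him : s.im = t := by simp [hs]
      have h1 := Lser_succ j (fun n => χ n) (fun a b => by push_cast; exact map_mul χ _ _) (char_norm χ) (s := s) (by rw [hre]; linarith)
      rw [Finset.sum_range_succ] at h1
      simp only [Nat.choose_self, Nat.cast_one, one_mul, Nat.sub_self, lco_zero] at h1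
      set G := LSeries (lco j (lamc fun n => χ n)) s with hG
      set L := LSeries (fun n => χ n) s with hL
      have hl : ∀ l ≤ j + 1, ‖LSeries (lco l fun n => χ n) s‖ ≤ A * Z ^ (j + 2) := by
        intro l hl
        have := hA l hl _ r Y (char_norm χ) (char_bsum χ hχ) hY hr s (by rw [hre]; linarith) (by rw [hre]; linarith)
        rwa [him] at this
      have h2 : ‖G * L‖ ≤ A * (1 + 2 ^ j * C) * Z ^ (D + (j + 2)) := by
        have e : G * L = LSeries (lco (j + 1) fun n => χ n) s - ∑ l ∈ Finset.range j, (j.choose l : ℂ) * (LSeries (lco l (lamc fun n => χ n)) s * LSeries (lco (j - l) fun n => χ n) s) := by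
          rw [h1]; ring
        rw [e]
        refine (norm_sub_le _ _).trans ?_
        have q1 : Z ^ (j + 2) ≤ Z ^ (D + (j + 2)) := pow_le_pow_right₀ hZ (by omega)
        have q2 : ‖∑ l ∈ Finset.range j, (j.choose l : ℂ) * (LSeries (lco l (lamc fun n => χ n)) s * LSeries (lco (j - l) fun n => χ n) s)‖
            ≤ ∑ l ∈ Finset.range j, (j.choose l : ℝ) * ((C * Z ^ D) * (A * Z ^ (j + 2))) := by
          refine norm_sum_le_of_le _ fun l hlj => ?_
          rw [norm_mul, norm_mul, Complex.norm_natCast]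
          gcongr
          · exact h l (Finset.mem_range.1 hlj) r χ Y d hχ hY hr hd hd1 hex t
          · exact hl _ (by omega)
        have q3 : ∑ l ∈ Finset.range j, (j.choose l : ℝ) ≤ 2 ^ j := by
          have : ∑ l ∈ Finset.range (j + 1), (j.choose l : ℝ) = 2 ^ j := by exact_mod_cast Nat.sum_range_choose j
          rw [Finset.sum_range_succ] at this
          have : (0:ℝ) ≤ j.choose j := by positivity
          linarith
        rw [← Finset.sum_mul] at q2
        have q4 : (∑ l ∈ Finset.range j, (j.choose l : ℝ)) * ((C * Z ^ D) * (A * Z ^ (j + 2))) ≤ 2 ^ j * ((C * Z ^ D) * (A * Z ^ (j + 2))) := by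
          gcongr
        have q5 := hl (j + 1) le_rfl
        have q6 : A * Z ^ (j + 2) ≤ A * Z ^ (D + (j + 2)) := by gcongr
        calc _ ≤ A * Z ^ (D + (j + 2)) + 2 ^ j * ((C * Z ^ D) * (A * Z ^ (j + 2))) := by linarith
          _ = _ := by rw [pow_add Z D]; ring
      have h3 := hB r χ Y d hχ hY hr hd hd1 hex t
      rw [← hs, ← hL, ← hZd] at h3
      rw [norm_mul] at h2
      have hG0 := norm_nonneg G
      calc ‖G‖ = ‖G‖ * 1 := by ring
        _ ≤ ‖G‖ * (B * Z ^ 13 * ‖L‖) := by gcongr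
        _ = B * Z ^ 13 * (‖G‖ * ‖L‖) := by ring
        _ ≤ B * Z ^ 13 * (A * (1 + 2 ^ j * C) * Z ^ (D + (j + 2))) := by gcongr
        _ = B * A * (1 + 2 ^ j * C) * Z ^ (D + (j + 15)) := by
          rw [show D + (j + 15) = 13 + (D + (j + 2)) by omega, pow_add Z 13]; ring
        _ ≤ _ := by gcongr; linarith

/-- Siegel-Walfisz type bound for nonexceptional characters -/
lemma SW (j : ℕ) : ∃ C : ℝ, 1 ≤ C ∧ ∃ D : ℕ, ∀ (N : ℝ), 3 ≤ N → ∀ (r : ℕ) [NeZero r] (χ : DirichletCharacter ℂ r) (Y : ℝ), χ ≠ 1 → 1 ≤ Y → (r:ℝ) ≤ Real.exp Y →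
    nonexc χ Y (1 / Real.log N) →
    ‖∑ n ∈ Finset.Icc 1 (XN N), lamc (fun n => χ n) n * (om N n : ℂ)‖ * (Real.log N) ^ j ≤ C * Y ^ D * N := by
  obtain ⟨C, hC1, D, h⟩ := Gbound (j + 1)
  choose K hK0 hK using fun i => transfer (psis i) D
  set KK : ℝ := ∑ i ∈ Finset.range (j + 1), K i with hKK
  have hKK0 : 0 ≤ KK := Finset.sum_nonneg fun i _ => hK0 i
  refine ⟨1 + 2 ^ j * KK * C * Real.exp 1, ?_, D, ?_⟩
  · have : 0 ≤ 2 ^ j * KK * C * Real.exp 1 := by positivity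
    linarith
  intro N hN r _ χ Y hχ hY hr hex
  have hlog := log_ge_one hN
  have hsg : ((sg N : ℝ):ℂ) = 1 + ((1 / Real.log N : ℝ) : ℂ) := by rw [sg]; push_cast; rfl
  have hsg0 := (sg_bounds hN).1
  set a : ℕ → ℕ → ℂ := fun i => lco i (lamc fun n => χ n) with ha
  have hT : ∀ i ∈ Finset.range (j + 1), ‖∑' n : ℕ, a i n * (((N / n) ^ sg N : ℝ) : ℂ) * psis (j - i) (Real.log n - Real.log N)‖ ≤ KK * (C * Y ^ D) * (Real.exp 1 * N) := by
    intro i hi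
    have := hK (j - i) (sg N) N (by linarith) (by linarith) (a i) (lamc_summable i _ (char_norm χ) (by simpa using hsg0)) (C * Y ^ D) ?_
    · refine this.trans ?_
      rw [N_rpow_sg hN]
      gcongr
      exact Finset.single_le_sum (f := K) (fun i _ => hK0 i) (Finset.mem_range.2 (by omega))
    · intro t
      have := h i (Finset.mem_range.1 hi) r χ Y (1 / Real.log N) hχ hY hr (by positivity) (by rw [div_le_one] <;> linarith) hex t
      rw [← hsg, mul_pow, ← mul_assoc] at this
      exact this
  have hfin : ∀ i, ∑' n : ℕ, a i n * (((N / n) ^ sg N : ℝ) : ℂ) * psis (j - i) (Real.log n - Real.log N) =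
      ∑ n ∈ Finset.Icc 1 (XN N), ((Real.log n - Real.log N) ^ (j - i) : ℝ) * ((Real.log n) ^ i : ℝ) * (lamc (fun n => χ n) n * (om N n : ℂ)) := by
    intro i
    have ept : ∀ n : ℕ, a i n * (((N / n) ^ sg N : ℝ) : ℂ) * psis (j - i) (Real.log n - Real.log N) =
       ((Real.log n - Real.log N) ^ (j - i) : ℝ) * ((Real.log n) ^ i : ℝ) * (lamc (fun n => χ n) n * (om N n : ℂ)) := by
      intro n
      rw [psis_apply, om]
      simp only [ha, lco]
      push_cast
      ring
    simp_rw [ept]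
    apply tsum_eq_sum
    intro n hn
    rw [Finset.mem_Icc, not_and_or] at hn
    rcases hn with hn | hn
    · obtain rfl : n = 0 := by omega
      simp [lamc]
    · rw [om_big hN (by omega)]; simp
  have hmain : ((Real.log N) ^ j : ℝ) * (∑ n ∈ Finset.Icc 1 (XN N), lamc (fun n => χ n) n * (om N n : ℂ)) =
      ∑ i ∈ Finset.range (j + 1), ((-1) ^ (j - i) * (j.choose i : ℂ)) * ∑' n : ℕ, a i n * (((N / n) ^ sg N : ℝ) : ℂ) * psis (j - i) (Real.log n - Real.log N) := by
    simp_rw [hfin, Finset.mul_sum]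
    rw [Finset.sum_comm]
    refine Finset.sum_congr rfl fun n _ => ?_
    have e : Real.log N = Real.log n + (-(Real.log n - Real.log N)) := by ring
    have e2 : (((Real.log N) ^ j : ℝ) : ℂ) = ∑ i ∈ Finset.range (j + 1), ((-1) ^ (j - i) * (j.choose i : ℂ)) * (((Real.log n - Real.log N) ^ (j - i) : ℝ) * ((Real.log n) ^ i : ℝ)) := by
      conv_lhs => rw [e, add_pow]
      rw [Complex.ofReal_sum]
      refine Finset.sum_congr rfl fun i _ => ?_
      rw [neg_pow]
      push_cast
      ring
    rw [e2, Finset.sum_mul]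
    refine Finset.sum_congr rfl fun i _ => ?_
    ring
  have hn1 : ‖∑ n ∈ Finset.Icc 1 (XN N), lamc (fun n => χ n) n * (om N n : ℂ)‖ * (Real.log N) ^ j =
    ‖((Real.log N) ^ j : ℝ) * (∑ n ∈ Finset.Icc 1 (XN N), lamc (fun n => χ n) n * (om N n : ℂ))‖ := by
    rw [norm_mul, Complex.norm_real, Real.norm_of_nonneg (by positivity)]; ring
  rw [hn1, hmain]
  calc _ ≤ ∑ i ∈ Finset.range (j + 1), (j.choose i : ℝ) * (KK * (C * Y ^ D) * (Real.exp 1 * N)) := by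
        refine norm_sum_le_of_le _ fun i hi => ?_
        rw [norm_mul, norm_mul, Complex.norm_natCast, norm_pow, norm_neg, norm_one, one_pow, one_mul]
        gcongr
        exact hT i hi
    _ = 2 ^ j * (KK * (C * Y ^ D) * (Real.exp 1 * N)) := by
        rw [← Finset.sum_mul]; congr 1; exact_mod_cast Nat.sum_range_choose j
    _ = (2 ^ j * KK * C * Real.exp 1) * Y ^ D * N := by ring
    _ ≤ _ := by gcongr; linarith

end ModPC9

section ModPC10
lemma prod_char {r1 r2 : ℕ} [NeZero r1] [NeZero r2] (χ1 : DirichletCharacter ℂ r1) (χ2 : DirichletCharacter ℂ r2)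
    (h1 : χ1.IsPrimitive) (h2 : χ2.IsPrimitive) (hne : (⟨r1, χ1⟩ : Σ r : ℕ, DirichletCharacter ℂ r) ≠ ⟨r2, χ2⟩) :
    ∃ ψ : DirichletCharacter ℂ (r1 * r2), ψ ≠ 1 ∧ ∀ n : ℕ, ψ n = χ1 n * (starRingEnd ℂ) (χ2 n) := by
  have : NeZero (r1 * r2) := ⟨mul_ne_zero (NeZero.ne r1) (NeZero.ne r2)⟩
  refine ⟨DirichletCharacter.changeLevel (r1.dvd_mul_right r2) χ1 * (DirichletCharacter.changeLevel (r2.dvd_mul_left r1) χ2)⁻¹, ?_, ?_⟩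
  · intro h
    rw [mul_inv_eq_one] at h
    have hc := congrArg DirichletCharacter.conductor h
    rw [DirichletCharacter.conductor_changeLevel, DirichletCharacter.conductor_changeLevel] at hc
    rw [DirichletCharacter.IsPrimitive] at h1 h2
    rw [h1, h2] at hc
    subst hc
    have : χ1 = χ2 := DirichletCharacter.changeLevel_injective (r1.dvd_mul_right r1) h
    exact hne (by rw [this])
  · intro n
    by_cases hn : IsCoprime (n : ℤ) ((r1 * r2 : ℕ) : ℤ)
    · have e1 := DirichletCharacter.changeLevel_eq_cast_of_dvd' χ1 (r1.dvd_mul_right r2) hn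
      have e2 := DirichletCharacter.changeLevel_eq_cast_of_dvd' χ2 (r2.dvd_mul_left r1) hn
      push_cast at e1 e2
      rw [MulChar.mul_apply, ← MulChar.star_apply', e1, e2]
      rfl
    · have hnu : ¬ IsUnit ((n : ℕ) : ZMod (r1 * r2)) := by
        rw [ZMod.isUnit_iff_coprime]
        rwa [Nat.isCoprime_iff_coprime] at hn
      rw [MulChar.map_nonunit _ hnu]
      rw [ZMod.isUnit_iff_coprime, Nat.coprime_mul_iff_right, not_and_or] at hnu
      rcases hnu with hnu | hnu
      · rw [MulChar.map_nonunit χ1 (by rwa [ZMod.isUnit_iff_coprime]), zero_mul]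
      · rw [MulChar.map_nonunit χ2 (by rwa [ZMod.isUnit_iff_coprime]), map_zero, mul_zero]

lemma real_vals {r : ℕ} (χ : DirichletCharacter ℂ r) (h : χ ^ 2 = 1) (n : ZMod r) : χ n = 0 ∨ χ n = 1 ∨ χ n = -1 := by
  by_cases hn : IsUnit n
  · right
    have : χ n ^ 2 = 1 := by rw [← MulChar.pow_apply' _ (by norm_num), h, MulChar.one_apply hn]
    rw [sq] at this; exact mul_self_eq_one_iff.1 this
  · left; exact MulChar.map_nonunit _ hn

lemma four_prod {r1 r2 r : ℕ} (χ1 : DirichletCharacter ℂ r1) (χ2 : DirichletCharacter ℂ r2) (ψ : DirichletCharacter ℂ r)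
    (h1 : χ1 ^ 2 = 1) (h2 : χ2 ^ 2 = 1) (hψ : ∀ n : ℕ, ψ n = χ1 n * χ2 n) {x : ℝ} (hx : 0 < x) :
    1 ≤ ‖LSeries (fun n => (1 : DirichletCharacter ℂ 1) n) (1 + x)‖ * ‖LSeries (fun n => χ1 n) (1 + x)‖ *
      ‖LSeries (fun n => χ2 n) (1 + x)‖ * ‖LSeries (fun n => ψ n) (1 + x)‖ := by
  have hs : 1 < (1 + (x:ℂ)).re := by simpa using hx
  have H0 := DirichletCharacter.summable_neg_log_one_sub_mul_prime_cpow (1 : DirichletCharacter ℂ 1) hs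
  have H1 := DirichletCharacter.summable_neg_log_one_sub_mul_prime_cpow χ1 hs
  have H2 := DirichletCharacter.summable_neg_log_one_sub_mul_prime_cpow χ2 hs
  have H3 := DirichletCharacter.summable_neg_log_one_sub_mul_prime_cpow ψ hs
  rw [← DirichletCharacter.LSeries_eulerProduct_exp_log _ hs, ← DirichletCharacter.LSeries_eulerProduct_exp_log χ1 hs,
    ← DirichletCharacter.LSeries_eulerProduct_exp_log χ2 hs, ← DirichletCharacter.LSeries_eulerProduct_exp_log ψ hs]
  rw [← norm_mul, ← norm_mul, ← norm_mul, ← Complex.exp_add, ← Complex.exp_add, ← Complex.exp_add,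
    ← H0.tsum_add H1, ← (H0.add H1).tsum_add H2, ← ((H0.add H1).add H2).tsum_add H3, Complex.norm_exp, Real.one_le_exp_iff,
    Complex.re_tsum (((H0.add H1).add H2).add H3)]
  refine tsum_nonneg fun p => ?_
  have hp : (2:ℝ) ≤ (p:ℕ) := by exact_mod_cast p.2.two_le
  set y : ℝ := ((p:ℕ):ℝ) ^ (-(1 + x)) with hy
  have hy0 : 0 < y := by positivity
  have hy1 : y < 1 := Real.rpow_lt_one_of_one_lt_of_neg (by linarith) (by linarith)
  have ey : ((p:ℕ):ℂ) ^ (-(1 + (x:ℂ))) = (y : ℂ) := by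
    rw [hy, Complex.ofReal_cpow (by positivity)]; push_cast; rfl
  rw [ey, hψ]
  have one1 : (1 : DirichletCharacter ℂ 1) (p : ℕ) = 1 := MulChar.one_apply (isUnit_of_subsingleton _)
  rw [one1]
  have L1 : (Complex.log (1 - 1 * (y:ℂ))).re = Real.log (1 - y) := by
    rw [Complex.log_re, one_mul, ← Complex.ofReal_one, ← Complex.ofReal_sub, Complex.norm_real, Real.norm_of_nonneg (by linarith)]
  have L2 : (Complex.log (1 - (-1) * (y:ℂ))).re = Real.log (1 + y) := by
    rw [Complex.log_re, neg_one_mul, sub_neg_eq_add, ← Complex.ofReal_one, ← Complex.ofReal_add, Complex.norm_real, Real.norm_of_nonneg (by linarith)]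
  have L0 : (Complex.log (1 - 0 * (y:ℂ))).re = 0 := by simp
  have l1 : Real.log (1 - y) ≤ 0 := Real.log_nonpos (by linarith) (by linarith)
  have l2 : Real.log (1 - y) + Real.log (1 + y) ≤ 0 := by
    rw [← Real.log_mul (by linarith) (by linarith)]
    exact Real.log_nonpos (by nlinarith) (by nlinarith)
  simp only [Complex.add_re, Complex.neg_re]
  rcases real_vals χ1 h1 (p:ℕ) with a | a | a <;> rcases real_vals χ2 h2 (p:ℕ) with b | b | b <;>
    rw [a, b] <;> norm_num only [mul_zero, zero_mul, mul_one, one_mul, mul_neg, neg_neg] <;>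
    simp only [L0, L1, L2, one_mul, neg_mul, mul_zero, zero_mul, neg_one_mul] at * <;>
    simp only [L0, L1, L2, sub_zero, Complex.log_one, Complex.zero_re] <;> linarith

end ModPC10

section ModPC11
open Filter Topology

lemma exc_unique : ∃ C : ℝ, 1 ≤ C ∧ ∀ (Y d : ℝ), 1 ≤ Y → 0 < d → d * (C * Y ^ 5) ≤ 1 → ∀ (r1 r2 : ℕ) [NeZero r1] [NeZero r2]
    (χ1 : DirichletCharacter ℂ r1) (χ2 : DirichletCharacter ℂ r2), χ1.IsPrimitive → χ2.IsPrimitive → χ1 ≠ 1 → χ2 ≠ 1 →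
    χ1 ^ 2 = 1 → χ2 ^ 2 = 1 → (r1 : ℝ) ≤ Real.exp Y → (r2 : ℝ) ≤ Real.exp Y →
    C * Y ^ 3 * ‖LSeries (fun n => χ1 n) (1 + d)‖ ≤ 1 → C * Y ^ 3 * ‖LSeries (fun n => χ2 n) (1 + d)‖ ≤ 1 →
    (⟨r1, χ1⟩ : Σ r : ℕ, DirichletCharacter ℂ r) = ⟨r2, χ2⟩ := by
  obtain ⟨A, hA1, hA⟩ := Lbound0
  obtain ⟨B, hB1, hB⟩ := Llip
  set C : ℝ := 17 * B ^ 2 * A with hC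
  have hC1 : 17 ≤ C := by
    have : 1 ≤ B ^ 2 := one_le_pow₀ hB1
    have : 1 ≤ B ^ 2 * A := one_le_mul_of_one_le_of_one_le ‹_› hA1
    rw [hC, mul_assoc]; linarith
  refine ⟨C, by linarith, ?_⟩
  intro Y d hY hd hdY r1 r2 _ _ χ1 χ2 hp1 hp2 hn1 hn2 hs1 hs2 hr1 hr2 hL1 hL2
  by_contra hne
  have : NeZero (r1 * r2) := ⟨mul_ne_zero (NeZero.ne r1) (NeZero.ne r2)⟩
  obtain ⟨ψ, hψ1, hψ⟩ := prod_char χ1 χ2 hp1 hp2 hne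
  have hψ' : ∀ n : ℕ, ψ n = χ1 n * χ2 n := by
    intro n
    rw [hψ]; congr 1
    rcases real_vals χ2 hs2 n with h | h | h <;> simp [h]
  have hY5 : 1 ≤ Y ^ 5 := one_le_pow₀ hY
  set η : ℝ := 1 / (C * Y ^ 5) with hη
  have hη0 : 0 < η := by positivity
  have hη1 : η ≤ 1 := by rw [hη, div_le_one (by positivity)]; nlinarith
  have hdη : d ≤ η := by rw [hη, le_div_iff₀ (by positivity)]; exact hdY
  have hfp := four_prod χ1 χ2 ψ hs1 hs2 hψ' hη0
  have hre : (1 + (η:ℂ)).re = 1 + η := by simp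
  have hz := ser_bound _ (char_norm (1 : DirichletCharacter ℂ 1)) (s := 1 + η) (by rw [hre]; linarith)
  have hz' : ‖(1 + (η:ℂ))‖ / ((1 + (η:ℂ)).re - 1) ≤ 2 / η := by
    have : (1 + (η:ℂ)).re - 1 = η := by simp
    rw [this]
    gcongr
    rw [← Complex.ofReal_one, ← Complex.ofReal_add, Complex.norm_real, Real.norm_of_nonneg] <;> linarith
  have hsm : ∀ (r : ℕ) [NeZero r] (χ : DirichletCharacter ℂ r), χ ≠ 1 → (r:ℝ) ≤ Real.exp Y → C * Y ^ 3 * ‖LSeries (fun n => χ n) (1 + d)‖ ≤ 1 →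
      ‖LSeries (fun n => χ n) (1 + η)‖ ≤ 2 * B / (C * Y ^ 3) := by
    intro r _ χ hχ hr hL
    have h1 := hB _ r Y (char_norm χ) (char_bsum χ hχ) hY hr 0 (1 + d) (1 + η) (by simpa using hd) (by simp; linarith) (by simpa using hη0)
      (by simp; linarith) (by simp) (by simp)
    have h2 : ‖(1 + (η:ℂ)) - (1 + d)‖ ≤ η := by
      rw [show (1 + (η:ℂ)) - (1 + d) = ((η - d : ℝ) : ℂ) by push_cast; ring, Complex.norm_real, Real.norm_of_nonneg] <;> linarith
    have h3 : ‖LSeries (fun n => χ n) (1 + d)‖ ≤ 1 / (C * Y ^ 3) := by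
      rw [le_div_iff₀ (by positivity)]; linarith
    have h4 : B * Y ^ 2 * (1 + 0) * ‖(1 + (η:ℂ)) - (1 + d)‖ ≤ B / (C * Y ^ 3) := by
      calc _ ≤ B * Y ^ 2 * (1 + 0) * η := by gcongr
        _ = _ := by rw [hη]; field_simp; ring
    have h5 := norm_sub_norm_le (LSeries (fun n => χ n) (1 + η)) (LSeries (fun n => χ n) (1 + d))
    have h6 : 1 / (C * Y ^ 3) ≤ B / (C * Y ^ 3) := by gcongr
    have h7 : 2 * B / (C * Y ^ 3) = B / (C * Y ^ 3) + B / (C * Y ^ 3) := by ring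
    rw [h7]
    linarith
  have b1 := hsm r1 χ1 hn1 hr1 hL1
  have b2 := hsm r2 χ2 hn2 hr2 hL2
  have b3 := hA _ ((r1 * r2 : ℕ) : ℝ) (2 * Y) (char_norm ψ) (char_bsum ψ hψ1) (by linarith) (by
    push_cast; rw [two_mul, Real.exp_add]; gcongr) (1 + η) (by rw [hre]; linarith) (by rw [hre]; linarith)
  have him : (1 + (η:ℂ)).im = 0 := by simp
  rw [him, abs_zero, add_zero, mul_one] at b3
  have : (1:ℝ) ≤ (2 / η) * (2 * B / (C * Y ^ 3)) * (2 * B / (C * Y ^ 3)) * (A * (2 * Y)) := by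
    refine hfp.trans ?_
    gcongr
    exact hz.trans hz'
  have e : (2 / η) * (2 * B / (C * Y ^ 3)) * (2 * B / (C * Y ^ 3)) * (A * (2 * Y)) = 16 * B ^ 2 * A / C := by
    rw [hη]; field_simp; ring
  rw [e, hC] at this
  have hBA : 0 < B ^ 2 * A := by positivity
  rw [le_div_iff₀ (by positivity)] at this
  nlinarith

noncomputable def Yf (B : ℕ) (N : ℝ) : ℝ := 1 + B * Real.log (Real.log N)

lemma Yf_tendsto (B : ℕ) (hB : 1 ≤ B) : Tendsto (fun N : ℕ => Yf B N) atTop atTop := by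
  unfold Yf
  apply tendsto_atTop_add_const_left
  apply Tendsto.const_mul_atTop (by exact_mod_cast hB)
  exact Real.tendsto_log_atTop.comp (Real.tendsto_log_atTop.comp tendsto_natCast_atTop_atTop)

lemma Yf_pow (B k : ℕ) : Tendsto (fun N : ℕ => Yf B N ^ k / Real.log N) atTop (𝓝 0) := by
  have h : Tendsto (fun x : ℝ => (1 + B * Real.log x) ^ k / x) atTop (𝓝 0) := by
    have h2 : Tendsto (fun u : ℝ => (1 + B * u) ^ k / Real.exp u) atTop (𝓝 0) := by
      have h3 : Tendsto (fun u : ℝ => (B + 1 : ℝ) ^ k * (u ^ k * Real.exp (-u))) atTop (𝓝 ((B+1:ℝ) ^ k * 0)) :=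
        (Real.tendsto_pow_mul_exp_neg_atTop_nhds_zero k).const_mul _
      rw [mul_zero] at h3
      refine squeeze_zero' ?_ ?_ h3
      · filter_upwards [eventually_ge_atTop 0] with u hu
        positivity
      · filter_upwards [eventually_ge_atTop 1] with u hu
        rw [← mul_assoc, ← mul_pow, Real.exp_neg, ← div_eq_mul_inv]
        gcongr
        linarith
    have h4 := h2.comp Real.tendsto_log_atTop
    refine h4.congr' ?_
    filter_upwards [eventually_gt_atTop 0] with x hx
    simp only [Function.comp_apply]
    rw [Real.exp_log hx]
  exact h.comp (Real.tendsto_log_atTop.comp tendsto_natCast_atTop_atTop)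

def excfree (B : ℕ) (N : ℝ) : Prop := ∀ (r : ℕ) [NeZero r] (χ : DirichletCharacter ℂ r), χ.IsPrimitive → χ ≠ 1 →
  (r:ℝ) ≤ Real.exp (Yf B N) → nonexc χ (Yf B N) (1 / Real.log N)

lemma sig_tr {r1 r2 : ℕ} (χ1 : DirichletCharacter ℂ r1) (χ2 : DirichletCharacter ℂ r2)
    (h : (⟨r1, χ1⟩ : Σ r : ℕ, DirichletCharacter ℂ r) = ⟨r2, χ2⟩) (P : ℝ → Prop) (s : ℂ)
    (h2 : P ‖LSeries (fun n => χ2 n) s‖) : P ‖LSeries (fun n => χ1 n) s‖ := by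
  cases h
  exact h2

set_option maxHeartbeats 800000 in
lemma exc_freq (B : ℕ) (hB : 1 ≤ B) : ∃ᶠ N : ℕ in atTop, excfree B N := by
  intro hcon
  obtain ⟨C, hC1, hC⟩ := exc_unique
  obtain ⟨A, hA1, hA⟩ := Llip
  have hY := Yf_tendsto B hB
  have hY5 := Yf_pow B 5
  have hshift : Tendsto (fun N : ℕ => N + 1) atTop atTop := tendsto_add_atTop_nat 1
  have ev1 : ∀ᶠ N : ℕ in atTop, 16 * C ≤ Yf B N := hY.eventually_ge_atTop _
  have ev2 : ∀ᶠ N : ℕ in atTop, Yf B N ^ 5 / Real.log N ≤ 1 / (16 * C * A) :=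
    hY5.eventually_le_const (by positivity)
  have ev3 : ∀ᶠ N : ℕ in atTop, 2 ≤ Real.log N :=
    (Real.tendsto_log_atTop.comp tendsto_natCast_atTop_atTop).eventually_ge_atTop 2
  have evE : ∀ᶠ N : ℕ in atTop, ∃ (r : ℕ) (_ : NeZero r) (χ : DirichletCharacter ℂ r), χ.IsPrimitive ∧ χ ≠ 1 ∧
      (r:ℝ) ≤ Real.exp (Yf B N) ∧ χ ^ 2 = 1 ∧ Yf B N ^ 4 * ‖LSeries (fun n => χ n) (1 + (1 / Real.log N : ℝ))‖ < 1 := by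
    filter_upwards [hcon] with N hN
    unfold excfree nonexc at hN
    push Not at hN
    obtain ⟨r, h1, χ, h2⟩ := hN
    exact ⟨r, h1, χ, h2⟩
  obtain ⟨N0, hN0⟩ := eventually_atTop.1 (((ev1.and ev2).and ev3).and evE)
  choose! r hr χ hχ using fun N (hN : N0 ≤ N) => (hN0 N hN).2
  have step : ∀ N, N0 ≤ N → (⟨r N, χ N⟩ : Σ r : ℕ, DirichletCharacter ℂ r) = ⟨r (N+1), χ (N+1)⟩ := by
    intro N hN
    have := hr N hN
    have := hr (N+1) (by omega)
    obtain ⟨⟨⟨a1, a2⟩, a3⟩, -⟩ := hN0 N hN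
    obtain ⟨⟨⟨b1, b2⟩, b3⟩, -⟩ := hN0 (N+1) (by omega)
    obtain ⟨p1, n1, q1, s1, e1⟩ := hχ N hN
    obtain ⟨p2, n2, q2, s2, e2⟩ := hχ (N+1) (by omega)
    set Y := Yf B N with hYd
    set Y' := Yf B ((N+1 : ℕ):ℝ) with hYd'
    have hNpos : (0:ℝ) < N := by
      rcases Nat.eq_zero_or_pos N with h | h
      · rw [h] at a3; simp at a3; linarith
      · exact_mod_cast h
    have hN1 : (1:ℝ) ≤ N := by
      have : 0 < N := by exact_mod_cast hNpos
      exact_mod_cast this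
    have hlog : Real.log N ≤ Real.log ((N+1:ℕ):ℝ) := by
      apply Real.log_le_log hNpos; push_cast; linarith
    have hlog2 : Real.log ((N+1:ℕ):ℝ) ≤ 2 * Real.log N := by
      rw [← Nat.cast_two, ← Real.log_pow]
      have : Real.log 2 ≤ Real.log N := by
        have := Real.log_two_lt_d9; linarith
      have h2 : (2:ℝ) ≤ N := (Real.log_le_log_iff (by norm_num) hNpos).1 this
      apply Real.log_le_log (by positivity)
      push_cast; nlinarith
    have hYY : Y ≤ Y' := by
      rw [hYd, hYd', Yf, Yf]
      gcongr
    have hYY2 : Y' ≤ 2 * Y := by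
      rw [hYd, hYd', Yf, Yf]
      have h1 : Real.log (Real.log ((N+1:ℕ):ℝ)) ≤ Real.log 2 + Real.log (Real.log N) := by
        rw [← Real.log_mul (by norm_num) (by linarith)]
        exact Real.log_le_log (by linarith) hlog2
      have h2 : Real.log 2 ≤ Real.log (Real.log N) := Real.log_le_log (by norm_num) a3
      have hB0 : (0:ℝ) ≤ B := Nat.cast_nonneg B
      nlinarith
    have hYp : 16 ≤ Y := by linarith
    have hYp0 : 0 ≤ Y' := by linarith
    have hd1 : (1 + ((1 / Real.log N : ℝ):ℂ)).re = 1 + 1 / Real.log N := by rw [Complex.add_re, Complex.one_re, Complex.ofReal_re]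
    have hd2 : (1 + ((1 / Real.log ((N+1:ℕ):ℝ) : ℝ):ℂ)).re = 1 + 1 / Real.log ((N+1:ℕ):ℝ) := by rw [Complex.add_re, Complex.one_re, Complex.ofReal_re]
    have i1 : 0 < 1 / Real.log N := by positivity
    have i2 : 0 < 1 / Real.log ((N+1:ℕ):ℝ) := by apply one_div_pos.2; linarith
    have i3 : 1 / Real.log N ≤ 1 := by rw [div_le_one] <;> linarith
    have i4 : 1 / Real.log ((N+1:ℕ):ℝ) ≤ 1 / Real.log N := by gcongr
    have key := hC Y' (1 / Real.log ((N+1:ℕ):ℝ)) (by linarith) i2 ?_ (r N) (r (N+1)) (χ N) (χ (N+1)) p1 p2 n1 n2 s1 s2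
      (q1.trans (Real.exp_le_exp.2 hYY)) q2 ?_ ?_
    · exact key
    · rw [div_mul_eq_mul_div, one_mul, mul_div_assoc]
      calc C * (Y' ^ 5 / Real.log ((N+1:ℕ):ℝ)) ≤ C * (1 / (16 * C * A)) := by gcongr
        _ = 1 / (16 * A) := by field_simp
        _ ≤ 1 := by rw [div_le_one (by positivity)]; linarith
    · have l1 := hA _ (r N) Y (char_norm (χ N)) (char_bsum _ n1) (by linarith) q1 0 (1 + (1 / Real.log N : ℝ)) (1 + (1 / Real.log ((N+1:ℕ):ℝ) : ℝ))
        (by rw [hd1]; linarith) (by rw [hd1]; linarith) (by rw [hd2]; linarith) (by rw [hd2]; linarith) (by rw [Complex.add_im, Complex.one_im, Complex.ofReal_im]; simp) (by rw [Complex.add_im, Complex.one_im, Complex.ofReal_im]; simp)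
      have l2 : ‖(1 + ((1 / Real.log ((N+1:ℕ):ℝ) : ℝ):ℂ)) - (1 + ((1 / Real.log N : ℝ):ℂ))‖ ≤ 1 / Real.log N := by
        rw [add_sub_add_left_eq_sub, ← Complex.ofReal_sub, Complex.norm_real, Real.norm_eq_abs, abs_le]
        constructor <;> linarith
      have l3 := norm_sub_norm_le (LSeries (fun n => χ N n) (1 + (1 / Real.log ((N+1:ℕ):ℝ) : ℝ))) (LSeries (fun n => χ N n) (1 + (1 / Real.log N : ℝ)))
      set L1 := ‖LSeries (fun n => χ N n) (1 + (1 / Real.log N : ℝ))‖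
      set L2 := ‖LSeries (fun n => χ N n) (1 + (1 / Real.log ((N+1:ℕ):ℝ) : ℝ))‖
      have hL10 : 0 ≤ L1 := norm_nonneg _
      have hL20 : 0 ≤ L2 := norm_nonneg _
      have l4 : L2 ≤ L1 + A * Y ^ 2 * (1 / Real.log N) := by
        have : A * Y ^ 2 * (1 + 0) * ‖(1 + ((1 / Real.log ((N+1:ℕ):ℝ) : ℝ):ℂ)) - (1 + ((1 / Real.log N : ℝ):ℂ))‖ ≤ A * Y ^ 2 * (1 + 0) * (1 / Real.log N) := by
          gcongr
        linarith
      have l5 : C * Y ^ 3 * L1 ≤ 1 / 16 := by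
        have : C * Y ^ 3 * L1 * 16 ≤ Y ^ 4 * L1 := by
          have : 16 * C * (Y ^ 3 * L1) ≤ Y * (Y ^ 3 * L1) := by gcongr
          nlinarith
        linarith
      have l6 : C * Y ^ 3 * (A * Y ^ 2 * (1 / Real.log N)) ≤ 1 / 16 := by
        calc _ = C * A * (Y ^ 5 / Real.log N) := by ring
          _ ≤ C * A * (1 / (16 * C * A)) := by gcongr
          _ = 1 / 16 := by field_simp
      calc C * Y' ^ 3 * L2 ≤ C * (2 * Y) ^ 3 * (L1 + A * Y ^ 2 * (1 / Real.log N)) := by gcongr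
        _ = 8 * (C * Y ^ 3 * L1 + C * Y ^ 3 * (A * Y ^ 2 * (1 / Real.log N))) := by ring
        _ ≤ 1 := by linarith
    · have hY' : 16 * C ≤ Y' := b1
      have := norm_nonneg (LSeries (fun n => χ (N+1) n) (1 + (1 / Real.log ((N+1:ℕ):ℝ) : ℝ)))
      refine le_trans ?_ e2.le
      rw [pow_succ Y' 3, mul_comm (Y' ^ 3) Y']
      gcongr
      linarith
  have hconst : ∀ k, (⟨r N0, χ N0⟩ : Σ r : ℕ, DirichletCharacter ℂ r) = ⟨r (N0 + k), χ (N0 + k)⟩ := by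
    intro k
    induction k with
    | zero => rfl
    | succ k ih => rw [ih]; exact step (N0 + k) (by omega)
  have hsm : ∀ N, N0 ≤ N → Yf B N ^ 4 * ‖LSeries (fun n => χ N0 n) (1 + (1 / Real.log N : ℝ))‖ < 1 := by
    intro N hN
    have h1 := (hχ N hN).2.2.2.2
    obtain ⟨k, rfl⟩ := Nat.exists_eq_add_of_le hN
    have h2 := hconst k
    exact sig_tr _ _ h2 (fun p => Yf B (N0 + k : ℕ) ^ 4 * p < 1) _ h1
  have := hr N0 le_rfl
  have hne := (hχ N0 le_rfl).2.1
  have hlim : Tendsto (fun N : ℕ => ‖DirichletCharacter.LFunction (χ N0) (1 + (1 / Real.log N : ℝ))‖) atTop (𝓝 ‖DirichletCharacter.LFunction (χ N0) 1‖) := by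
    have hc : Continuous (fun x : ℝ => ‖DirichletCharacter.LFunction (χ N0) (1 + (x : ℂ))‖) := by
      have := (DirichletCharacter.differentiable_LFunction hne).continuous
      fun_prop
    have h0 : Tendsto (fun N : ℕ => 1 / Real.log N) atTop (𝓝 0) := by
      simp_rw [one_div]
      exact tendsto_inv_atTop_zero.comp (Real.tendsto_log_atTop.comp tendsto_natCast_atTop_atTop)
    have := (hc.tendsto 0).comp h0
    rw [Complex.ofReal_zero, add_zero] at this
    exact this
  have hpos : 0 < ‖DirichletCharacter.LFunction (χ N0) 1‖ :=
    norm_pos_iff.2 (DirichletCharacter.LFunction_apply_one_ne_zero hne)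
  have e1 := hlim.eventually_const_le (half_lt_self hpos)
  have e2 : ∀ᶠ N : ℕ in atTop, 2 / ‖DirichletCharacter.LFunction (χ N0) 1‖ + 1 ≤ Yf B N := hY.eventually_ge_atTop _
  obtain ⟨N, ⟨⟨h1, h2⟩, h3⟩, h4⟩ := (((e1.and e2).and ev3).and (eventually_ge_atTop N0)).exists
  have h5 := hsm N h4
  rw [DirichletCharacter.LFunction_eq_LSeries (χ N0) (s := 1 + ((1 / Real.log N : ℝ) : ℂ)) (by rw [Complex.add_re, Complex.one_re, Complex.ofReal_re]; have : 0 < 1 / Real.log N := one_div_pos.2 (by linarith); linarith)] at h1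
  set P := ‖DirichletCharacter.LFunction (χ N0) 1‖
  have h6 : 0 < 2 / P := by positivity
  have h7 : Yf B N ≤ Yf B N ^ 4 := le_self_pow₀ (by linarith) (by norm_num)
  have h8 : 2 / P * (P / 2) = 1 := by field_simp
  have h9 : 2 / P * (P / 2) ≤ Yf B N ^ 4 * ‖LSeries (fun n => χ N0 n) (1 + (1 / Real.log N : ℝ))‖ := by
    exact mul_le_mul (by linarith) h1 (by positivity) (by positivity)
  linarith

end ModPC11

section ModPC12
open Filter Topology

noncomputable def gth (N : ℝ) (n : ℕ) : ℝ := if n.Prime then Real.log n * om N n else 0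

noncomputable def Pth (N : ℝ) (f : ℕ → ℂ) : ℂ := ∑ n ∈ Finset.Icc 1 (XN N), (gth N n : ℂ) * f n

noncomputable def Xth (N : ℝ) : ℝ := ∑ n ∈ Finset.Icc 1 (XN N), gth N n

lemma gth_nonneg {N : ℝ} (hN : 0 < N) (n : ℕ) : 0 ≤ gth N n := by
  unfold gth
  split_ifs
  · exact mul_nonneg (Real.log_natCast_nonneg n) (om_nonneg hN (Nat.cast_nonneg n))
  · exact le_rfl

lemma gth_ne {N : ℝ} (hN : 0 < N) {n : ℕ} (h : gth N n ≠ 0) : n.Prime ∧ Real.exp (-3) * N < n := by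
  unfold gth at h
  split_ifs at h with hp
  · exact ⟨hp, (om_supp hN (by exact_mod_cast hp.pos) (right_ne_zero_of_mul h)).1⟩
  · exact absurd rfl h

lemma gth_cop {N : ℝ} (hN : 0 < N) {q n : ℕ} (hq0 : 0 < q) (hq : (q:ℝ) ≤ Real.exp (-3) * N) (h : gth N n ≠ 0) : n.Coprime q := by
  obtain ⟨hp, hn⟩ := gth_ne hN h
  rw [hp.coprime_iff_not_dvd]
  intro hd
  have := Nat.le_of_dvd hq0 hd
  have : (n:ℝ) ≤ q := by exact_mod_cast this
  linarith

lemma Pth_one {N : ℝ} (hN : 0 < N) {q : ℕ} [NeZero q] (hq : (q:ℝ) ≤ Real.exp (-3) * N) :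
    Pth N (fun n => (1 : DirichletCharacter ℂ q) n) = Xth N := by
  unfold Pth Xth
  push_cast
  apply Finset.sum_congr rfl
  intro n _
  by_cases h : gth N n = 0
  · simp [h]
  · have := gth_cop hN (NeZero.pos q) hq h
    rw [MulChar.one_apply ((ZMod.isUnit_iff_coprime _ _).2 this), mul_one]

lemma Pth_prim {N : ℝ} (hN : 0 < N) {q : ℕ} [NeZero q] (hq : (q:ℝ) ≤ Real.exp (-3) * N) (χ : DirichletCharacter ℂ q) :
    Pth N (fun n => χ n) = Pth N (fun n => χ.primitiveCharacter n) := by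
  unfold Pth
  apply Finset.sum_congr rfl
  intro n _
  by_cases h : gth N n = 0
  · simp [h]
  · have := gth_cop hN (NeZero.pos q) hq h
    have h2 := DirichletCharacter.primitiveCharacter_apply_of_isCoprime χ (a := (n:ℤ)) (by
      rw [Nat.isCoprime_iff_coprime]; exact this)
    simp only [Int.cast_natCast] at h2
    simp only [h2]

lemma ap_bound {N : ℝ} (hN : 0 < N) {q : ℕ} [NeZero q] (hq : (q:ℝ) ≤ Real.exp (-3) * N) (c : ℕ) (hc : c.Coprime q) :
    |∑ n ∈ (Finset.Icc 1 (XN N)).filter (fun n => n ≡ c [MOD q]), gth N n - Xth N / q.totient| ≤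
      1 / q.totient * ∑ χ ∈ Finset.univ.filter (fun χ : DirichletCharacter ℂ q => χ ≠ 1), ‖Pth N (fun n => χ n)‖ := by
  have hcu : IsUnit (c : ZMod q) := (ZMod.isUnit_iff_coprime _ _).2 hc
  have hφ : (0:ℝ) < q.totient := by exact_mod_cast Nat.totient_pos.2 (NeZero.pos q)
  have key : ((q.totient * ∑ n ∈ (Finset.Icc 1 (XN N)).filter (fun n => n ≡ c [MOD q]), gth N n : ℝ) : ℂ) =
      ∑ χ : DirichletCharacter ℂ q, χ (c : ZMod q)⁻¹ * Pth N (fun n => χ n) := by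
    unfold Pth
    simp_rw [Finset.mul_sum]
    rw [Finset.sum_comm, Finset.sum_filter]
    push_cast
    apply Finset.sum_congr rfl
    intro n _
    have h1 : ∀ χ : DirichletCharacter ℂ q, χ (c : ZMod q)⁻¹ * ((gth N n : ℂ) * χ n) = (gth N n : ℂ) * (χ (c : ZMod q)⁻¹ * χ n) := by
      intro χ; ring
    simp_rw [h1]
    rw [← Finset.mul_sum, DirichletCharacter.sum_char_inv_mul_char_eq ℂ hcu, mul_comm]
    by_cases h : n ≡ c [MOD q]
    · rw [if_pos h, if_pos]
      · push_cast; ring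
      · exact ((ZMod.natCast_eq_natCast_iff _ _ _).2 h).symm
    · rw [if_neg h, if_neg]
      · simp
      · intro h2; exact h ((ZMod.natCast_eq_natCast_iff _ _ _).1 h2.symm)
  have hsplit : ∑ χ : DirichletCharacter ℂ q, χ (c : ZMod q)⁻¹ * Pth N (fun n => χ n) =
      (Xth N : ℂ) + ∑ χ ∈ Finset.univ.filter (fun χ : DirichletCharacter ℂ q => χ ≠ 1), χ (c : ZMod q)⁻¹ * Pth N (fun n => χ n) := by
    rw [Finset.filter_ne', ← Finset.add_sum_erase _ _ (Finset.mem_univ (1 : DirichletCharacter ℂ q)), Pth_one hN hq]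
    congr 1
    rw [MulChar.one_apply, one_mul]
    have hz : (c : ZMod q) * (c : ZMod q)⁻¹ = 1 := ZMod.coe_mul_inv_eq_one c hc
    exact IsUnit.of_mul_eq_one _ (by rw [mul_comm]; exact hz)
  rw [hsplit] at key
  set T := ∑ n ∈ (Finset.Icc 1 (XN N)).filter (fun n => n ≡ c [MOD q]), gth N n
  have h3 : ((q.totient * T - Xth N : ℝ) : ℂ) = ∑ χ ∈ Finset.univ.filter (fun χ : DirichletCharacter ℂ q => χ ≠ 1), χ (c : ZMod q)⁻¹ * Pth N (fun n => χ n) := by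
    rw [Complex.ofReal_sub, key]; ring
  have h4 : |q.totient * T - Xth N| ≤ ∑ χ ∈ Finset.univ.filter (fun χ : DirichletCharacter ℂ q => χ ≠ 1), ‖Pth N (fun n => χ n)‖ := by
    rw [← Real.norm_eq_abs, ← Complex.norm_real, h3]
    refine (norm_sum_le _ _).trans (Finset.sum_le_sum fun χ _ => ?_)
    rw [norm_mul]
    have : ‖χ (c : ZMod q)⁻¹‖ ≤ 1 := DirichletCharacter.norm_le_one χ _
    exact mul_le_of_le_one_left (norm_nonneg _) this
  have h5 : T - Xth N / q.totient = 1 / q.totient * (q.totient * T - Xth N) := by field_simp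
  rw [h5, abs_mul, abs_of_pos (by positivity)]
  gcongr

/-- passing from the von Mangoldt function to primes -/
lemma lam_theta {N : ℝ} (hN : 3 ≤ N) (f : ℕ → ℂ) (hf : ∀ n, ‖f n‖ ≤ 1) :
    ‖Pth N f‖ ≤ ‖∑ n ∈ Finset.Icc 1 (XN N), (ArithmeticFunction.vonMangoldt n : ℂ) * f n * (om N n : ℂ)‖ +
      Real.exp 6 * (2 * √(XN N) * Real.log (XN N)) := by
  set S := ∑ n ∈ Finset.Icc 1 (XN N), (ArithmeticFunction.vonMangoldt n : ℂ) * f n * (om N n : ℂ) with hS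
  have h1 : S - Pth N f = ∑ n ∈ (Finset.Icc 1 (XN N)).filter (fun n => ¬ n.Prime), (ArithmeticFunction.vonMangoldt n : ℂ) * f n * (om N n : ℂ) := by
    rw [hS, Pth, ← Finset.sum_sub_distrib, Finset.sum_filter]
    apply Finset.sum_congr rfl
    intro n _
    by_cases hp : n.Prime
    · rw [if_neg (by simpa using hp), gth, if_pos hp, ArithmeticFunction.vonMangoldt_apply_prime hp]; push_cast; ring
    · rw [if_pos hp, gth, if_neg hp]; simp
  have hX : 1 ≤ (XN N : ℝ) := by
    have : 0 < XN N := Nat.ceil_pos.2 (by positivity)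
    exact_mod_cast this
  have h2 : ‖S - Pth N f‖ ≤ Real.exp 6 * (2 * √(XN N) * Real.log (XN N)) := by
    rw [h1]
    calc _ ≤ ∑ n ∈ (Finset.Icc 1 (XN N)).filter (fun n => ¬ n.Prime), Real.exp 6 * ArithmeticFunction.vonMangoldt n := by
          refine (norm_sum_le _ _).trans (Finset.sum_le_sum fun n _ => ?_)
          rw [norm_mul, norm_mul, Complex.norm_real, Complex.norm_real, Real.norm_of_nonneg ArithmeticFunction.vonMangoldt_nonneg,
            Real.norm_of_nonneg (om_nonneg (by linarith) (Nat.cast_nonneg n)), mul_comm]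
          have hΛ : 0 ≤ ArithmeticFunction.vonMangoldt n := ArithmeticFunction.vonMangoldt_nonneg
          apply mul_le_mul (om_le hN (Nat.cast_nonneg n)) _ (by positivity) (by positivity)
          exact mul_le_of_le_one_right hΛ (hf n)
      _ = Real.exp 6 * (Chebyshev.psi (XN N) - Chebyshev.theta (XN N)) := by
          rw [Chebyshev.psi_sub_theta_eq_sum_not_prime, ← Finset.mul_sum, Nat.floor_natCast]
          rfl
      _ ≤ _ := by
          gcongr
          exact Chebyshev.psi_sub_theta_le hX
  have h3 : Pth N f = S - (S - Pth N f) := by ring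
  calc ‖Pth N f‖ = ‖S - (S - Pth N f)‖ := by rw [← h3]
    _ ≤ ‖S‖ + ‖S - Pth N f‖ := norm_sub_le _ _
    _ ≤ _ := by linarith

/-- lower bound for the main term -/
lemma Xth_lower : ∃ c : ℝ, 0 < c ∧ ∀ᶠ N : ℕ in atTop, c * (N:ℝ) ≤ Xth N := by
  have hl2 : 0 < Real.log 2 := Real.log_pos (by norm_num)
  have e2 : (4:ℝ) ≤ Real.exp 2 := by
    have := Real.add_one_lt_exp (x := 1) (by norm_num)
    have h2 : Real.exp 2 = Real.exp 1 * Real.exp 1 := by rw [← Real.exp_add]; norm_num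
    nlinarith
  have e2' : Real.exp (-2) ≤ 0.14 := by
    have := Real.exp_one_gt_d9
    have h2 : Real.exp 2 = Real.exp 1 * Real.exp 1 := by rw [← Real.exp_add]; norm_num
    rw [Real.exp_neg, inv_le_comm₀ (by positivity) (by norm_num)]
    norm_num
    nlinarith
  refine ⟨0.1 * Real.log 2, by positivity, ?_⟩
  have t1 : Tendsto (fun N : ℕ => (Real.log ((N:ℝ) + 2)) / N) atTop (𝓝 0) := by
    have a : Tendsto (fun x : ℝ => Real.log x / x) atTop (𝓝 0) := by
      have := (Real.isLittleO_log_id_atTop).tendsto_div_nhds_zero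
      simpa using this
    have b : Tendsto (fun x : ℝ => Real.log (x + 2) / (x + 2)) atTop (𝓝 0) := a.comp (tendsto_atTop_add_const_right _ _ tendsto_id)
    have c : Tendsto (fun N : ℕ => 3 * (Real.log ((N:ℝ) + 2) / ((N:ℝ) + 2))) atTop (𝓝 (3 * 0)) :=
      (b.comp tendsto_natCast_atTop_atTop).const_mul 3
    rw [mul_zero] at c
    refine squeeze_zero' ?_ ?_ c
    · filter_upwards with N
      apply div_nonneg (Real.log_nonneg (by have : (0:ℝ) ≤ N := Nat.cast_nonneg N; linarith)) (Nat.cast_nonneg N)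
    · filter_upwards [eventually_ge_atTop 1] with N hN
      have hN' : (1:ℝ) ≤ N := by exact_mod_cast hN
      have : 0 ≤ Real.log ((N:ℝ) + 2) := Real.log_nonneg (by linarith)
      rw [← mul_div_assoc, div_le_div_iff₀ (by linarith) (by linarith)]
      nlinarith
  have t2 : Tendsto (fun N : ℕ => Real.log (N:ℝ) / √(N:ℝ)) atTop (𝓝 0) := by
    have := (isLittleO_log_rpow_atTop (r := 1/2) (by norm_num)).tendsto_div_nhds_zero
    have := this.comp (tendsto_natCast_atTop_atTop (R := ℝ))
    refine this.congr fun N => ?_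
    simp [Real.sqrt_eq_rpow]
  filter_upwards [t1.eventually_le_const (show (0:ℝ) < 0.1 * Real.log 2 by positivity),
    t2.eventually_le_const (show (0:ℝ) < 0.1 * Real.log 2 by positivity), eventually_ge_atTop 10] with N h1 h2 hN
  have hN' : (10:ℝ) ≤ N := by exact_mod_cast hN
  have hN0 : (0:ℝ) < N := by linarith
  rw [div_le_iff₀ hN0] at h1
  have hs : 0 < √(N:ℝ) := Real.sqrt_pos.2 hN0
  rw [div_le_iff₀ hs] at h2
  have hss : √(N:ℝ) * √(N:ℝ) = N := Real.mul_self_sqrt hN0.le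
  have th := Chebyshev.theta_ge' (x := N) (by linarith)
  have tl := Chebyshev.theta_le_log4_mul_x (x := Real.exp (-2) * N) (by positivity)
  have l4 : Real.log 4 = 2 * Real.log 2 := by
    rw [show (4:ℝ) = 2 ^ 2 by norm_num, Real.log_pow]; norm_num
  have hdiff : Chebyshev.theta N - Chebyshev.theta (Real.exp (-2) * N) ≤ Xth N := by
    have hle : ⌊Real.exp (-2) * N⌋₊ ≤ N := by
      apply Nat.floor_le_of_le
      apply mul_le_of_le_one_left hN0.le
      linarith
    have hXN : N ≤ XN N := by
      have : (N:ℝ) ≤ XN N := by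
        refine le_trans ?_ (Nat.le_ceil _)
        exact le_mul_of_one_le_left hN0.le (Real.one_le_exp (by norm_num))
      exact_mod_cast this
    unfold Chebyshev.theta Xth
    rw [Nat.floor_natCast, sub_le_iff_le_add]
    rw [Finset.sum_filter, Finset.sum_filter]
    have hu : Finset.Ioc 0 N = Finset.Ioc ⌊Real.exp (-2) * N⌋₊ N ∪ Finset.Ioc 0 ⌊Real.exp (-2) * N⌋₊ := by
      rw [Finset.union_comm, Finset.Ioc_union_Ioc_eq_Ioc (Nat.zero_le _) hle]
    rw [hu, Finset.sum_union]
    · gcongr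
      calc _ ≤ ∑ n ∈ Finset.Ioc ⌊Real.exp (-2) * N⌋₊ N, gth N n := by
            apply Finset.sum_le_sum
            intro n hn
            rw [Finset.mem_Ioc] at hn
            unfold gth
            split_ifs
            · have hg : 1 ≤ om N n := by
                apply om_ge_one (by linarith) _ (by exact_mod_cast hn.2)
                exact (Nat.lt_of_floor_lt hn.1).le
              exact le_mul_of_one_le_right (Real.log_natCast_nonneg n) hg
            · exact le_rfl
        _ ≤ _ := by
            apply Finset.sum_le_sum_of_subset_of_nonneg
            · intro n hn
              rw [Finset.mem_Ioc] at hn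
              rw [Finset.mem_Icc]; omega
            · intro n _ _; exact gth_nonneg hN0 n
    · rw [Finset.disjoint_left]
      intro n hn hn2
      rw [Finset.mem_Ioc] at hn hn2; omega
  rw [l4] at tl
  have a1 : 2 * √(N:ℝ) * Real.log N ≤ 0.2 * Real.log 2 * N := by
    calc 2 * √(N:ℝ) * Real.log N ≤ 2 * √(N:ℝ) * (0.1 * Real.log 2 * √(N:ℝ)) := by gcongr
      _ = 0.2 * Real.log 2 * (√(N:ℝ) * √(N:ℝ)) := by ring
      _ = _ := by rw [hss]
  have a2 : 2 * Real.log 2 * (Real.exp (-2) * N) ≤ 2 * Real.log 2 * (0.14 * N) := by gcongr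
  nlinarith

lemma Xth_upper {N : ℝ} (hN : 3 ≤ N) : Xth N ≤ Real.exp 12 * N := by
  have h1 : Xth N ≤ Real.exp 6 * Chebyshev.theta (XN N) := by
    unfold Xth Chebyshev.theta
    rw [Nat.floor_natCast, Finset.mul_sum, Finset.sum_filter]
    apply Finset.sum_le_sum
    intro n _
    unfold gth
    split_ifs
    · rw [mul_comm]
      exact mul_le_mul_of_nonneg_right (om_le hN (Nat.cast_nonneg n)) (Real.log_natCast_nonneg n)
    · exact le_rfl
  have h2 := Chebyshev.theta_le_log4_mul_x (x := XN N) (Nat.cast_nonneg _)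
  have h3 := XN_le hN
  have h4 : Real.log 4 ≤ Real.exp 2 := by
    have := Real.log_le_sub_one_of_pos (x := 4) (by norm_num)
    have := Real.add_one_le_exp (2:ℝ)
    linarith
  have h5 : Real.log 4 * (XN N) ≤ Real.exp 2 * (Real.exp 4 * N) := by gcongr
  calc Xth N ≤ Real.exp 6 * (Real.exp 2 * (Real.exp 4 * N)) := h1.trans (by gcongr; linarith)
    _ = Real.exp 12 * N := by
      rw [show (12:ℝ) = 6 + (2 + 4) by norm_num, Real.exp_add, Real.exp_add]; ring

end ModPC12

section ModPC13
open Filter Topology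

instance fin_dc (r : ℕ) : Finite (DirichletCharacter ℂ r) := by
  rcases Nat.eq_zero_or_pos r with h | h
  · subst h
    have : Finite (ZMod 0)ˣ := inferInstanceAs (Finite ℤˣ)
    exact inferInstanceAs (Finite (MulChar (ZMod 0) ℂ))
  · have : NeZero r := ⟨h.ne'⟩
    exact inferInstanceAs (Finite (MulChar (ZMod r) ℂ))

abbrev DCS := Σ r : ℕ, DirichletCharacter ℂ r

open Classical in
noncomputable def Fam (Q : ℕ) : Finset DCS :=
  ((Finset.Icc 1 Q).sigma (fun r => @Finset.univ (DirichletCharacter ℂ r) (Fintype.ofFinite _))).filter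
    (fun p => p.2.IsPrimitive ∧ p.2 ≠ 1)

lemma mem_Fam {Q : ℕ} {p : DCS} : p ∈ Fam Q ↔ (1 ≤ p.1 ∧ p.1 ≤ Q) ∧ p.2.IsPrimitive ∧ p.2 ≠ 1 := by
  classical
  unfold Fam
  rw [Finset.mem_filter, Finset.mem_sigma, Finset.mem_Icc]
  simp

lemma card_Fam (Q : ℕ) : (Fam Q).card ≤ Q ^ 2 := by
  classical
  unfold Fam
  refine (Finset.card_filter_le _ _).trans ?_
  rw [Finset.card_sigma]
  calc _ ≤ ∑ r ∈ Finset.Icc 1 Q, Q := by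
        apply Finset.sum_le_sum
        intro r hr
        rw [Finset.mem_Icc] at hr
        have : NeZero r := ⟨by omega⟩
        rw [Finset.card_univ, ← Nat.card_eq_fintype_card, DirichletCharacter.card_eq_totient_of_hasEnoughRootsOfUnity]
        exact (Nat.totient_le r).trans hr.2
    _ = Q ^ 2 := by simp [sq]

lemma cl_sig {q c1 c2 : ℕ} (ψ1 : DirichletCharacter ℂ c1) (ψ2 : DirichletCharacter ℂ c2) (h1 : c1 ∣ q) (h2 : c2 ∣ q)
    (h : (⟨c1, ψ1⟩ : DCS) = ⟨c2, ψ2⟩) : DirichletCharacter.changeLevel h1 ψ1 = DirichletCharacter.changeLevel h2 ψ2 := by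
  cases h
  rfl

lemma red_prim {N : ℝ} (hN : 0 < N) {q Q : ℕ} [NeZero q] (hq : (q:ℝ) ≤ Real.exp (-3) * N) (hQ : q ≤ Q) :
    ∑ χ ∈ Finset.univ.filter (fun χ : DirichletCharacter ℂ q => χ ≠ 1), ‖Pth N (fun n => χ n)‖ ≤
      ∑ p ∈ (Fam Q).filter (fun p => p.1 ∣ q), ‖Pth N (fun n => p.2 n)‖ := by
  classical
  have hinj : Set.InjOn (fun χ : DirichletCharacter ℂ q => (⟨χ.conductor, χ.primitiveCharacter⟩ : DCS))
      (Finset.univ.filter (fun χ : DirichletCharacter ℂ q => χ ≠ 1)) := by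
    intro χ1 _ χ2 _ h
    rw [← DirichletCharacter.changeLevel_primitiveCharacter χ1, ← DirichletCharacter.changeLevel_primitiveCharacter χ2]
    exact cl_sig _ _ _ _ h
  calc _ = ∑ χ ∈ Finset.univ.filter (fun χ : DirichletCharacter ℂ q => χ ≠ 1), ‖Pth N (fun n => χ.primitiveCharacter n)‖ := by
        apply Finset.sum_congr rfl
        intro χ _
        rw [Pth_prim hN hq]
    _ = ∑ p ∈ (Finset.univ.filter (fun χ : DirichletCharacter ℂ q => χ ≠ 1)).image
          (fun χ : DirichletCharacter ℂ q => (⟨χ.conductor, χ.primitiveCharacter⟩ : DCS)), ‖Pth N (fun n => p.2 n)‖ := by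
        rw [Finset.sum_image hinj]
    _ ≤ _ := by
        apply Finset.sum_le_sum_of_subset_of_nonneg
        · intro p hp
          rw [Finset.mem_image] at hp
          obtain ⟨χ, hχ, rfl⟩ := hp
          rw [Finset.mem_filter] at hχ
          rw [Finset.mem_filter, mem_Fam]
          have hd := χ.conductor_dvd_level
          refine ⟨⟨⟨Nat.pos_of_dvd_of_pos hd (NeZero.pos q), (Nat.le_of_dvd (NeZero.pos q) hd).trans hQ⟩,
            DirichletCharacter.primitiveCharacter_isPrimitive χ, ?_⟩, hd⟩
          intro h1
          apply hχ.2
          rw [← DirichletCharacter.changeLevel_primitiveCharacter χ]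
          simp only at h1
          rw [h1, map_one]
        · intro _ _ _; exact norm_nonneg _

lemma pow_omega_le (M e : ℕ) (he : Squarefree e) : (M:ℝ) ^ e.primeFactors.card ≤ ((M:ℝ) + 1) ^ (M ^ 2) * √e := by
  have h1 : (e:ℝ) = ∏ p ∈ e.primeFactors, (p:ℝ) := by
    conv_lhs => rw [← Nat.prod_primeFactors_of_squarefree he]
    push_cast; rfl
  have h2 : √(e:ℝ) = ∏ p ∈ e.primeFactors, √(p:ℝ) := by
    rw [h1, Real.sqrt_eq_rpow, ← Real.finsetProd_rpow _ _ (fun p _ => Nat.cast_nonneg p)]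
    apply Finset.prod_congr rfl
    intro p _; rw [Real.sqrt_eq_rpow]
  rw [← Finset.prod_const]
  calc ∏ p ∈ e.primeFactors, (M:ℝ) ≤ ∏ p ∈ e.primeFactors, ((if p ≤ M ^ 2 then (M:ℝ) + 1 else 1) * √(p:ℝ)) := by
        apply Finset.prod_le_prod
        · intro p _; positivity
        · intro p hp
          have hp1 : (1:ℝ) ≤ p := by exact_mod_cast (Nat.prime_of_mem_primeFactors hp).one_le
          split_ifs with h
          · have : 1 ≤ √(p:ℝ) := Real.one_le_sqrt.2 hp1
            nlinarith [Nat.cast_nonneg (α := ℝ) M]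
          · push Not at h
            rw [one_mul]
            apply Real.le_sqrt_of_sq_le
            exact_mod_cast h.le
    _ = (∏ p ∈ e.primeFactors, (if p ≤ M ^ 2 then (M:ℝ) + 1 else 1)) * √e := by
        rw [Finset.prod_mul_distrib, h2]
    _ ≤ _ := by
        gcongr
        rw [Finset.prod_ite, Finset.prod_const, Finset.prod_const_one, mul_one]
        apply pow_le_pow_right₀ (by linarith [Nat.cast_nonneg (α := ℝ) M])
        calc _ ≤ (Finset.Icc 1 (M ^ 2)).card := by
              apply Finset.card_le_card
              intro p hp
              rw [Finset.mem_filter] at hp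
              rw [Finset.mem_Icc]
              exact ⟨(Nat.prime_of_mem_primeFactors hp.1).one_le, hp.2⟩
          _ = _ := by simp

lemma totient_ge_sq (d : ℕ) (hd : Squarefree d) : (d:ℝ) ≤ 2 ^ d.primeFactors.card * d.totient := by
  have h1 : (d:ℝ) = ∏ p ∈ d.primeFactors, (p:ℝ) := by
    conv_lhs => rw [← Nat.prod_primeFactors_of_squarefree hd]
    push_cast; rfl
  have h2 : (d.totient:ℝ) = ∏ p ∈ d.primeFactors, ((p:ℝ) - 1) := by
    have := Nat.totient_mul_prod_primeFactors d
    rw [Nat.prod_primeFactors_of_squarefree hd, mul_comm] at this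
    have := Nat.eq_of_mul_eq_mul_left (Nat.pos_of_ne_zero hd.ne_zero) this
    rw [this]
    push_cast
    apply Finset.prod_congr rfl
    intro p hp
    rw [Nat.cast_sub (Nat.prime_of_mem_primeFactors hp).one_le]; simp
  rw [h1, h2, ← Finset.prod_const, ← Finset.prod_mul_distrib]
  apply Finset.prod_le_prod
  · intro p _; positivity
  · intro p hp
    have : (2:ℝ) ≤ p := by exact_mod_cast (Nat.prime_of_mem_primeFactors hp).two_le
    linarith

lemma wt_sum (A W r x : ℕ) (hW : 0 < W) (hr : 0 < r) :
    ∑ d ∈ ((Finset.Icc 1 x).filter (fun d => Squarefree d ∧ d.Coprime W)).filter (fun d => r ∣ W * d),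
      (A:ℝ) ^ d.primeFactors.card * (1 / (W * d).totient) ≤
      (((2 * A : ℕ):ℝ) + 1) ^ ((2 * A) ^ 2) * W / √r * (1 + Real.log x) ^ (2 * A) := by
  set D := ((Finset.Icc 1 x).filter (fun d => Squarefree d ∧ d.Coprime W)).filter (fun d => r ∣ W * d) with hD
  have hlog : 0 ≤ 1 + Real.log x := by have := Real.log_natCast_nonneg x; linarith
  rcases D.eq_empty_or_nonempty with h0 | ⟨d0, hd0⟩
  · rw [h0, Finset.sum_empty]; positivity
  set g := Nat.gcd r W with hg
  have hg0 : 0 < g := Nat.gcd_pos_of_pos_left _ hr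
  obtain ⟨e, he⟩ : g ∣ r := Nat.gcd_dvd_left r W
  obtain ⟨W', hW'⟩ : g ∣ W := Nat.gcd_dvd_right r W
  have hcop : Nat.Coprime e W' := by
    have := Nat.coprime_div_gcd_div_gcd (m := r) (n := W) hg0
    rw [← hg] at this
    rwa [he, hW', Nat.mul_div_cancel_left _ hg0, Nat.mul_div_cancel_left _ hg0] at this
  have hed : ∀ d ∈ D, e ∣ d := by
    intro d hd
    have h1 := (Finset.mem_filter.1 hd).2
    rw [he, hW', mul_assoc] at h1
    exact hcop.dvd_of_dvd_mul_left (Nat.dvd_of_mul_dvd_mul_left hg0 h1)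
  have hsq : ∀ d ∈ D, Squarefree d ∧ d.Coprime W ∧ 1 ≤ d ∧ d ≤ x := by
    intro d hd
    have h1 := Finset.mem_filter.1 (Finset.mem_filter.1 hd).1
    rw [Finset.mem_Icc] at h1
    exact ⟨h1.2.1, h1.2.2, h1.1⟩
  have hesq : Squarefree e := (hsq d0 hd0).1.squarefree_of_dvd (hed d0 hd0)
  have he0 : 0 < e := Nat.pos_of_ne_zero hesq.ne_zero
  have heR : (0:ℝ) < e := by exact_mod_cast he0
  set M := 2 * A with hM
  have hterm : ∀ d ∈ D, (A:ℝ) ^ d.primeFactors.card * (1 / (W * d).totient) ≤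
      (M:ℝ) ^ e.primeFactors.card / e * ((M:ℝ) ^ (d / e).primeFactors.card / (d / e : ℕ)) := by
    intro d hd
    obtain ⟨s1, s2, s3, s4⟩ := hsq d hd
    obtain ⟨d', hd'⟩ := hed d hd
    have hd'e : d / e = d' := by rw [hd', Nat.mul_div_cancel_left _ he0]
    rw [hd'e]
    have hc : e.Coprime d' := by rw [hd'] at s1; exact (Nat.squarefree_mul_iff.1 s1).1
    have hω : d.primeFactors.card = e.primeFactors.card + d'.primeFactors.card := by
      rw [hd', hc.primeFactors_mul, Finset.card_union_of_disjoint hc.disjoint_primeFactors]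
    have hφ : (W * d).totient = W.totient * d.totient := Nat.totient_mul s2.symm
    have hW1 : 1 ≤ W.totient := Nat.totient_pos.2 hW
    have hφd : (0:ℝ) < d.totient := by exact_mod_cast Nat.totient_pos.2 s3
    have hd0 : (0:ℝ) < d := by exact_mod_cast s3
    have t := totient_ge_sq d s1
    have h1 : 1 / ((W * d).totient : ℝ) ≤ 2 ^ d.primeFactors.card / d := by
      rw [div_le_div_iff₀ _ hd0, one_mul]
      · rw [hφ]; push_cast
        have : (1:ℝ) ≤ W.totient := by exact_mod_cast hW1
        calc (d:ℝ) ≤ 2 ^ d.primeFactors.card * d.totient := t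
          _ ≤ 2 ^ d.primeFactors.card * (W.totient * d.totient) := by
            gcongr; exact le_mul_of_one_le_left hφd.le this
      · rw [hφ]; push_cast
        have : (1:ℝ) ≤ W.totient := by exact_mod_cast hW1
        positivity
    calc (A:ℝ) ^ d.primeFactors.card * (1 / (W * d).totient) ≤ (A:ℝ) ^ d.primeFactors.card * (2 ^ d.primeFactors.card / d) := by gcongr
      _ = (M:ℝ) ^ d.primeFactors.card / d := by rw [hM]; push_cast; rw [mul_pow]; ring
      _ = _ := by
        rw [hω, pow_add]
        conv_lhs => rw [hd']
        push_cast
        rw [mul_div_mul_comm]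
  have hsumle : ∑ d ∈ D, ((M:ℝ) ^ (d / e).primeFactors.card / (d / e : ℕ)) ≤ (1 + Real.log x) ^ M := by
    refine le_trans ?_ (sum_pow_omega M x)
    have hinj : Set.InjOn (fun d => d / e) D := by
      intro a ha b hb hab
      simp only at hab
      rw [← Nat.div_mul_cancel (hed a ha), ← Nat.div_mul_cancel (hed b hb), hab]
    rw [← Finset.sum_image (f := fun n : ℕ => (M:ℝ) ^ n.primeFactors.card / (n:ℝ)) hinj]
    apply Finset.sum_le_sum_of_subset_of_nonneg
    · intro n hn
      rw [Finset.mem_image] at hn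
      obtain ⟨d, hd, rfl⟩ := hn
      obtain ⟨s1, s2, s3, s4⟩ := hsq d hd
      rw [Finset.mem_filter, Finset.mem_Icc]
      refine ⟨⟨Nat.div_pos (Nat.le_of_dvd s3 (hed d hd)) he0, (Nat.div_le_self _ _).trans s4⟩, ?_⟩
      exact s1.squarefree_of_dvd (Nat.div_dvd_of_dvd (hed d hd))
    · intro n _ _; positivity
  have hee : (M:ℝ) ^ e.primeFactors.card / e ≤ ((M:ℝ) + 1) ^ (M ^ 2) * W / √r := by
    have hp := pow_omega_le M e hesq
    have hre : (r:ℝ) ≤ W * e := by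
      have : r ≤ W * e := by rw [he]; exact Nat.mul_le_mul_right _ (Nat.le_of_dvd hW ⟨W', hW'⟩)
      exact_mod_cast this
    have hWR : (1:ℝ) ≤ W := by exact_mod_cast hW
    have hrp : (0:ℝ) < √r := Real.sqrt_pos.2 (by exact_mod_cast hr)
    rw [div_le_div_iff₀ heR hrp]
    have hs : √(r:ℝ) ≤ W * √e := by
      rw [Real.sqrt_le_left (by positivity), mul_pow, Real.sq_sqrt heR.le]
      nlinarith
    calc (M:ℝ) ^ e.primeFactors.card * √r ≤ ((M:ℝ) + 1) ^ (M ^ 2) * √e * (W * √e) := by gcongr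
      _ = ((M:ℝ) + 1) ^ (M ^ 2) * W * (√e * √e) := by ring
      _ = _ := by rw [Real.mul_self_sqrt heR.le]
  calc _ ≤ ∑ d ∈ D, (M:ℝ) ^ e.primeFactors.card / e * ((M:ℝ) ^ (d / e).primeFactors.card / (d / e : ℕ)) := Finset.sum_le_sum hterm
    _ = (M:ℝ) ^ e.primeFactors.card / e * ∑ d ∈ D, ((M:ℝ) ^ (d / e).primeFactors.card / (d / e : ℕ)) := by rw [Finset.mul_sum]
    _ ≤ _ := by gcongr

noncomputable def Dl (N : ℝ) : ℝ := Real.exp 6 * (2 * √(XN N) * Real.log (XN N))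

lemma Dl_nonneg (N : ℝ) : 0 ≤ Dl N := by
  unfold Dl
  have := Real.log_natCast_nonneg (XN N)
  positivity

lemma bsum_mono {f : ℕ → ℂ} {K K' : ℝ} (h : bsum f K) (hK : K ≤ K') : bsum f K' := fun M => (h M).trans hK

lemma fam_bv : ∃ C : ℝ, 0 ≤ C ∧ ∀ N : ℝ, 3 ≤ N → ∀ Q : ℕ, 2 ≤ Q → (Q:ℝ) ^ 100 ≤ N →
    ∑ p ∈ Fam Q, ‖Pth N (fun n => p.2 n)‖ ≤ C * N * Real.log N ^ 5 + (Q:ℝ) ^ 2 * Dl N := by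
  classical
  obtain ⟨C, hC0, hC⟩ := BVcore
  refine ⟨C * 6 ^ 5, by positivity, ?_⟩
  intro N hN Q hQ hQN
  have hQR : (2:ℝ) ≤ Q := by exact_mod_cast hQ
  have hnz : ∀ p ∈ Fam Q, NeZero p.1 := fun p hp => ⟨by have := (mem_Fam.1 hp).1; omega⟩
  have hcard : ((Fam Q).card : ℝ) ≤ (Q:ℝ) ^ 2 := by exact_mod_cast card_Fam Q
  have hprodle : ∀ p ∈ Fam Q, ∀ q ∈ Fam Q, ((p.1 * q.1 : ℕ):ℝ) ≤ (Q:ℝ) ^ 2 := by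
    intro p hp q hq
    have h1 := (mem_Fam.1 hp).1.2
    have h2 := (mem_Fam.1 hq).1.2
    have : p.1 * q.1 ≤ Q ^ 2 := by rw [sq]; exact Nat.mul_le_mul h1 h2
    exact_mod_cast this
  have main := hC N hN ((Q:ℝ) ^ 2) (by nlinarith) (by rw [← pow_mul]; exact hQN) (Fam Q) (fun p n => p.1.2 n)
    (fun p n => DirichletCharacter.norm_le_one _ _) (fun p m n => by push_cast; rw [map_mul]) ((Q:ℝ) ^ 2) (by positivity) le_rfl
    (fun p => by
      have := hnz p.1 p.2
      have hm := mem_Fam.1 p.2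
      apply bsum_mono (char_bsum p.1.2 hm.2.2)
      have : (p.1.1:ℝ) ≤ Q := by exact_mod_cast hm.1.2
      nlinarith)
    (fun p q hpq => by
      have := hnz p.1 p.2
      have := hnz q.1 q.2
      have : NeZero (p.1.1 * q.1.1) := ⟨mul_ne_zero (NeZero.ne _) (NeZero.ne _)⟩
      have hm := mem_Fam.1 p.2
      have hm2 := mem_Fam.1 q.2
      obtain ⟨ψ, hψ1, hψ⟩ := prod_char p.1.2 q.1.2 hm.2.1 hm2.2.1 (fun h => hpq (Subtype.ext h))
      have := char_bsum ψ hψ1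
      apply bsum_mono _ (hprodle p.1 p.2 q.1 q.2)
      convert this using 2 with n
      exact (hψ n).symm) (by rw [Fintype.card_coe]; exact hcard)
  rw [Finset.sum_coe_sort (Fam Q) (fun p => ‖∑ n ∈ Finset.Icc 1 (XN N), (ArithmeticFunction.vonMangoldt n : ℂ) * p.2 n * (om N n : ℂ)‖)] at main
  calc ∑ p ∈ Fam Q, ‖Pth N (fun n => p.2 n)‖ ≤ ∑ p ∈ Fam Q, (‖∑ n ∈ Finset.Icc 1 (XN N), (ArithmeticFunction.vonMangoldt n : ℂ) * p.2 n * (om N n : ℂ)‖ + Dl N) := by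
        apply Finset.sum_le_sum
        intro p _
        exact lam_theta hN _ (fun n => DirichletCharacter.norm_le_one _ _)
    _ = ∑ p ∈ Fam Q, ‖∑ n ∈ Finset.Icc 1 (XN N), (ArithmeticFunction.vonMangoldt n : ℂ) * p.2 n * (om N n : ℂ)‖ + (Fam Q).card * Dl N := by
        rw [Finset.sum_add_distrib, Finset.sum_const, nsmul_eq_mul]
    _ ≤ C * N * Lg N ^ 5 + (Q:ℝ) ^ 2 * Dl N := by
        have := Dl_nonneg N
        gcongr
    _ ≤ C * N * (6 * Real.log N) ^ 5 + (Q:ℝ) ^ 2 * Dl N := by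
        have := Lg_one hN
        have := Lg_le hN
        gcongr
    _ = _ := by ring

end ModPC13

section ModPC14
open Filter Topology

noncomputable def Rn (N : ℕ) : ℕ := ⌊(N:ℝ) ^ (1/400 : ℝ)⌋₊

lemma Rn_tendsto : Tendsto Rn atTop atTop := by
  unfold Rn
  exact tendsto_nat_floor_atTop.comp ((tendsto_rpow_atTop (by norm_num)).comp tendsto_natCast_atTop_atTop)

lemma Rn_pow (N : ℕ) : (Rn N : ℝ) ^ 400 ≤ N := by
  have h : (Rn N : ℝ) ≤ (N:ℝ) ^ (1/400 : ℝ) := Nat.floor_le (by positivity)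
  calc (Rn N : ℝ) ^ 400 ≤ ((N:ℝ) ^ (1/400 : ℝ)) ^ 400 := by gcongr
    _ = (N:ℝ) := by rw [← Real.rpow_natCast, ← Real.rpow_mul (Nat.cast_nonneg N)]; norm_num

lemma Rn_Q (W N : ℕ) (hW : 0 < W) (hR : W + 5 ≤ Rn N) :
    ((W * Rn N ^ 2 : ℕ):ℝ) ^ 100 ≤ N ∧ 25 ≤ W * Rn N ^ 2 ∧ ((W * Rn N ^ 2 : ℕ):ℝ) ≤ Real.exp (-3) * N := by
  have h1 : ((W * Rn N ^ 2 : ℕ):ℝ) ^ 100 ≤ N := by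
    refine le_trans ?_ (Rn_pow N)
    push_cast
    have : (W:ℝ) ≤ Rn N := by exact_mod_cast (by omega : W ≤ Rn N)
    have h1 : (1:ℝ) ≤ Rn N := by exact_mod_cast (by omega : 1 ≤ Rn N)
    calc ((W:ℝ) * (Rn N : ℝ) ^ 2) ^ 100 ≤ ((Rn N : ℝ) * (Rn N : ℝ) ^ 2) ^ 100 := by gcongr
      _ = (Rn N : ℝ) ^ 300 := by rw [← pow_succ', ← pow_mul]
      _ ≤ _ := pow_le_pow_right₀ h1 (by norm_num)
  have h2 : 25 ≤ W * Rn N ^ 2 := by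
    calc 25 = 1 * 5 ^ 2 := by norm_num
      _ ≤ _ := by apply Nat.mul_le_mul hW; exact Nat.pow_le_pow_left (by omega) 2
  refine ⟨h1, h2, ?_⟩
  set Q := W * Rn N ^ 2
  have hQ : (25:ℝ) ≤ Q := by exact_mod_cast h2
  have h3 : (Q:ℝ) ^ 2 ≤ (Q:ℝ) ^ 100 := pow_le_pow_right₀ (by linarith) (by norm_num)
  have e3 : Real.exp 3 ≤ 25 := by
    have := Real.exp_one_lt_d9
    have h2 : Real.exp 3 = Real.exp 1 ^ 3 := by rw [← Real.exp_nat_mul]; norm_num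
    rw [h2]
    calc Real.exp 1 ^ 3 ≤ 2.7182818286 ^ 3 := by gcongr
      _ ≤ 25 := by norm_num
  rw [Real.exp_neg, inv_mul_eq_div, le_div_iff₀ (by positivity)]
  nlinarith

noncomputable def Ed (W N d : ℕ) : ℝ :=
  1 / (W * d).totient * ∑ p ∈ (Fam (W * Rn N ^ 2)).filter (fun p => p.1 ∣ W * d), ‖Pth N (fun n => p.2 n)‖

lemma Ed_nonneg (W N d : ℕ) : 0 ≤ Ed W N d := by unfold Ed; positivity

lemma dist_ap (W N : ℕ) (hW : 0 < W) (hR : W + 5 ≤ Rn N) (d : ℕ) (hd : 1 ≤ d) (hd2 : d ≤ Rn N ^ 2) (c : ℕ)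
    (hc : c.Coprime (W * d)) :
    |∑ n ∈ (Finset.Icc 1 (XN N)).filter (fun n => n ≡ c [MOD (W * d)]), gth N n - Xth N / (W * d).totient| ≤ Ed W N d := by
  obtain ⟨h1, h2, h3⟩ := Rn_Q W N hW hR
  have : NeZero (W * d) := ⟨by positivity⟩
  have hle : W * d ≤ W * Rn N ^ 2 := Nat.mul_le_mul_left _ hd2
  have hle' : ((W * d : ℕ):ℝ) ≤ ((W * Rn N ^ 2 : ℕ):ℝ) := by exact_mod_cast hle
  have hN : (0:ℝ) < N := by
    have : (25:ℝ) ≤ ((W * Rn N ^ 2 : ℕ):ℝ) := by exact_mod_cast h2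
    by_contra hcon
    have h0 : (N:ℝ) = 0 := le_antisymm (not_lt.1 hcon) (Nat.cast_nonneg N)
    rw [h0] at h3; linarith
  refine (ap_bound hN (hle'.trans h3) c hc).trans ?_
  unfold Ed
  gcongr
  exact red_prim hN (hle'.trans h3) hle

lemma Dl_small (M : ℕ) : ∀ᶠ N : ℕ in atTop, ∀ Q : ℝ, 0 ≤ Q → Q ^ 50 ≤ N → Q * Dl N * Real.log N ^ M ≤ N := by
  have h1 := (isLittleO_log_rpow_rpow_atTop ((M + 1 : ℕ):ℝ) (s := 2/5) (by norm_num)).comp_tendsto (tendsto_natCast_atTop_atTop (R := ℝ))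
  set K : ℝ := Real.exp 6 * (2 * Real.exp 4 * 6) with hK
  have hK0 : 0 < K := by positivity
  have h2 := h1.bound (c := 1 / K) (by positivity)
  filter_upwards [h2, eventually_ge_atTop 3] with N h hN Q hQ0 hQN
  have hNR : (3:ℝ) ≤ N := by exact_mod_cast hN
  have hN0 : (0:ℝ) < N := by linarith
  have hl := log_ge_one hNR
  simp only [Function.comp_apply] at h
  rw [Real.rpow_natCast, Real.norm_of_nonneg (by positivity), Real.norm_of_nonneg (by positivity)] at h
  have hQ : Q ≤ (N:ℝ) ^ (1/50 : ℝ) := by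
    rw [one_div, Real.le_rpow_inv_iff_of_pos hQ0 hN0.le (by norm_num)]
    exact_mod_cast hQN
  have hD : Dl N ≤ K * (√N * Real.log N) := by
    unfold Dl
    have a1 := XN_le hNR
    have a2 : Real.log (XN N) ≤ 6 * Real.log N := by
      have := Lg_le hNR
      unfold Lg at this; linarith
    have a3 : √(XN N) ≤ Real.exp 4 * √N := by
      rw [Real.sqrt_le_left (by positivity), mul_pow, Real.sq_sqrt hN0.le]
      refine a1.trans ?_
      gcongr
      exact le_self_pow₀ (Real.one_le_exp (by norm_num)) (by norm_num)
    calc _ ≤ Real.exp 6 * (2 * (Real.exp 4 * √N) * (6 * Real.log N)) := by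
          have := Real.log_natCast_nonneg (XN N)
          gcongr
      _ = _ := by rw [hK]; ring
  calc Q * Dl N * Real.log N ^ M ≤ (N:ℝ) ^ (1/50 : ℝ) * (K * (√N * Real.log N)) * Real.log N ^ M := by
        have := Dl_nonneg N
        gcongr
    _ = K * ((N:ℝ) ^ (1/50 : ℝ) * √N) * Real.log N ^ (M + 1) := by ring
    _ ≤ K * ((N:ℝ) ^ (1/50 : ℝ) * √N) * (1 / K * (N:ℝ) ^ (2/5 : ℝ)) := by gcongr
    _ = (N:ℝ) ^ (1/50 : ℝ) * (N:ℝ) ^ (1/2 : ℝ) * (N:ℝ) ^ (2/5 : ℝ) := by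
        rw [Real.sqrt_eq_rpow]; field_simp
    _ ≤ (N:ℝ) ^ (1 : ℝ) := by
        rw [← Real.rpow_add hN0, ← Real.rpow_add hN0]
        apply Real.rpow_le_rpow_of_exponent_le (by linarith); norm_num
    _ = N := Real.rpow_one _

/-- small conductors -/
lemma fam_sw (B1 j : ℕ) (hB1 : 1 ≤ B1) : ∃ C : ℝ, 0 ≤ C ∧ ∀ᶠ N : ℕ in atTop, excfree B1 N → ∀ Q : ℕ,
    ∑ p ∈ (Fam Q).filter (fun p => (p.1:ℝ) ≤ Real.log N ^ B1), ‖Pth N (fun n => p.2 n)‖ ≤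
      Real.log N ^ (2 * B1) * (C * N * Real.log N / Real.log N ^ j + Dl N) := by
  obtain ⟨C, hC1, D, hC⟩ := SW j
  refine ⟨C, by linarith, ?_⟩
  have hY := (Yf_tendsto B1 hB1).eventually_ge_atTop 1
  have hYD := (Yf_pow B1 D).eventually_le_const (show (0:ℝ) < 1 by norm_num)
  filter_upwards [hY, hYD, eventually_ge_atTop 3] with N h1 h2 hN hexc Q
  have hNR : (3:ℝ) ≤ N := by exact_mod_cast hN
  have hl := log_ge_one hNR
  have hl0 : 0 < Real.log N := by linarith
  rw [div_le_one hl0] at h2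
  have hexp : Real.log N ^ B1 ≤ Real.exp (Yf B1 N) := by
    unfold Yf
    rw [Real.exp_add, Real.exp_nat_mul, Real.exp_log hl0]
    exact le_mul_of_one_le_left (by positivity) (Real.one_le_exp (by norm_num))
  have hDl := Dl_nonneg N
  calc _ ≤ ∑ p ∈ (Fam Q).filter (fun p => (p.1:ℝ) ≤ Real.log N ^ B1), (C * N * Real.log N / Real.log N ^ j + Dl N) := by
        apply Finset.sum_le_sum
        intro p hp
        rw [Finset.mem_filter, mem_Fam] at hp
        obtain ⟨⟨⟨p1, p2⟩, p3, p4⟩, p5⟩ := hp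
        have : NeZero p.1 := ⟨by omega⟩
        refine (lam_theta hNR _ (fun n => DirichletCharacter.norm_le_one _ _)).trans ?_
        have := hC N hNR p.1 p.2 (Yf B1 N) p4 h1 (p5.trans hexp) (hexc p.1 p.2 p3 p4 (p5.trans hexp))
        rw [← le_div_iff₀ (by positivity)] at this
        have h3 : C * Yf B1 N ^ D * N / Real.log N ^ j ≤ C * N * Real.log N / Real.log N ^ j := by
          apply div_le_div_of_nonneg_right _ (by positivity)
          calc C * Yf B1 N ^ D * N ≤ C * Real.log N * N := by gcongr
            _ = _ := by ring
        exact add_le_add (this.trans h3) le_rfl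
    _ ≤ _ := by
        rw [Finset.sum_const, nsmul_eq_mul]
        gcongr
        have hsub : (Fam Q).filter (fun p => (p.1:ℝ) ≤ Real.log N ^ B1) ⊆ Fam ⌊Real.log N ^ B1⌋₊ := by
          intro p hp
          rw [Finset.mem_filter, mem_Fam] at hp
          rw [mem_Fam]
          exact ⟨⟨hp.1.1.1, Nat.le_floor hp.2⟩, hp.1.2⟩
        have h4 := (Finset.card_le_card hsub).trans (card_Fam _)
        calc _ ≤ ((⌊Real.log N ^ B1⌋₊ ^ 2 : ℕ):ℝ) := by exact_mod_cast h4
          _ = (⌊Real.log N ^ B1⌋₊ : ℝ) ^ 2 := by push_cast; rfl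
          _ ≤ (Real.log N ^ B1) ^ 2 := by gcongr; exact Nat.floor_le (by positivity)
          _ = _ := by rw [← pow_mul, mul_comm]

set_option maxHeartbeats 1000000 in
lemma dist_avg (W A B : ℕ) (hW : 0 < W) : ∃ᶠ N : ℕ in atTop,
    ∑ d ∈ (Finset.Icc 1 (Rn N ^ 2)).filter (fun d => Squarefree d ∧ d.Coprime W),
      (A:ℝ) ^ d.primeFactors.card * Ed W N d ≤ N / Real.log N ^ B := by
  set b := 2 * A + B + 6 with hb
  set B1 := 2 * b with hB1
  set j := 2 * A + B + 2 * B1 + 2 with hj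
  obtain ⟨C2, hC20, hC2⟩ := fam_sw B1 j (by omega)
  obtain ⟨C1, hC10, hC1⟩ := fam_bv
  set C3 : ℝ := (((2 * A : ℕ):ℝ) + 1) ^ ((2 * A) ^ 2) * W * 2 ^ (2 * A) with hC3
  have hC30 : 0 ≤ C3 := by positivity
  have hlogt : Tendsto (fun N : ℕ => Real.log (N:ℝ)) atTop atTop := Real.tendsto_log_atTop.comp tendsto_natCast_atTop_atTop
  refine ((exc_freq B1 (by omega)).and_eventually (hC2.and ((Dl_small j).and ((eventually_ge_atTop 3).and
    ((Rn_tendsto.eventually_ge_atTop (W + 5)).and (hlogt.eventually_ge_atTop (C3 * (C2 + 1 + (C1 + 1)))))))) ).mono ?_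
  rintro N ⟨hexc, hsw, hDl, hN, hR, hlogC⟩
  obtain ⟨q1, q2, q3⟩ := Rn_Q W N hW hR
  set Q := W * Rn N ^ 2 with hQ
  have hQR : (25:ℝ) ≤ Q := by exact_mod_cast q2
  have hNR : (3:ℝ) ≤ N := by exact_mod_cast hN
  have hN0 : (0:ℝ) < N := by linarith
  set l := Real.log N with hl
  have hl1 : 1 ≤ l := log_ge_one hNR
  have hl0 : 0 < l := by linarith
  set D := (Finset.Icc 1 (Rn N ^ 2)).filter (fun d => Squarefree d ∧ d.Coprime W) with hD
  set F : DCS → ℝ := fun p => ‖Pth N (fun n => p.2 n)‖ with hF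
  have hF0 : ∀ p, 0 ≤ F p := fun p => norm_nonneg _
  have hDln := Dl_nonneg N
  have hDl' : (Q:ℝ) ^ 2 * Dl N * l ^ j ≤ N := hDl ((Q:ℝ) ^ 2) (by positivity) (by rw [← pow_mul]; exact q1)
  have hRlog : 1 + Real.log ((Rn N ^ 2 : ℕ):ℝ) ≤ 2 * l := by
    have : ((Rn N ^ 2 : ℕ):ℝ) ≤ N := by
      push_cast
      refine le_trans ?_ (Rn_pow N)
      apply pow_le_pow_right₀ _ (by norm_num)
      exact_mod_cast (by omega : 1 ≤ Rn N)
    have h2 : (0:ℝ) < ((Rn N ^ 2 : ℕ):ℝ) := by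
      have : 0 < Rn N ^ 2 := pow_pos (by omega) 2
      exact_mod_cast this
    have := Real.log_le_log h2 this
    linarith
  have hRlog0 : 0 ≤ 1 + Real.log ((Rn N ^ 2 : ℕ):ℝ) := by
    have := Real.log_natCast_nonneg (Rn N ^ 2); linarith
  have s1 : ∑ d ∈ D, (A:ℝ) ^ d.primeFactors.card * Ed W N d ≤ ∑ p ∈ Fam Q, F p * (C3 * l ^ (2 * A) / √p.1) := by
    calc _ = ∑ p ∈ Fam Q, F p * ∑ d ∈ D.filter (fun d => p.1 ∣ W * d), (A:ℝ) ^ d.primeFactors.card * (1 / (W * d).totient) := by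
          unfold Ed
          simp only [Finset.sum_filter (s := Fam _), Finset.sum_filter (s := D), Finset.mul_sum]
          rw [Finset.sum_comm]
          apply Finset.sum_congr rfl
          intro p _
          apply Finset.sum_congr rfl
          intro d _
          split_ifs
          · rw [hF]; ring
          · ring
      _ ≤ _ := by
          apply Finset.sum_le_sum
          intro p hp
          apply mul_le_mul_of_nonneg_left _ (hF0 p)
          have hp1 := (mem_Fam.1 hp).1.1
          refine (wt_sum A W p.1 (Rn N ^ 2) hW hp1).trans ?_
          calc _ ≤ (((2 * A : ℕ):ℝ) + 1) ^ ((2 * A) ^ 2) * W / √p.1 * (2 * l) ^ (2 * A) := by gcongr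
            _ = _ := by rw [hC3, mul_pow]; ring
  have hLs : √(l ^ B1) = l ^ b := by
    rw [hB1, mul_comm, pow_mul, Real.sqrt_sq (by positivity)]
  have s2 : ∑ p ∈ Fam Q, F p * (C3 * l ^ (2 * A) / √p.1) ≤
      C3 * l ^ (2 * A) * (∑ p ∈ (Fam Q).filter (fun p => (p.1:ℝ) ≤ l ^ B1), F p + (∑ p ∈ Fam Q, F p) / l ^ b) := by
    rw [mul_add, Finset.sum_filter, Finset.sum_div, Finset.mul_sum, Finset.mul_sum, ← Finset.sum_add_distrib]
    apply Finset.sum_le_sum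
    intro p hp
    have hp1 : (1:ℝ) ≤ p.1 := by exact_mod_cast (mem_Fam.1 hp).1.1
    have hsp : 1 ≤ √(p.1:ℝ) := Real.one_le_sqrt.2 hp1
    have hFp := hF0 p
    split_ifs with h
    · have : C3 * l ^ (2 * A) / √p.1 ≤ C3 * l ^ (2 * A) := div_le_self (by positivity) hsp
      have h2 : 0 ≤ C3 * l ^ (2 * A) * (F p / l ^ b) := by positivity
      nlinarith
    · push Not at h
      have h3 : l ^ b ≤ √(p.1:ℝ) := by rw [← hLs]; exact Real.sqrt_le_sqrt h.le
      calc F p * (C3 * l ^ (2 * A) / √p.1) ≤ F p * (C3 * l ^ (2 * A) / l ^ b) := by gcongr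
        _ = _ := by ring
  have s3 := hsw hexc Q
  have s4 := hC1 N hNR Q (by omega) q1
  have hQ2 : 1 ≤ (Q:ℝ) ^ 2 := by nlinarith
  have d1 : Dl N ≤ N / l ^ j := by
    rw [le_div_iff₀ (by positivity)]
    refine le_trans ?_ hDl'
    have : 0 ≤ Dl N * l ^ j := by positivity
    nlinarith
  have d2 : (Q:ℝ) ^ 2 * Dl N ≤ N * l ^ 5 := by
    have h1 : 1 ≤ l ^ j := one_le_pow₀ hl1
    have h2 : 0 ≤ (Q:ℝ) ^ 2 * Dl N := by positivity
    have h5 : 1 ≤ l ^ 5 := one_le_pow₀ hl1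
    nlinarith
  have f1 : ∑ p ∈ (Fam Q).filter (fun p => (p.1:ℝ) ≤ l ^ B1), F p ≤ (C2 + 1) * N * (l ^ (2 * B1) * l / l ^ j) := by
    refine s3.trans ?_
    calc _ ≤ l ^ (2 * B1) * (C2 * N * l / l ^ j + N * l / l ^ j) := by
          gcongr
          refine d1.trans ?_
          gcongr
          nlinarith
      _ = _ := by ring
  have f2 : (∑ p ∈ Fam Q, F p) / l ^ b ≤ (C1 + 1) * N * (l ^ 5 / l ^ b) := by
    calc _ ≤ (C1 * N * l ^ 5 + N * l ^ 5) / l ^ b := by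
          gcongr
          exact s4.trans (by linarith)
      _ = _ := by ring
  have g1 : l ^ (2 * A) * (l ^ (2 * B1) * l / l ^ j) = 1 / l ^ (B + 1) := by
    have : l ^ j = l ^ (2 * A) * l ^ (2 * B1) * l * l ^ (B + 1) := by
      rw [hj]; ring
    rw [this]; field_simp
  have g2 : l ^ (2 * A) * (l ^ 5 / l ^ b) = 1 / l ^ (B + 1) := by
    have : l ^ b = l ^ (2 * A) * l ^ 5 * l ^ (B + 1) := by
      rw [hb]; ring
    rw [this]; field_simp
  calc _ ≤ C3 * l ^ (2 * A) * ((C2 + 1) * N * (l ^ (2 * B1) * l / l ^ j) + (C1 + 1) * N * (l ^ 5 / l ^ b)) := by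
        refine (s1.trans s2).trans ?_
        gcongr
    _ = C3 * N * ((C2 + 1) * (l ^ (2 * A) * (l ^ (2 * B1) * l / l ^ j)) + (C1 + 1) * (l ^ (2 * A) * (l ^ 5 / l ^ b))) := by ring
    _ = (C3 * (C2 + 1 + (C1 + 1))) * (N / l ^ (B + 1)) := by rw [g1, g2]; ring
    _ ≤ l * (N / l ^ (B + 1)) := by gcongr
    _ = N / l ^ B := by rw [pow_succ]; field_simp

end ModPC14

section ModPA
/-- Maynard–Tao statement, in the special form used below. -/
def MTstmt (m : ℕ) : Prop :=
  ∃ k D0 : ℕ, 1 ≤ k ∧ k ≤ D0 ∧ ∀ (W v : ℕ) (h : Fin k → ℕ), 0 < W → Function.Injective h →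
    (∀ p : ℕ, p.Prime → p ≤ D0 → p ∣ W) →
    (∀ i j, i ≠ j → ∀ p : ℕ, p.Prime → (p : ℤ) ∣ (h i : ℤ) - h j → p ∣ W) →
    (∀ i, Nat.Coprime (v + h i) W) →
    ∀ n0 : ℕ, ∃ n > n0, n ≡ v [MOD W] ∧
      m ≤ (Finset.univ.filter fun i : Fin k => (n + h i).Prime).card

/-- Choice of the residue class. -/
lemma exists_good_class (k D0 q : ℕ) (a : ℤ) (hk : k ≤ D0) (hq : 3 ≤ q)
    (ha : Int.gcd a q = 1) :
    ∃ W v B : ℕ, 0 < W ∧ (∀ p : ℕ, p.Prime → p ≤ D0 → p ∣ W) ∧ q ∣ W ∧ primorial D0 ∣ W ∧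
      ((v : ℤ) ≡ a [ZMOD q]) ∧
      (∀ i < k, Nat.Coprime (v + q * primorial D0 * i) W) ∧
      (∀ n : ℕ, B < n → n ≡ v [MOD W] → ∀ b < q * primorial D0 * k,
        ¬ (q * primorial D0 ∣ b) → ¬ (n + b).Prime) := by
  classical
  set M := primorial D0 with hM
  have hMpos : 0 < M := primorial_pos D0
  set B0 := q * M * k + D0 + q with hB0
  set P : ℕ → ℕ := fun b => Nat.nth Nat.Prime (B0 + b) with hP
  have hPp : ∀ b, (P b).Prime := fun b => Nat.prime_nth_prime _
  have hPgt : ∀ b, B0 + b < P b := fun b => by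
    have := Nat.add_two_le_nth_prime (B0 + b)
    simp only [hP]; omega
  have hPinj : Function.Injective P := by
    intro b c hbc
    have := Nat.nth_injective Nat.infinite_setOfPred_prime hbc
    omega
  set Bs := (Finset.range (q * M * k)).filter (fun b => ¬ (q * M ∣ b)) with hBs
  set M' := ∏ p ∈ (Finset.range (D0 + 1)).filter (fun p => p.Prime ∧ ¬ p ∣ q), p with hM'
  have hM'prime : ∀ p : ℕ, p.Prime → p ∣ M' → p ≤ D0 ∧ ¬ p ∣ q := by
    intro p hp hd
    obtain ⟨r, hr, hpr⟩ := (Prime.dvd_finsetProd_iff hp.prime _).1 hd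
    simp only [Finset.mem_filter, Finset.mem_range] at hr
    have : p = r := (Nat.prime_dvd_prime_iff_eq hp hr.2.1).1 hpr
    subst this
    exact ⟨by omega, hr.2.2⟩
  have hqM' : Nat.Coprime q M' := by
    apply Nat.Coprime.symm
    apply Nat.coprime_of_dvd
    intro p hp h1 h2
    exact (hM'prime p hp h1).2 h2
  set PP := ∏ b ∈ Bs, P b with hPi
  have hPiprime : ∀ p : ℕ, p.Prime → p ∣ PP → ∃ b ∈ Bs, p = P b := by
    intro p hp hd
    obtain ⟨b, hb, hpb⟩ := (Prime.dvd_finsetProd_iff hp.prime _).1 hd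
    exact ⟨b, hb, (Nat.prime_dvd_prime_iff_eq hp (hPp b)).1 hpb⟩
  have hcop2 : Nat.Coprime (q * M') PP := by
    apply Nat.Coprime.symm
    apply Nat.coprime_of_dvd
    intro p hp h1 h2
    obtain ⟨b, hb, rfl⟩ := hPiprime p hp h1
    have hg := hPgt b
    rcases (hPp b).dvd_mul.1 h2 with h | h
    · have := Nat.le_of_dvd (by omega) h
      omega
    · have := (hM'prime _ hp h).1
      omega
  set a0 := (a % q).toNat with ha0
  have ha0' : (a0 : ℤ) ≡ a [ZMOD q] := by
    have h1 : (a0 : ℤ) = a % q := Int.toNat_of_nonneg (Int.emod_nonneg _ (by omega))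
    rw [h1]; exact Int.mod_modEq _ _
  obtain ⟨v1, hv1q, hv1M⟩ := Nat.chineseRemainder hqM' a0 1
  have hpair : Set.Pairwise (Bs : Set ℕ) (Function.onFun Nat.Coprime P) := by
    intro b _ c _ hbc
    exact (Nat.coprime_primes (hPp b) (hPp c)).2 (fun h => hbc (hPinj h))
  obtain ⟨v2, hv2⟩ := Nat.chineseRemainderOfFinset (fun b => P b - b) P Bs
    (fun b _ => (hPp b).ne_zero) hpair
  obtain ⟨v, hvv1, hvv2⟩ := Nat.chineseRemainder hcop2 v1 v2
  have hvq : v ≡ a0 [MOD q] := (Nat.ModEq.of_mul_right _ hvv1).trans hv1q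
  have hvM : v ≡ 1 [MOD M'] := (Nat.ModEq.of_mul_left _ hvv1).trans hv1M
  have hvb : ∀ b ∈ Bs, P b ∣ v + b := by
    intro b hb
    have h1 : v ≡ P b - b [MOD P b] :=
      (hvv2.of_dvd (Finset.dvd_prod_of_mem P hb)).trans (hv2 b hb)
    have h2 := h1.add_right b
    rw [Nat.sub_add_cancel (by have := hPgt b; omega)] at h2
    exact (Nat.modEq_zero_iff_dvd).1 (h2.trans (by simp [Nat.ModEq]))
  have hpM : ∀ p : ℕ, p.Prime → p ≤ D0 → p ∣ M := by
    intro p hp h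
    exact (hp.dvd_primorial_iff).2 h
  refine ⟨q * M * PP, v, ∑ b ∈ Bs, P b, ?_, ?_, ?_, ?_, ?_, ?_, ?_⟩
  · have : 0 < PP := Finset.prod_pos fun b _ => (hPp b).pos
    positivity
  · intro p hp h
    exact Dvd.dvd.mul_right (Dvd.dvd.mul_left (hpM p hp h) _) _
  · rw [mul_assoc]; exact dvd_mul_right _ _
  · exact Dvd.dvd.mul_right (dvd_mul_left _ _) _
  · exact ((Int.natCast_modEq_iff).2 hvq).trans ha0'
  · intro i hi
    apply Nat.coprime_of_dvd
    intro p hp h1 h2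
    have hcase : p ∣ q * M → False := by
      intro hqm
      have hpv : p ∣ v := by
        refine (Nat.dvd_add_left (Dvd.dvd.mul_right hqm i)).1 h1
      by_cases hpq : p ∣ q
      · have h3 : a0 ≡ 0 [MOD p] :=
          ((hvq.of_dvd hpq).symm).trans ((Nat.modEq_zero_iff_dvd).2 hpv)
        have h4 : p ∣ a0 := (Nat.modEq_zero_iff_dvd).1 h3
        have h5 : (p : ℤ) ∣ a := by
          have h6 : a ≡ 0 [ZMOD p] :=
            (ha0'.of_dvd (by exact_mod_cast hpq)).symm.trans
              ((Int.modEq_zero_iff_dvd).2 (by exact_mod_cast h4))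
          exact (Int.modEq_zero_iff_dvd).1 h6
        have h7 : (p : ℤ) ∣ (Int.gcd a q : ℤ) := Int.dvd_coe_gcd h5 (by exact_mod_cast hpq)
        rw [ha] at h7
        have h8 : p ∣ 1 := by exact_mod_cast h7
        exact hp.one_lt.ne' (Nat.dvd_one.1 h8)
      · have hpM2 : p ∣ M := (hp.dvd_mul.1 hqm).resolve_left hpq
        have hpD : p ≤ D0 := (hp.dvd_primorial_iff).1 hpM2
        have hpM' : p ∣ M' := by
          apply Finset.dvd_prod_of_mem (fun p => p)
          simp only [Finset.mem_filter, Finset.mem_range]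
          exact ⟨by omega, hp, hpq⟩
        have h3 : 1 ≡ 0 [MOD p] :=
          ((hvM.of_dvd hpM').symm).trans ((Nat.modEq_zero_iff_dvd).2 hpv)
        exact hp.one_lt.ne' (Nat.dvd_one.1 ((Nat.modEq_zero_iff_dvd).1 h3))
    rcases hp.dvd_mul.1 h2 with h | h
    · exact hcase h
    · obtain ⟨b, hb, rfl⟩ := hPiprime p hp h
      have hb' := hvb b hb
      have hg := hPgt b
      simp only [hBs, Finset.mem_filter, Finset.mem_range] at hb
      have hi' : q * M * i < q * M * k := by
        apply Nat.mul_lt_mul_of_pos_left hi (by positivity)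
      have hz : ((P b : ℕ) : ℤ) ∣ ((q * M * i : ℕ) : ℤ) - b := by
        have e1 : ((P b : ℕ) : ℤ) ∣ ((v + q * M * i : ℕ) : ℤ) := by exact_mod_cast h1
        have e2 : ((P b : ℕ) : ℤ) ∣ ((v + b : ℕ) : ℤ) := by exact_mod_cast hb'
        have e3 := dvd_sub e1 e2
        have e4 : ((v + q * M * i : ℕ) : ℤ) - ((v + b : ℕ) : ℤ) = ((q * M * i : ℕ) : ℤ) - b := by
          rw [Nat.cast_add, Nat.cast_add]; abel
        rwa [e4] at e3
      have hz0 := Int.eq_zero_of_abs_lt_dvd hz (by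
        rw [abs_lt]; constructor <;> omega)
      apply hb.2
      have : b = q * M * i := by omega
      rw [this]; exact dvd_mul_right _ _
  · intro n hn hnv b hb hnb hprime
    have hbB : b ∈ Bs := by simp only [hBs, Finset.mem_filter, Finset.mem_range]; exact ⟨hb, hnb⟩
    have h1 : P b ∣ n + b := by
      have h2 : n + b ≡ v + b [MOD P b] :=
        (hnv.of_dvd (Dvd.dvd.mul_left (Finset.dvd_prod_of_mem P hbB) _)).add_right b
      exact (Nat.modEq_zero_iff_dvd).1 (h2.trans ((Nat.modEq_zero_iff_dvd).2 (hvb b hbB)))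
    have h2 : P b = n + b := (Nat.prime_dvd_prime_iff_eq (hPp b) hprime).1 h1
    have h3 : P b ≤ ∑ b ∈ Bs, P b := Finset.single_le_sum (fun _ _ => Nat.zero_le _) hbB
    omega

theorem shiu_of_MT (hMT : ∀ m : ℕ, 2 ≤ m → MTstmt m) :
    ∃ A N : ℝ, 0 < A ∧ 0 < N ∧
      ∀ m : ℕ, 2 ≤ m → ∃ k : ℕ,
        ∀ (q : ℕ) (a : ℤ), 3 ≤ q → Int.gcd a q = 1 →
          {n : ℕ |
            (∀ i < m, ((Nat.nth Nat.Prime (n + i) : ℤ) ≡ a [ZMOD (q : ℤ)])) ∧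
            ((Nat.nth Nat.Prime (n + m - 1) : ℝ) - (Nat.nth Nat.Prime n : ℝ)) <
              A * (q : ℝ) ^ N * (k : ℝ) ^ 2 * Real.log (q * k)}.Infinite := by
  classical
  refine ⟨1, 1, one_pos, one_pos, fun m hm => ?_⟩
  obtain ⟨k, D0, hk1, hkD, H⟩ := hMT m hm
  refine ⟨primorial D0 * k + 3, fun q a hq ha => ?_⟩
  obtain ⟨W, v, B, hW, hpW, hqW, hMW, hva, hcop, hcomp⟩ :=
    exists_good_class k D0 q a hkD hq ha
  set M := primorial D0 with hM
  have hMpos : 0 < M := primorial_pos D0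
  apply Set.infinite_of_forall_exists_gt
  intro N0
  obtain ⟨n, hn, hnv, hcard⟩ := H W v (fun i => q * M * i) hW
    (by
      intro i j hij
      have : q * M ≠ 0 := by positivity
      exact Fin.ext (Nat.eq_of_mul_eq_mul_left (Nat.pos_of_ne_zero this) hij)) hpW
    (by
      intro i j hij p hp hd
      have h1 : (p : ℤ) ∣ ((q * M : ℕ) : ℤ) * ((i : ℤ) - j) := by
        convert hd using 1; push_cast; ring
      rcases (Nat.prime_iff_prime_int.1 hp).dvd_mul.1 h1 with h | h
      · have h2 : p ∣ q * M := by exact_mod_cast h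
        rcases hp.dvd_mul.1 h2 with h3 | h3
        · exact h3.trans hqW
        · exact h3.trans hMW
      · apply hpW p hp
        by_contra hlt
        have := Int.eq_zero_of_abs_lt_dvd h (by
          rw [abs_lt]
          have := i.2; have := j.2
          constructor <;> omega)
        apply hij; apply Fin.ext; omega)
    (fun i => hcop i i.2) (B + Nat.nth Nat.Prime (N0 + 1))
  have hBn : B < n := by omega
  set j := Nat.count Nat.Prime n with hj
  have hkey : ∀ b < q * M * k, (n + b).Prime → (((n + b : ℕ) : ℤ) ≡ a [ZMOD q]) := by
    intro b hb hpr
    have hdiv : q * M ∣ b := by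
      by_contra hnd
      exact hcomp n hBn hnv b hb hnd hpr
    have h1 : n + b ≡ v + 0 [MOD q] := by
      apply Nat.ModEq.add (hnv.of_dvd hqW)
      exact (Nat.modEq_zero_iff_dvd).2 ((dvd_mul_right q M).trans hdiv)
    exact ((Int.natCast_modEq_iff).2 h1).trans (by simpa using hva)
  have hcount : j + m ≤ Nat.count Nat.Prime (n + q * M * k) := by
    rw [Nat.count_add, Nat.count_eq_card_filter_range (fun x => (n + x).Prime)]
    refine Nat.add_le_add_left (hcard.trans ?_) _
    refine Finset.card_le_card_of_injOn (fun i : Fin k => q * M * (i : ℕ)) ?_ ?_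
    · intro i hi
      simp only [Finset.coe_filter, Set.mem_ofPred_eq, Finset.mem_univ, true_and,
        Finset.mem_range] at hi ⊢
      exact ⟨Nat.mul_lt_mul_of_pos_left i.2 (by positivity), hi⟩
    · intro i _ i' _ hij
      exact Fin.ext (Nat.eq_of_mul_eq_mul_left (by positivity) hij)
  have hlt : ∀ i < m, Nat.nth Nat.Prime (j + i) < n + q * M * k := by
    intro i hi
    apply Nat.nth_lt_of_lt_count
    omega
  have hge : ∀ i, n ≤ Nat.nth Nat.Prime (j + i) := by
    intro i
    refine (Nat.count_le_iff_le_nth Nat.infinite_setOfPred_prime).1 ?_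
    change j ≤ j + i
    omega
  refine ⟨j, ⟨?_, ?_⟩, ?_⟩
  · intro i hi
    obtain ⟨b, hb⟩ := Nat.exists_eq_add_of_le (hge i)
    have hl := hlt i hi
    have hp := Nat.prime_nth_prime (j + i)
    rw [hb] at hl hp ⊢
    exact hkey b (by omega) hp
  · have h1 := hlt (m - 1) (by omega)
    have h2 := hge 0
    rw [add_zero] at h2
    rw [show j + (m - 1) = j + m - 1 by omega] at h1
    have h3 : (Nat.nth Nat.Prime (j + m - 1) : ℝ) < n + q * M * k := by exact_mod_cast h1
    have h4 : (n : ℝ) ≤ Nat.nth Nat.Prime j := by exact_mod_cast h2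
    have hq' : (3 : ℝ) ≤ q := by exact_mod_cast hq
    have hMk : (0 : ℝ) ≤ (M : ℝ) * k := by positivity
    have hlog : 1 ≤ Real.log (q * ((M * k + 3 : ℕ) : ℝ)) := by
      rw [Real.le_log_iff_exp_le (by positivity)]
      have := Real.exp_one_lt_d9
      push_cast
      nlinarith
    have h5 : (q : ℝ) * M * k ≤ 1 * (q : ℝ) ^ (1 : ℝ) * ((M * k + 3 : ℕ) : ℝ) ^ 2 *
        Real.log (q * ((M * k + 3 : ℕ) : ℝ)) := by
      rw [Real.rpow_one]
      have h6 : (q : ℝ) * M * k ≤ 1 * (q : ℝ) * ((M * k + 3 : ℕ) : ℝ) ^ 2 := by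
        push_cast
        nlinarith [mul_nonneg (by positivity : (0:ℝ) ≤ q) hMk, mul_nonneg (by positivity : (0:ℝ) ≤ q) (mul_nonneg hMk hMk)]
      calc (q : ℝ) * M * k ≤ 1 * (q : ℝ) * ((M * k + 3 : ℕ) : ℝ) ^ 2 := h6
        _ ≤ _ := le_mul_of_one_le_right (by positivity) hlog
    linarith
  · have h1 : N0 + 1 ≤ j := by
      by_contra hc
      have h2 : Nat.nth Nat.Prime j ≤ Nat.nth Nat.Prime (N0 + 1) :=
        Nat.nth_monotone Nat.infinite_setOfPred_prime (by omega)
      have h3 := hge 0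
      rw [add_zero] at h3
      omega
    omega

end ModPA

section ModPB1
/-- tensor product of inequalities between sums of squares, indexed by `Fin n` -/
lemma tensor_fin {O : Type} [Fintype O] : ∀ (n : ℕ) (α1 α2 : Fin n → O → ℝ) (L1 L2 : Fin n → O → O → ℝ),
    (∀ p t, 0 ≤ α1 p t) → (∀ p t, 0 ≤ α2 p t) →
    (∀ p (x : O → ℝ), ∑ t, α1 p t * (∑ j, L1 p t j * x j) ^ 2 ≤ ∑ t, α2 p t * (∑ j, L2 p t j * x j) ^ 2) →
    ∀ c : (Fin n → O) → ℝ,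
    ∑ τ : Fin n → O, (∏ p, α1 p (τ p)) * (∑ ρ : Fin n → O, (∏ p, L1 p (τ p) (ρ p)) * c ρ) ^ 2 ≤
    ∑ τ : Fin n → O, (∏ p, α2 p (τ p)) * (∑ ρ : Fin n → O, (∏ p, L2 p (τ p) (ρ p)) * c ρ) ^ 2 := by
  intro n
  induction n with
  | zero => intro α1 α2 L1 L2 _ _ _ c; simp
  | succ n ih =>
    intro α1 α2 L1 L2 h1 h2 h c
    have split : ∀ F : (Fin (n+1) → O) → ℝ, ∑ τ, F τ = ∑ t : O, ∑ τ : Fin n → O, F (Fin.cons t τ) := by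
      intro F
      rw [← Fintype.sum_prod_type']
      exact (Fintype.sum_equiv (Fin.consEquiv (fun _ => O)) _ _ (fun x => rfl)).symm
    simp_rw [split, Fin.prod_univ_succ, Fin.cons_zero, Fin.cons_succ]
    have e1 : ∀ (L : Fin (n+1) → O → O → ℝ) (t : O) (τ : Fin n → O),
        ∑ j : O, ∑ ρ : Fin n → O, L 0 t j * (∏ p : Fin n, L p.succ (τ p) (ρ p)) * c (Fin.cons j ρ) =
        ∑ ρ : Fin n → O, (∏ p : Fin n, L p.succ (τ p) (ρ p)) * (∑ j : O, L 0 t j * c (Fin.cons j ρ)) := by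
      intro L t τ
      rw [Finset.sum_comm]
      refine Finset.sum_congr rfl fun ρ _ => ?_
      rw [Finset.mul_sum]
      exact Finset.sum_congr rfl fun j _ => by ring
    have e2 : ∀ (La Lb : Fin (n+1) → O → O → ℝ) (t : O) (τ : Fin n → O),
        ∑ ρ : Fin n → O, (∏ p : Fin n, Lb p.succ (τ p) (ρ p)) * (∑ j : O, La 0 t j * c (Fin.cons j ρ)) =
        ∑ j : O, La 0 t j * ∑ ρ : Fin n → O, (∏ p : Fin n, Lb p.succ (τ p) (ρ p)) * c (Fin.cons j ρ) := by
      intro La Lb t τ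
      simp_rw [Finset.mul_sum]
      rw [Finset.sum_comm]
      exact Finset.sum_congr rfl fun j _ => Finset.sum_congr rfl fun ρ _ => by ring
    simp_rw [e1]
    calc _ = ∑ t : O, α1 0 t * ∑ τ : Fin n → O, (∏ p : Fin n, α1 p.succ (τ p)) *
          (∑ ρ : Fin n → O, (∏ p : Fin n, L1 p.succ (τ p) (ρ p)) * (∑ j : O, L1 0 t j * c (Fin.cons j ρ))) ^ 2 := by
          refine Finset.sum_congr rfl fun t _ => ?_
          rw [Finset.mul_sum]
          exact Finset.sum_congr rfl fun τ _ => by ring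
      _ ≤ ∑ t : O, α1 0 t * ∑ τ : Fin n → O, (∏ p : Fin n, α2 p.succ (τ p)) *
          (∑ ρ : Fin n → O, (∏ p : Fin n, L2 p.succ (τ p) (ρ p)) * (∑ j : O, L1 0 t j * c (Fin.cons j ρ))) ^ 2 := by
          refine Finset.sum_le_sum fun t _ => mul_le_mul_of_nonneg_left ?_ (h1 0 t)
          exact ih (fun p => α1 p.succ) (fun p => α2 p.succ) (fun p => L1 p.succ) (fun p => L2 p.succ)
            (fun p t => h1 _ t) (fun p t => h2 _ t) (fun p x => h _ x) _
      _ = ∑ τ : Fin n → O, (∏ p : Fin n, α2 p.succ (τ p)) * ∑ t : O, α1 0 t *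
          (∑ j : O, L1 0 t j * ∑ ρ : Fin n → O, (∏ p : Fin n, L2 p.succ (τ p) (ρ p)) * c (Fin.cons j ρ)) ^ 2 := by
          rw [Finset.sum_congr rfl fun t _ => Finset.mul_sum _ _ _, Finset.sum_comm]
          refine Finset.sum_congr rfl fun τ _ => ?_
          rw [Finset.mul_sum]
          refine Finset.sum_congr rfl fun t _ => ?_
          rw [e2 L1 L2]; ring
      _ ≤ ∑ τ : Fin n → O, (∏ p : Fin n, α2 p.succ (τ p)) * ∑ t : O, α2 0 t *
          (∑ j : O, L2 0 t j * ∑ ρ : Fin n → O, (∏ p : Fin n, L2 p.succ (τ p) (ρ p)) * c (Fin.cons j ρ)) ^ 2 := by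
          refine Finset.sum_le_sum fun τ _ => mul_le_mul_of_nonneg_left (h 0 _) ?_
          exact Finset.prod_nonneg fun p _ => h2 _ _
      _ = _ := by
          rw [Finset.sum_comm]
          refine Finset.sum_congr rfl fun τ _ => ?_
          rw [Finset.mul_sum]
          refine Finset.sum_congr rfl fun t _ => ?_
          rw [e2 L2 L2]; ring

lemma tensor {ι O : Type} [Fintype ι] [DecidableEq ι] [Fintype O] (α1 α2 : ι → O → ℝ) (L1 L2 : ι → O → O → ℝ)
    (h1 : ∀ p t, 0 ≤ α1 p t) (h2 : ∀ p t, 0 ≤ α2 p t)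
    (h : ∀ p (x : O → ℝ), ∑ t, α1 p t * (∑ j, L1 p t j * x j) ^ 2 ≤ ∑ t, α2 p t * (∑ j, L2 p t j * x j) ^ 2)
    (c : (ι → O) → ℝ) :
    ∑ τ : ι → O, (∏ p, α1 p (τ p)) * (∑ ρ : ι → O, (∏ p, L1 p (τ p) (ρ p)) * c ρ) ^ 2 ≤
    ∑ τ : ι → O, (∏ p, α2 p (τ p)) * (∑ ρ : ι → O, (∏ p, L2 p (τ p) (ρ p)) * c ρ) ^ 2 := by
  have e := Fintype.equivFin ι
  have key := tensor_fin (Fintype.card ι) (fun p => α1 (e.symm p)) (fun p => α2 (e.symm p)) (fun p => L1 (e.symm p)) (fun p => L2 (e.symm p))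
    (fun p t => h1 _ t) (fun p t => h2 _ t) (fun p x => h _ x) (fun ρ => c (fun i => ρ (e i)))
  have tr : ∀ (α : ι → O → ℝ) (L : ι → O → O → ℝ),
      ∑ τ : ι → O, (∏ p, α p (τ p)) * (∑ ρ : ι → O, (∏ p, L p (τ p) (ρ p)) * c ρ) ^ 2 =
      ∑ τ : Fin (Fintype.card ι) → O, (∏ p, α (e.symm p) (τ p)) *
        (∑ ρ : Fin (Fintype.card ι) → O, (∏ p, L (e.symm p) (τ p) (ρ p)) * c (fun i => ρ (e i))) ^ 2 := by
    intro α L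
    refine Fintype.sum_equiv (Equiv.arrowCongr e (Equiv.refl O)) _ _ fun τ => ?_
    congr 1
    · refine Fintype.prod_equiv e _ _ fun p => ?_
      simp
    · congr 1
      refine Fintype.sum_equiv (Equiv.arrowCongr e (Equiv.refl O)) _ _ fun ρ => ?_
      congr 1
      · refine Fintype.prod_equiv e _ _ fun p => ?_
        simp
      · simp
  rw [tr, tr]
  exact key

section sieve
variable {k : ℕ}

noncomputable def bb (a : ℝ) (j o : Option (Fin k)) : ℝ :=
  match j with
  | none => 1
  | some i => (if o = some i then 1 else 0) - 1 / a

noncomputable def pi1 (k : ℕ) (a : ℝ) (o : Option (Fin k)) : ℝ :=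
  match o with
  | none => 1 - k / a
  | some _ => 1 / a

noncomputable def pi2 (k : ℕ) (a : ℝ) (m : Fin k) (o : Option (Fin k)) : ℝ :=
  match o with
  | none => 1 - (k - 1) / (a - 1)
  | some i => if i = m then 0 else 1 / (a - 1)

noncomputable def al2 (k : ℕ) (a : ℝ) (m : Fin k) (o : Option (Fin k)) : ℝ :=
  match o with
  | none => 1 - 1 / a ^ 2
  | some i => if i = m then 0 else 1 / (a - 1) * (1 - 2 * k / (a - 1))

noncomputable def ll2 (a : ℝ) (m : Fin k) (t j : Option (Fin k)) : ℝ :=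
  match t with
  | none => (match j with | none => 1 | some i => if i = m then - 1 / a else 0)
  | some _ => if j = t then 1 else 0

lemma single1 (a : ℝ) (ha : 0 < a) (x : Option (Fin k) → ℝ) :
    ∑ o, pi1 k a o * (∑ j, bb a j o * x j) ^ 2 ≤
    ∑ o, (match o with | none => (1:ℝ) | some _ => 1 / a) * (∑ j, (if j = o then 1 else 0) * x j) ^ 2 := by
  simp only [Fintype.sum_option, pi1, bb, ite_mul, one_mul, zero_mul, Finset.sum_ite_eq', Finset.sum_ite_eq,
    Finset.mem_univ, if_true, Option.some.injEq, reduceCtorEq, if_false, Finset.sum_const_zero, zero_add, add_zero, sub_mul,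
    Finset.sum_sub_distrib, zero_sub]
  have hs : ∑ i : Fin k, 1 / a * x (some i) = 1 / a * ∑ i : Fin k, x (some i) := by rw [Finset.mul_sum]
  simp only [hs, Finset.sum_neg_distrib]
  generalize hS : ∑ i : Fin k, x (some i) = s
  generalize x none = y
  have e1 : ∑ i : Fin k, 1 / a * (y + (x (some i) - 1 / a * s)) ^ 2 =
      1 / a * (k * (y - 1 / a * s) ^ 2 + 2 * (y - 1 / a * s) * s + ∑ i : Fin k, x (some i) ^ 2) := by
    have : ∀ i : Fin k, 1 / a * (y + (x (some i) - 1 / a * s)) ^ 2 =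
      1 / a * (y - 1 / a * s) ^ 2 + 1 / a * (2 * (y - 1 / a * s)) * x (some i) + 1 / a * x (some i) ^ 2 := fun i => by ring
    rw [Finset.sum_congr rfl fun i _ => this i]
    rw [Finset.sum_add_distrib, Finset.sum_add_distrib, ← Finset.mul_sum, ← Finset.mul_sum, ← Finset.mul_sum, Finset.sum_const, Finset.card_univ, Fintype.card_fin, nsmul_eq_mul, hS]
    ring
  rw [e1, ← Finset.mul_sum]
  generalize ∑ i : Fin k, x (some i) ^ 2 = q
  have : y ^ 2 + 1 / a * q - ((1 - k / a) * (y + -(1 / a * s)) ^ 2 + 1 / a * (k * (y - 1 / a * s) ^ 2 + 2 * (y - 1 / a * s) * s + q)) = (1 / a * s) ^ 2 := by ring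
  have h2 : 0 ≤ (1 / a * s) ^ 2 := sq_nonneg _
  linarith

lemma single2 (a : ℝ) (m : Fin k) (ha : 2 < a) (x : Option (Fin k) → ℝ) :
    ∑ o, al2 k a m o * (∑ j, ll2 a m o j * x j) ^ 2 ≤ ∑ o, pi2 k a m o * (∑ j, bb a j o * x j) ^ 2 := by
  simp only [Fintype.sum_option, pi2, bb, al2, ll2, ite_mul, one_mul, zero_mul, Finset.sum_ite_eq', Finset.sum_ite_eq,
    Finset.mem_univ, if_true, Option.some.injEq, reduceCtorEq, if_false, Finset.sum_const_zero, zero_add, add_zero, sub_mul,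
    Finset.sum_sub_distrib, zero_sub]
  have hs : ∑ i : Fin k, 1 / a * x (some i) = 1 / a * ∑ i : Fin k, x (some i) := by rw [Finset.mul_sum]
  simp only [hs, Finset.sum_neg_distrib]
  set y := x none
  set xm := x (some m)
  set s := ∑ i ∈ Finset.univ.erase m, x (some i)
  set q := ∑ i ∈ Finset.univ.erase m, x (some i) ^ 2
  have hsum : ∑ i : Fin k, x (some i) = xm + s := (Finset.add_sum_erase _ _ (Finset.mem_univ m)).symm
  have hcard : ((Finset.univ.erase m).card : ℝ) = k - 1 := by
    rw [Finset.card_erase_of_mem (Finset.mem_univ m), Finset.card_univ, Fintype.card_fin, Nat.cast_sub, Nat.cast_one]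
    exact Fin.pos m
  have hk : (1:ℝ) ≤ k := by exact_mod_cast Fin.pos m
  have drop : ∀ g : Fin k → ℝ, ∑ i : Fin k, (if i = m then 0 else g i) = ∑ i ∈ Finset.univ.erase m, g i := by
    intro g
    rw [← Finset.add_sum_erase _ _ (Finset.mem_univ m), if_pos rfl, zero_add]
    exact Finset.sum_congr rfl fun i hi => if_neg (Finset.ne_of_mem_erase hi)
  rw [drop, drop, hsum]
  set z := y - 1 / a * (xm + s) with hz
  have e1 : ∑ i ∈ Finset.univ.erase m, 1 / (a - 1) * (y + (x (some i) - 1 / a * (xm + s))) ^ 2 =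
      1 / (a - 1) * ((k - 1) * z ^ 2 + 2 * z * s + q) := by
    have : ∀ i : Fin k, 1 / (a - 1) * (y + (x (some i) - 1 / a * (xm + s))) ^ 2 =
      1 / (a - 1) * z ^ 2 + 1 / (a - 1) * (2 * z) * x (some i) + 1 / (a - 1) * x (some i) ^ 2 := fun i => by rw [hz]; ring
    rw [Finset.sum_congr rfl fun i _ => this i]
    rw [Finset.sum_add_distrib, Finset.sum_add_distrib, ← Finset.mul_sum, ← Finset.mul_sum, ← Finset.mul_sum, Finset.sum_const, nsmul_eq_mul, hcard]
    change _ + 1 / (a - 1) * (2 * z) * s + 1 / (a - 1) * q = _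
    ring
  have e2 : ∑ i ∈ Finset.univ.erase m, 1 / (a - 1) * (1 - 2 * k / (a - 1)) * x (some i) ^ 2 = 1 / (a - 1) * (1 - 2 * k / (a - 1)) * q := by
    rw [← Finset.mul_sum]
  have hcs : s ^ 2 ≤ (k - 1) * q := by
    have := sq_sum_le_card_mul_sum_sq (s := Finset.univ.erase m) (f := fun i => x (some i))
    rwa [hcard] at this
  have hyz : y + -(1 / a * (xm + s)) = z := by rw [hz]; ring
  rw [e1, e2, hyz]
  have ha1 : 0 < a - 1 := by linarith
  have ha0 : 0 < a := by linarith
  have hB : (y - xm / a + s / (a * (a - 1))) ^ 2 ≥ (1 - 1 / a ^ 2) * (y - xm / a) ^ 2 - (a ^ 2 - 1) * (s / (a * (a - 1))) ^ 2 := by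
    have h := sq_nonneg ((y - xm / a) / a + a * (s / (a * (a - 1))))
    have e : (y - xm / a + s / (a * (a - 1))) ^ 2 - ((1 - 1 / a ^ 2) * (y - xm / a) ^ 2 - (a ^ 2 - 1) * (s / (a * (a - 1))) ^ 2) = ((y - xm / a) / a + a * (s / (a * (a - 1)))) ^ 2 := by
      field_simp
      ring
    linarith
  have hz2 : z ^ 2 + 2 * z * s / (a - 1) = (y - xm / a + s / (a * (a - 1))) ^ 2 - s ^ 2 / (a - 1) ^ 2 := by
    rw [hz]; field_simp; ring
  have hb2 : (a ^ 2 - 1) * (s / (a * (a - 1))) ^ 2 ≤ s ^ 2 / (a - 1) ^ 2 := by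
    have : (a ^ 2 - 1) * (s / (a * (a - 1))) ^ 2 = s ^ 2 / (a - 1) ^ 2 - (s / (a * (a - 1))) ^ 2 := by
      field_simp
    rw [this]
    linarith [sq_nonneg (s / (a * (a - 1)))]
  have hq0 : 0 ≤ q := Finset.sum_nonneg fun i _ => sq_nonneg _
  have hsq : s ^ 2 / (a - 1) ^ 2 ≤ k * q / (a - 1) ^ 2 := by
    gcongr
    nlinarith
  have er : z ^ 2 - ((k:ℝ) - 1) / (a - 1) * z ^ 2 + 1 / (a - 1) * ((k - 1) * z ^ 2 + 2 * z * s + q) = (z ^ 2 + 2 * z * s / (a - 1)) + q / (a - 1) := by ring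
  have el : 1 / (a - 1) * (1 - 2 * k / (a - 1)) * q = q / (a - 1) - 2 * (k * q / (a - 1) ^ 2) := by
    field_simp
  have el2 : y + -1 / a * xm = y - xm / a := by ring
  rw [er, el, el2, hz2]
  linarith

end sieve

end ModPB1

section ModPB2
lemma one_sub_sum_le_prod {ι : Type} (s : Finset ι) (x : ι → ℝ) (h0 : ∀ i ∈ s, 0 ≤ x i) (h1 : ∀ i ∈ s, x i ≤ 1) :
    1 - ∑ i ∈ s, x i ≤ ∏ i ∈ s, (1 - x i) := by
  classical
  induction s using Finset.induction_on with
  | empty => simp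
  | insert i s hi ih =>
    rw [Finset.sum_insert hi, Finset.prod_insert hi]
    have ih := ih (fun j hj => h0 j (Finset.mem_insert_of_mem hj)) (fun j hj => h1 j (Finset.mem_insert_of_mem hj))
    have a0 := h0 i (Finset.mem_insert_self _ _)
    have a1 := h1 i (Finset.mem_insert_self _ _)
    have hp : ∏ j ∈ s, (1 - x j) ≤ 1 := by
      refine Finset.prod_le_one (fun j hj => ?_) (fun j hj => ?_)
      · linarith [h1 j (Finset.mem_insert_of_mem hj)]
      · linarith [h0 j (Finset.mem_insert_of_mem hj)]
    nlinarith

/-- a non-increasing weight times a multiplicative one: the mass of sets containing `p` -/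
lemma mono_sum {ι : Type} [Fintype ι] [DecidableEq ι] (G : Finset ι → ℝ) (g : ι → ℝ) (hG : ∀ U, 0 ≤ G U)
    (hmono : ∀ U V : Finset ι, U ⊆ V → G V ≤ G U) (hg : ∀ p, 0 ≤ g p) (p : ι) :
    ∑ U : Finset ι with p ∈ U, G U * ∏ q ∈ U, g q ≤ g p * ∑ U : Finset ι, G U * ∏ q ∈ U, g q := by
  calc ∑ U : Finset ι with p ∈ U, G U * ∏ q ∈ U, g q
      ≤ ∑ U : Finset ι with p ∈ U, g p * (G (U.erase p) * ∏ q ∈ U.erase p, g q) := by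
        refine Finset.sum_le_sum fun U hU => ?_
        have hp : p ∈ U := (Finset.mem_filter.1 hU).2
        rw [← Finset.mul_prod_erase U g hp]
        have := hmono (U.erase p) U (Finset.erase_subset _ _)
        have h2 : 0 ≤ g p * ∏ q ∈ U.erase p, g q := mul_nonneg (hg p) (Finset.prod_nonneg fun q _ => hg q)
        calc _ ≤ G (U.erase p) * (g p * ∏ q ∈ U.erase p, g q) := mul_le_mul_of_nonneg_right this h2
          _ = _ := by ring
    _ = g p * ∑ U : Finset ι with p ∈ U, (G (U.erase p) * ∏ q ∈ U.erase p, g q) := by rw [Finset.mul_sum]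
    _ ≤ _ := by
        refine mul_le_mul_of_nonneg_left ?_ (hg p)
        rw [← Finset.sum_image (s := Finset.univ.filter fun U : Finset ι => p ∈ U) (g := fun U => U.erase p) (f := fun U => G U * ∏ q ∈ U, g q)]
        · exact Finset.sum_le_sum_of_subset_of_nonneg (Finset.subset_univ _) fun U _ _ => mul_nonneg (hG U) (Finset.prod_nonneg fun q _ => hg q)
        · intro U hU V hV h
          have hU : p ∈ U := by simpa using hU
          have hV : p ∈ V := by simpa using hV
          rw [← Finset.insert_erase hU, ← Finset.insert_erase hV]
          simp only at h
          rw [h]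

lemma tuple_sum {k : ℕ} {Y : Type} [Fintype Y] [DecidableEq Y] (ν : Fin k → Y → ℝ) :
    ∑ V : Fin k → Y, ∏ i, ν i (V i) = ∏ i, ∑ y, ν i y := by
  rw [Finset.prod_univ_sum, Fintype.piFinset_univ]

lemma disj {k : ℕ} {ι : Type} [Fintype ι] [DecidableEq ι] (ν : Fin k → Finset ι → ℝ) (hν : ∀ i V, 0 ≤ ν i V)
    (P : ι → ℝ) (hP0 : ∀ p, 0 ≤ P p) (hP : ∀ i p, ∑ V : Finset ι with p ∈ V, ν i V ≤ P p * ∑ V, ν i V)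
    (lin : Finset ι → ℝ) (η : ℝ) (hlin : ∀ i, ∑ V, ν i V * lin V ≤ η * ∑ V, ν i V) :
    (∏ i, ∑ V, ν i V) * (1 - k * η - k ^ 2 * ∑ p, P p ^ 2) ≤
    ∑ V : Fin k → Finset ι, (∏ i, ν i (V i)) * (1 - ∑ i, lin (V i) - ∑ ij ∈ (Finset.univ : Finset (Fin k)).offDiag, ((V ij.1 ∩ V ij.2).card : ℝ)) := by
  have hS0 : ∀ i, 0 ≤ ∑ V, ν i V := fun i => Finset.sum_nonneg fun V _ => hν i V
  have hlin' : ∀ i, ∑ V : Fin k → Finset ι, (∏ j, ν j (V j)) * lin (V i) ≤ (∏ j, ∑ V, ν j V) * η := by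
    intro i
    have e : ∀ V : Fin k → Finset ι, (∏ j, ν j (V j)) * lin (V i) = ∏ j, (ν j (V j) * if j = i then lin (V j) else 1) := by
      intro V
      rw [Finset.prod_mul_distrib, Finset.prod_ite_eq' Finset.univ i (fun j => lin (V j)), if_pos (Finset.mem_univ _)]
    simp_rw [e]
    rw [tuple_sum (fun j U => ν j U * if j = i then lin U else 1), ← Finset.mul_prod_erase _ _ (Finset.mem_univ i),
      ← Finset.mul_prod_erase _ (fun j => ∑ V, ν j V) (Finset.mem_univ i)]
    have e2 : ∏ j ∈ Finset.univ.erase i, ∑ U, (ν j U * if j = i then lin U else 1) = ∏ j ∈ Finset.univ.erase i, ∑ U, ν j U := by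
      refine Finset.prod_congr rfl fun j hj => ?_
      simp [Finset.ne_of_mem_erase hj]
    rw [e2]
    simp only [if_true]
    have h3 : 0 ≤ ∏ j ∈ Finset.univ.erase i, ∑ U, ν j U := Finset.prod_nonneg fun j _ => hS0 j
    calc _ ≤ (η * ∑ V, ν i V) * ∏ j ∈ Finset.univ.erase i, ∑ U, ν j U := mul_le_mul_of_nonneg_right (hlin i) h3
      _ = _ := by ring
  have hpair : ∀ i j : Fin k, i ≠ j → ∑ V : Fin k → Finset ι, (∏ l, ν l (V l)) * ((V i ∩ V j).card : ℝ) ≤ (∏ j, ∑ V, ν j V) * ∑ p, P p ^ 2 := by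
    intro i j hij
    have e : ∀ V : Fin k → Finset ι, (∏ l, ν l (V l)) * ((V i ∩ V j).card : ℝ) = ∑ p, ∏ l, (ν l (V l) * if l = i ∨ l = j then (if p ∈ V l then 1 else 0) else 1) := by
      intro V
      have : ((V i ∩ V j).card : ℝ) = ∑ p, ∏ l, (if l = i ∨ l = j then (if p ∈ V l then (1:ℝ) else 0) else 1) := by
        rw [Finset.card_eq_sum_ones, Nat.cast_sum, ← Finset.sum_filter_add_sum_filter_not Finset.univ (fun p => p ∈ V i ∩ V j)]
        rw [Finset.sum_eq_zero (s := Finset.univ.filter fun p => ¬ p ∈ V i ∩ V j), add_zero]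
        · have : Finset.univ.filter (fun p => p ∈ V i ∩ V j) = V i ∩ V j := by ext; simp
          rw [this]
          refine Finset.sum_congr rfl fun p hp => ?_
          rw [Finset.prod_eq_one]
          · simp
          · intro l _
            rw [Finset.mem_inter] at hp
            split_ifs with h1 h2
            · rfl
            · rcases h1 with rfl | rfl
              · exact absurd hp.1 h2
              · exact absurd hp.2 h2
            · rfl
        · intro p hp
          have hp := (Finset.mem_filter.1 hp).2
          rw [Finset.mem_inter, not_and_or] at hp
          rcases hp with hp | hp
          · exact Finset.prod_eq_zero (Finset.mem_univ i) (by simp [hp])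
          · exact Finset.prod_eq_zero (Finset.mem_univ j) (by simp [hp])
      rw [this, Finset.mul_sum]
      exact Finset.sum_congr rfl fun p _ => Finset.prod_mul_distrib.symm
    simp_rw [e]
    rw [Finset.sum_comm, Finset.mul_sum]
    refine Finset.sum_le_sum fun p _ => ?_
    rw [tuple_sum (fun l U => ν l U * if l = i ∨ l = j then (if p ∈ U then 1 else 0) else 1)]
    calc _ ≤ ∏ l, ((∑ V, ν l V) * if l = i ∨ l = j then P p else 1) := by
          refine Finset.prod_le_prod (fun l _ => Finset.sum_nonneg fun U _ => mul_nonneg (hν _ _) (by split_ifs <;> norm_num)) (fun l _ => ?_)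
          split_ifs with h
          · simp_rw [mul_ite, mul_one, mul_zero]
            rw [← Finset.sum_filter, mul_comm]
            exact hP l p
          · simp
      _ = _ := by
          rw [Finset.prod_mul_distrib]
          congr 1
          rw [Finset.prod_ite, Finset.prod_const, Finset.prod_const_one, mul_one]
          congr 1
          have : Finset.univ.filter (fun l : Fin k => l = i ∨ l = j) = {i, j} := by ext; simp
          rw [this, Finset.card_pair hij]
  have hall : ∀ V : Fin k → Finset ι, (∏ i, ν i (V i)) * (1 - ∑ i, lin (V i) - ∑ ij ∈ (Finset.univ : Finset (Fin k)).offDiag, ((V ij.1 ∩ V ij.2).card : ℝ)) =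
      (∏ i, ν i (V i)) - ∑ i, (∏ j, ν j (V j)) * lin (V i) - ∑ ij ∈ (Finset.univ : Finset (Fin k)).offDiag, (∏ j, ν j (V j)) * ((V ij.1 ∩ V ij.2).card : ℝ) := by
    intro V
    rw [← Finset.mul_sum, ← Finset.mul_sum]; ring
  simp_rw [hall]
  rw [Finset.sum_sub_distrib, Finset.sum_sub_distrib, tuple_sum, Finset.sum_comm, Finset.sum_comm (s := Finset.univ) (t := Finset.offDiag _)]
  have h1 : ∑ i : Fin k, ∑ V : Fin k → Finset ι, (∏ j, ν j (V j)) * lin (V i) ≤ k * ((∏ j, ∑ V, ν j V) * η) := by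
    calc _ ≤ ∑ i : Fin k, (∏ j, ∑ V, ν j V) * η := Finset.sum_le_sum fun i _ => hlin' i
      _ = _ := by rw [Finset.sum_const, Finset.card_univ, Fintype.card_fin, nsmul_eq_mul]
  have h2 : ∑ ij ∈ (Finset.univ : Finset (Fin k)).offDiag, ∑ V : Fin k → Finset ι, (∏ j, ν j (V j)) * ((V ij.1 ∩ V ij.2).card : ℝ) ≤ k ^ 2 * ((∏ j, ∑ V, ν j V) * ∑ p, P p ^ 2) := by
    have h0 : 0 ≤ (∏ j, ∑ V, ν j V) * ∑ p, P p ^ 2 := mul_nonneg (Finset.prod_nonneg fun j _ => hS0 j) (Finset.sum_nonneg fun p _ => sq_nonneg _)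
    calc _ ≤ ∑ ij ∈ (Finset.univ : Finset (Fin k)).offDiag, (∏ j, ∑ V, ν j V) * ∑ p, P p ^ 2 :=
          Finset.sum_le_sum fun ij h => hpair _ _ (Finset.mem_offDiag.1 h).2.2
      _ ≤ _ := by
          rw [Finset.sum_const, nsmul_eq_mul, Finset.offDiag_card, Finset.card_univ, Fintype.card_fin]
          refine mul_le_mul_of_nonneg_right ?_ h0
          calc ((k * k - k : ℕ) : ℝ) ≤ ((k * k : ℕ) : ℝ) := by exact_mod_cast Nat.sub_le _ _
            _ = _ := by push_cast; ring
  nlinarith [h1, h2]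

end ModPB2

section ModPB2b
section sieve2
variable {k : ℕ} {ι : Type} [Fintype ι] [DecidableEq ι]

noncomputable def nrm (a : ι → ℝ) (U : Finset ι) : ℝ := ∏ p ∈ U, a p

def fib (ρ : ι → Option (Fin k)) (i : Fin k) : Finset ι := Finset.univ.filter fun p => ρ p = some i

def sup (ρ : ι → Option (Fin k)) : Finset ι := Finset.univ.filter fun p => ρ p ≠ none

noncomputable def cc (a : ι → ℝ) (F : Finset ι → ℝ) (R : ℝ) (ρ : ι → Option (Fin k)) : ℝ :=
  (∏ i, F (fib ρ i)) * (if nrm a (sup ρ) ≤ R then 1 else 0) * ∏ p ∈ sup ρ, (-(a p / (a p - 1)))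

lemma prod_sup (ρ : ι → Option (Fin k)) (g : ι → ℝ) : ∏ p ∈ sup ρ, g p = ∏ i, ∏ p ∈ fib ρ i, g p := by
  unfold sup fib
  simp_rw [Finset.prod_filter]
  rw [Finset.prod_comm]
  refine Finset.prod_congr rfl fun p _ => ?_
  rcases ρ p with _ | i
  · simp
  · simp

lemma fib_inj : Function.Injective (fib : (ι → Option (Fin k)) → Fin k → Finset ι) := by
  intro ρ σ h
  funext p
  have hp : ∀ i, ρ p = some i ↔ σ p = some i := by
    intro i
    have := congrFun h i
    have h2 : p ∈ fib ρ i ↔ p ∈ fib σ i := by rw [this]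
    simpa [fib] using h2
  exact Option.ext hp

lemma sum_delta (c : (ι → Option (Fin k)) → ℝ) (τ : ι → Option (Fin k)) :
    ∑ ρ : ι → Option (Fin k), (∏ p, if ρ p = τ p then (1:ℝ) else 0) * c ρ = c τ := by
  rw [Finset.sum_eq_single τ]
  · simp
  · intro ρ _ hne
    obtain ⟨p, hp⟩ := Function.ne_iff.1 hne
    rw [Finset.prod_eq_zero (Finset.mem_univ p) (if_neg hp), zero_mul]
  · simp

theorem Q1_le (a : ι → ℝ) (F : Finset ι → ℝ) (R : ℝ) (ha : ∀ p, 1 < a p) (hk : ∀ p, (k:ℝ) ≤ a p) :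
    ∑ o : ι → Option (Fin k), (∏ p, pi1 k (a p) (o p)) * (∑ ρ : ι → Option (Fin k), (∏ p, bb (a p) (ρ p) (o p)) * cc a F R ρ) ^ 2 ≤
    (∑ U : Finset ι, F U ^ 2 * ∏ p ∈ U, (a p / (a p - 1) ^ 2)) ^ k := by
  have key := tensor (fun p o => pi1 k (a p) o) (fun p o => match o with | none => (1:ℝ) | some _ => 1 / a p)
    (fun p t j => bb (a p) j t) (fun p t j => if j = t then 1 else 0)
    (by
      intro p t
      have := hk p
      have h1 := ha p
      rcases t with _ | i
      · simp only [pi1]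
        rw [sub_nonneg, div_le_one (by linarith)]; exact this
      · simp only [pi1]
        have : 0 < a p := by linarith
        positivity)
    (by
      intro p t
      have h1 := ha p
      have : 0 < a p := by linarith
      rcases t with _ | i
      · simp
      · simp only; positivity)
    (fun p x => single1 (a p) (by linarith [ha p]) x) (cc a F R)
  refine key.trans ?_
  simp_rw [sum_delta]
  have hprod : ∀ o : ι → Option (Fin k), (∏ p, (match o p with | none => (1:ℝ) | some _ => 1 / a p)) = ∏ p ∈ sup o, 1 / a p := by
    intro o
    unfold sup
    rw [Finset.prod_filter]
    refine Finset.prod_congr rfl fun p _ => ?_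
    rcases o p with _ | i <;> simp
  have hg : ∀ p, 0 ≤ a p / (a p - 1) ^ 2 := fun p => div_nonneg (by linarith [ha p]) (sq_nonneg _)
  have hterm : ∀ o : ι → Option (Fin k), (∏ p, (match o p with | none => (1:ℝ) | some _ => 1 / a p)) * cc a F R o ^ 2 ≤
      ∏ i, (F (fib o i) ^ 2 * ∏ p ∈ fib o i, (a p / (a p - 1) ^ 2)) := by
    intro o
    rw [hprod, Finset.prod_mul_distrib, ← prod_sup, Finset.prod_pow]
    unfold cc
    rw [mul_pow, mul_pow, ← Finset.prod_pow (sup o)]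
    have e : ∏ p ∈ sup o, (a p / (a p - 1) ^ 2) = (∏ p ∈ sup o, 1 / a p) * ∏ p ∈ sup o, (-(a p / (a p - 1))) ^ 2 := by
      rw [← Finset.prod_mul_distrib]
      refine Finset.prod_congr rfl fun p _ => ?_
      have h1 : 0 < a p - 1 := by linarith [ha p]
      have h2 : 0 < a p := by linarith [ha p]
      field_simp
    have h0 : 0 ≤ ∏ p ∈ sup o, (a p / (a p - 1) ^ 2) := Finset.prod_nonneg fun p _ => hg p
    have h1 : 0 ≤ (∏ i, F (fib o i)) ^ 2 := sq_nonneg _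
    have h2 : (if nrm a (sup o) ≤ R then (1:ℝ) else 0) ^ 2 ≤ 1 := by split_ifs <;> norm_num
    calc _ = (∏ i, F (fib o i)) ^ 2 * (∏ p ∈ sup o, (a p / (a p - 1) ^ 2)) * (if nrm a (sup o) ≤ R then (1:ℝ) else 0) ^ 2 := by
          rw [e]; ring
      _ ≤ (∏ i, F (fib o i)) ^ 2 * (∏ p ∈ sup o, (a p / (a p - 1) ^ 2)) * 1 := mul_le_mul_of_nonneg_left h2 (mul_nonneg h1 h0)
      _ = _ := by ring
  refine (Finset.sum_le_sum fun o _ => hterm o).trans ?_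
  rw [← Finset.sum_image (s := Finset.univ) (g := fib) (f := fun V : Fin k → Finset ι => ∏ i, (F (V i) ^ 2 * ∏ p ∈ V i, (a p / (a p - 1) ^ 2))) (fun x _ y _ h => fib_inj h)]
  refine (Finset.sum_le_sum_of_subset_of_nonneg (Finset.subset_univ _) fun V _ _ => ?_).trans ?_
  · exact Finset.prod_nonneg fun i _ => mul_nonneg (sq_nonneg _) (Finset.prod_nonneg fun p _ => hg p)
  · rw [tuple_sum (fun _ U => F U ^ 2 * ∏ p ∈ U, (a p / (a p - 1) ^ 2)), Finset.prod_const, Finset.card_univ, Fintype.card_fin]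

lemma C_formula (a : ι → ℝ) (F : Finset ι → ℝ) (R : ℝ) (ha : ∀ p, 1 < a p) (m : Fin k) (τ : ι → Option (Fin k))
    (hm : ∀ p, τ p ≠ some m) (hT : ∀ U, F U ≠ 0 → nrm a (sup τ) * nrm a U ≤ R) :
    ∑ ρ : ι → Option (Fin k), (∏ p, ll2 (a p) m (τ p) (ρ p)) * cc a F R ρ =
    (∏ p ∈ sup τ, (-(a p / (a p - 1)))) * (∏ i ∈ Finset.univ.erase m, F (fib τ i)) *
      ∑ U : Finset ι with Disjoint (sup τ) U, F U * ∏ p ∈ U, (1 / (a p - 1)) := by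
  classical
  rw [Finset.mul_sum]
  symm
  have hsup : ∀ p, p ∈ sup τ ↔ τ p ≠ none := fun p => by simp [sup]
  have memfib : ∀ (ρ : ι → Option (Fin k)) i p, p ∈ fib ρ i ↔ ρ p = some i := fun ρ i p => by simp [fib]
  refine Finset.sum_of_injOn (fun U p => if p ∈ U then some m else τ p) ?_ (fun _ _ => Finset.mem_coe.2 (Finset.mem_univ _)) ?_ ?_
  · intro U _ V _ h
    ext p
    have := congrFun h p
    simp only at this
    by_cases h1 : p ∈ U <;> by_cases h2 : p ∈ V
    · simp [h1, h2]
    · rw [if_pos h1, if_neg h2] at this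
      exact absurd this.symm (hm p)
    · rw [if_neg h1, if_pos h2] at this
      exact absurd this (hm p)
    · simp [h1, h2]
  · intro ρ _ hρ
    by_contra hne
    have hfac : ∀ p, ll2 (a p) m (τ p) (ρ p) ≠ 0 := by
      intro p h0
      exact hne (by rw [Finset.prod_eq_zero (Finset.mem_univ p) h0, zero_mul])
    apply hρ
    have hcase : ∀ p, (τ p = none ∧ (ρ p = none ∨ ρ p = some m)) ∨ (τ p ≠ none ∧ ρ p = τ p) := by
      intro p
      have := hfac p
      rcases ht : τ p with _ | i
      · left
        rw [ht] at this
        refine ⟨rfl, ?_⟩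
        rcases hr : ρ p with _ | j
        · exact Or.inl rfl
        · right
          rw [hr] at this
          simp only [ll2] at this
          by_contra hj
          exact this (if_neg (fun h => hj (by rw [h])))
      · right
        refine ⟨by simp, ?_⟩
        rw [ht] at this
        simp only [ll2] at this
        by_contra hj
        exact this (if_neg hj)
    refine ⟨fib ρ m, ?_, ?_⟩
    · rw [Finset.mem_coe, Finset.mem_filter]
      refine ⟨Finset.mem_univ _, ?_⟩
      rw [Finset.disjoint_left]
      intro p hp hq
      rw [hsup] at hp
      rw [memfib] at hq
      rcases hcase p with h | h
      · exact hp h.1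
      · exact hm p (h.2 ▸ hq)
    · funext p
      simp only [memfib]
      split_ifs with h
      · exact h.symm
      · rcases hcase p with h1 | h1
        · rcases h1.2 with h2 | h2
          · rw [h1.1, h2]
          · exact absurd h2 h
        · exact h1.2.symm
  · intro U hU
    have hU : Disjoint (sup τ) U := (Finset.mem_filter.1 hU).2
    have hd : ∀ p ∈ U, τ p = none := by
      intro p hp
      by_contra h
      exact Finset.disjoint_left.1 hU ((hsup p).2 h) hp
    simp only
    set ρ : ι → Option (Fin k) := fun p => if p ∈ U then some m else τ p with hρ
    have f1 : fib ρ m = U := by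
      ext p
      rw [memfib, hρ]
      simp only
      split_ifs with h
      · simp [h]
      · simp [h, hm p]
    have f2 : ∀ i ∈ Finset.univ.erase m, fib ρ i = fib τ i := by
      intro i hi
      ext p
      rw [memfib, memfib, hρ]
      simp only
      split_ifs with h
      · rw [hd p h]
        simp [(Finset.ne_of_mem_erase hi).symm]
      · rfl
    have f3 : sup ρ = sup τ ∪ U := by
      ext p
      rw [Finset.mem_union, hsup]
      simp only [sup, Finset.mem_filter, Finset.mem_univ, true_and, hρ]
      split_ifs with h
      · simp [h]
      · simp [h]
    have f4 : ∏ p, ll2 (a p) m (τ p) (ρ p) = ∏ p ∈ U, (-1 / a p) := by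
      rw [← Finset.prod_subset (Finset.subset_univ U)]
      · refine Finset.prod_congr rfl fun p hp => ?_
        rw [hd p hp, hρ]
        simp [hp, ll2]
      · intro p _ hp
        have : ρ p = τ p := if_neg hp
        rw [this]
        rcases τ p with _ | i <;> simp [ll2]
    have f5 : ∏ i ∈ Finset.univ.erase m, F (fib ρ i) = ∏ i ∈ Finset.univ.erase m, F (fib τ i) :=
      Finset.prod_congr rfl fun i hi => by rw [f2 i hi]
    unfold cc
    rw [f4, ← Finset.mul_prod_erase _ _ (Finset.mem_univ m), f1, f5, f3]
    by_cases hF : F U = 0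
    · rw [hF]; ring
    have hn : nrm a (sup τ ∪ U) ≤ R := by
      have := hT U hF
      unfold nrm at this ⊢
      rwa [Finset.prod_union hU]
    rw [if_pos hn, Finset.prod_union hU]
    have e : ∏ p ∈ U, (1 / (a p - 1)) = (∏ p ∈ U, (-1 / a p)) * ∏ p ∈ U, (-(a p / (a p - 1))) := by
      rw [← Finset.prod_mul_distrib]
      refine Finset.prod_congr rfl fun p _ => ?_
      have h1 : 0 < a p - 1 := by linarith [ha p]
      have h2 : 0 < a p := by linarith [ha p]
      field_simp
    rw [e]; ring

end sieve2

end ModPB2b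

section ModPB2c
section sieve3
variable {k : ℕ} {ι : Type} [Fintype ι] [DecidableEq ι]

lemma E_lower (a : ι → ℝ) (F : Finset ι → ℝ) (ha : ∀ p, 1 < a p) (hF : ∀ U, 0 ≤ F U)
    (hmono : ∀ U V : Finset ι, U ⊆ V → F V ≤ F U) (T : Finset ι) :
    (∑ U, F U * ∏ p ∈ U, (1 / (a p - 1))) * (1 - ∑ p ∈ T, 1 / (a p - 1)) ≤
      ∑ U : Finset ι with Disjoint T U, F U * ∏ p ∈ U, (1 / (a p - 1)) := by
  have hg : ∀ p, 0 ≤ 1 / (a p - 1) := fun p => one_div_nonneg.2 (by linarith [ha p])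
  have hpos : ∀ U, 0 ≤ F U * ∏ p ∈ U, (1 / (a p - 1)) := fun U => mul_nonneg (hF U) (Finset.prod_nonneg fun p _ => hg p)
  set A := ∑ U, F U * ∏ p ∈ U, (1 / (a p - 1)) with hA
  have h1 : A = ∑ U : Finset ι with Disjoint T U, F U * ∏ p ∈ U, (1 / (a p - 1)) + ∑ U : Finset ι with ¬ Disjoint T U, F U * ∏ p ∈ U, (1 / (a p - 1)) :=
    (Finset.sum_filter_add_sum_filter_not _ _ _).symm
  have h2 : ∑ U : Finset ι with ¬ Disjoint T U, F U * ∏ p ∈ U, (1 / (a p - 1)) ≤ ∑ p ∈ T, ∑ U : Finset ι with p ∈ U, F U * ∏ p ∈ U, (1 / (a p - 1)) := by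
    have e : ∀ p, ∑ U : Finset ι with p ∈ U, F U * ∏ p ∈ U, (1 / (a p - 1)) = ∑ U : Finset ι, if p ∈ U then F U * ∏ p ∈ U, (1 / (a p - 1)) else 0 := fun p => by rw [Finset.sum_filter]
    simp_rw [e]
    rw [Finset.sum_comm, Finset.sum_filter]
    refine Finset.sum_le_sum fun U _ => ?_
    by_cases h : Disjoint T U
    · rw [if_neg (not_not.2 h)]
      refine Finset.sum_nonneg fun q _ => ?_
      split_ifs
      · exact hpos U
      · exact le_rfl
    · rw [if_pos h]
      rw [Finset.not_disjoint_iff] at h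
      obtain ⟨p, hp, hpU⟩ := h
      calc _ = (if p ∈ U then F U * ∏ p ∈ U, (1 / (a p - 1)) else 0) := (if_pos hpU).symm
        _ ≤ _ := Finset.single_le_sum (f := fun p => if p ∈ U then F U * ∏ p ∈ U, (1 / (a p - 1)) else 0) (fun q _ => by
          show 0 ≤ if q ∈ U then F U * ∏ p ∈ U, (1 / (a p - 1)) else 0
          split_ifs
          · exact hpos U
          · exact le_rfl) hp
  have h3 : ∑ p ∈ T, ∑ U : Finset ι with p ∈ U, F U * ∏ p ∈ U, (1 / (a p - 1)) ≤ A * ∑ p ∈ T, 1 / (a p - 1) := by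
    rw [Finset.mul_sum]
    refine Finset.sum_le_sum fun p _ => ?_
    rw [mul_comm]
    exact mono_sum F (fun p => 1 / (a p - 1)) hF hmono hg p
  linarith

/-- contribution of one outcome to the lower bound -/
lemma term_lower (a : ι → ℝ) (F : Finset ι → ℝ) (R Z Λ : ℝ) (m : Fin k) (ha2 : ∀ p, 2 ≤ a p) (hk : ∀ p, 2 * (k:ℝ) ≤ a p - 1)
    (hF : ∀ U, 0 ≤ F U) (hmono : ∀ U V : Finset ι, U ⊆ V → F V ≤ F U)
    (hZ : ∀ U, F U ≠ 0 → nrm a U ≤ Z) (hR : Real.exp Λ * Z ≤ R)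
    (heps : ∑ p, 1 / (a p - 1) ^ 2 ≤ 1 / 4)
    (τ : ι → Option (Fin k)) (hm : ∀ p, τ p ≠ some m) (hτ : ∑ p ∈ sup τ, Real.log (a p) ≤ Λ) (x : ℝ)
    (hx : x ≤ 1 - (2 * k + 2) * ∑ p ∈ sup τ, 1 / (a p - 1)) (hx0 : 0 ≤ x) :
    3 / 4 * (∑ U, F U * ∏ p ∈ U, (1 / (a p - 1))) ^ 2 * ((∏ i ∈ Finset.univ.erase m, F (fib τ i) ^ 2) * ∏ p ∈ sup τ, (a p / (a p - 1) ^ 2)) * x ≤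
    (∏ p, al2 k (a p) m (τ p)) * (∑ ρ : ι → Option (Fin k), (∏ p, ll2 (a p) m (τ p) (ρ p)) * cc a F R ρ) ^ 2 := by
  have ha : ∀ p, 1 < a p := fun p => by linarith [ha2 p]
  have hap : ∀ p, 0 < a p - 1 := fun p => by linarith [ha p]
  have hT : ∀ U, F U ≠ 0 → nrm a (sup τ) * nrm a U ≤ R := by
    intro U hU
    have h1 : nrm a (sup τ) ≤ Real.exp Λ := by
      have : nrm a (sup τ) = Real.exp (∑ p ∈ sup τ, Real.log (a p)) := by
        rw [Real.exp_sum]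
        exact Finset.prod_congr rfl fun p _ => (Real.exp_log (by linarith [ha p])).symm
      rw [this]
      exact Real.exp_le_exp.2 hτ
    have h2 : 0 ≤ nrm a U := Finset.prod_nonneg fun p _ => by linarith [ha p]
    calc _ ≤ Real.exp Λ * nrm a U := mul_le_mul_of_nonneg_right h1 h2
      _ ≤ Real.exp Λ * Z := mul_le_mul_of_nonneg_left (hZ U hU) (Real.exp_pos _).le
      _ ≤ R := hR
  rw [C_formula a F R ha m τ hm hT]
  set A := ∑ U, F U * ∏ p ∈ U, (1 / (a p - 1)) with hA
  set E := ∑ U : Finset ι with Disjoint (sup τ) U, F U * ∏ p ∈ U, (1 / (a p - 1)) with hE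
  set s := ∑ p ∈ sup τ, 1 / (a p - 1) with hs
  have hA0 : 0 ≤ A := Finset.sum_nonneg fun U _ => mul_nonneg (hF U) (Finset.prod_nonneg fun p _ => one_div_nonneg.2 (hap p).le)
  have hEA : A * (1 - s) ≤ E := E_lower a F ha hF hmono (sup τ)
  have hs0 : 0 ≤ s := Finset.sum_nonneg fun p _ => one_div_nonneg.2 (hap p).le
  have hkk : (0:ℝ) ≤ k := Nat.cast_nonneg k
  have hs1 : (2 * k + 2) * s ≤ 1 := by linarith
  have hs2 : s ≤ 1 := by nlinarith
  have hE2 : A ^ 2 * (1 - 2 * s) ≤ E ^ 2 := by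
    have h0 : 0 ≤ A * (1 - s) := mul_nonneg hA0 (by linarith)
    calc A ^ 2 * (1 - 2 * s) ≤ (A * (1 - s)) ^ 2 := by nlinarith [mul_nonneg (sq_nonneg A) (sq_nonneg s)]
      _ ≤ E ^ 2 := pow_le_pow_left₀ h0 hEA 2
  -- the product of al2
  have hal : ∏ p, al2 k (a p) m (τ p) = (∏ p ∈ Finset.univ.filter (fun p => ¬ τ p ≠ none), (1 - 1 / a p ^ 2)) * ((∏ p ∈ sup τ, 1 / (a p - 1)) * ∏ p ∈ sup τ, (1 - 2 * k / (a p - 1))) := by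
    rw [← Finset.prod_mul_distrib, ← Finset.prod_filter_mul_prod_filter_not Finset.univ (fun p => τ p ≠ none), mul_comm]
    congr 1
    · refine Finset.prod_congr rfl fun p hp => ?_
      have : τ p = none := by simpa using hp
      rw [this]; rfl
    · refine Finset.prod_congr rfl fun p hp => ?_
      have hp : τ p ≠ none := by simpa [sup] using hp
      obtain ⟨i, hi⟩ := Option.ne_none_iff_exists'.1 hp
      rw [hi]
      simp only [al2]
      rw [if_neg]
      intro h
      exact hm p (by rw [hi, h])
  have h34 : 3 / 4 ≤ ∏ p ∈ Finset.univ.filter (fun p => ¬ τ p ≠ none), (1 - 1 / a p ^ 2) := by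
    refine le_trans ?_ (one_sub_sum_le_prod _ _ (fun p _ => by positivity) (fun p _ => ?_))
    · have : ∑ p ∈ Finset.univ.filter (fun p => ¬ τ p ≠ none), 1 / a p ^ 2 ≤ ∑ p, 1 / (a p - 1) ^ 2 := by
        refine (Finset.sum_le_sum fun p _ => ?_).trans (Finset.sum_le_sum_of_subset_of_nonneg (Finset.subset_univ _) fun p _ _ => by positivity)
        have := hap p
        gcongr
        linarith
      linarith
    · rw [div_le_one (by have := ha p; positivity)]
      nlinarith [ha p]
  have h2k : 1 - 2 * k * s ≤ ∏ p ∈ sup τ, (1 - 2 * k / (a p - 1)) := by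
    refine le_trans ?_ (one_sub_sum_le_prod _ _ (fun p _ => by have := hap p; positivity) (fun p _ => ?_))
    · rw [hs, Finset.mul_sum]
      refine le_of_eq ?_
      congr 1
      exact Finset.sum_congr rfl fun p _ => by ring
    · rw [div_le_one (hap p)]; exact hk p
  have hgg : ∏ p ∈ sup τ, (a p / (a p - 1) ^ 2) ≤ (∏ p ∈ sup τ, 1 / (a p - 1)) * (∏ p ∈ sup τ, (-(a p / (a p - 1)))) ^ 2 := by
    rw [← Finset.prod_pow, ← Finset.prod_mul_distrib]
    refine Finset.prod_le_prod (fun p _ => by have := ha p; positivity) (fun p _ => ?_)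
    have h1 := hap p
    have h2 : 0 < a p := by linarith [ha p]
    have : 1 / (a p - 1) * (-(a p / (a p - 1))) ^ 2 = a p / (a p - 1) ^ 2 * (a p / (a p - 1)) := by field_simp
    rw [this]
    have h3 : 1 ≤ a p / (a p - 1) := by rw [le_div_iff₀ h1]; linarith
    have h4 : 0 ≤ a p / (a p - 1) ^ 2 := by positivity
    nlinarith
  rw [hal]
  set X1 := ∏ p ∈ Finset.univ.filter (fun p => ¬ τ p ≠ none), (1 - 1 / a p ^ 2)
  set X2 := ∏ p ∈ sup τ, (1 - 2 * (k:ℝ) / (a p - 1))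
  set X3 := ∏ p ∈ sup τ, (a p / (a p - 1) ^ 2)
  have hX30 : 0 ≤ X3 := Finset.prod_nonneg fun p _ => div_nonneg (by linarith [ha p]) (sq_nonneg _)
  have hprodF : ∏ i ∈ Finset.univ.erase m, F (fib τ i) ^ 2 = (∏ i ∈ Finset.univ.erase m, F (fib τ i)) ^ 2 := Finset.prod_pow _ _ _
  rw [hprodF]
  set Y := ∏ i ∈ Finset.univ.erase m, F (fib τ i)
  set P1 := ∏ p ∈ sup τ, 1 / (a p - 1)
  set P2 := ∏ p ∈ sup τ, (-(a p / (a p - 1)))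
  have hxx : x ≤ X2 * (1 - 2 * s) := by
    have h1 : (0:ℝ) ≤ 1 - 2 * s := by nlinarith
    have h2 : (1 - 2 * k * s) * (1 - 2 * s) ≤ X2 * (1 - 2 * s) := mul_le_mul_of_nonneg_right h2k h1
    nlinarith [mul_nonneg hkk (sq_nonneg s)]
  have hX20 : 0 ≤ X2 := by
    refine le_trans ?_ h2k
    nlinarith
  have hAx : A ^ 2 * x ≤ X2 * E ^ 2 := by
    calc A ^ 2 * x ≤ A ^ 2 * (X2 * (1 - 2 * s)) := mul_le_mul_of_nonneg_left hxx (sq_nonneg _)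
      _ = X2 * (A ^ 2 * (1 - 2 * s)) := by ring
      _ ≤ X2 * E ^ 2 := mul_le_mul_of_nonneg_left hE2 hX20
  have hX1 : 0 ≤ X1 := by linarith
  have hY : 0 ≤ Y ^ 2 := sq_nonneg _
  have hAx0 : 0 ≤ A ^ 2 * x := mul_nonneg (sq_nonneg _) hx0
  calc _ = 3 / 4 * X3 * Y ^ 2 * (A ^ 2 * x) := by ring
    _ ≤ X1 * (P1 * P2 ^ 2) * Y ^ 2 * (X2 * E ^ 2) := by
        have hP0 : 0 ≤ P1 * P2 ^ 2 := hX30.trans hgg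
        have hq : 0 ≤ X1 * (P1 * P2 ^ 2) * Y ^ 2 := by positivity
        gcongr
    _ = _ := by ring

set_option maxHeartbeats 1000000 in
theorem Q2_ge (a : ι → ℝ) (F : Finset ι → ℝ) (R Z Λ : ℝ) (m : Fin k) (ha2 : ∀ p, 2 < a p) (hk : ∀ p, 2 * (k:ℝ) ≤ a p - 1)
    (hF : ∀ U, 0 ≤ F U) (hmono : ∀ U V : Finset ι, U ⊆ V → F V ≤ F U)
    (hZ : ∀ U, F U ≠ 0 → nrm a U ≤ Z) (hR : Real.exp Λ * Z ≤ R) (hΛ : 0 < Λ)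
    (heps : ∑ p, 1 / (a p - 1) ^ 2 ≤ 1 / (48 * (k:ℝ) ^ 2))
    (hB : 12 * k * ∑ U, F U ^ 2 * (∏ p ∈ U, (a p / (a p - 1) ^ 2)) * (∑ p ∈ U, Real.log (a p)) ≤ Λ * ∑ U, F U ^ 2 * (∏ p ∈ U, (a p / (a p - 1) ^ 2))) :
    1 / 2 * (∑ U, F U * ∏ p ∈ U, (1 / (a p - 1))) ^ 2 * (∑ U, F U ^ 2 * ∏ p ∈ U, (a p / (a p - 1) ^ 2)) ^ (k - 1) ≤
    ∑ o : ι → Option (Fin k), (∏ p, pi2 k (a p) m (o p)) * (∑ ρ : ι → Option (Fin k), (∏ p, bb (a p) (ρ p) (o p)) * cc a F R ρ) ^ 2 := by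
  classical
  have ha : ∀ p, 1 < a p := fun p => by linarith [ha2 p]
  have hap : ∀ p, 0 < a p - 1 := fun p => by linarith [ha p]
  have hk1 : (1:ℝ) ≤ k := by exact_mod_cast Fin.pos m
  have hal0 : ∀ p t, 0 ≤ al2 k (a p) m t := by
    intro p t
    have h1 := hap p
    rcases t with _ | i
    · simp only [al2]
      rw [sub_nonneg, div_le_one (by have := ha p; positivity)]
      nlinarith [ha p]
    · simp only [al2]
      split_ifs
      · exact le_rfl
      · refine mul_nonneg (by positivity) ?_
        rw [sub_nonneg, div_le_one h1]; exact hk p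
  have key := tensor (fun p o => al2 k (a p) m o) (fun p o => pi2 k (a p) m o)
    (fun p t j => ll2 (a p) m t j) (fun p t j => bb (a p) j t) hal0
    (by
      intro p t
      have h1 := hap p
      rcases t with _ | i
      · simp only [pi2]
        rw [sub_nonneg, div_le_one h1]
        linarith [hk p]
      · simp only [pi2]
        split_ifs
        · exact le_rfl
        · positivity)
    (fun p x => single2 (a p) m (ha2 p) x) (cc a F R)
  refine le_trans ?_ key
  set A := ∑ U, F U * ∏ p ∈ U, (1 / (a p - 1)) with hA
  set μ : Finset ι → ℝ := fun U => F U ^ 2 * ∏ p ∈ U, (a p / (a p - 1) ^ 2) with hμ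
  set A2 := ∑ U, μ U with hA2
  change 1 / 2 * A ^ 2 * A2 ^ (k - 1) ≤ _
  have hg : ∀ p, 0 ≤ a p / (a p - 1) ^ 2 := fun p => div_nonneg (by linarith [ha p]) (sq_nonneg _)
  have hμ0 : ∀ U, 0 ≤ μ U := fun U => mul_nonneg (sq_nonneg _) (Finset.prod_nonneg fun p _ => hg p)
  have hA20 : 0 ≤ A2 := Finset.sum_nonneg fun U _ => hμ0 U
  set P : ι → ℝ := fun p => a p / (a p - 1) ^ 2 with hP
  set ε := ∑ p, 1 / (a p - 1) ^ 2 with hε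
  have hε0 : 0 ≤ ε := Finset.sum_nonneg fun p _ => by positivity
  have hεk : 48 * k ^ 2 * ε ≤ 1 := by
    rw [le_div_iff₀ (by positivity)] at heps
    linarith
  have hP2 : ∀ p, P p ≤ 2 * (1 / (a p - 1)) := by
    intro p
    have h1 := hap p
    have : P p = (a p / (a p - 1)) * (1 / (a p - 1)) := by rw [hP]; field_simp
    rw [this]
    refine mul_le_mul_of_nonneg_right ?_ (by positivity)
    rw [div_le_iff₀ h1]; linarith [ha2 p]
  have hPsum : ∑ p, P p ^ 2 ≤ 4 * ε := by
    rw [hε, Finset.mul_sum]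
    refine Finset.sum_le_sum fun p _ => ?_
    calc P p ^ 2 ≤ (2 * (1 / (a p - 1))) ^ 2 := pow_le_pow_left₀ (hg p) (hP2 p) 2
      _ = _ := by rw [mul_pow, div_pow, one_pow]; norm_num
  set lin : Finset ι → ℝ := fun V => (2 * k + 2) * (∑ p ∈ V, 1 / (a p - 1)) + (∑ p ∈ V, Real.log (a p)) / Λ with hlin
  set ν : Fin k → Finset ι → ℝ := fun i V => if i = m then (if V = ∅ then 1 else 0) else μ V with hν
  have hμp : ∀ p, ∑ V : Finset ι with p ∈ V, μ V ≤ P p * A2 := by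
    intro p
    refine mono_sum (fun U => F U ^ 2) P (fun U => sq_nonneg _) (fun U V h => pow_le_pow_left₀ (hF V) (hmono U V h) 2) hg p
  have hmu_s : ∑ V, μ V * ∑ p ∈ V, 1 / (a p - 1) ≤ 2 * ε * A2 := by
    have e : ∀ V : Finset ι, μ V * ∑ p ∈ V, 1 / (a p - 1) = ∑ p, 1 / (a p - 1) * (if p ∈ V then μ V else 0) := by
      intro V
      simp_rw [mul_ite, mul_zero]
      rw [← Finset.sum_filter, Finset.mul_sum]
      have : Finset.univ.filter (fun p => p ∈ V) = V := by ext; simp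
      rw [this]
      exact Finset.sum_congr rfl fun p _ => mul_comm _ _
    simp_rw [e]
    rw [Finset.sum_comm]
    calc _ ≤ ∑ p, 1 / (a p - 1) * (2 * (1 / (a p - 1)) * A2) := by
          refine Finset.sum_le_sum fun p _ => ?_
          rw [← Finset.mul_sum, ← Finset.sum_filter]
          refine mul_le_mul_of_nonneg_left ((hμp p).trans (mul_le_mul_of_nonneg_right (hP2 p) hA20)) (one_div_nonneg.2 (hap p).le)
      _ = 2 * ε * A2 := by
          rw [hε, mul_assoc, mul_comm _ A2, ← mul_assoc, Finset.mul_sum]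
          exact Finset.sum_congr rfl fun p _ => by rw [← one_div_pow]; ring
  set η : ℝ := (2 * k + 2) * (2 * ε) + 1 / (12 * k) with hη
  have hD := disj ν
    (by
      intro i V
      simp only [hν]
      split_ifs
      · norm_num
      · norm_num
      · exact hμ0 V) P hg
    (by
      intro i p
      simp only [hν]
      split_ifs with h
      · rw [Finset.sum_eq_zero]
        · refine mul_nonneg (hg p) (Finset.sum_nonneg fun V _ => ?_)
          split_ifs <;> norm_num
        · intro V hV
          have hV : p ∈ V := (Finset.mem_filter.1 hV).2
          rw [if_neg (Finset.ne_empty_of_mem hV)]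
      · exact hμp p)
    lin η
    (by
      intro i
      simp only [hν]
      split_ifs with h
      · simp only [ite_mul, one_mul, zero_mul, Finset.sum_ite_eq', Finset.mem_univ, if_true]
        have : lin ∅ = 0 := by simp [hlin]
        rw [this, mul_one]
        positivity
      · have e : ∑ V, μ V * lin V = (2 * k + 2) * (∑ V, μ V * ∑ p ∈ V, 1 / (a p - 1)) + (∑ V, μ V * ∑ p ∈ V, Real.log (a p)) / Λ := by
          rw [Finset.mul_sum, Finset.sum_div, ← Finset.sum_add_distrib]
          exact Finset.sum_congr rfl fun V _ => by simp only [hlin]; ring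
        rw [e]
        have h2 : (∑ V, μ V * ∑ p ∈ V, Real.log (a p)) / Λ ≤ 1 / (12 * k) * A2 := by
          rw [div_le_iff₀ hΛ]
          have h3 : 12 * k * (∑ V, μ V * ∑ p ∈ V, Real.log (a p)) ≤ Λ * A2 := hB
          have : (1 / (12 * k) * A2 * Λ) = (Λ * A2) / (12 * k) := by ring
          rw [this, le_div_iff₀ (by positivity)]
          linarith
        have h4 : (2 * (k:ℝ) + 2) * (∑ V, μ V * ∑ p ∈ V, 1 / (a p - 1)) ≤ (2 * k + 2) * (2 * ε * A2) := mul_le_mul_of_nonneg_left hmu_s (by positivity)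
        calc _ ≤ (2 * (k:ℝ) + 2) * (2 * ε * A2) + 1 / (12 * k) * A2 := add_le_add h4 h2
          _ = η * A2 := by rw [hη]; ring)
  have hprodν : ∏ i, ∑ V, ν i V = A2 ^ (k - 1) := by
    rw [← Finset.mul_prod_erase _ _ (Finset.mem_univ m)]
    have h1 : ∑ V, ν m V = 1 := by simp [hν]
    have h2 : ∏ i ∈ Finset.univ.erase m, ∑ V, ν i V = ∏ i ∈ Finset.univ.erase m, A2 := by
      refine Finset.prod_congr rfl fun i hi => ?_
      simp [hν, Finset.ne_of_mem_erase hi, hA2]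
    rw [h1, h2, Finset.prod_const, Finset.card_erase_of_mem (Finset.mem_univ m), Finset.card_univ, Fintype.card_fin, one_mul]
  have h23 : 2 / 3 ≤ 1 - k * η - k ^ 2 * ∑ p, P p ^ 2 := by
    have h1 : k * η = (2 * k + 2) * (2 * ε) * k + 1 / 12 := by rw [hη]; field_simp
    have h2 : (k:ℝ) ^ 2 * ∑ p, P p ^ 2 ≤ k ^ 2 * (4 * ε) := mul_le_mul_of_nonneg_left hPsum (sq_nonneg _)
    have h3 : (2 * k + 2) * (2 * ε) * k ≤ 8 * (k ^ 2 * ε) := by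
      have : 0 ≤ ε * (k * (k - 1)) := mul_nonneg hε0 (mul_nonneg (by linarith) (by linarith))
      nlinarith
    rw [h1]
    nlinarith
  rw [hprodν] at hD
  set H : (Fin k → Finset ι) → ℝ := fun V => 1 - ∑ i, lin (V i) - ∑ ij ∈ (Finset.univ : Finset (Fin k)).offDiag, ((V ij.1 ∩ V ij.2).card : ℝ) with hH
  set G : (Fin k → Finset ι) → ℝ := fun V => ∏ i, ν i (V i) with hG
  have hD' : A2 ^ (k - 1) * (2 / 3) ≤ ∑ V, G V * H V := le_trans (mul_le_mul_of_nonneg_left h23 (pow_nonneg hA20 _)) hD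
  have hν0 : ∀ i V, 0 ≤ ν i V := by
      intro i V
      simp only [hν]
      split_ifs
      · norm_num
      · norm_num
      · exact hμ0 V
  have hG0 : ∀ V, 0 ≤ G V := fun V => Finset.prod_nonneg fun i _ => hν0 i _
  have hlin0 : ∀ V, 0 ≤ lin V := by
    intro V
    simp only [hlin]
    have h1 : 0 ≤ ∑ p ∈ V, 1 / (a p - 1) := Finset.sum_nonneg fun p _ => one_div_nonneg.2 (hap p).le
    have h2 : 0 ≤ ∑ p ∈ V, Real.log (a p) := Finset.sum_nonneg fun p _ => Real.log_nonneg (ha p).le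
    positivity
  -- non-disjoint tuples contribute nonpositively
  have himg : ∀ V : Fin k → Finset ι, V ∉ Finset.univ.image (fib : (ι → Option (Fin k)) → _) → G V * H V ≤ 0 := by
    intro V hV
    refine mul_nonpos_of_nonneg_of_nonpos (hG0 V) ?_
    by_contra hpos
    push Not at hpos
    have h1 : ∑ ij ∈ (Finset.univ : Finset (Fin k)).offDiag, ((V ij.1 ∩ V ij.2).card : ℝ) < 1 := by
      have : 0 ≤ ∑ i, lin (V i) := Finset.sum_nonneg fun i _ => hlin0 _
      simp only [hH] at hpos
      linarith
    have hdis : ∀ i j, i ≠ j → ∀ p, p ∈ V i → p ∉ V j := by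
      intro i j hij p hpi hpj
      have h2 : ((V i ∩ V j).card : ℝ) ≤ ∑ ij ∈ (Finset.univ : Finset (Fin k)).offDiag, ((V ij.1 ∩ V ij.2).card : ℝ) :=
        Finset.single_le_sum (f := fun ij : Fin k × Fin k => ((V ij.1 ∩ V ij.2).card : ℝ)) (fun ij _ => Nat.cast_nonneg _)
          (Finset.mem_offDiag.2 ⟨Finset.mem_univ i, Finset.mem_univ j, hij⟩ : (i, j) ∈ _)
      have h3 : 1 ≤ (V i ∩ V j).card := Finset.card_pos.2 ⟨p, Finset.mem_inter.2 ⟨hpi, hpj⟩⟩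
      have h4 : (1:ℝ) ≤ (V i ∩ V j).card := by exact_mod_cast h3
      linarith
    apply hV
    rw [Finset.mem_image]
    refine ⟨fun p => if h : ∃ i, p ∈ V i then some h.choose else none, Finset.mem_univ _, ?_⟩
    funext i
    ext p
    simp only [fib, Finset.mem_filter, Finset.mem_univ, true_and]
    constructor
    · intro h
      by_cases hex : ∃ i, p ∈ V i
      · rw [dif_pos hex] at h
        have := hex.choose_spec
        rwa [Option.some.inj h] at this
      · rw [dif_neg hex] at h; cases h
    · intro h
      have hex : ∃ i, p ∈ V i := ⟨i, h⟩
      rw [dif_pos hex]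
      by_contra hne
      have hne : hex.choose ≠ i := fun h => hne (by rw [h])
      exact hdis _ _ hne p hex.choose_spec h
  have hstep : ∑ V, G V * H V ≤ ∑ τ : ι → Option (Fin k), max (G (fib τ) * H (fib τ)) 0 := by
    rw [← Finset.sum_image (s := Finset.univ) (g := fib) (f := fun V : Fin k → Finset ι => max (G V * H V) 0) (fun x _ y _ h => fib_inj h)]
    rw [← Finset.sum_add_sum_compl (Finset.univ.image (fib : (ι → Option (Fin k)) → _)) (fun V => G V * H V)]
    have h1 : ∑ V ∈ (Finset.univ.image (fib : (ι → Option (Fin k)) → _))ᶜ, G V * H V ≤ 0 :=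
      Finset.sum_nonpos fun V hV => himg V (Finset.mem_compl.1 hV)
    have h2 := Finset.sum_le_sum fun V (_ : V ∈ Finset.univ.image (fib : (ι → Option (Fin k)) → _)) => le_max_left (G V * H V) 0
    linarith
  have hterm : ∀ τ : ι → Option (Fin k), 3 / 4 * A ^ 2 * max (G (fib τ) * H (fib τ)) 0 ≤
      (∏ p, al2 k (a p) m (τ p)) * (∑ ρ : ι → Option (Fin k), (∏ p, ll2 (a p) m (τ p) (ρ p)) * cc a F R ρ) ^ 2 := by
    intro τ
    rcases le_or_gt (G (fib τ) * H (fib τ)) 0 with h | h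
    · rw [max_eq_right h, mul_zero]
      exact mul_nonneg (Finset.prod_nonneg fun p _ => hal0 _ _) (sq_nonneg _)
    · rw [max_eq_left h.le]
      have hHpos : 0 < H (fib τ) := by
        by_contra hn
        push Not at hn
        linarith [mul_nonpos_of_nonneg_of_nonpos (hG0 (fib τ)) hn]
      have hGne : G (fib τ) ≠ 0 := by
        intro h0
        rw [h0, zero_mul] at h
        exact lt_irrefl _ h
      have hmm : fib τ m = ∅ := by
        by_contra hne
        apply hGne
        exact Finset.prod_eq_zero (Finset.mem_univ m) (by simp [hν, hne])
      have hm : ∀ p, τ p ≠ some m := by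
        intro p hp
        have : p ∈ fib τ m := by simp [fib, hp]
        rw [hmm] at this
        exact Finset.notMem_empty p this
      have hsupsum : ∀ g : ι → ℝ, ∑ p ∈ sup τ, g p = ∑ i, ∑ p ∈ fib τ i, g p := by
        intro g
        unfold sup fib
        simp_rw [Finset.sum_filter]
        rw [Finset.sum_comm]
        refine Finset.sum_congr rfl fun p _ => ?_
        rcases τ p with _ | i <;> simp
      have hlins : ∑ i, lin (fib τ i) = (2 * k + 2) * (∑ p ∈ sup τ, 1 / (a p - 1)) + (∑ p ∈ sup τ, Real.log (a p)) / Λ := by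
        rw [hsupsum, hsupsum, Finset.mul_sum, Finset.sum_div, ← Finset.sum_add_distrib]
      have hoff : 0 ≤ ∑ ij ∈ (Finset.univ : Finset (Fin k)).offDiag, ((fib τ ij.1 ∩ fib τ ij.2).card : ℝ) := Finset.sum_nonneg fun _ _ => Nat.cast_nonneg _
      have hHle : H (fib τ) ≤ 1 - ((2 * k + 2) * (∑ p ∈ sup τ, 1 / (a p - 1)) + (∑ p ∈ sup τ, Real.log (a p)) / Λ) := by
        simp only [hH]
        rw [hlins]
        linarith
      have hs0 : 0 ≤ ∑ p ∈ sup τ, 1 / (a p - 1) := Finset.sum_nonneg fun p _ => one_div_nonneg.2 (hap p).le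
      have hl0 : 0 ≤ ∑ p ∈ sup τ, Real.log (a p) := Finset.sum_nonneg fun p _ => Real.log_nonneg (ha p).le
      have hs0' : 0 ≤ (2 * (k:ℝ) + 2) * ∑ p ∈ sup τ, 1 / (a p - 1) := by positivity
      have hl0' : 0 ≤ (∑ p ∈ sup τ, Real.log (a p)) / Λ := by positivity
      have hτ : ∑ p ∈ sup τ, Real.log (a p) ≤ Λ := by
        have : (∑ p ∈ sup τ, Real.log (a p)) / Λ ≤ 1 := by linarith
        rwa [div_le_one hΛ] at this
      have heps4 : ε ≤ 1 / 4 := by nlinarith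
      have := term_lower a F R Z Λ m (fun p => (ha2 p).le) hk hF hmono hZ hR heps4 τ hm hτ (H (fib τ)) (by linarith) hHpos.le
      refine le_trans (le_of_eq ?_) this
      have hGe : G (fib τ) = (∏ i ∈ Finset.univ.erase m, F (fib τ i) ^ 2) * ∏ p ∈ sup τ, (a p / (a p - 1) ^ 2) := by
        rw [prod_sup]
        simp only [hG]
        rw [← Finset.mul_prod_erase _ _ (Finset.mem_univ m), ← Finset.mul_prod_erase _ (fun i => ∏ p ∈ fib τ i, (a p / (a p - 1) ^ 2)) (Finset.mem_univ m), hmm]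
        have h1 : ν m ∅ = 1 := by simp [hν]
        have h2 : ∏ i ∈ Finset.univ.erase m, ν i (fib τ i) = ∏ i ∈ Finset.univ.erase m, (F (fib τ i) ^ 2 * ∏ p ∈ fib τ i, (a p / (a p - 1) ^ 2)) := by
          refine Finset.prod_congr rfl fun i hi => ?_
          simp only [hν]
          rw [if_neg (Finset.ne_of_mem_erase hi)]
        rw [h1, h2, Finset.prod_mul_distrib, Finset.prod_empty]
        ring
      rw [hGe]; ring
  calc 1 / 2 * A ^ 2 * A2 ^ (k - 1) = 3 / 4 * A ^ 2 * (A2 ^ (k - 1) * (2 / 3)) := by ring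
    _ ≤ 3 / 4 * A ^ 2 * ∑ τ : ι → Option (Fin k), max (G (fib τ) * H (fib τ)) 0 := mul_le_mul_of_nonneg_left (hD'.trans hstep) (by positivity)
    _ = ∑ τ : ι → Option (Fin k), 3 / 4 * A ^ 2 * max (G (fib τ) * H (fib τ)) 0 := by rw [Finset.mul_sum]
    _ ≤ _ := Finset.sum_le_sum fun τ _ => hterm τ

end sieve3

end ModPB2c

section ModPB3
open Finset in
lemma cop_upper (W : ℕ) (hW : 0 < W) (X : ℕ) :
    ∑ n ∈ (Icc 1 X).filter (fun n => n.Coprime W), (1:ℝ) / n ≤ (1 + Real.log W) + (W.totient / W : ℝ) * (1 + Real.log X) := by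
  have hblock : ∀ M : ℕ, ∑ n ∈ (Icc 1 (W * (M + 1))).filter (fun n => n.Coprime W), (1:ℝ) / n ≤ (1 + Real.log W) + (W.totient / W : ℝ) * ∑ q ∈ Icc 1 M, (1:ℝ) / q := by
    intro M
    induction M with
    | zero =>
      simp only [zero_add, mul_one]
      refine (Finset.sum_le_sum_of_subset_of_nonneg (Finset.filter_subset _ _) fun n _ _ => by positivity).trans ?_
      have := hs_le W
      simpa using this
    | succ M ih =>
      have hd : Icc 1 (W * (M + 1 + 1)) = Icc 1 (W * (M + 1)) ∪ Ico (W * (M + 1) + 1) (W * (M + 1) + 1 + W) := by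
        ext n
        simp only [mem_union, mem_Icc, mem_Ico]
        have : W * (M + 1 + 1) = W * (M + 1) + W := by ring
        rw [this]
        constructor
        · intro h; omega
        · intro h
          have := Nat.zero_le (W * (M + 1))
          omega
      rw [hd, filter_union, sum_union, Finset.sum_Icc_succ_top (by omega), mul_add (W.totient / W : ℝ), ← add_assoc]
      · refine add_le_add ih ?_
        calc ∑ n ∈ (Ico (W * (M + 1) + 1) (W * (M + 1) + 1 + W)).filter (fun n => n.Coprime W), (1:ℝ) / n
            ≤ ∑ n ∈ (Ico (W * (M + 1) + 1) (W * (M + 1) + 1 + W)).filter (fun n => n.Coprime W), (1:ℝ) / (W * (M + 1)) := by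
              refine Finset.sum_le_sum fun n hn => ?_
              have h1 := (mem_Ico.1 (mem_filter.1 hn).1).1
              have h2 : (W * (M + 1) : ℝ) ≤ n := by exact_mod_cast (by omega : W * (M + 1) ≤ n)
              have h3 : (0:ℝ) < W * (M + 1) := by positivity
              gcongr
          _ = _ := by
              have hc : ((Ico (W * (M + 1) + 1) (W * (M + 1) + 1 + W)).filter (fun n => n.Coprime W)).card = W.totient := by
                rw [← Nat.filter_coprime_Ico_eq_totient W (W * (M + 1) + 1)]
                congr 1
                ext n
                simp [Nat.coprime_comm]
              rw [Finset.sum_const, nsmul_eq_mul, hc]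
              push_cast
              field_simp
      · rw [Finset.disjoint_left]
        intro n h1 h2
        have h1 := (mem_Icc.1 (mem_filter.1 h1).1).2
        have h2 := (mem_Ico.1 (mem_filter.1 h2).1).1
        omega
  have h := hblock (X / W)
  have hX : X ≤ W * (X / W + 1) := (Nat.lt_mul_div_succ X hW).le
  refine le_trans (Finset.sum_le_sum_of_subset_of_nonneg (Finset.filter_subset_filter _ (Finset.Icc_subset_Icc_right hX)) fun n _ _ => by positivity) (h.trans ?_)
  have h2 : ∑ q ∈ Icc 1 (X / W), (1:ℝ) / q ≤ 1 + Real.log X := by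
    refine le_trans (Finset.sum_le_sum_of_subset_of_nonneg (Finset.Icc_subset_Icc_right (Nat.div_le_self X W)) fun n _ _ => by positivity) ?_
    exact hs_le X
  gcongr

open Finset in
lemma cop_lower (W : ℕ) (hW : 0 < W) (X : ℕ) (hX : 0 < X) :
    (W.totient / W : ℝ) * (Real.log X - Real.log W) ≤ ∑ n ∈ (Icc 1 X).filter (fun n => n.Coprime W), (1:ℝ) / n := by
  have hblock : ∀ M : ℕ, (W.totient / W : ℝ) * ∑ q ∈ Icc 1 M, (1:ℝ) / q ≤ ∑ n ∈ (Icc 1 (W * M)).filter (fun n => n.Coprime W), (1:ℝ) / n := by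
    intro M
    induction M with
    | zero => simp
    | succ M ih =>
      have hd : Icc 1 (W * (M + 1)) = Icc 1 (W * M) ∪ Ico (W * M + 1) (W * M + 1 + W) := by
        ext n
        simp only [mem_union, mem_Icc, mem_Ico]
        have : W * (M + 1) = W * M + W := by ring
        rw [this]
        constructor
        · intro h; omega
        · intro h
          have := Nat.zero_le (W * M)
          omega
      rw [hd, filter_union, sum_union, Finset.sum_Icc_succ_top (by omega), mul_add]
      · refine add_le_add ih ?_
        calc _ = ∑ n ∈ (Ico (W * M + 1) (W * M + 1 + W)).filter (fun n => n.Coprime W), (1:ℝ) / (W * (M + 1)) := by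
              have hc : ((Ico (W * M + 1) (W * M + 1 + W)).filter (fun n => n.Coprime W)).card = W.totient := by
                rw [← Nat.filter_coprime_Ico_eq_totient W (W * M + 1)]
                congr 1
                ext n
                simp [Nat.coprime_comm]
              rw [Finset.sum_const, nsmul_eq_mul, hc]
              push_cast
              field_simp
          _ ≤ ∑ n ∈ (Ico (W * M + 1) (W * M + 1 + W)).filter (fun n => n.Coprime W), (1:ℝ) / n := by
              refine Finset.sum_le_sum fun n hn => ?_
              have h1 := (mem_Ico.1 (mem_filter.1 hn).1)
              have h2 : (n:ℝ) ≤ (W * (M + 1) : ℝ) := by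
                have : W * (M + 1) = W * M + W := by ring
                exact_mod_cast (by omega : n ≤ W * (M + 1))
              have h3 : (0:ℝ) < n := by exact_mod_cast (by omega : 0 < n)
              gcongr
      · rw [Finset.disjoint_left]
        intro n h1 h2
        have h1 := (mem_Icc.1 (mem_filter.1 h1).1).2
        have h2 := (mem_Ico.1 (mem_filter.1 h2).1).1
        omega
  have h := hblock (X / W)
  have hXW : W * (X / W) ≤ X := Nat.mul_div_le X W
  refine le_trans ?_ (h.trans (Finset.sum_le_sum_of_subset_of_nonneg (Finset.filter_subset_filter _ (Finset.Icc_subset_Icc_right hXW)) fun n _ _ => by positivity))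
  have h1 : Real.log ((X / W : ℕ) + 1) ≤ ∑ q ∈ Icc 1 (X / W), (1:ℝ) / q := by
    have := log_add_one_le_harmonic (X / W)
    rw [harmonic_eq_sum_Icc] at this
    push_cast at this
    simpa [one_div] using this
  have h2 : Real.log X - Real.log W ≤ Real.log ((X / W : ℕ) + 1) := by
    have hW' : (0:ℝ) < W := by exact_mod_cast hW
    have hX' : (0:ℝ) < X := by exact_mod_cast hX
    rw [← Real.log_div hX'.ne' hW'.ne']
    refine Real.log_le_log (by positivity) ?_
    rw [div_le_iff₀ hW']
    have : X ≤ (X / W + 1) * W := by rw [mul_comm]; exact (Nat.lt_mul_div_succ X hW).le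
    exact_mod_cast this
  have : (0:ℝ) ≤ W.totient / W := by positivity
  exact mul_le_mul_of_nonneg_left (h2.trans h1) this

open Finset in
lemma sqf_lower (W X : ℕ) :
    ∑ n ∈ (Icc 1 X).filter (fun n => n.Coprime W), (1:ℝ) / n ≤ 2 * ∑ u ∈ (Icc 1 X).filter (fun u => Squarefree u ∧ u.Coprime W), (1:ℝ) / u := by
  choose a b h1 h2 using fun n : ℕ => Nat.sq_mul_squarefree n
  have hs : ∑ s ∈ Icc 1 X, (1:ℝ) / s ^ 2 ≤ 2 := by
    have := sum_Ioo_inv_sq_le (α := ℝ) 0 (X + 1)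
    have e : Ioo 0 (X + 1) = Icc 1 X := by ext; simp only [mem_Ioo, mem_Icc]; omega
    rw [e] at this
    simp only [one_div]
    refine this.trans ?_
    norm_num
  have hinj : ∀ n ∈ (Icc 1 X).filter (fun n => n.Coprime W), ∀ m ∈ (Icc 1 X).filter (fun n => n.Coprime W), (a n, b n) = (a m, b m) → n = m := by
    intro n _ m _ h
    rw [Prod.mk.injEq] at h
    rw [← h1 n, ← h1 m, h.1, h.2]
  have e1 : ∑ n ∈ (Icc 1 X).filter (fun n => n.Coprime W), (1:ℝ) / n = ∑ n ∈ (Icc 1 X).filter (fun n => n.Coprime W), (fun x : ℕ × ℕ => (1:ℝ) / x.1 * (1 / x.2 ^ 2)) (a n, b n) := by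
    refine Finset.sum_congr rfl fun n _ => ?_
    simp only
    conv_lhs => rw [← h1 n]
    push_cast
    rw [one_div_mul_one_div]
    congr 1; ring
  rw [e1, ← Finset.sum_image (f := fun x : ℕ × ℕ => (1:ℝ) / x.1 * (1 / x.2 ^ 2)) (g := fun n => (a n, b n)) hinj]
  refine (Finset.sum_le_sum_of_subset_of_nonneg (t := ((Icc 1 X).filter (fun u => Squarefree u ∧ u.Coprime W)) ×ˢ Icc 1 X) ?_ fun x _ _ => by positivity).trans ?_
  · intro x hx
    obtain ⟨n, hn, rfl⟩ := mem_image.1 hx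
    obtain ⟨hn1, hn2⟩ := mem_filter.1 hn
    obtain ⟨hn1, hn3⟩ := mem_Icc.1 hn1
    have ha : a n ∣ n := ⟨b n ^ 2, by rw [mul_comm]; exact (h1 n).symm⟩
    have hb : b n ∣ n := ⟨b n * a n, by conv_lhs => rw [← h1 n]
                                        ring⟩
    rw [mem_product, mem_filter, mem_Icc, mem_Icc]
    exact ⟨⟨⟨Nat.pos_of_dvd_of_pos ha hn1, (Nat.le_of_dvd hn1 ha).trans hn3⟩, h2 n, hn2.coprime_dvd_left ha⟩,
      Nat.pos_of_dvd_of_pos hb hn1, (Nat.le_of_dvd hn1 hb).trans hn3⟩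
  · rw [Finset.sum_product, ]
    simp_rw [← Finset.mul_sum]
    rw [← Finset.sum_mul, mul_comm]
    exact mul_le_mul_of_nonneg_right hs (Finset.sum_nonneg fun u _ => by positivity)

/-- sieving primes -/
def SS (W R : ℕ) : Finset ℕ := (Finset.Icc 1 R).filter fun p => p.Prime ∧ ¬ p ∣ W

lemma SS_prime {W R : ℕ} (p : SS W R) : (p:ℕ).Prime := (Finset.mem_filter.1 p.2).2.1
lemma SS_ndvd {W R : ℕ} (p : SS W R) : ¬ (p:ℕ) ∣ W := (Finset.mem_filter.1 p.2).2.2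
lemma SS_le {W R : ℕ} (p : SS W R) : (p:ℕ) ≤ R := (Finset.mem_Icc.1 (Finset.mem_filter.1 p.2).1).2

def eU {W R : ℕ} (U : Finset (SS W R)) : ℕ := ∏ p ∈ U, (p:ℕ)

noncomputable def av {W R : ℕ} (p : SS W R) : ℝ := ((p:ℕ):ℝ)

lemma nrm_eU {W R : ℕ} (U : Finset (SS W R)) : nrm av U = (eU U : ℝ) := by
  unfold nrm eU av; push_cast; rfl

lemma dvd_eU {W R : ℕ} (U : Finset (SS W R)) (q : ℕ) (hq : q.Prime) : q ∣ eU U ↔ ∃ p ∈ U, (p:ℕ) = q := by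
  unfold eU
  rw [Prime.dvd_finsetProd_iff hq.prime]
  constructor
  · rintro ⟨p, hp, h⟩
    exact ⟨p, hp, ((Nat.prime_dvd_prime_iff_eq hq (SS_prime p)).1 h).symm⟩
  · rintro ⟨p, hp, h⟩
    exact ⟨p, hp, h ▸ dvd_rfl⟩

lemma mem_eU {W R : ℕ} (U : Finset (SS W R)) (p : SS W R) : p ∈ U ↔ (p:ℕ) ∣ eU U := by
  rw [dvd_eU U p (SS_prime p)]
  constructor
  · intro h; exact ⟨p, h, rfl⟩
  · rintro ⟨q, hq, h⟩
    rwa [← Subtype.ext h]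

lemma eU_inj {W R : ℕ} : Function.Injective (eU : Finset (SS W R) → ℕ) := by
  intro U V h
  ext p
  rw [mem_eU, mem_eU, h]

lemma eU_pos {W R : ℕ} (U : Finset (SS W R)) : 0 < eU U := Finset.prod_pos fun p _ => (SS_prime p).pos

lemma eU_cop {W R : ℕ} (U : Finset (SS W R)) : (eU U).Coprime W := by
  unfold eU
  exact Nat.Coprime.prod_left fun p _ => (Nat.Prime.coprime_iff_not_dvd (SS_prime p)).2 (SS_ndvd p)

lemma eU_sqf {W R : ℕ} (U : Finset (SS W R)) : Squarefree (eU U) := by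
  induction U using Finset.induction_on with
  | empty => simp [eU]
  | insert p U hp ih =>
    have e : eU (insert p U) = p * eU U := Finset.prod_insert hp
    rw [e, Nat.squarefree_mul]
    · exact ⟨(SS_prime p).squarefree, ih⟩
    · rw [Nat.Prime.coprime_iff_not_dvd (SS_prime p), ← mem_eU]; exact hp

lemma eU_factors {W R : ℕ} (U : Finset (SS W R)) : (eU U).primeFactors.card = U.card := by
  rw [← Finset.card_map ⟨fun p : SS W R => (p:ℕ), Subtype.val_injective⟩ (s := U)]
  congr 1
  ext q
  rw [Nat.mem_primeFactors, Finset.mem_map]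
  constructor
  · rintro ⟨h1, h2, _⟩
    exact (dvd_eU U q h1).1 h2
  · rintro ⟨p, hp, rfl⟩
    exact ⟨SS_prime p, (mem_eU U p).1 hp, (eU_pos U).ne'⟩

lemma eU_surj {W R u : ℕ} (h1 : Squarefree u) (h2 : u.Coprime W) (h3 : u ≤ R) (h4 : 0 < u) : ∃ U : Finset (SS W R), eU U = u := by
  refine ⟨Finset.univ.filter fun p => (p:ℕ) ∣ u, ?_⟩
  have e : (Finset.univ.filter fun p : SS W R => (p:ℕ) ∣ u).map ⟨fun p : SS W R => (p:ℕ), Subtype.val_injective⟩ = u.primeFactors := by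
    ext q
    rw [Finset.mem_map, Nat.mem_primeFactors]
    constructor
    · rintro ⟨p, hp, rfl⟩
      exact ⟨SS_prime p, (Finset.mem_filter.1 hp).2, h4.ne'⟩
    · rintro ⟨hq, hd, _⟩
      have hW : ¬ q ∣ W := by
        intro h
        have := Nat.dvd_gcd hd h
        rw [h2] at this
        exact hq.one_lt.ne' (Nat.dvd_one.1 this)
      refine ⟨⟨q, Finset.mem_filter.2 ⟨Finset.mem_Icc.2 ⟨hq.pos, (Nat.le_of_dvd h4 hd).trans h3⟩, hq, hW⟩⟩, ?_, rfl⟩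
      exact Finset.mem_filter.2 ⟨Finset.mem_univ _, hd⟩
  conv_rhs => rw [← Nat.prod_primeFactors_of_squarefree h1, ← e, Finset.prod_map]
  rfl

open Finset in
lemma eU_sum {W R : ℕ} (z : ℝ) (hz : z ≤ R) (g : ℕ → ℝ) :
    ∑ U : Finset (SS W R) with nrm av U ≤ z, g (eU U) = ∑ u ∈ (Icc 1 ⌊z⌋₊).filter (fun u => Squarefree u ∧ u.Coprime W), g u := by
  rw [← Finset.sum_image (g := eU) (f := g) (fun x _ y _ h => eU_inj h)]
  refine Finset.sum_congr ?_ fun _ _ => rfl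
  ext u
  rw [mem_image, mem_filter, mem_Icc]
  constructor
  · rintro ⟨U, hU, rfl⟩
    have := (mem_filter.1 hU).2
    rw [nrm_eU] at this
    exact ⟨⟨eU_pos U, Nat.le_floor this⟩, eU_sqf U, eU_cop U⟩
  · rintro ⟨⟨h1, h2⟩, h3, h4⟩
    have h5 : (u:ℝ) ≤ z := (Nat.le_floor_iff' (by omega)).1 h2
    obtain ⟨U, rfl⟩ := eU_surj (R := R) h3 h4 (by exact_mod_cast h5.trans hz) h1
    refine ⟨U, mem_filter.2 ⟨mem_univ _, ?_⟩, rfl⟩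
    rw [nrm_eU]; exact h5

end ModPB3

section ModPB3b
open Filter Topology

lemma mono_sum_set {ι : Type} [Fintype ι] [DecidableEq ι] (G : Finset ι → ℝ) (g : ι → ℝ) (hG : ∀ U, 0 ≤ G U)
    (hmono : ∀ U V : Finset ι, U ⊆ V → G V ≤ G U) (hg : ∀ p, 0 ≤ g p) (V : Finset ι) :
    ∑ U : Finset ι with V ⊆ U, G U * ∏ q ∈ U, g q ≤ (∏ q ∈ V, g q) * ∑ U : Finset ι, G U * ∏ q ∈ U, g q := by
  have hV0 : 0 ≤ ∏ q ∈ V, g q := Finset.prod_nonneg fun q _ => hg q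
  calc ∑ U : Finset ι with V ⊆ U, G U * ∏ q ∈ U, g q
      ≤ ∑ U : Finset ι with V ⊆ U, (∏ q ∈ V, g q) * (G (U \ V) * ∏ q ∈ U \ V, g q) := by
        refine Finset.sum_le_sum fun U hU => ?_
        have hp : V ⊆ U := (Finset.mem_filter.1 hU).2
        rw [← Finset.prod_sdiff hp]
        have := hmono (U \ V) U Finset.sdiff_subset
        have h2 : 0 ≤ (∏ q ∈ U \ V, g q) * ∏ q ∈ V, g q := mul_nonneg (Finset.prod_nonneg fun q _ => hg q) hV0
        calc _ ≤ G (U \ V) * ((∏ q ∈ U \ V, g q) * ∏ q ∈ V, g q) := mul_le_mul_of_nonneg_right this h2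
          _ = _ := by ring
    _ = (∏ q ∈ V, g q) * ∑ U : Finset ι with V ⊆ U, (G (U \ V) * ∏ q ∈ U \ V, g q) := by rw [Finset.mul_sum]
    _ ≤ _ := by
        refine mul_le_mul_of_nonneg_left ?_ hV0
        rw [← Finset.sum_image (s := Finset.univ.filter fun U : Finset ι => V ⊆ U) (g := fun U => U \ V) (f := fun U => G U * ∏ q ∈ U, g q)]
        · exact Finset.sum_le_sum_of_subset_of_nonneg (Finset.subset_univ _) fun U _ _ => mul_nonneg (hG U) (Finset.prod_nonneg fun q _ => hg q)
        · intro U hU U' hU' h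
          have hU : V ⊆ U := by simpa using hU
          have hU' : V ⊆ U' := by simpa using hU'
          simp only at h
          rw [← Finset.sdiff_union_of_subset hU, ← Finset.sdiff_union_of_subset hU', h]

lemma super_sum {ι : Type} [Fintype ι] [DecidableEq ι] (G : Finset ι → ℝ) (b g : ι → ℝ) (hG : ∀ U, 0 ≤ G U)
    (hmono : ∀ U V : Finset ι, U ⊆ V → G V ≤ G U) (hb : ∀ p, 0 ≤ b p) (hg : ∀ p, 0 ≤ g p) :
    ∑ U : Finset ι, G U * ∏ q ∈ U, (b q * (1 + g q)) ≤ (∏ q, (1 + b q * g q)) * ∑ U : Finset ι, G U * ∏ q ∈ U, b q := by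
  have e : ∀ U : Finset ι, G U * ∏ q ∈ U, (b q * (1 + g q)) = ∑ V : Finset ι, (∏ q ∈ V, g q) * (if V ⊆ U then G U * ∏ q ∈ U, b q else 0) := by
    intro U
    rw [Finset.prod_mul_distrib, Finset.prod_one_add]
    simp_rw [mul_ite, mul_zero]
    rw [← Finset.sum_filter]
    have : Finset.univ.filter (fun V => V ⊆ U) = U.powerset := by ext; simp
    rw [this, ← mul_assoc, Finset.mul_sum]
    exact Finset.sum_congr rfl fun V _ => mul_comm _ _
  simp_rw [e]
  rw [Finset.sum_comm]
  calc _ ≤ ∑ V : Finset ι, (∏ q ∈ V, g q) * ((∏ q ∈ V, b q) * ∑ U : Finset ι, G U * ∏ q ∈ U, b q) := by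
        refine Finset.sum_le_sum fun V _ => ?_
        rw [← Finset.mul_sum, ← Finset.sum_filter]
        exact mul_le_mul_of_nonneg_left (mono_sum_set G b hG hmono hb V) (Finset.prod_nonneg fun q _ => hg q)
    _ = _ := by
        rw [Finset.prod_one_add, Finset.sum_mul, Finset.powerset_univ]
        refine Finset.sum_congr rfl fun V _ => ?_
        rw [Finset.prod_mul_distrib]; ring

lemma av_ge {W R : ℕ} (h2 : 2 ∣ W) (p : SS W R) : 3 ≤ av p := by
  unfold av
  have h := (SS_prime p).two_le
  have : (p:ℕ) ≠ 2 := fun h => SS_ndvd p (h ▸ h2)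
  exact_mod_cast (by omega : 3 ≤ (p:ℕ))

lemma sum_SS_sq (W R : ℕ) : ∑ p : SS W R, 1 / av p ^ 2 ≤ 2 := by
  have hs : ∑ s ∈ Finset.Icc 1 R, (1:ℝ) / s ^ 2 ≤ 2 := by
    have := sum_Ioo_inv_sq_le (α := ℝ) 0 (R + 1)
    have e : Finset.Ioo 0 (R + 1) = Finset.Icc 1 R := by ext; simp only [Finset.mem_Ioo, Finset.mem_Icc]; omega
    rw [e] at this
    simp only [one_div]
    refine this.trans ?_
    norm_num
  refine le_trans ?_ hs
  unfold av
  rw [Finset.sum_coe_sort (SS W R) (fun p => (1:ℝ) / p ^ 2)]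
  exact Finset.sum_le_sum_of_subset_of_nonneg (Finset.filter_subset _ _) fun p _ _ => by positivity

lemma nrm_mono {W R : ℕ} {U V : Finset (SS W R)} (h : U ⊆ V) : nrm av U ≤ nrm av V := by
  rw [nrm_eU, nrm_eU]
  have : eU U ∣ eU V := Finset.prod_dvd_prod_of_subset _ _ _ h
  exact_mod_cast Nat.le_of_dvd (eU_pos V) this

theorem H_bounds (W : ℕ) (hW : 0 < W) (h2 : 2 ∣ W) : ∃ z0 : ℝ, 1 ≤ z0 ∧ ∀ z ≥ z0, ∀ R : ℕ, z ≤ R →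
    1 / 8 * (W.totient / W : ℝ) * Real.log z ≤ ∑ U : Finset (SS W R) with nrm av U ≤ z, ∏ p ∈ U, (1 / (av p - 1)) ∧
    ∑ U : Finset (SS W R) with nrm av U ≤ z, ∏ p ∈ U, (av p / (av p - 1) ^ 2) ≤ 3 * Real.exp 8 * (W.totient / W : ℝ) * Real.log z := by
  set h0 : ℝ := W.totient / W with hh0
  have hh : 0 < h0 := by
    have : 0 < W.totient := Nat.totient_pos.2 hW
    positivity
  have hlW : 0 ≤ Real.log W := Real.log_natCast_nonneg W
  set T := max 1 (max (2 * (Real.log 2 + Real.log W)) ((1 + Real.log W) / h0)) with hT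
  refine ⟨Real.exp T, ?_, ?_⟩
  · exact Real.one_le_exp (le_trans zero_le_one (le_max_left _ _))
  intro z hz R hzR
  have hz0 : 0 < z := lt_of_lt_of_le (Real.exp_pos _) hz
  have hlz : T ≤ Real.log z := by rw [Real.le_log_iff_exp_le hz0]; exact hz
  have hl1 : 1 ≤ Real.log z := (le_max_left _ _).trans hlz
  have hl2 : 2 * (Real.log 2 + Real.log W) ≤ Real.log z := ((le_max_left _ _).trans (le_max_right _ _)).trans hlz
  have hl3 : 1 + Real.log W ≤ h0 * Real.log z := by
    have : (1 + Real.log W) / h0 ≤ Real.log z := ((le_max_right _ _).trans (le_max_right _ _)).trans hlz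
    rw [div_le_iff₀ hh] at this
    linarith
  have hz1 : 1 ≤ z := by
    rw [← Real.exp_log hz0]
    exact Real.one_le_exp (by linarith)
  have hfl : 0 < ⌊z⌋₊ := Nat.floor_pos.2 hz1
  have hinv : ∀ U : Finset (SS W R), ∏ p ∈ U, (1 / av p) = (fun u : ℕ => (1:ℝ) / u) (eU U) := by
    intro U
    simp only
    rw [← nrm_eU]
    unfold nrm
    rw [Finset.prod_div_distrib, Finset.prod_const_one]
  have esum := eU_sum (W := W) (R := R) z hzR (fun u : ℕ => (1:ℝ) / u)
  constructor
  · calc 1 / 8 * h0 * Real.log z ≤ 1 / 2 * (h0 * (Real.log ⌊z⌋₊ - Real.log W)) := by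
          have h3 : Real.log z - Real.log 2 ≤ Real.log ⌊z⌋₊ := by
            rw [← Real.log_div hz0.ne' (by norm_num)]
            refine Real.log_le_log (by positivity) ?_
            have h4 := Nat.lt_floor_add_one z
            have h5 : (1:ℝ) ≤ ⌊z⌋₊ := by exact_mod_cast hfl
            linarith
          have h6 : Real.log z / 2 ≤ Real.log ⌊z⌋₊ - Real.log W := by linarith
          have := mul_le_mul_of_nonneg_left h6 hh.le
          nlinarith
      _ ≤ 1 / 2 * (2 * ∑ u ∈ (Finset.Icc 1 ⌊z⌋₊).filter (fun u => Squarefree u ∧ u.Coprime W), (1:ℝ) / u) :=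
          mul_le_mul_of_nonneg_left ((cop_lower W hW _ hfl).trans (sqf_lower W _)) (by norm_num)
      _ = ∑ U : Finset (SS W R) with nrm av U ≤ z, (fun u : ℕ => (1:ℝ) / u) (eU U) := by rw [esum]; ring
      _ ≤ _ := by
          refine Finset.sum_le_sum fun U _ => ?_
          rw [← hinv]
          refine Finset.prod_le_prod (fun p _ => ?_) fun p _ => ?_
          · have := av_ge h2 p
            positivity
          · have := av_ge h2 p
            have : 0 < av p - 1 := by linarith
            gcongr
            linarith
  · have hsup := super_sum (fun U : Finset (SS W R) => if nrm av U ≤ z then (1:ℝ) else 0) (fun p => 1 / av p) (fun p => av p ^ 2 / (av p - 1) ^ 2 - 1)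
      (fun U => by split_ifs <;> norm_num) (fun U V h => by
        
        split_ifs with h1 h2 h2
        · exact le_rfl
        · exact absurd ((nrm_mono h).trans h1) h2
        · norm_num
        · exact le_rfl) (fun p => by have := av_ge h2 p; positivity)
      (fun p => by
        have := av_ge h2 p
        have h3 : 0 < av p - 1 := by linarith
        rw [sub_nonneg, le_div_iff₀ (by positivity)]
        nlinarith)
    have hP : ∏ q : SS W R, (1 + 1 / av q * (av q ^ 2 / (av q - 1) ^ 2 - 1)) ≤ Real.exp 8 := by
      calc _ ≤ ∏ q : SS W R, Real.exp (4 * (1 / av q ^ 2)) := by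
            refine Finset.prod_le_prod (fun q _ => ?_) fun q _ => ?_
            · have := av_ge h2 q
              have h3 : 0 < av q - 1 := by linarith
              have h4 : 0 ≤ av q ^ 2 / (av q - 1) ^ 2 - 1 := by
                rw [sub_nonneg, le_div_iff₀ (by positivity)]
                nlinarith
              positivity
            · have h5 := av_ge h2 q
              have h3 : 0 < av q - 1 := by linarith
              have h6 : 0 < av q := by linarith
              refine le_trans ?_ (Real.add_one_le_exp _)
              rw [add_comm]
              refine add_le_add ?_ le_rfl
              have e : 1 / av q * (av q ^ 2 / (av q - 1) ^ 2 - 1) = (2 * av q - 1) / (av q * (av q - 1) ^ 2) := by field_simp; ring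
              rw [e, mul_one_div, div_le_div_iff₀ (by positivity) (by positivity)]
              have : 0 ≤ av q * (2 * av q ^ 2 - 7 * av q + 4) := mul_nonneg h6.le (by nlinarith)
              nlinarith
        _ = Real.exp (4 * ∑ q : SS W R, 1 / av q ^ 2) := by rw [← Real.exp_sum, Finset.mul_sum]
        _ ≤ Real.exp 8 := Real.exp_le_exp.2 (by linarith [sum_SS_sq W R])
    have e1 : ∑ U : Finset (SS W R) with nrm av U ≤ z, ∏ p ∈ U, (av p / (av p - 1) ^ 2) =
        ∑ U : Finset (SS W R), (if nrm av U ≤ z then (1:ℝ) else 0) * ∏ q ∈ U, (1 / av q * (1 + (av q ^ 2 / (av q - 1) ^ 2 - 1))) := by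
      rw [Finset.sum_filter]
      refine Finset.sum_congr rfl fun U _ => ?_
      split_ifs
      · rw [one_mul]
        refine Finset.prod_congr rfl fun q _ => ?_
        have h5 := av_ge h2 q
        have h6 : 0 < av q := by linarith
        field_simp
        ring
      · rw [zero_mul]
    have e2 : ∑ U : Finset (SS W R), (if nrm av U ≤ z then (1:ℝ) else 0) * ∏ q ∈ U, (1 / av q) ≤ 3 * (h0 * Real.log z) := by
      have e3 : ∑ U : Finset (SS W R), (if nrm av U ≤ z then (1:ℝ) else 0) * ∏ q ∈ U, (1 / av q) = ∑ U : Finset (SS W R) with nrm av U ≤ z, (fun u : ℕ => (1:ℝ) / u) (eU U) := by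
        rw [Finset.sum_filter]
        refine Finset.sum_congr rfl fun U _ => ?_
        rw [hinv]
        split_ifs <;> simp
      rw [e3, esum]
      calc _ ≤ ∑ n ∈ (Finset.Icc 1 ⌊z⌋₊).filter (fun n => n.Coprime W), (1:ℝ) / n := by
            refine Finset.sum_le_sum_of_subset_of_nonneg ?_ fun _ _ _ => by positivity
            intro u hu
            rw [Finset.mem_filter] at hu ⊢
            exact ⟨hu.1, hu.2.2⟩
        _ ≤ _ := cop_upper W hW _
        _ ≤ 3 * (h0 * Real.log z) := by
            have h7 : Real.log ⌊z⌋₊ ≤ Real.log z := Real.log_le_log (by exact_mod_cast hfl) (Nat.floor_le hz0.le)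
            have h8 : h0 * (1 + Real.log ⌊z⌋₊) ≤ h0 * (2 * Real.log z) := mul_le_mul_of_nonneg_left (by linarith) hh.le
            linarith
    rw [e1]
    refine hsup.trans ?_
    have h9 : 0 ≤ ∑ U : Finset (SS W R), (if nrm av U ≤ z then (1:ℝ) else 0) * ∏ q ∈ U, (1 / av q) :=
      Finset.sum_nonneg fun U _ => mul_nonneg (by split_ifs <;> norm_num) (Finset.prod_nonneg fun q _ => by have := av_ge h2 q; positivity)
    calc _ ≤ Real.exp 8 * (3 * (h0 * Real.log z)) := mul_le_mul hP e2 h9 (Real.exp_pos _).le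
      _ = _ := by ring

end ModPB3b

section ModPB3c
open Filter Topology

noncomputable def FJ {ι : Type} (a : ι → ℝ) (ell : ℝ) (J : ℕ) (U : Finset ι) : ℝ :=
  ∑ j ∈ Finset.range (J+1), (1/2:ℝ)^j * (if nrm a U ≤ Real.exp (2^j*ell) then 1 else 0)

lemma half_sum (x : ℕ → ℝ) (hx : ∀ j, x j = 0 ∨ x j = 1) (n : ℕ) :
    0 ≤ ∑ j ∈ Finset.range n, (1/2:ℝ)^j * x j ∧ ∑ j ∈ Finset.range n, (1/2:ℝ)^j * x j ≤ 2 := by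
  have h0 : ∀ j, 0 ≤ x j ∧ x j ≤ 1 := fun j => by rcases hx j with h | h <;> rw [h] <;> norm_num
  constructor
  · exact Finset.sum_nonneg fun j _ => mul_nonneg (by positivity) (h0 j).1
  · calc _ ≤ ∑ j ∈ Finset.range n, (1/2:ℝ)^j := Finset.sum_le_sum fun j _ => by
          have := (h0 j).2
          have h : (0:ℝ) ≤ (1/2:ℝ)^j := by positivity
          nlinarith
      _ ≤ 2 := sum_geometric_two_le n

lemma half_sq (n : ℕ) : ∀ (x : ℕ → ℝ) (_ : ∀ j, x j = 0 ∨ x j = 1),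
    (∑ j ∈ Finset.range n, (1/2:ℝ)^j * x j)^2 ≤ 4 * ∑ j ∈ Finset.range n, (1/4:ℝ)^j * x j := by
  induction n with
  | zero => intro x _; simp
  | succ n ih =>
    intro x hx
    rcases hx 0 with h | h
    · rw [Finset.sum_range_succ', Finset.sum_range_succ']
      have := ih (fun j => x (j+1)) (fun j => hx _)
      have e1 : ∑ j ∈ Finset.range n, (1/2:ℝ)^(j+1) * x (j+1) = 1/2 * ∑ j ∈ Finset.range n, (1/2:ℝ)^j * x (j+1) := by
        rw [Finset.mul_sum]; exact Finset.sum_congr rfl fun j _ => by ring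
      have e2 : ∑ j ∈ Finset.range n, (1/4:ℝ)^(j+1) * x (j+1) = 1/4 * ∑ j ∈ Finset.range n, (1/4:ℝ)^j * x (j+1) := by
        rw [Finset.mul_sum]; exact Finset.sum_congr rfl fun j _ => by ring
      rw [e1, e2, h]
      nlinarith
    · have h1 := half_sum x hx (n+1)
      have h2 : 1 ≤ ∑ j ∈ Finset.range (n+1), (1/4:ℝ)^j * x j := by
        have := Finset.single_le_sum (s := Finset.range (n+1)) (f := fun j => (1/4:ℝ)^j * x j) (fun j _ => by
          have : 0 ≤ x j := by rcases hx j with h | h <;> rw [h]; norm_num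
          positivity) (Finset.mem_range.2 (Nat.succ_pos n))
        simpa [h] using this
      nlinarith [h1.1, h1.2]

section
variable {ι : Type} [Fintype ι] [DecidableEq ι]

lemma swap_sum (a : ι → ℝ) (ell : ℝ) (J : ℕ) (c : ℕ → ℝ) (g : Finset ι → ℝ) :
    ∑ U : Finset ι, (∑ j ∈ Finset.range (J+1), c j * (if nrm a U ≤ Real.exp (2^j*ell) then (1:ℝ) else 0)) * g U
    = ∑ j ∈ Finset.range (J+1), c j * ∑ U : Finset ι with nrm a U ≤ Real.exp (2^j*ell), g U := by
  simp_rw [Finset.sum_mul]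
  rw [Finset.sum_comm]
  refine Finset.sum_congr rfl fun j _ => ?_
  rw [Finset.sum_filter, Finset.mul_sum]
  refine Finset.sum_congr rfl fun U _ => ?_
  split_ifs <;> ring

lemma A_core (a : ι → ℝ) (ha : ∀ p, 3 ≤ a p) (ell h0 Cc : ℝ) (hell : 0 < ell) (hh : 0 < h0) (hCc : 0 < Cc) (J : ℕ)
    (H1 : ∀ j ∈ Finset.range (J+1), 1/8*h0*(2^j*ell) ≤ ∑ U : Finset ι with nrm a U ≤ Real.exp (2^j*ell), ∏ p ∈ U, (1/(a p-1)))
    (H2 : ∀ j ∈ Finset.range (J+1), ∑ U : Finset ι with nrm a U ≤ Real.exp (2^j*ell), ∏ p ∈ U, (a p/(a p-1)^2) ≤ Cc*h0*(2^j*ell)) :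
    1/8*h0*ell*(J+1) ≤ ∑ U : Finset ι, FJ a ell J U * ∏ p ∈ U, (1/(a p-1)) ∧
    1/8*h0*ell ≤ ∑ U : Finset ι, FJ a ell J U^2 * ∏ p ∈ U, (a p/(a p-1)^2) ∧
    ∑ U : Finset ι, FJ a ell J U^2 * ∏ p ∈ U, (a p/(a p-1)^2) ≤ 8*Cc*h0*ell ∧
    ∑ U : Finset ι, FJ a ell J U^2 * (∏ p ∈ U, (a p/(a p-1)^2)) * (∑ p ∈ U, Real.log (a p)) ≤ 4*Cc*h0*ell^2*(J+1) := by
  have hx : ∀ U : Finset ι, ∀ j : ℕ, (if nrm a U ≤ Real.exp (2^j*ell) then (1:ℝ) else 0) = 0 ∨ (if nrm a U ≤ Real.exp (2^j*ell) then (1:ℝ) else 0) = 1 := by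
    intro U j; split_ifs <;> simp
  have hg : ∀ U : Finset ι, 0 ≤ ∏ p ∈ U, (a p/(a p-1)^2) := fun U => Finset.prod_nonneg fun p _ => by
    have := ha p; positivity
  have hsq : ∀ U : Finset ι, FJ a ell J U^2 ≤ ∑ j ∈ Finset.range (J+1), (4*(1/4:ℝ)^j) * (if nrm a U ≤ Real.exp (2^j*ell) then (1:ℝ) else 0) := by
    intro U
    refine (half_sq (J+1) _ (hx U)).trans (le_of_eq ?_)
    rw [Finset.mul_sum]; exact Finset.sum_congr rfl fun j _ => by ring
  have h24 : ∀ j:ℕ, (1/4:ℝ)^j * 2^j = (1/2)^j := fun j => by rw [← mul_pow]; norm_num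
  have h22 : ∀ j:ℕ, (1/2:ℝ)^j * 2^j = 1 := fun j => by rw [← mul_pow]; norm_num
  refine ⟨?_, ?_, ?_, ?_⟩
  · unfold FJ
    rw [swap_sum a ell J (fun j => (1/2:ℝ)^j)]
    calc 1/8*h0*ell*(J+1) = ∑ j ∈ Finset.range (J+1), (1/2:ℝ)^j * (1/8*h0*(2^j*ell)) := by
          rw [Finset.sum_congr rfl (g := fun _ => 1/8*h0*ell) (fun j _ => by linear_combination (1/8*h0*ell)*h22 j)]
          simp; ring
      _ ≤ _ := Finset.sum_le_sum fun j hj => mul_le_mul_of_nonneg_left (H1 j hj) (by positivity)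
  · have := H1 0 (by simp)
    calc 1/8*h0*ell ≤ ∑ U : Finset ι with nrm a U ≤ Real.exp (2^0*ell), ∏ p ∈ U, (1/(a p-1)) := by simpa using this
      _ ≤ ∑ U : Finset ι with nrm a U ≤ Real.exp (2^0*ell), FJ a ell J U^2 * ∏ p ∈ U, (a p/(a p-1)^2) := by
          refine Finset.sum_le_sum fun U hU => ?_
          have hU := (Finset.mem_filter.1 hU).2
          have h1 : 1 ≤ FJ a ell J U := by
            have := Finset.single_le_sum (s := Finset.range (J+1)) (f := fun j => (1/2:ℝ)^j * (if nrm a U ≤ Real.exp (2^j*ell) then (1:ℝ) else 0)) (fun j _ => by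
              rcases hx U j with h | h <;> rw [h] <;> positivity) (Finset.mem_range.2 (Nat.succ_pos J))
            refine le_trans (le_of_eq ?_) this
            rw [if_pos hU]; norm_num
          calc ∏ p ∈ U, (1/(a p-1)) ≤ ∏ p ∈ U, (a p/(a p-1)^2) := by
                refine Finset.prod_le_prod (fun p _ => ?_) fun p _ => ?_
                · have := ha p
                  have : 0 < a p - 1 := by linarith
                  positivity
                · have := ha p
                  have : 0 < a p - 1 := by linarith
                  rw [div_le_div_iff₀ (by positivity) (by positivity)]
                  nlinarith
            _ ≤ _ := le_mul_of_one_le_left (hg U) (by nlinarith)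
      _ ≤ _ := Finset.sum_le_sum_of_subset_of_nonneg (Finset.filter_subset _ _) fun U _ _ => mul_nonneg (sq_nonneg _) (hg U)
  · calc _ ≤ ∑ U : Finset ι, (∑ j ∈ Finset.range (J+1), (4*(1/4:ℝ)^j) * (if nrm a U ≤ Real.exp (2^j*ell) then (1:ℝ) else 0)) * ∏ p ∈ U, (a p/(a p-1)^2) :=
          Finset.sum_le_sum fun U _ => mul_le_mul_of_nonneg_right (hsq U) (hg U)
      _ = _ := swap_sum a ell J (fun j => 4*(1/4:ℝ)^j) _
      _ ≤ ∑ j ∈ Finset.range (J+1), (4*(1/4:ℝ)^j) * (Cc*h0*(2^j*ell)) := Finset.sum_le_sum fun j hj => mul_le_mul_of_nonneg_left (H2 j hj) (by positivity)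
      _ = 4*Cc*h0*ell * ∑ j ∈ Finset.range (J+1), (1/2:ℝ)^j := by
          rw [Finset.mul_sum]
          exact Finset.sum_congr rfl fun j _ => by linear_combination (4*Cc*h0*ell)*h24 j
      _ ≤ 4*Cc*h0*ell * 2 := mul_le_mul_of_nonneg_left (sum_geometric_two_le _) (by positivity)
      _ = _ := by ring
  · have hlog : ∀ U : Finset ι, ∑ p ∈ U, Real.log (a p) = Real.log (nrm a U) := fun U => by
      unfold nrm
      rw [Real.log_prod]
      intro p _
      have := ha p
      positivity
    have hn1 : ∀ U : Finset ι, 1 ≤ nrm a U := fun U => by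
      unfold nrm
      have := Finset.prod_le_prod (s := U) (f := fun _ => (1:ℝ)) (g := a) (fun _ _ => by norm_num) (fun p _ => by linarith [ha p])
      simpa using this
    calc _ ≤ ∑ U : Finset ι, (∑ j ∈ Finset.range (J+1), (4*(1/4:ℝ)^j) * (if nrm a U ≤ Real.exp (2^j*ell) then (1:ℝ) else 0)) * ((∏ p ∈ U, (a p/(a p-1)^2)) * Real.log (nrm a U)) := by
          refine Finset.sum_le_sum fun U _ => ?_
          rw [mul_assoc, hlog]
          exact mul_le_mul_of_nonneg_right (hsq U) (mul_nonneg (hg U) (Real.log_nonneg (hn1 U)))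
      _ = _ := swap_sum a ell J (fun j => 4*(1/4:ℝ)^j) _
      _ ≤ ∑ j ∈ Finset.range (J+1), (4*(1/4:ℝ)^j) * (Cc*h0*(2^j*ell)*(2^j*ell)) := by
          refine Finset.sum_le_sum fun j hj => mul_le_mul_of_nonneg_left ?_ (by positivity)
          calc _ ≤ ∑ U : Finset ι with nrm a U ≤ Real.exp (2^j*ell), (∏ p ∈ U, (a p/(a p-1)^2)) * (2^j*ell) := by
                refine Finset.sum_le_sum fun U hU => mul_le_mul_of_nonneg_left ?_ (hg U)
                rw [Real.log_le_iff_le_exp (by linarith [hn1 U])]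
                exact (Finset.mem_filter.1 hU).2
            _ ≤ _ := by
                rw [← Finset.sum_mul]
                exact mul_le_mul_of_nonneg_right (H2 j hj) (by positivity)
      _ = ∑ j ∈ Finset.range (J+1), 4*Cc*h0*ell^2 := by
          refine Finset.sum_congr rfl fun j _ => ?_
          have : (1/4:ℝ)^j*2^j*2^j = 1 := by rw [h24, h22]
          linear_combination (4*Cc*h0*ell^2)*this
      _ = _ := by simp; ring
end

noncomputable def Cc : ℝ := 3*Real.exp 8
noncomputable def Kc : ℝ := 768*Cc
noncomputable def c0 : ℝ := 1/(512*Cc*Kc)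

lemma Cc_pos : 0 < Cc := by unfold Cc; positivity
lemma Cc_ge : 1 ≤ Cc := by unfold Cc; nlinarith [Real.add_one_le_exp 8]
lemma Kc_pos : 0 < Kc := by unfold Kc; linarith [Cc_pos]
lemma c0_pos : 0 < c0 := by unfold c0; have := Cc_pos; have := Kc_pos; positivity

lemma A_bounds (W : ℕ) (hW : 0 < W) (h2 : 2 ∣ W) (J : ℕ) : ∃ R0 : ℕ, ∀ R : ℕ, R0 ≤ R →
    ∃ (F : Finset (SS W R) → ℝ) (Z Λ : ℝ), (∀ U, 0 ≤ F U) ∧ (∀ U, F U ≤ 2) ∧ (∀ U V, U ⊆ V → F V ≤ F U) ∧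
      (∀ U, F U ≠ 0 → nrm av U ≤ Z) ∧ Real.exp Λ * Z ≤ R ∧ 0 < Λ ∧
      12*((2^J:ℕ):ℝ)*∑ U : Finset (SS W R), F U^2*(∏ p ∈ U,(av p/(av p-1)^2))*(∑ p ∈ U, Real.log (av p)) ≤ Λ*∑ U : Finset (SS W R), F U^2*∏ p ∈ U,(av p/(av p-1)^2) ∧
      1 ≤ ∑ U : Finset (SS W R), F U^2*∏ p ∈ U,(av p/(av p-1)^2) ∧
      c0*(J+1)*Real.log R*((W.totient:ℝ)/W)*(∑ U : Finset (SS W R), F U^2*∏ p ∈ U,(av p/(av p-1)^2)) ≤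
        ((2^J:ℕ):ℝ)*(∑ U : Finset (SS W R), F U*∏ p ∈ U,(1/(av p-1)))^2 := by
  obtain ⟨z0, hz0, H⟩ := H_bounds W hW h2
  set h0 : ℝ := (W.totient:ℝ)/W with hh0
  have hh : 0 < h0 := by
    have : 0 < W.totient := Nat.totient_pos.2 hW
    positivity
  set k : ℝ := ((2^J:ℕ):ℝ) with hk
  have hk1 : 1 ≤ k := by rw [hk]; exact_mod_cast Nat.one_le_two_pow
  have hkJ : k = 2^J := by rw [hk]; push_cast; rfl
  have hC := Cc_ge
  have hK := Kc_pos
  have hK768 : 768 ≤ Kc := by unfold Kc; linarith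
  set D : ℝ := Kc*k*(J+1) with hD
  have hDk : 768*k ≤ D := by
    have hJ : (0:ℝ) ≤ J := Nat.cast_nonneg J
    rw [hD]
    calc 768*k ≤ Kc*k := by gcongr
      _ ≤ Kc*k*(J+1) := le_mul_of_one_le_right (by positivity) (by linarith)
  have hD0 : 0 < D := by linarith
  have ht : Tendsto (fun R : ℕ => Real.log R / D) atTop atTop :=
    (Real.tendsto_log_atTop.comp tendsto_natCast_atTop_atTop).atTop_div_const hD0
  obtain ⟨R0, hR0⟩ := eventually_atTop.1 ((ht.eventually_ge_atTop (Real.log z0)).and ((ht.eventually_ge_atTop (8/h0)).and (eventually_ge_atTop 2)))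
  refine ⟨R0, fun R hR => ?_⟩
  obtain ⟨hl1, hl2, hR2⟩ := hR0 R hR
  have hRpos : (0:ℝ) < R := by exact_mod_cast (by omega : 0 < R)
  set ell : ℝ := Real.log R / D with hell
  have hlog : 0 < Real.log R := Real.log_pos (by exact_mod_cast (by omega : 1 < R))
  have hellpos : 0 < ell := by positivity
  have hellD : ell * D = Real.log R := by rw [hell]; field_simp
  have hkl : k*ell ≤ Real.log R / 2 := by nlinarith
  have hz : ∀ j ∈ Finset.range (J+1), z0 ≤ Real.exp (2^j*ell) ∧ Real.exp (2^j*ell) ≤ R := by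
    intro j hj
    have hj := Finset.mem_range.1 hj
    have h1 : (1:ℝ) ≤ 2^j := one_le_pow₀ (by norm_num)
    have h3 : (2:ℝ)^j ≤ k := by rw [hkJ]; exact pow_le_pow_right₀ (by norm_num) (by omega)
    constructor
    · rw [← Real.log_le_iff_le_exp (by linarith)]; nlinarith
    · rw [← Real.le_log_iff_exp_le hRpos]; nlinarith
  obtain ⟨B1, B2, B3, B4⟩ := A_core (ι := SS W R) av (fun p => av_ge h2 p) ell h0 Cc hellpos hh Cc_pos J
    (fun j hj => by
      have := (H _ (hz j hj).1 R (hz j hj).2).1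
      rwa [Real.log_exp] at this)
    (fun j hj => by
      have := (H _ (hz j hj).1 R (hz j hj).2).2
      rw [Real.log_exp] at this
      exact this)
  have hx : ∀ U : Finset (SS W R), ∀ j : ℕ, (if nrm av U ≤ Real.exp (2^j*ell) then (1:ℝ) else 0) = 0 ∨ (if nrm av U ≤ Real.exp (2^j*ell) then (1:ℝ) else 0) = 1 := by
    intro U j; split_ifs <;> simp
  refine ⟨FJ av ell J, Real.exp (k*ell), Real.log R - k*ell, fun U => (half_sum _ (hx U) _).1, fun U => (half_sum _ (hx U) _).2, ?_, ?_, ?_, ?_, ?_, ?_, ?_⟩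
  · intro U V hUV
    unfold FJ
    refine Finset.sum_le_sum fun j _ => mul_le_mul_of_nonneg_left ?_ (by positivity)
    split_ifs with h1 h2 h2
    · exact le_rfl
    · exact absurd ((nrm_mono hUV).trans h1) h2
    · norm_num
    · exact le_rfl
  · intro U hU
    by_contra hcon
    push Not at hcon
    apply hU
    unfold FJ
    refine Finset.sum_eq_zero fun j hj => ?_
    have hj := Finset.mem_range.1 hj
    rw [if_neg, mul_zero]
    push Not
    refine lt_of_le_of_lt ?_ hcon
    refine Real.exp_le_exp.2 (mul_le_mul_of_nonneg_right ?_ hellpos.le)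
    rw [hkJ]; exact pow_le_pow_right₀ (by norm_num) (by omega)
  · rw [← Real.exp_add, sub_add_cancel, Real.exp_log hRpos]
  · linarith
  · have hL : Real.log R/2 ≤ Real.log R - k*ell := by linarith
    have e : 12*k*(4*Cc*h0*ell^2*(J+1)) = Real.log R/2*(1/8*h0*ell) := by
      rw [← hellD, hD, Kc]; ring
    calc _ ≤ 12*k*(4*Cc*h0*ell^2*(J+1)) := mul_le_mul_of_nonneg_left B4 (by positivity)
      _ = Real.log R/2*(1/8*h0*ell) := e
      _ ≤ _ := mul_le_mul hL B2 (by positivity) (by linarith)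
  · refine le_trans ?_ B2
    rw [div_le_iff₀ hh] at hl2
    linarith
  · have hc0 : c0*512*Cc*Kc = 1 := by unfold c0; field_simp
    have hCp := Cc_pos
    have hc := c0_pos
    have e : c0*(J+1)*Real.log R*h0*(8*Cc*h0*ell) = k*(1/8*h0*ell*(J+1))^2 := by
      rw [← hellD, hD]
      linear_combination (1/64*k*h0^2*ell^2*(J+1)^2)*hc0
    calc _ ≤ c0*(J+1)*Real.log R*h0*(8*Cc*h0*ell) := mul_le_mul_of_nonneg_left B3 (by positivity)
      _ = _ := e
      _ ≤ _ := by gcongr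

end ModPB3c

section ModPB4
section sieve4
variable {k : ℕ} {ι : Type} [Fintype ι] [DecidableEq ι]

def leo (τ o : ι → Option (Fin k)) : Prop := ∀ p, τ p = none ∨ o p = τ p

noncomputable def ind (τ o : ι → Option (Fin k)) : ℝ := ∏ p, (if τ p = none ∨ o p = τ p then (1:ℝ) else 0)

lemma ind_eq (τ o : ι → Option (Fin k)) [Decidable (leo τ o)] : ind τ o = if leo τ o then 1 else 0 := by
  unfold ind
  split_ifs with h
  · exact Finset.prod_eq_one fun p _ => if_pos (h p)
  · unfold leo at h
    push Not at h
    obtain ⟨p, hp⟩ := h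
    exact Finset.prod_eq_zero (Finset.mem_univ p) (if_neg (by tauto))

lemma join (δ δ' : ι → Option (Fin k)) : (∀ o, ind δ o * ind δ' o = 0) ∨
    ∃ τ : ι → Option (Fin k), sup τ = sup δ ∪ sup δ' ∧ ∀ o, ind δ o * ind δ' o = ind τ o := by
  classical
  by_cases h : ∃ p, δ p ≠ none ∧ δ' p ≠ none ∧ δ p ≠ δ' p
  · left
    obtain ⟨p, h1, h2, h3⟩ := h
    intro o
    by_cases h4 : o p = δ p
    · rw [show ind δ' o = 0 from Finset.prod_eq_zero (Finset.mem_univ p) (if_neg (by rw [h4]; tauto)), mul_zero]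
    · rw [show ind δ o = 0 from Finset.prod_eq_zero (Finset.mem_univ p) (if_neg (by tauto)), zero_mul]
  · right
    push Not at h
    refine ⟨fun p => if δ p = none then δ' p else δ p, ?_, fun o => ?_⟩
    · ext p
      simp only [sup, Finset.mem_filter, Finset.mem_univ, true_and, Finset.mem_union]
      by_cases h1 : δ p = none <;> simp [h1]
    · unfold ind
      rw [← Finset.prod_mul_distrib]
      refine Finset.prod_congr rfl fun p _ => ?_
      by_cases h1 : δ p = none
      · simp [h1]
      · by_cases h2 : δ' p = none
        · simp [h1, h2]
        · have := h p h1 h2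
          rw [← this]
          simp only [if_neg h1]
          split_ifs <;> simp

lemma sum_supp (G : Finset ι → ℝ) : ∑ ρ : ι → Option (Fin k), G (sup ρ) = ∑ U : Finset ι, (k:ℝ)^U.card * G U := by
  classical
  rw [← Finset.sum_fiberwise_of_maps_to (s := Finset.univ) (t := Finset.univ) (g := sup) (fun _ _ => Finset.mem_univ _)]
  refine Finset.sum_congr rfl fun U _ => ?_
  rw [Finset.sum_congr rfl (g := fun _ => G U) (fun ρ hρ => by rw [(Finset.mem_filter.1 hρ).2]), Finset.sum_const, nsmul_eq_mul]
  congr 1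
  have : (Finset.univ.filter fun ρ : ι → Option (Fin k) => sup ρ = U) =
      Fintype.piFinset (fun p => if p ∈ U then (Finset.univ : Finset (Fin k)).map Function.Embedding.some else {none}) := by
    ext ρ
    simp only [Finset.mem_filter, Finset.mem_univ, true_and, Fintype.mem_piFinset]
    constructor
    · rintro rfl p
      by_cases h : ρ p = none
      · simp [sup, h]
      · obtain ⟨i, hi⟩ := Option.ne_none_iff_exists'.1 h
        simp [sup, hi]
    · intro h
      ext p
      have := h p
      by_cases hp : p ∈ U
      · rw [if_pos hp] at this
        simp only [Finset.mem_map, Finset.mem_univ, true_and, Function.Embedding.some_apply] at this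
        obtain ⟨i, hi⟩ := this
        simp [sup, hp, ← hi]
      · rw [if_neg hp] at this
        simp [sup, hp, Finset.mem_singleton.1 this]
  rw [this, Fintype.card_piFinset]
  push_cast
  rw [← Finset.prod_const, ← Finset.prod_filter_mul_prod_filter_not Finset.univ (· ∈ U)]
  rw [Finset.prod_congr rfl (g := fun _ => (k:ℝ)) (fun p hp => by rw [if_pos (Finset.mem_filter.1 hp).2]; simp),
    Finset.prod_congr (s₁ := Finset.univ.filter (¬ · ∈ U)) rfl (g := fun _ => (1:ℝ)) (fun p hp => by rw [if_neg (Finset.mem_filter.1 hp).2]; simp)]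
  simp

lemma sum_sub (U : Finset ι) : ∑ δ : ι → Option (Fin k) with sup δ ⊆ U, (2:ℝ)^(sup δ).card = (2*k+1)^U.card := by
  classical
  have h1 : ∀ δ : ι → Option (Fin k), (if sup δ ⊆ U then (2:ℝ)^(sup δ).card else 0) = ∏ p, (match δ p with | none => (1:ℝ) | some _ => if p ∈ U then 2 else 0) := by
    intro δ
    split_ifs with h
    · rw [← Finset.prod_const, sup, Finset.prod_filter]
      refine Finset.prod_congr rfl fun p _ => ?_
      rcases hp : δ p with _ | i
      · simp
      · have : p ∈ U := h (by simp [sup, hp])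
        simp [this]
    · obtain ⟨p, h1, h2⟩ := Finset.not_subset.1 h
      refine (Finset.prod_eq_zero (Finset.mem_univ p) ?_).symm
      simp only [sup, Finset.mem_filter] at h1
      obtain ⟨i, hi⟩ := Option.ne_none_iff_exists'.1 h1.2
      simp [hi, h2]
  rw [Finset.sum_filter, Finset.sum_congr rfl fun δ _ => h1 δ]
  have := Finset.prod_univ_sum (fun _ : ι => (Finset.univ : Finset (Option (Fin k)))) (fun p o => (match o with | none => (1:ℝ) | some _ => if p ∈ U then 2 else 0))
  rw [Fintype.piFinset_univ] at this
  rw [← this, ← Finset.prod_const, Finset.prod_congr rfl (g := fun p => if p ∈ U then (2*k+1:ℝ) else 1)]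
  · rw [← Finset.prod_filter]; simp
  · intro p _
    rw [Fintype.sum_option]
    split_ifs <;> simp; ring

lemma nrm_union (a : ι → ℝ) (ha : ∀ p, 1 ≤ a p) (U V : Finset ι) : nrm a (U ∪ V) ≤ nrm a U * nrm a V := by
  unfold nrm
  rw [← Finset.prod_union_inter]
  refine le_mul_of_one_le_right (Finset.prod_nonneg fun p _ => by linarith [ha p]) ?_
  have := Finset.prod_le_prod (s := U ∩ V) (f := fun _ => (1:ℝ)) (g := a) (fun _ _ => by norm_num) (fun p _ => ha p)
  simpa using this

theorem compare (a : ι → ℝ) (ha : ∀ p, 1 ≤ a p) (R M : ℝ) (hR : 1 ≤ R) (hM : 0 ≤ M) (lam : (ι → Option (Fin k)) → ℝ)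
    (hlam : ∀ δ, |lam δ| ≤ if nrm a (sup δ) ≤ R then M * 2^(sup δ).card else 0)
    (T : Finset ℕ) (g : ℕ → ℝ) (om : ℕ → ι → Option (Fin k)) (X : ℝ) (π : ι → Option (Fin k) → ℝ) (hπ : ∀ p, ∑ o, π p o = 1)
    (Err : Finset ι → ℝ) (hE0 : ∀ U, 0 ≤ Err U)
    (hErr : ∀ τ : ι → Option (Fin k), nrm a (sup τ) ≤ R^2 → |∑ n ∈ T, g n * ind τ (om n) - X * ∏ p ∈ sup τ, π p (τ p)| ≤ Err (sup τ)) :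
    |∑ n ∈ T, g n * (∑ δ, lam δ * ind δ (om n))^2 - X * ∑ o : ι → Option (Fin k), (∏ p, π p (o p)) * (∑ δ, lam δ * ind δ o)^2| ≤
      M^2 * ∑ U : Finset ι with nrm a U ≤ R^2, ((2*k+1:ℝ)^2)^U.card * Err U := by
  classical
  have hmod : ∀ τ : ι → Option (Fin k), ∑ o : ι → Option (Fin k), (∏ p, π p (o p)) * ind τ o = ∏ p ∈ sup τ, π p (τ p) := by
    intro τ
    have := Finset.prod_univ_sum (fun _ : ι => (Finset.univ : Finset (Option (Fin k)))) (fun p o => π p o * (if τ p = none ∨ o = τ p then (1:ℝ) else 0))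
    rw [Fintype.piFinset_univ] at this
    unfold ind
    simp_rw [← Finset.prod_mul_distrib]
    rw [← this, sup, Finset.prod_filter]
    refine Finset.prod_congr rfl fun p _ => ?_
    by_cases hp : τ p = none
    · simp [hp, hπ]
    · simp [hp]
  let L : ((ι → Option (Fin k)) → ℝ) → ℝ := fun f => ∑ n ∈ T, g n * f (om n) - X * ∑ o : ι → Option (Fin k), (∏ p, π p (o p)) * f o
  have hL : L (fun o => (∑ δ, lam δ * ind δ o)^2) = ∑ δ, ∑ δ', lam δ * lam δ' * L (fun o => ind δ o * ind δ' o) := by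
    have e1 : ∀ o, (∑ δ, lam δ * ind δ o)^2 = ∑ δ, ∑ δ', lam δ * lam δ' * (ind δ o * ind δ' o) := by
      intro o
      rw [sq, Finset.sum_mul_sum]
      exact Finset.sum_congr rfl fun δ _ => Finset.sum_congr rfl fun δ' _ => by ring
    simp only [L, mul_sub, Finset.sum_sub_distrib]
    congr 1
    · simp_rw [e1, Finset.mul_sum]
      rw [Finset.sum_comm]
      refine Finset.sum_congr rfl fun δ _ => ?_
      rw [Finset.sum_comm]
      exact Finset.sum_congr rfl fun δ' _ => Finset.sum_congr rfl fun n _ => by ring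
    · simp_rw [e1, Finset.mul_sum]
      rw [Finset.sum_comm]
      refine Finset.sum_congr rfl fun δ _ => ?_
      rw [Finset.sum_comm]
      exact Finset.sum_congr rfl fun δ' _ => Finset.sum_congr rfl fun n _ => by ring
  change |L (fun o => (∑ δ, lam δ * ind δ o)^2)| ≤ _
  rw [hL]
  have hn0 : ∀ U : Finset ι, 0 ≤ nrm a U := fun U => Finset.prod_nonneg fun p _ => by linarith [ha p]
  have hterm : ∀ δ δ' : ι → Option (Fin k), |lam δ * lam δ' * L (fun o => ind δ o * ind δ' o)| ≤
      ∑ U : Finset ι with nrm a U ≤ R^2, (if sup δ ⊆ U then (2:ℝ)^(sup δ).card else 0) * (if sup δ' ⊆ U then (2:ℝ)^(sup δ').card else 0) * (M^2 * Err U) := by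
    intro δ δ'
    have hnn : ∀ U : Finset ι, 0 ≤ (if sup δ ⊆ U then (2:ℝ)^(sup δ).card else 0) * (if sup δ' ⊆ U then (2:ℝ)^(sup δ').card else 0) * (M^2 * Err U) := by
      intro U
      have := hE0 U
      split_ifs <;> positivity
    have hS0 := Finset.sum_nonneg (s := Finset.univ.filter fun U : Finset ι => nrm a U ≤ R^2) fun U _ => hnn U
    by_cases h1 : nrm a (sup δ) ≤ R
    · by_cases h2 : nrm a (sup δ') ≤ R
      · have hle : nrm a (sup δ ∪ sup δ') ≤ R^2 := by
          refine (nrm_union a ha _ _).trans ?_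
          rw [sq]
          exact mul_le_mul h1 h2 (hn0 _) (by linarith)
        rcases join δ δ' with h | ⟨τ, ht, h⟩
        · have : L (fun o => ind δ o * ind δ' o) = 0 := by simp [L, h]
          rw [this, mul_zero, abs_zero]; exact hS0
        · have e : L (fun o => ind δ o * ind δ' o) = L (fun o => ind τ o) := by simp only [h]
          have hb : |L (fun o => ind τ o)| ≤ Err (sup τ) := by
            simp only [L, hmod]
            exact hErr τ (by rw [ht]; exact hle)
          have l1 := hlam δ
          have l2 := hlam δ'
          rw [if_pos h1] at l1
          rw [if_pos h2] at l2
          refine le_trans ?_ (Finset.single_le_sum (fun U _ => hnn U) (Finset.mem_filter.2 ⟨Finset.mem_univ (sup δ ∪ sup δ'), hle⟩))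
          rw [if_pos Finset.subset_union_left, if_pos Finset.subset_union_right, e, abs_mul, abs_mul, ← ht]
          calc _ ≤ (M * 2^(sup δ).card) * (M * 2^(sup δ').card) * Err (sup τ) := by gcongr
            _ = _ := by ring
      · have l2 := hlam δ'
        rw [if_neg h2] at l2
        have : lam δ' = 0 := abs_nonpos_iff.1 l2
        simpa [this] using hS0
    · have l2 := hlam δ
      rw [if_neg h1] at l2
      have : lam δ = 0 := abs_nonpos_iff.1 l2
      simpa [this] using hS0
  calc _ ≤ ∑ δ : ι → Option (Fin k), ∑ δ' : ι → Option (Fin k), ∑ U : Finset ι with nrm a U ≤ R^2, (if sup δ ⊆ U then (2:ℝ)^(sup δ).card else 0) * (if sup δ' ⊆ U then (2:ℝ)^(sup δ').card else 0) * (M^2 * Err U) :=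
        (Finset.abs_sum_le_sum_abs _ _).trans (Finset.sum_le_sum fun δ _ => (Finset.abs_sum_le_sum_abs _ _).trans (Finset.sum_le_sum fun δ' _ => hterm δ δ'))
    _ = ∑ U : Finset ι with nrm a U ≤ R^2, (∑ δ : ι → Option (Fin k), (if sup δ ⊆ U then (2:ℝ)^(sup δ).card else 0))^2 * (M^2 * Err U) := by
        rw [Finset.sum_congr rfl fun δ _ => Finset.sum_comm, Finset.sum_comm]
        refine Finset.sum_congr rfl fun U _ => ?_
        rw [sq (∑ δ : ι → Option (Fin k), _), Finset.sum_mul_sum, Finset.sum_mul]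
        refine Finset.sum_congr rfl fun δ _ => ?_
        rw [Finset.sum_mul]
    _ = _ := by
        rw [Finset.mul_sum]
        refine Finset.sum_congr rfl fun U _ => ?_
        rw [← Finset.sum_filter, sum_sub, pow_right_comm]
        generalize (2*(k:ℝ)+1)^U.card = y
        ring
end sieve4

end ModPB4

section ModPB4b
section sieve4b
variable {k : ℕ} {ι : Type} [Fintype ι] [DecidableEq ι]

noncomputable def kap (a : ℝ) (j t : Option (Fin k)) : ℝ :=
  match j with
  | none => if t = none then 1 else 0
  | some i => if t = none then -(1/a) else if t = some i then 1 else 0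

noncomputable def lamd (a : ι → ℝ) (F : Finset ι → ℝ) (R : ℝ) (δ : ι → Option (Fin k)) : ℝ :=
  ∑ ρ : ι → Option (Fin k), (∏ p, kap (a p) (ρ p) (δ p)) * cc a F R ρ

lemma bb_kap (a : ℝ) (j o : Option (Fin k)) : bb a j o = ∑ t, kap a j t * (if t = none ∨ o = t then (1:ℝ) else 0) := by
  rw [Fintype.sum_option]
  rcases j with _ | i
  · simp [bb, kap]
  · simp only [bb, kap]
    rw [Finset.sum_eq_single i]
    · simp; ring
    · intro b _ hb
      simp [hb]
    · simp

lemma w_eq (a : ι → ℝ) (F : Finset ι → ℝ) (R : ℝ) (o : ι → Option (Fin k)) :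
    ∑ ρ : ι → Option (Fin k), (∏ p, bb (a p) (ρ p) (o p)) * cc a F R ρ = ∑ δ, lamd a F R δ * ind δ o := by
  unfold lamd
  simp_rw [Finset.sum_mul]
  rw [Finset.sum_comm]
  refine Finset.sum_congr rfl fun ρ _ => ?_
  have := Finset.prod_univ_sum (fun _ : ι => (Finset.univ : Finset (Option (Fin k)))) (fun p t => kap (a p) (ρ p) t * (if t = none ∨ o p = t then (1:ℝ) else 0))
  rw [Fintype.piFinset_univ] at this
  rw [Finset.prod_congr rfl fun p _ => bb_kap (a p) (ρ p) (o p), this, Finset.sum_mul]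
  refine Finset.sum_congr rfl fun δ _ => ?_
  rw [Finset.prod_mul_distrib, ind]
  ring

lemma lam_bound (a : ι → ℝ) (ha : ∀ p, 2 ≤ a p) (F : Finset ι → ℝ) (hF0 : ∀ U, 0 ≤ F U) (hF2 : ∀ U, F U ≤ 2) (R : ℝ)
    (δ : ι → Option (Fin k)) : |lamd a F R δ| ≤ if nrm a (sup δ) ≤ R then
      (2^k * ∑ U : Finset ι with nrm a U ≤ R, (∏ p ∈ U, (2*k/a p))) * 2^(sup δ).card else 0 := by
  classical
  have ha1 : ∀ p, 1 ≤ a p := fun p => by linarith [ha p]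
  have hmono : ∀ U V : Finset ι, U ⊆ V → nrm a U ≤ nrm a V := fun U V h => by
    unfold nrm
    rw [← Finset.prod_sdiff h]
    refine le_mul_of_one_le_left (Finset.prod_nonneg fun p _ => by linarith [ha p]) ?_
    have := Finset.prod_le_prod (s := V \ U) (f := fun _ => (1:ℝ)) (g := a) (fun _ _ => by norm_num) (fun p _ => ha1 p)
    simpa using this
  have hpt : ∀ ρ : ι → Option (Fin k), |(∏ p, kap (a p) (ρ p) (δ p)) * cc a F R ρ| ≤
      if leo δ ρ ∧ nrm a (sup ρ) ≤ R then 2^k * 2^(sup δ).card * ∏ p ∈ sup ρ \ sup δ, (2/a p) else 0 := by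
    intro ρ
    by_cases h1 : leo δ ρ
    · by_cases h2 : nrm a (sup ρ) ≤ R
      · rw [if_pos ⟨h1, h2⟩]
        have hsub : sup δ ⊆ sup ρ := by
          intro p hp
          simp only [sup, Finset.mem_filter, Finset.mem_univ, true_and] at hp ⊢
          rcases h1 p with h | h
          · exact absurd h hp
          · rw [h]; exact hp
        have hk : |∏ p, kap (a p) (ρ p) (δ p)| = ∏ p ∈ sup ρ \ sup δ, (1/a p) := by
          rw [Finset.abs_prod, ← Finset.prod_subset (Finset.subset_univ (sup ρ \ sup δ))]
          · refine Finset.prod_congr rfl fun p hp => ?_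
            simp only [sup, Finset.mem_sdiff, Finset.mem_filter, Finset.mem_univ, true_and, not_not] at hp
            obtain ⟨i, hi⟩ := Option.ne_none_iff_exists'.1 hp.1
            have := ha p
            rw [hi, hp.2]
            simp only [kap, if_true]
            rw [abs_neg, abs_of_nonneg (by positivity)]
          · intro p _ hp
            simp only [sup, Finset.mem_sdiff, Finset.mem_filter, Finset.mem_univ, true_and, not_not] at hp
            by_cases h3 : ρ p = none
            · have : δ p = none := by
                rcases h1 p with h | h
                · exact h
                · rw [← h, h3]
              simp [h3, this, kap]
            · have h4 : ¬ δ p = none := fun h => hp ⟨h3, h⟩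
              have h5 : ρ p = δ p := (h1 p).resolve_left h4
              obtain ⟨i, hi⟩ := Option.ne_none_iff_exists'.1 h3
              rw [← h5, hi]
              simp [kap]
        have hc : |cc a F R ρ| ≤ 2^k * 2^(sup ρ).card := by
          unfold cc
          rw [if_pos h2, mul_one, abs_mul]
          refine mul_le_mul ?_ ?_ (abs_nonneg _) (by positivity)
          · rw [abs_of_nonneg (Finset.prod_nonneg fun i _ => hF0 _)]
            have := Finset.prod_le_prod (s := Finset.univ) (f := fun i : Fin k => F (fib ρ i)) (g := fun _ => (2:ℝ)) (fun i _ => hF0 _) (fun i _ => hF2 _)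
            simpa using this
          · rw [Finset.abs_prod]
            have := Finset.prod_le_prod (s := sup ρ) (f := fun p => |-(a p/(a p-1))|) (g := fun _ => (2:ℝ)) (fun i _ => abs_nonneg _) (fun p _ => by
              have := ha p
              have h0 : 0 < a p - 1 := by linarith
              rw [abs_neg, abs_of_nonneg (by positivity), div_le_iff₀ h0]
              linarith)
            simpa using this
        rw [abs_mul, hk]
        have hcard : (sup ρ).card = (sup δ).card + (sup ρ \ sup δ).card := by
          have := Finset.card_sdiff_add_card_eq_card hsub
          omega
        calc _ ≤ (∏ p ∈ sup ρ \ sup δ, (1/a p)) * (2^k * 2^(sup ρ).card) := mul_le_mul_of_nonneg_left hc (Finset.prod_nonneg fun p _ => by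
                have := ha p; positivity)
          _ = _ := by
            rw [hcard, pow_add, Finset.prod_div_distrib, Finset.prod_div_distrib, Finset.prod_const, Finset.prod_const, one_pow]
            ring
      · have : cc a F R ρ = 0 := by unfold cc; rw [if_neg h2]; ring
        rw [this, mul_zero, abs_zero, if_neg (by tauto)]
    · rw [if_neg (by tauto)]
      unfold leo at h1
      push Not at h1
      obtain ⟨p, h3, h4⟩ := h1
      rw [Finset.prod_eq_zero (Finset.mem_univ p), zero_mul, abs_zero]
      obtain ⟨i, hi⟩ := Option.ne_none_iff_exists'.1 h3
      rcases hr : ρ p with _ | j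
      · simp [kap, hi]
      · have : i ≠ j := by rintro rfl; exact h4 (by rw [hr, hi])
        simp [kap, hi, this]
  unfold lamd
  refine (Finset.abs_sum_le_sum_abs _ _).trans ((Finset.sum_le_sum fun ρ _ => hpt ρ).trans ?_)
  rw [← Finset.sum_filter]
  split_ifs with hd
  · rw [← Finset.mul_sum, mul_right_comm]
    refine mul_le_mul_of_nonneg_right (mul_le_mul_of_nonneg_left ?_ (by positivity)) (by positivity)
    set S := Finset.univ.filter fun ρ : ι → Option (Fin k) => leo δ ρ ∧ nrm a (sup ρ) ≤ R with hS
    let σ : (ι → Option (Fin k)) → (ι → Option (Fin k)) := fun ρ p => if δ p = none then ρ p else none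
    have hsup : ∀ ρ, sup (σ ρ) = sup ρ \ sup δ := by
      intro ρ
      ext p
      simp only [sup, σ, Finset.mem_sdiff, Finset.mem_filter, Finset.mem_univ, true_and, not_not]
      by_cases h : δ p = none <;> simp [h]
    have hinj : Set.InjOn σ S := by
      intro ρ hρ ρ' hρ' h
      have h1 := (Finset.mem_filter.1 hρ).2.1
      have h2 := (Finset.mem_filter.1 hρ').2.1
      funext p
      by_cases hp : δ p = none
      · have := congrFun h p
        simpa [σ, hp] using this
      · rw [(h1 p).resolve_left hp, (h2 p).resolve_left hp]
    calc ∑ ρ ∈ S, ∏ p ∈ sup ρ \ sup δ, (2/a p) = ∑ ρ ∈ S, (fun s => ∏ p ∈ sup s, (2/a p)) (σ ρ) := by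
          refine Finset.sum_congr rfl fun ρ _ => ?_
          simp only [hsup]
      _ = ∑ s ∈ S.image σ, ∏ p ∈ sup s, (2/a p) := by
          rw [Finset.sum_image hinj]
      _ ≤ ∑ s ∈ Finset.univ.filter (fun s : ι → Option (Fin k) => nrm a (sup s) ≤ R), ∏ p ∈ sup s, (2/a p) := by
          refine Finset.sum_le_sum_of_subset_of_nonneg ?_ fun s _ _ => Finset.prod_nonneg fun p _ => by
            have := ha p; positivity
          intro s hs
          obtain ⟨ρ, hρ, rfl⟩ := Finset.mem_image.1 hs
          refine Finset.mem_filter.2 ⟨Finset.mem_univ _, ?_⟩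
          rw [hsup]
          exact (hmono _ _ Finset.sdiff_subset).trans (Finset.mem_filter.1 hρ).2.2
      _ = ∑ U : Finset ι, (k:ℝ)^U.card * (if nrm a U ≤ R then ∏ p ∈ U, (2/a p) else 0) := by
          rw [Finset.sum_filter]
          exact sum_supp (fun U => if nrm a U ≤ R then ∏ p ∈ U, (2/a p) else 0)
      _ = _ := by
          rw [Finset.sum_filter]
          refine Finset.sum_congr rfl fun U _ => ?_
          split_ifs
          · rw [← Finset.prod_const, ← Finset.prod_mul_distrib]
            exact Finset.prod_congr rfl fun p _ => by ring
          · rw [mul_zero]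
  · refine le_of_eq (Finset.sum_eq_zero fun ρ hρ => ?_)
    exfalso
    have h := (Finset.mem_filter.1 hρ).2
    refine hd ((hmono _ _ ?_).trans h.2)
    intro p hp
    simp only [sup, Finset.mem_filter, Finset.mem_univ, true_and] at hp ⊢
    rcases h.1 p with h | h
    · exact absurd h hp
    · rw [h]; exact hp
end sieve4b

end ModPB4b

section ModPB4c
open Filter Topology

lemma eU_sum_le {W R : ℕ} (z : ℕ) (g : ℕ → ℝ) (hg : ∀ d, 0 ≤ g d) :
    ∑ U : Finset (SS W R) with nrm av U ≤ z, g (eU U) ≤ ∑ d ∈ (Finset.Icc 1 z).filter (fun d => Squarefree d ∧ d.Coprime W), g d := by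
  classical
  rw [← Finset.sum_image (s := Finset.univ.filter fun U : Finset (SS W R) => nrm av U ≤ z) (g := eU) (f := g) (fun U _ V _ h => eU_inj h)]
  refine Finset.sum_le_sum_of_subset_of_nonneg ?_ fun d _ _ => hg d
  intro d hd
  obtain ⟨U, hU, rfl⟩ := Finset.mem_image.1 hd
  have h1 := (Finset.mem_filter.1 hU).2
  rw [nrm_eU] at h1
  exact Finset.mem_filter.2 ⟨Finset.mem_Icc.2 ⟨eU_pos U, by exact_mod_cast h1⟩, eU_sqf U, eU_cop U⟩

lemma eU_insert {W R : ℕ} {p : SS W R} {U : Finset (SS W R)} (hp : p ∉ U) : eU (insert p U) = p * eU U := by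
  unfold eU; rw [Finset.prod_insert hp]

lemma eU_cop_p {W R : ℕ} {p : SS W R} {U : Finset (SS W R)} (hp : p ∉ U) : (W * eU U).Coprime p := by
  rw [Nat.coprime_comm, Nat.Prime.coprime_iff_not_dvd (SS_prime p), (SS_prime p).dvd_mul]
  rintro (h | h)
  · exact SS_ndvd p h
  · exact hp ((mem_eU U p).2 h)

lemma eU_totient {W R : ℕ} (U : Finset (SS W R)) : ((eU U).totient : ℝ) = ∏ p ∈ U, (av p - 1) := by
  induction U using Finset.induction_on with
  | empty => simp [eU]
  | insert p U hp ih =>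
    rw [eU_insert hp, Finset.prod_insert hp, Nat.totient_mul]
    · push_cast
      rw [ih, Nat.totient_prime (SS_prime p), av, Nat.cast_sub (SS_prime p).one_le]
      simp
    · exact (Nat.Coprime.coprime_mul_left (eU_cop_p hp)).symm

lemma crt_class {W R : ℕ} (v : ℕ) (r : SS W R → ℕ) (U : Finset (SS W R)) : ∃ c : ℕ, ∀ n : ℕ,
    (n ≡ v [MOD W] ∧ ∀ p ∈ U, n ≡ r p [MOD p]) ↔ n ≡ c [MOD (W * eU U)] := by
  induction U using Finset.induction_on with
  | empty => exact ⟨v, fun n => by simp [eU]⟩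
  | insert p U hp ih =>
    obtain ⟨c, hc⟩ := ih
    have hcop := eU_cop_p hp
    refine ⟨Nat.chineseRemainder hcop c (r p), fun n => ?_⟩
    have h1 := (Nat.chineseRemainder hcop c (r p)).2
    rw [eU_insert hp, show W * ((p:ℕ) * eU U) = (W * eU U) * p by ring, ← Nat.modEq_and_modEq_iff_modEq_mul hcop]
    simp only [Finset.forall_mem_insert]
    constructor
    · rintro ⟨ha, hb, hd⟩
      exact ⟨((hc n).1 ⟨ha, hd⟩).trans h1.1.symm, hb.trans h1.2.symm⟩
    · rintro ⟨ha, hb⟩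
      have := (hc n).2 (ha.trans h1.1)
      exact ⟨this.1, hb.trans h1.2, this.2⟩

section arith
variable {k W R : ℕ}

open Classical in
noncomputable def omf (h : Fin k → ℕ) (W R : ℕ) (n : ℕ) (p : SS W R) : Option (Fin k) :=
  if H : ∃ i, (p:ℕ) ∣ n + h i then some H.choose else none

lemma omf_iff (h : Fin k → ℕ) (hh : ∀ i j, i ≠ j → ∀ p : ℕ, p.Prime → (p:ℤ) ∣ (h i:ℤ) - h j → p ∣ W)
    (n : ℕ) (p : SS W R) (i : Fin k) : omf h W R n p = some i ↔ (p:ℕ) ∣ n + h i := by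
  have uniq : ∀ i j, (p:ℕ) ∣ n + h i → (p:ℕ) ∣ n + h j → i = j := by
    intro i j h1 h2
    by_contra hne
    refine SS_ndvd p (hh i j hne p (SS_prime p) ?_)
    have h1' : ((p:ℕ):ℤ) ∣ (n:ℤ) + h i := by exact_mod_cast h1
    have h2' : ((p:ℕ):ℤ) ∣ (n:ℤ) + h j := by exact_mod_cast h2
    have := dvd_sub h1' h2'
    rwa [add_sub_add_left_eq_sub] at this
  unfold omf
  split_ifs with H
  · have hc := H.choose_spec
    constructor
    · intro h'
      rw [Option.some_inj] at h'
      rwa [h'] at hc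
    · intro h'
      rw [uniq _ _ hc h']
  · constructor
    · intro h'; exact absurd h' (by simp)
    · intro h'; exact absurd ⟨i, h'⟩ H

lemma om_class (h : Fin k → ℕ) (hh : ∀ i j, i ≠ j → ∀ p : ℕ, p.Prime → (p:ℤ) ∣ (h i:ℤ) - h j → p ∣ W) (v : ℕ)
    (τ : SS W R → Option (Fin k)) : ∃ c : ℕ, c ≡ v [MOD W] ∧ leo τ (omf h W R c) ∧
      ∀ n : ℕ, (n ≡ v [MOD W] ∧ leo τ (omf h W R n)) ↔ n ≡ c [MOD (W * eU (sup τ))] := by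
  let r : SS W R → ℕ := fun p => match τ p with | none => 0 | some i => h i * (p - 1)
  obtain ⟨c, hc⟩ := crt_class v r (sup τ)
  have hdiv : ∀ n (p : SS W R) (i : Fin k), n ≡ h i * (p - 1) [MOD p] ↔ (p:ℕ) ∣ n + h i := by
    intro n p i
    have h1 : h i * (p - 1) + h i = h i * p := by
      obtain ⟨q, hq⟩ := Nat.exists_eq_add_of_le (SS_prime p).one_le
      rw [hq]; simp; ring
    have h2 : h i * (p - 1) + h i ≡ 0 [MOD p] := by
      rw [h1]; exact (Nat.modEq_zero_iff_dvd).2 (dvd_mul_left _ _)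
    rw [← Nat.modEq_zero_iff_dvd]
    constructor
    · intro H
      exact (H.add_right (h i)).trans h2
    · intro H
      exact Nat.ModEq.add_right_cancel' (h i) (H.trans h2.symm)
  have key : ∀ n, (∀ p ∈ sup τ, n ≡ r p [MOD p]) ↔ leo τ (omf h W R n) := by
    intro n
    refine ⟨fun H p => ?_, fun H p hp => ?_⟩
    · rcases ht : τ p with _ | i
      · left; rfl
      · right
        have := H p (by simp [sup, ht])
        simp only [r, ht] at this
        rw [omf_iff h hh]
        exact (hdiv n p i).1 this
    · simp only [sup, Finset.mem_filter, Finset.mem_univ, true_and] at hp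
      obtain ⟨i, hi⟩ := Option.ne_none_iff_exists'.1 hp
      have := (H p).resolve_left hp
      rw [hi, omf_iff h hh] at this
      simp only [r, hi]
      exact (hdiv n p i).2 this
  have key2 : ∀ n : ℕ, (n ≡ v [MOD W] ∧ leo τ (omf h W R n)) ↔ n ≡ c [MOD (W * eU (sup τ))] := fun n => by
    rw [← key, hc]
  have := (key2 c).2 rfl
  exact ⟨c, this.1, this.2, key2⟩

lemma count_ap (X D c : ℕ) (hD : 0 < D) : |(((Finset.Icc 1 X).filter (fun n => n ≡ c [MOD D])).card : ℝ) - X / D| ≤ 1 := by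
  have h := Nat.Ioc_filter_modEq_card 0 X hD c
  have e : Finset.Icc 1 X = Finset.Ioc 0 X := by ext; simp [Nat.succ_le_iff]
  rw [e]
  have hmono : ⌊(((0:ℕ):ℚ) - c) / (D:ℚ)⌋ ≤ ⌊((X:ℚ) - c) / (D:ℚ)⌋ := by
    apply Int.floor_le_floor
    gcongr
    simp
  rw [max_eq_left (by linarith)] at h
  have h' : (((Finset.Ioc 0 X).filter (fun n => n ≡ c [MOD D])).card : ℚ) = (⌊((X:ℚ) - c) / (D:ℚ)⌋ : ℚ) - ⌊(((0:ℕ):ℚ) - c) / (D:ℚ)⌋ := by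
    exact_mod_cast h
  have a1 := Int.floor_le (((X:ℚ) - c) / (D:ℚ))
  have a2 := Int.lt_floor_add_one (((X:ℚ) - c) / (D:ℚ))
  have b1 := Int.floor_le ((((0:ℕ):ℚ) - c) / (D:ℚ))
  have b2 := Int.lt_floor_add_one ((((0:ℕ):ℚ) - c) / (D:ℚ))
  have e2 : ((X:ℚ) - c) / (D:ℚ) - (((0:ℕ):ℚ) - c) / (D:ℚ) = X / D := by push_cast; ring
  have : |(((Finset.Ioc 0 X).filter (fun n => n ≡ c [MOD D])).card : ℚ) - X / D| ≤ 1 := by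
    rw [abs_le]; constructor <;> linarith
  have := (Rat.cast_le (K := ℝ)).2 this
  push_cast at this
  exact this

open Classical in
lemma ind_sum (h : Fin k → ℕ) (hh : ∀ i j, i ≠ j → ∀ p : ℕ, p.Prime → (p:ℤ) ∣ (h i:ℤ) - h j → p ∣ W) (v X : ℕ)
    (τ : SS W R → Option (Fin k)) (g : ℕ → ℝ) (c : ℕ)
    (hc : ∀ n : ℕ, (n ≡ v [MOD W] ∧ leo τ (omf h W R n)) ↔ n ≡ c [MOD (W * eU (sup τ))]) :
    ∑ n ∈ (Finset.Icc 1 X).filter (fun n => n ≡ v [MOD W]), g n * ind τ (omf h W R n) =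
    ∑ n ∈ (Finset.Icc 1 X).filter (fun n => n ≡ c [MOD (W * eU (sup τ))]), g n := by
  rw [Finset.sum_filter, Finset.sum_filter]
  refine Finset.sum_congr rfl fun n _ => ?_
  rw [ind_eq, ← if_congr (hc n) rfl rfl]
  by_cases h1 : n ≡ v [MOD W] <;> by_cases h2 : leo τ (omf h W R n) <;> simp [h1, h2]

lemma S1_err (hW : 0 < W) (h : Fin k → ℕ) (hh : ∀ i j, i ≠ j → ∀ p : ℕ, p.Prime → (p:ℤ) ∣ (h i:ℤ) - h j → p ∣ W) (v X : ℕ)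
    (τ : SS W R → Option (Fin k)) :
    |∑ n ∈ (Finset.Icc 1 X).filter (fun n => n ≡ v [MOD W]), (1:ℝ) * ind τ (omf h W R n) - X / W * ∏ p ∈ sup τ, pi1 k (av p) (τ p)| ≤ 1 := by
  obtain ⟨c, _, _, hc⟩ := om_class h hh v τ
  rw [ind_sum h hh v X τ (fun _ => 1) c hc]
  have e : ∏ p ∈ sup τ, pi1 k (av p) (τ p) = 1 / (eU (sup τ) : ℝ) := by
    rw [← nrm_eU, nrm, ← Finset.prod_const_one (s := sup τ), ← Finset.prod_div_distrib]
    refine Finset.prod_congr rfl fun p hp => ?_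
    simp only [sup, Finset.mem_filter, Finset.mem_univ, true_and] at hp
    obtain ⟨i, hi⟩ := Option.ne_none_iff_exists'.1 hp
    rw [hi]; simp [pi1]
  have := count_ap X (W * eU (sup τ)) c (Nat.mul_pos hW (eU_pos _))
  rw [e, Finset.sum_const, nsmul_eq_mul, mul_one, div_mul_div_comm, mul_one]
  exact_mod_cast this

lemma shift_sum (N hm : ℕ) (hN3 : 3 ≤ (N:ℝ)) (hhm : (hm:ℝ) ≤ Real.exp (-3) * N) (P : ℕ → Prop) [DecidablePred P] :
    ∑ n ∈ (Finset.Icc 1 (XN N)).filter (fun n => P (n + hm)), gth N (n + hm) = ∑ l ∈ (Finset.Icc 1 (XN N)).filter P, gth N l := by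
  have hN : 0 < (N:ℝ) := by linarith
  rw [Finset.sum_filter, Finset.sum_filter]
  have e : ∑ n ∈ Finset.Icc 1 (XN N), (if P (n + hm) then gth N (n + hm) else 0) = ∑ l ∈ Finset.Icc (1 + hm) (XN N + hm), if P l then gth N l else 0 := by
    rw [← Finset.map_add_right_Icc, Finset.sum_map]
    rfl
  rw [e]
  have z1 : ∀ l, l ≤ hm → (if P l then gth N l else 0) = 0 := by
    intro l hl
    split_ifs
    · by_contra hne
      have := (gth_ne hN hne).2
      have : (l:ℝ) ≤ hm := by exact_mod_cast hl
      linarith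
    · rfl
  have z2 : ∀ l, XN N < l → (if P l then gth N l else 0) = 0 := by
    intro l hl
    have : gth N l = 0 := by unfold gth; rw [om_big hN3 hl]; simp
    simp [this]
  refine Eq.trans (b := ∑ l ∈ Finset.Icc 1 (XN N + hm), if P l then gth N l else 0) ?_ ?_
  · refine Finset.sum_subset (Finset.Icc_subset_Icc (by omega) le_rfl) fun l h1 h2 => z1 l ?_
    rw [Finset.mem_Icc] at h1 h2
    omega
  · refine (Finset.sum_subset (Finset.Icc_subset_Icc le_rfl (by omega)) fun l h1 h2 => z2 l ?_).symm
    rw [Finset.mem_Icc] at h1 h2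
    omega

lemma S2_err (N : ℕ) (hW : 0 < W) (hRW : W + 5 ≤ Rn N) (h : Fin k → ℕ) (hh : ∀ i j, i ≠ j → ∀ p : ℕ, p.Prime → (p:ℤ) ∣ (h i:ℤ) - h j → p ∣ W) (v : ℕ)
    (hcop : ∀ i, Nat.Coprime (v + h i) W) (m : Fin k) (hhm : (h m:ℝ) ≤ Real.exp (-3) * N)
    (τ : SS W (Rn N) → Option (Fin k)) (hτ : nrm av (sup τ) ≤ (Rn N:ℝ)^2) :
    |∑ n ∈ (Finset.Icc 1 (XN N)).filter (fun n => n ≡ v [MOD W]), gth N (n + h m) * ind τ (omf h W (Rn N) n)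
      - Xth N / W.totient * ∏ p ∈ sup τ, pi2 k (av p) m (τ p)| ≤ Ed W N (eU (sup τ)) := by
  classical
  obtain ⟨h1, h2, h3⟩ := Rn_Q W N hW hRW
  have h25 : (25:ℝ) ≤ ((W * Rn N ^ 2 : ℕ):ℝ) := by exact_mod_cast h2
  push_cast at h25 h3
  have hN3 : 3 ≤ (N:ℝ) := by
    have : Real.exp (-3) ≤ 1 := Real.exp_le_one_iff.2 (by norm_num)
    have hN0 : (0:ℝ) ≤ N := Nat.cast_nonneg N
    nlinarith
  have hN : 0 < (N:ℝ) := by linarith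
  obtain ⟨c, hcv, hcl, hc⟩ := om_class h hh v τ
  by_cases hm : ∃ p, τ p = some m
  · obtain ⟨p, hp⟩ := hm
    have e1 : ∏ p ∈ sup τ, pi2 k (av p) m (τ p) = 0 := by
      refine Finset.prod_eq_zero (i := p) (by simp [sup, hp]) ?_
      rw [hp]; simp [pi2]
    have e2 : ∑ n ∈ (Finset.Icc 1 (XN N)).filter (fun n => n ≡ v [MOD W]), gth N (n + h m) * ind τ (omf h W (Rn N) n) = 0 := by
      refine Finset.sum_eq_zero fun n _ => ?_
      rw [ind_eq]
      split_ifs with hl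
      · by_contra hne
        rw [mul_one] at hne
        obtain ⟨hpr, hlt⟩ := gth_ne hN hne
        have := (hl p).resolve_left (by simp [hp])
        rw [hp, omf_iff h hh] at this
        have heq := (Nat.prime_dvd_prime_iff_eq (SS_prime p) hpr).1 this
        rw [← heq] at hlt
        have hle : ((p:ℕ):ℝ) ≤ Rn N := by exact_mod_cast SS_le p
        have hR1 : (1:ℝ) ≤ Rn N := by exact_mod_cast (by omega : 1 ≤ Rn N)
        have hW1 : (1:ℝ) ≤ W := by exact_mod_cast hW
        have : (Rn N:ℝ) ≤ W * (Rn N:ℝ)^2 := by nlinarith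
        linarith
      · rw [mul_zero]
    rw [e1, e2]
    simpa using Ed_nonneg W N _
  · push Not at hm
    rw [ind_sum h hh v (XN N) τ (fun n => gth N (n + h m)) c hc]
    have e : ∏ p ∈ sup τ, pi2 k (av p) m (τ p) = 1 / ((eU (sup τ)).totient : ℝ) := by
      rw [eU_totient, ← Finset.prod_const_one (s := sup τ), ← Finset.prod_div_distrib]
      refine Finset.prod_congr rfl fun p hp => ?_
      simp only [sup, Finset.mem_filter, Finset.mem_univ, true_and] at hp
      obtain ⟨i, hi⟩ := Option.ne_none_iff_exists'.1 hp
      have : i ≠ m := fun h => hm p (by rw [hi, h])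
      rw [hi]; simp [pi2, this]
    have hcc : (c + h m).Coprime (W * eU (sup τ)) := by
      refine Nat.Coprime.mul_right ?_ ?_
      · have : c + h m ≡ v + h m [MOD W] := hcv.add_right _
        have h5 := hcop m
        rw [Nat.Coprime, Nat.gcd_comm, ] at h5 ⊢
        rw [Nat.gcd_rec, this, ← Nat.gcd_rec]
        exact h5
      · unfold eU
        refine Nat.Coprime.prod_right fun p hp => ?_
        rw [Nat.coprime_comm, Nat.Prime.coprime_iff_not_dvd (SS_prime p)]
        intro hd
        have := (omf_iff h hh c p m).2 hd
        simp only [sup, Finset.mem_filter, Finset.mem_univ, true_and] at hp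
        exact hm p (((hcl p).resolve_left hp).symm.trans this)
    have hfil : (Finset.Icc 1 (XN N)).filter (fun n => n ≡ c [MOD (W * eU (sup τ))]) = (Finset.Icc 1 (XN N)).filter (fun n => n + h m ≡ c + h m [MOD (W * eU (sup τ))]) := by
      refine Finset.filter_congr fun n _ => ?_
      exact ⟨fun H => H.add_right _, fun H => Nat.ModEq.add_right_cancel' _ H⟩
    rw [hfil, shift_sum N (h m) hN3 hhm (fun l => l ≡ c + h m [MOD (W * eU (sup τ))]), e, div_mul_div_comm, mul_one]
    have hd2 : eU (sup τ) ≤ Rn N ^ 2 := by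
      rw [nrm_eU] at hτ
      exact_mod_cast hτ
    have := dist_ap W N hW hRW (eU (sup τ)) (eU_pos _) hd2 (c + h m) hcc
    rw [Nat.totient_mul (eU_cop _).symm] at this
    push_cast at this
    exact this
end arith

end ModPB4c

section ModPB5
open Filter Topology

lemma prod_av {W R : ℕ} (x : ℝ) (U : Finset (SS W R)) : ∏ p ∈ U, (x / av p) = x ^ (eU U).primeFactors.card / (eU U : ℝ) := by
  rw [Finset.prod_div_distrib, Finset.prod_const, eU_factors, ← nrm_eU, nrm]

lemma M_le (k W R : ℕ) : (2:ℝ)^k * ∑ U : Finset (SS W R) with nrm av U ≤ (R:ℝ), (∏ p ∈ U, (2*(k:ℝ)/av p)) ≤ 2^k * (1 + Real.log R)^(2*k) := by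
  refine mul_le_mul_of_nonneg_left ?_ (by positivity)
  calc _ = ∑ U : Finset (SS W R) with nrm av U ≤ (R:ℝ), (fun d : ℕ => ((2*k:ℕ):ℝ)^d.primeFactors.card / d) (eU U) := by
        refine Finset.sum_congr rfl fun U _ => ?_
        rw [prod_av]; push_cast; rfl
    _ ≤ ∑ d ∈ (Finset.Icc 1 R).filter (fun d => Squarefree d ∧ d.Coprime W), ((2*k:ℕ):ℝ)^d.primeFactors.card / d :=
        eU_sum_le R (fun d : ℕ => ((2*k:ℕ):ℝ)^d.primeFactors.card / d) (fun d => by positivity)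
    _ ≤ ∑ d ∈ (Finset.Icc 1 R).filter Squarefree, ((2*k:ℕ):ℝ)^d.primeFactors.card / d := by
        refine Finset.sum_le_sum_of_subset_of_nonneg ?_ fun d _ _ => by positivity
        intro d hd
        rw [Finset.mem_filter] at hd ⊢
        exact ⟨hd.1, hd.2.1⟩
    _ ≤ _ := sum_pow_omega _ _

lemma Er1_le (A W R : ℕ) : ∑ U : Finset (SS W R) with nrm av U ≤ (R:ℝ)^2, (A:ℝ)^U.card * 1 ≤ (R:ℝ)^2 * (1 + 2 * Real.log R)^A := by
  have e : (R:ℝ)^2 = ((R^2:ℕ):ℝ) := by push_cast; rfl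
  rw [e]
  calc _ = ∑ U : Finset (SS W R) with nrm av U ≤ ((R^2:ℕ):ℝ), (fun d : ℕ => (A:ℝ)^d.primeFactors.card) (eU U) := by
        refine Finset.sum_congr rfl fun U _ => ?_
        simp only [eU_factors, mul_one]
    _ ≤ ∑ d ∈ (Finset.Icc 1 (R^2)).filter (fun d => Squarefree d ∧ d.Coprime W), (A:ℝ)^d.primeFactors.card :=
        eU_sum_le (R^2) (fun d : ℕ => (A:ℝ)^d.primeFactors.card) (fun d => by positivity)
    _ ≤ ∑ d ∈ (Finset.Icc 1 (R^2)).filter Squarefree, ((R^2:ℕ):ℝ) * ((A:ℝ)^d.primeFactors.card / d) := by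
        refine (Finset.sum_le_sum (g := fun d : ℕ => ((R^2:ℕ):ℝ) * ((A:ℝ)^d.primeFactors.card / d)) fun d hd => ?_).trans
          (Finset.sum_le_sum_of_subset_of_nonneg ?_ fun d _ _ => by positivity)
        · have h1 := Finset.mem_Icc.1 (Finset.mem_filter.1 hd).1
          have h2 : (0:ℝ) < d := by exact_mod_cast h1.1
          have h3 : (d:ℝ) ≤ ((R^2:ℕ):ℝ) := by exact_mod_cast h1.2
          rw [mul_div_assoc', le_div_iff₀ h2, mul_comm]
          gcongr
        · intro d hd
          rw [Finset.mem_filter] at hd ⊢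
          exact ⟨hd.1, hd.2.1⟩
    _ ≤ _ := by
        rw [← Finset.mul_sum]
        refine mul_le_mul_of_nonneg_left ((sum_pow_omega A (R^2)).trans (le_of_eq ?_)) (by positivity)
        push_cast
        rw [Real.log_pow]; norm_num

lemma eps_le (k D0 W R : ℕ) (hk : 1 ≤ k) (hD : 96*k^2 + 2 ≤ D0) (hW : ∀ p : ℕ, p.Prime → p ≤ D0 → p ∣ W) :
    ∑ p : SS W R, 1/(av p - 1)^2 ≤ 1/(48*(k:ℝ)^2) := by
  have hgt : ∀ p ∈ SS W R, D0 < p := by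
    intro p hp
    by_contra h
    exact SS_ndvd ⟨p, hp⟩ (hW p (SS_prime ⟨p, hp⟩) (by omega))
  unfold av
  rw [Finset.sum_coe_sort (SS W R) (fun p => (1:ℝ) / ((p:ℝ)-1) ^ 2)]
  have e : ∑ p ∈ SS W R, (1:ℝ) / ((p:ℝ)-1) ^ 2 = ∑ p ∈ SS W R, (fun j : ℕ => ((j:ℝ)^2)⁻¹) (p - 1) := by
    refine Finset.sum_congr rfl fun p hp => ?_
    have := hgt p hp
    simp only
    rw [Nat.cast_sub (by omega)]
    simp
  rw [e, ← Finset.sum_image (s := SS W R) (g := fun p => p - 1) (f := fun j : ℕ => ((j:ℝ)^2)⁻¹)]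
  · calc _ ≤ ∑ j ∈ Finset.Ioo (D0 - 1) (R+1), ((j:ℝ)^2)⁻¹ := by
          refine Finset.sum_le_sum_of_subset_of_nonneg ?_ fun j _ _ => by positivity
          intro j hj
          obtain ⟨p, hp, rfl⟩ := Finset.mem_image.1 hj
          have h1 := hgt p hp
          have h2 := SS_le ⟨p, hp⟩
          simp only at h2
          rw [Finset.mem_Ioo]
          omega
      _ ≤ 2 / ((D0-1:ℕ) + 1) := sum_Ioo_inv_sq_le _ _
      _ ≤ _ := by
          have h1 : ((D0-1:ℕ):ℝ) + 1 = D0 := by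
            rw [Nat.cast_sub (by omega)]; simp
          have h2 : (96*(k:ℝ)^2 + 2) ≤ D0 := by exact_mod_cast hD
          have h3 : (1:ℝ) ≤ k := by exact_mod_cast hk
          rw [h1, div_le_div_iff₀ (by nlinarith) (by positivity)]
          linarith
  · intro p hp q hq h
    have h1 := hgt p hp
    have h2 := hgt q hq
    simp only at h
    omega

lemma pi1_sum (k : ℕ) (a : ℝ) : ∑ o, pi1 k a o = 1 := by
  rw [Fintype.sum_option]; simp [pi1]; ring

lemma pi2_sum (k : ℕ) (a : ℝ) (m : Fin k) : ∑ o, pi2 k a m o = 1 := by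
  rw [Fintype.sum_option]
  simp only [pi2]
  rw [Finset.sum_ite, Finset.sum_const_zero, zero_add, Finset.sum_const, Finset.filter_ne' , Finset.card_erase_of_mem (Finset.mem_univ m)]
  simp only [Finset.card_univ, Fintype.card_fin, nsmul_eq_mul]
  rw [Nat.cast_sub (Fin.pos m)]
  push_cast
  ring

section final
variable {k W : ℕ}

noncomputable def ww (h : Fin k → ℕ) (W R : ℕ) (F : Finset (SS W R) → ℝ) (n : ℕ) : ℝ :=
  ∑ δ, lamd av F R δ * ind δ (omf h W R n)

lemma S1_total (h : Fin k → ℕ) (R : ℕ) (hR : 1 ≤ R) (hW : 0 < W) (h2 : 2 ∣ W)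
    (hh : ∀ i j, i ≠ j → ∀ p : ℕ, p.Prime → (p:ℤ) ∣ (h i:ℤ) - h j → p ∣ W) (v X : ℕ)
    (F : Finset (SS W R) → ℝ) (hF0 : ∀ U, 0 ≤ F U) (hF2 : ∀ U, F U ≤ 2) (hk : ∀ p : SS W R, (k:ℝ) ≤ av p) :
    ∑ n ∈ (Finset.Icc 1 X).filter (fun n => n ≡ v [MOD W]), ww h W R F n ^ 2 ≤
      X/W * (∑ U : Finset (SS W R), F U^2*∏ p ∈ U,(av p/(av p-1)^2))^k +
      (2^k * (1 + Real.log R)^(2*k))^2 * ((R:ℝ)^2 * (1 + 2 * Real.log R)^((2*k+1)^2)) := by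
  have hav : ∀ p : SS W R, 3 ≤ av p := fun p => av_ge h2 p
  have hlog : 0 ≤ Real.log R := Real.log_natCast_nonneg R
  have key := compare (k := k) (ι := SS W R) av (fun p => by linarith [hav p]) R (2^k * (1 + Real.log R)^(2*k)) (by exact_mod_cast hR)
    (by positivity) (lamd av F R) (fun δ => by
      refine (lam_bound av (fun p => by linarith [hav p]) F hF0 hF2 R δ).trans ?_
      split_ifs
      · exact mul_le_mul_of_nonneg_right (M_le k W R) (by positivity)
      · exact le_rfl)
    ((Finset.Icc 1 X).filter (fun n => n ≡ v [MOD W])) (fun _ => 1) (omf h W R) (X/W) (fun p o => pi1 k (av p) o) (fun p => pi1_sum _ _)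
    (fun _ => 1) (fun _ => by norm_num) (fun τ _ => S1_err hW h hh v X τ)
  have h1 := (abs_le.1 key).2
  have hQ := Q1_le (k := k) (ι := SS W R) av F R (fun p => by linarith [hav p]) hk
  simp_rw [w_eq] at hQ
  have hE := Er1_le ((2*k+1)^2) W R
  push_cast at hE
  have hM0 : (0:ℝ) ≤ (2^k * (1 + Real.log R)^(2*k))^2 := by positivity
  have hX : (0:ℝ) ≤ X/W := by positivity
  have a1 := mul_le_mul_of_nonneg_left hE hM0
  have a2 := mul_le_mul_of_nonneg_left hQ hX
  simp only [one_mul] at h1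
  unfold ww
  linarith

lemma S2_total (h : Fin k → ℕ) (N : ℕ) (hRW : W + 5 ≤ Rn N) (hW : 0 < W) (h2 : 2 ∣ W)
    (hh : ∀ i j, i ≠ j → ∀ p : ℕ, p.Prime → (p:ℤ) ∣ (h i:ℤ) - h j → p ∣ W) (v : ℕ)
    (hcop : ∀ i, Nat.Coprime (v + h i) W) (m : Fin k) (hhm : (h m:ℝ) ≤ Real.exp (-3) * N)
    (F : Finset (SS W (Rn N)) → ℝ) (hF0 : ∀ U, 0 ≤ F U) (hF2 : ∀ U, F U ≤ 2) :
    Xth N / W.totient * (∑ o : SS W (Rn N) → Option (Fin k), (∏ p, pi2 k (av p) m (o p)) * (∑ ρ : SS W (Rn N) → Option (Fin k), (∏ p, bb (av p) (ρ p) (o p)) * cc av F (Rn N) ρ) ^ 2)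
      - (2^k * (1 + Real.log (Rn N))^(2*k))^2 * (∑ d ∈ (Finset.Icc 1 (Rn N ^ 2)).filter (fun d => Squarefree d ∧ d.Coprime W),
      (((2*k+1)^2:ℕ):ℝ) ^ d.primeFactors.card * Ed W N d) ≤
    ∑ n ∈ (Finset.Icc 1 (XN N)).filter (fun n => n ≡ v [MOD W]), gth N (n + h m) * ww h W (Rn N) F n ^ 2 := by
  have hav : ∀ p : SS W (Rn N), 3 ≤ av p := fun p => av_ge h2 p
  have hlog : 0 ≤ Real.log (Rn N) := Real.log_natCast_nonneg _
  have key := compare (k := k) (ι := SS W (Rn N)) av (fun p => by linarith [hav p]) (Rn N) (2^k * (1 + Real.log (Rn N))^(2*k)) (by exact_mod_cast (by omega : 1 ≤ Rn N))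
    (by positivity) (lamd av F (Rn N)) (fun δ => by
      refine (lam_bound av (fun p => by linarith [hav p]) F hF0 hF2 (Rn N) δ).trans ?_
      split_ifs
      · exact mul_le_mul_of_nonneg_right (M_le k W (Rn N)) (by positivity)
      · exact le_rfl)
    ((Finset.Icc 1 (XN N)).filter (fun n => n ≡ v [MOD W])) (fun n => gth N (n + h m)) (omf h W (Rn N)) (Xth N / W.totient) (fun p o => pi2 k (av p) m o) (fun p => pi2_sum _ _ m)
    (fun U => Ed W N (eU U)) (fun _ => Ed_nonneg _ _ _) (fun τ hτ => S2_err N hW hRW h hh v hcop m hhm τ hτ)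
  have h1 := (abs_le.1 key).1
  have hE := eU_sum_le (W := W) (R := Rn N) (Rn N ^ 2) (fun d => (((2*k+1)^2:ℕ):ℝ) ^ d.primeFactors.card * Ed W N d) (fun d => mul_nonneg (by positivity) (Ed_nonneg _ _ _))
  simp only [eU_factors] at hE
  have e : ((Rn N ^ 2 : ℕ):ℝ) = (Rn N:ℝ)^2 := by push_cast; rfl
  rw [e] at hE
  have hM0 : (0:ℝ) ≤ (2^k * (1 + Real.log (Rn N))^(2*k))^2 := by positivity
  have a1 := mul_le_mul_of_nonneg_left hE hM0
  have e2 : (((2*k+1)^2:ℕ):ℝ) = (2*(k:ℝ)+1)^2 := by push_cast; rfl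
  rw [e2] at a1 ⊢
  simp_rw [w_eq]
  unfold ww
  linarith

lemma count_bound (h : Fin k → ℕ) (N m n0 v R : ℕ) (hN3 : 3 ≤ (N:ℝ)) (hn0 : ∀ i, ((n0 + h i : ℕ):ℝ) ≤ Real.exp (-3) * N)
    (F : Finset (SS W R) → ℝ)
    (hcon : ∀ n > n0, n ≡ v [MOD W] → (Finset.univ.filter fun i : Fin k => (n + h i).Prime).card ≤ m) :
    ∑ i, ∑ n ∈ (Finset.Icc 1 (XN N)).filter (fun n => n ≡ v [MOD W]), gth N (n + h i) * ww h W R F n ^ 2 ≤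
      (m * (6 * Real.log N * Real.exp 6)) * ∑ n ∈ (Finset.Icc 1 (XN N)).filter (fun n => n ≡ v [MOD W]), ww h W R F n ^ 2 := by
  have hN : 0 < (N:ℝ) := by linarith
  have hlogN : 0 ≤ Real.log N := Real.log_natCast_nonneg N
  rw [Finset.sum_comm, Finset.mul_sum]
  refine Finset.sum_le_sum fun n hn => ?_
  rw [← Finset.sum_mul]
  refine mul_le_mul_of_nonneg_right ?_ (sq_nonneg _)
  by_cases hall : ∀ i, gth N (n + h i) = 0
  · rw [Finset.sum_eq_zero fun i _ => hall i]; positivity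
  · push Not at hall
    obtain ⟨i, hi⟩ := hall
    have h1 := (gth_ne hN hi).2
    have h3 : n0 < n := by
      have := lt_of_le_of_lt (hn0 i) h1
      have : n0 + h i < n + h i := by exact_mod_cast this
      omega
    have hc := hcon n h3 (Finset.mem_filter.1 hn).2
    have hle : ∀ j, gth N (n + h j) ≤ if (n + h j).Prime then 6 * Real.log N * Real.exp 6 else 0 := by
      intro j
      by_cases hX : XN N < n + h j
      · have : gth N (n + h j) = 0 := by unfold gth; rw [om_big hN3 hX]; simp
        rw [this]; split_ifs <;> positivity
      · push Not at hX
        unfold gth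
        split_ifs with hp
        · refine mul_le_mul ?_ (om_le hN3 (by positivity)) (om_nonneg hN (by positivity)) (by positivity)
          have h4 : Real.log ((n + h j : ℕ):ℝ) ≤ Real.log (XN N) := Real.log_le_log (by exact_mod_cast hp.pos) (by exact_mod_cast hX)
          have h5 := Lg_le hN3
          unfold Lg at h5
          linarith
        · exact le_rfl
    calc ∑ j, gth N (n + h j) ≤ ∑ j, if (n + h j).Prime then 6 * Real.log N * Real.exp 6 else 0 := Finset.sum_le_sum fun j _ => hle j
      _ = ((Finset.univ.filter fun i : Fin k => (n + h i).Prime).card : ℝ) * (6 * Real.log N * Real.exp 6) := by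
          rw [← Finset.sum_filter, Finset.sum_const, nsmul_eq_mul]
      _ ≤ _ := by
          have : ((Finset.univ.filter fun i : Fin k => (n + h i).Prime).card : ℝ) ≤ m := by exact_mod_cast hc
          gcongr
end final

end ModPB5

section ModPB6
open Filter Topology

lemma ev_logR : ∀ᶠ N : ℕ in atTop, Real.log N / 800 ≤ Real.log (Rn N) ∧ 1 + 2 * Real.log (Rn N) ≤ Real.log N := by
  have hlog : Tendsto (fun N : ℕ => Real.log N) atTop atTop := Real.tendsto_log_atTop.comp tendsto_natCast_atTop_atTop
  filter_upwards [Rn_tendsto.eventually_ge_atTop 2, hlog.eventually_ge_atTop 2, eventually_ge_atTop 1] with N h1 h2 h3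
  have hR : (2:ℝ) ≤ Rn N := by exact_mod_cast h1
  have hN : (0:ℝ) < N := by exact_mod_cast h3
  have hR0 : (0:ℝ) < Rn N := by linarith
  constructor
  · have h4 : (N:ℝ) ^ (1/400:ℝ) ≤ (Rn N:ℝ)^2 := by
      have := (Nat.lt_floor_add_one ((N:ℝ) ^ (1/400:ℝ))).le
      change _ ≤ (Rn N:ℝ) + 1 at this
      nlinarith
    have := Real.log_le_log (by positivity) h4
    rw [Real.log_rpow hN, Real.log_pow] at this
    push_cast at this
    linarith
  · have := Real.log_le_log (by positivity) (Rn_pow N)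
    rw [Real.log_pow] at this
    push_cast at this
    linarith

lemma ev_pow (C : ℕ) : ∀ᶠ N : ℕ in atTop, Real.log N ^ C * (Rn N:ℝ)^2 ≤ N := by
  have h := ((Real.isLittleO_pow_log_id_atTop (n := 2*C)).bound (c := 1) (by norm_num))
  have h' := tendsto_natCast_atTop_atTop.eventually h (α := ℕ)
  filter_upwards [h', Rn_tendsto.eventually_ge_atTop 1] with N h1 h2
  have hlog : 0 ≤ Real.log N := Real.log_natCast_nonneg N
  have hR : (1:ℝ) ≤ Rn N := by exact_mod_cast h2
  simp only [id, one_mul] at h1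
  rw [Real.norm_of_nonneg (by positivity), Real.norm_of_nonneg (by positivity)] at h1
  have h3 : ((Rn N:ℝ)^2)^2 ≤ N := by
    rw [← pow_mul]
    exact (pow_le_pow_right₀ hR (by norm_num)).trans (Rn_pow N)
  have h4 : (Real.log N ^ C)^2 ≤ N := by rw [← pow_mul, mul_comm]; exact h1
  nlinarith [sq_nonneg (Real.log N ^ C - (Rn N:ℝ)^2)]

lemma final_ineq (k : ℕ) (c c0 J m N W ph L lR A1 A2 M2E1 M2E2 S1 e4 e6 K : ℝ) (hN : 0 < N) (hW : 0 < W) (hph : 0 < ph)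
    (hL : 0 < L) (hc : 0 < c) (hc0 : 0 < c0) (hJ : 0 ≤ J) (hm : 0 ≤ m) (he6 : 0 < e6)
    (hk1 : 1 ≤ k) (hA2 : 1 ≤ A2) (hlR : L/800 ≤ lR)
    (hA : c0*(J+1)*lR*(ph/W)*A2 ≤ k*A1^2)
    (h1 : k*(c*N/ph*(1/2*A1^2*A2^(k-1)) - M2E2) ≤ m*(6*L*e6)*S1)
    (h2 : S1 ≤ e4*N/W*A2^k + M2E1)
    (h4 : M2E2 ≤ K*N) (h5 : L*M2E1 ≤ K*N)
    (hJm : 6*m*e6*e4+1 ≤ c*c0/1600*(J+1)) (hbig : W*(k*K+6*m*e6*K) < L) : False := by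
  have hP : 1 ≤ A2^k := one_le_pow₀ hA2
  have hP0 : 0 < A2^(k-1) := by positivity
  have eP : A2^k = A2*A2^(k-1) := by rw [← pow_succ']; congr 1; omega
  have b1 : c*N/ph/2*(c0*(J+1)*lR*(ph/W)*A2)*A2^(k-1) ≤ c*N/ph/2*(k*A1^2)*A2^(k-1) := by gcongr
  have b2 : c*N/ph/2*(c0*(J+1)*lR*(ph/W)*A2)*A2^(k-1) = c*c0/2*(J+1)*(N/W*A2^k)*lR := by
    rw [eP]; field_simp
  have b3 : c*c0/2*(J+1)*(N/W*A2^k)*(L/800) ≤ c*c0/2*(J+1)*(N/W*A2^k)*lR := by gcongr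
  have b4 : (6*m*e6*e4+1)*(N/W*A2^k*L) ≤ c*c0/1600*(J+1)*(N/W*A2^k*L) := by gcongr
  have b5 : m*(6*L*e6)*S1 ≤ m*(6*L*e6)*(e4*N/W*A2^k + M2E1) := by gcongr
  have b6 : 6*m*e6*(L*M2E1) ≤ 6*m*e6*(K*N) := by gcongr
  have b7 : (k:ℝ)*M2E2 ≤ k*(K*N) := by gcongr
  have b8 : N/W*A2^k*L ≤ (k*K+6*m*e6*K)*N := by
    have e1 : m*(6*L*e6)*(e4*N/W*A2^k + M2E1) = 6*m*e6*e4*(N/W*A2^k*L) + 6*m*e6*(L*M2E1) := by ring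
    have e2 : k*(c*N/ph*(1/2*A1^2*A2^(k-1)) - M2E2) = c*N/ph/2*(k*A1^2)*A2^(k-1) - k*M2E2 := by ring
    have e3 : c*c0/2*(J+1)*(N/W*A2^k)*(L/800) = c*c0/1600*(J+1)*(N/W*A2^k*L) := by ring
    rw [e1] at b5
    rw [e2] at h1
    rw [e3] at b3
    rw [b2] at b1
    nlinarith
  have b9 : N/W*1*L ≤ N/W*A2^k*L := by gcongr
  have b10 : N/W*(W*(k*K+6*m*e6*K)) < N/W*L := by gcongr
  have e4 : N/W*(W*(k*K+6*m*e6*K)) = (k*K+6*m*e6*K)*N := by field_simp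
  linarith

set_option maxHeartbeats 2000000 in
theorem maynard (m : ℕ) : MTstmt m := by
  obtain ⟨c, hc, hXl⟩ := Xth_lower
  obtain ⟨J, hJ⟩ := exists_nat_ge ((6*(m:ℝ)*Real.exp 6*Real.exp 4+1) / (c*c0/1600))
  have hc0 := c0_pos
  have hJm : 6*(m:ℝ)*Real.exp 6*Real.exp 4+1 ≤ c*c0/1600*(J+1) := by
    rw [div_le_iff₀ (by positivity)] at hJ
    have : 0 < c*c0/1600 := by positivity
    linarith
  obtain ⟨k, hk⟩ : ∃ k, k = 2^J := ⟨_, rfl⟩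
  have hk1 : 1 ≤ k := by rw [hk]; exact Nat.one_le_two_pow
  refine ⟨k, 96*k^2+2, hk1, by nlinarith, fun W v h hW hinj hWp hh hcop n0 => ?_⟩
  by_contra hcon0
  push Not at hcon0
  have hcon : ∀ n > n0, n ≡ v [MOD W] → (Finset.univ.filter fun i : Fin k => (n + h i).Prime).card ≤ m :=
    fun n h1 h2 => (hcon0 n h1 h2).le
  have h2W : 2 ∣ W := hWp 2 Nat.prime_two (by omega)
  obtain ⟨R0, hR0⟩ := A_bounds W hW h2W J
  have hlog : Tendsto (fun N : ℕ => Real.log N) atTop atTop := Real.tendsto_log_atTop.comp tendsto_natCast_atTop_atTop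
  have hlin : ∀ᶠ N : ℕ in atTop, ∀ i, ((n0 + h i : ℕ):ℝ) ≤ Real.exp (-3) * N := by
    rw [eventually_all]
    intro i
    exact (tendsto_natCast_atTop_atTop.const_mul_atTop (Real.exp_pos _)).eventually_ge_atTop _
  set A : ℕ := (2*k+1)^2 with hA
  have hev := hXl.and ((Rn_tendsto.eventually_ge_atTop (max (W+5) R0)).and (hlin.and (ev_logR.and ((ev_pow (4*k+A+1)).and
    ((hlog.eventually_gt_atTop (W*(k*(4:ℝ)^k+6*m*Real.exp 6*4^k))).and (eventually_ge_atTop 3))))))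
  obtain ⟨N, hdist, hX, hR, hlinN, ⟨hlR, hlR2⟩, hpow, hbig, hN3⟩ := ((dist_avg W A (4*k) hW).and_eventually hev).exists
  have hRW : W + 5 ≤ Rn N := (le_max_left _ _).trans hR
  obtain ⟨F, Z, Λ, hF0, hF2, hmono, hZ, hZR, hΛ, hB, hA2, hAA⟩ := hR0 (Rn N) ((le_max_right _ _).trans hR)
  have hN3' : 3 ≤ (N:ℝ) := by exact_mod_cast hN3
  have hNpos : 0 < (N:ℝ) := by linarith
  have hL1 : 1 ≤ Real.log N := log_ge_one hN3'
  have hlR0 : 0 ≤ Real.log (Rn N) := Real.log_natCast_nonneg _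
  have hgt : ∀ p : SS W (Rn N), 96*(k:ℝ)^2 + 2 < av p := by
    intro p
    have : 96*k^2+2 < (p:ℕ) := by
      by_contra hle
      exact SS_ndvd p (hWp p (SS_prime p) (by omega))
    unfold av
    exact_mod_cast this
  have hk1' : (1:ℝ) ≤ k := by exact_mod_cast hk1
  rw [← hk] at hB hAA
  set A2 := ∑ U : Finset (SS W (Rn N)), F U^2*∏ p ∈ U,(av p/(av p-1)^2) with hA2d
  set A1 := ∑ U : Finset (SS W (Rn N)), F U*∏ p ∈ U,(1/(av p-1)) with hA1d
  have hph : (0:ℝ) < W.totient := by exact_mod_cast Nat.totient_pos.2 hW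
  have hW' : (0:ℝ) < W := by exact_mod_cast hW
  have hQ2 : ∀ i : Fin k, _ := fun i => Q2_ge (k := k) (ι := SS W (Rn N)) av F (Rn N) Z Λ i (fun p => by nlinarith [hgt p]) (fun p => by nlinarith [hgt p])
    hF0 hmono hZ hZR hΛ (eps_le k (96*k^2+2) W (Rn N) hk1 le_rfl hWp) hB
  have hS2 := fun i => S2_total h N hRW hW h2W hh v hcop i ((by push_cast; linarith [(Nat.cast_nonneg n0 : (0:ℝ) ≤ n0)] : (h i:ℝ) ≤ ((n0 + h i:ℕ):ℝ)).trans (hlinN i)) F hF0 hF2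
  have hS1 := S1_total h (Rn N) (by omega) hW h2W hh v (XN N) F hF0 hF2 (fun p => by nlinarith [hgt p])
  have hcb := count_bound h N m n0 v (Rn N) hN3' hlinN F hcon
  set S1 := ∑ n ∈ (Finset.Icc 1 (XN N)).filter (fun n => n ≡ v [MOD W]), ww h W (Rn N) F n ^ 2 with hS1d
  set M : ℝ := 2^k * (1 + Real.log (Rn N))^(2*k) with hM
  have hM0 : 0 ≤ M := by positivity
  have hMle : M^2 ≤ 4^k * Real.log N^(4*k) := by
    have : M ≤ 2^k * Real.log N^(2*k) := by
      rw [hM]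
      gcongr
      linarith
    calc M^2 ≤ (2^k * Real.log N^(2*k))^2 := by gcongr
      _ = _ := by
        rw [mul_pow, ← pow_mul, ← pow_mul, mul_comm k 2, pow_mul]
        norm_num
        ring
  set E2 := ∑ d ∈ (Finset.Icc 1 (Rn N ^ 2)).filter (fun d => Squarefree d ∧ d.Coprime W), ((A:ℕ):ℝ) ^ d.primeFactors.card * Ed W N d with hE2
  have hE20 : 0 ≤ E2 := Finset.sum_nonneg fun d _ => mul_nonneg (by positivity) (Ed_nonneg _ _ _)
  refine final_ineq k c c0 J m N W W.totient (Real.log N) (Real.log (Rn N)) A1 A2 (M^2*((Rn N:ℝ)^2*(1+2*Real.log (Rn N))^A)) (M^2*E2) S1 (Real.exp 4) (Real.exp 6) (4^k)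
    hNpos hW' hph (by linarith) hc hc0 (Nat.cast_nonneg _) (Nat.cast_nonneg _) (Real.exp_pos _) hk1 hA2 hlR hAA ?_ ?_ ?_ ?_ hJm hbig
  · refine le_trans ?_ hcb
    calc _ = ∑ i : Fin k, (c*N/W.totient*(1/2*A1^2*A2^(k-1)) - M^2*E2) := (by rw [Finset.sum_const, Finset.card_univ, Fintype.card_fin, nsmul_eq_mul])
      _ ≤ _ := Finset.sum_le_sum fun i _ => by
        refine le_trans ?_ (hS2 i)
        refine sub_le_sub_right ?_ _
        have hz : 0 ≤ 1/2*A1^2*A2^(k-1) := mul_nonneg (mul_nonneg (by norm_num) (sq_nonneg _)) (pow_nonneg (by linarith [hA2]) _)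
        have hX0 : 0 ≤ Xth N := le_trans (div_nonneg (mul_nonneg hc.le hNpos.le) zero_le_one |>.trans_eq (div_one _)) hX
        have hx : c*N/W.totient ≤ Xth N / W.totient := div_le_div_of_nonneg_right hX hph.le
        exact mul_le_mul hx (hQ2 i) hz (div_nonneg hX0 hph.le)
  · refine hS1.trans (add_le_add_left ?_ _)
    gcongr
    exact XN_le hN3'
  · calc M^2*E2 ≤ (4^k * Real.log N^(4*k)) * (N / Real.log N^(4*k)) := by gcongr
      _ = 4^k*N := by
        have : Real.log N ≠ 0 := by linarith
        field_simp
  · calc Real.log N * (M^2*((Rn N:ℝ)^2*(1+2*Real.log (Rn N))^A)) ≤ Real.log N * ((4^k * Real.log N^(4*k))*((Rn N:ℝ)^2*Real.log N^A)) := by gcongr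
      _ = 4^k * (Real.log N^(4*k+A+1) * (Rn N:ℝ)^2) := by ring
      _ ≤ 4^k*N := by gcongr

end ModPB6

/-- **Shiu strings with an explicit bound.**
Let `p_1 = 2 < p_2 = 3 < ⋯` be the sequence of all primes (here `Nat.nth Nat.Prime j`
is `p_{j+1}`).  There exist absolute positive constants `A` and `N` such that for every
integer `m ≥ 2` there is an integer `k = k(m)` with the following property: for all
integers `q ≥ 3` and `a` with `gcd(a, q) = 1`, there exist infinitely many `n` such
that `p_{n+1} ≡ p_{n+2} ≡ ⋯ ≡ p_{n+m} ≡ a (mod q)` and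
`p_{n+m} − p_{n+1} < A q^N k² log(qk)`. -/
theorem shiu_strings_explicit_bound :
    ∃ A N : ℝ, 0 < A ∧ 0 < N ∧
      ∀ m : ℕ, 2 ≤ m → ∃ k : ℕ,
        ∀ (q : ℕ) (a : ℤ), 3 ≤ q → Int.gcd a q = 1 →
          {n : ℕ |
            (∀ i < m, ((Nat.nth Nat.Prime (n + i) : ℤ) ≡ a [ZMOD (q : ℤ)])) ∧
            ((Nat.nth Nat.Prime (n + m - 1) : ℝ) - (Nat.nth Nat.Prime n : ℝ)) <
              A * (q : ℝ) ^ N * (k : ℝ) ^ 2 * Real.log (q * k)}.Infinite := by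
  exact shiu_of_MT (fun m _ => maynard m)
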